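/- Channels for even-in-time solutions around a multisoliton: for every J ∈ ℕ there exist γ* > 0 and C > 0 such that for every λ = (λ₁,…,λ_J) with 0 < λ_J < … < λ₁ and γ(λ) ≤ γ*, every radial finite-energy solution u of ∂_t²u − Δu + V_λ u = 0 on ℝ × ℝ⁶, for which both limits lim_{t→±∞} ∫_{|x|≥|t|} |∇_{t,x}u|² dx exist, satisfies ‖∇(Π⊥_{Ḣ¹,λ} u₀)‖²_{Z_{−3,λ}} ≤ C ( Σ_± lim_{t→±∞} ∫_{|x|≥|t|} |∇_{t,x}u(t,x)|² dx + γ(λ)⁴ |log γ(λ)|² ‖∇u₀‖²_{Z_{−3,λ}} ), where u₀ = u(0,·). -/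

import Mathlib

open MeasureTheory Real Filter Set Topology ENNReal RealInnerProductSpace

noncomputable section

abbrev E6 := EuclideanSpace ℝ (Fin 6)

/-- The ground state `W(x) = (1+|x|²/24)⁻²` on `ℝ⁶`. -/
def W6 (x : E6) : ℝ := ((1 + ‖x‖ ^ 2 / 24) ^ 2)⁻¹

/-- The potential `V = -2W` of the linearized equation. -/
def V6 (x : E6) : ℝ := -2 * W6 x

/-- `ΛW(x) = x·∇W(x) + 2W(x)`. -/
def LW6 (x : E6) : ℝ := fderiv ℝ W6 x x + 2 * W6 x

/-- The Laplacian of `f : ℝ⁶ → ℝ`. -/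
def lap6 (f : E6 → ℝ) (x : E6) : ℝ :=
  ∑ i : Fin 6, fderiv ℝ (fun y => fderiv ℝ f y (EuclideanSpace.single i 1)) x
    (EuclideanSpace.single i 1)

/-- `∂ₜ u`. -/
def dtu (u : ℝ → E6 → ℝ) (t : ℝ) (x : E6) : ℝ := deriv (fun s => u s x) t

/-- `∂ₜ² u`. -/
def dttu (u : ℝ → E6 → ℝ) (t : ℝ) (x : E6) : ℝ := deriv (fun s => dtu u s x) t

/-- `|∇_{t,x} u|² = (∂ₜ u)² + |∇u|²`. -/
def eDensity (u : ℝ → E6 → ℝ) (t : ℝ) (x : E6) : ℝ :=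
  dtu u t x ^ 2 + ‖gradient (u t) x‖ ^ 2

/-- `u` is a radial finite-energy solution of `∂ₜ²u - Δu + P·u = 0` on `ℝ × ℝ⁶`. -/
def IsRadSolOf (P : E6 → ℝ) (u : ℝ → E6 → ℝ) : Prop :=
  ContDiff ℝ 2 (fun p : ℝ × E6 => u p.1 p.2) ∧
  (∀ t x y, ‖x‖ = ‖y‖ → u t x = u t y) ∧
  (∀ t x, dttu u t x - lap6 (u t) x + P x * u t x = 0) ∧
  Integrable (fun x => eDensity u 0 x)

/-- `Ḣ¹`-invariant rescaling `f_{(λ)}(x) = λ⁻² f(x/λ)`. -/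
def rescH (lam : ℝ) (f : E6 → ℝ) (x : E6) : ℝ := (lam ^ 2)⁻¹ * f (lam⁻¹ • x)

/-- `L²`-invariant rescaling `f_{[λ]}(x) = λ⁻³ f(x/λ)`. -/
def rescL (lam : ℝ) (f : E6 → ℝ) (x : E6) : ℝ := (lam ^ 3)⁻¹ * f (lam⁻¹ • x)

/-- The multisoliton potential `V_λ = Σ_j V_{(λ_j)}`. -/
def Vmulti {J : ℕ} (lam : Fin J → ℝ) (x : E6) : ℝ := ∑ j, rescH (lam j) V6 x

/-- The scale separation parameter `γ(λ) = max_{1≤j≤J-1} λ_{j+1}/λ_j`. -/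
def gam {J : ℕ} (lam : Fin J → ℝ) : ℝ :=
  sSup {g | ∃ (j : Fin J) (h : (j : ℕ) + 1 < J), g = lam ⟨(j : ℕ) + 1, h⟩ / lam j}

/-- The `Z_{-3,λ}` norm of a function on `ℝ⁶`:
`sup_{R>0} (inf_j ⟨log(R/λ_j)⟩)⁻¹ (∫_{R<|x|<2R} f²)^{1/2}`. -/
def ZlamE {J : ℕ} (lam : Fin J → ℝ) (f : E6 → ℝ) : ℝ≥0∞ :=
  ⨆ R : {R : ℝ // 0 < R}, ENNReal.ofReal
    ((⨅ j, Real.sqrt (1 + Real.log (R.1 / lam j) ^ 2))⁻¹ *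
      Real.sqrt (∫ x in {x : E6 | R.1 < ‖x‖ ∧ ‖x‖ < 2 * R.1}, f x ^ 2))

/-- `v` belongs to `span((ΛW)_{[λ_j]}, 1 ≤ j ≤ J)`. -/
def InSpanL {J : ℕ} (lam : Fin J → ℝ) (v : E6 → ℝ) : Prop :=
  ∃ c : Fin J → ℝ, v = fun x => ∑ j, c j * rescL (lam j) LW6 x

/-- `w` belongs to `span((ΛW)_{(λ_j)}, 1 ≤ j ≤ J)`. -/
def InSpanH {J : ℕ} (lam : Fin J → ℝ) (w : E6 → ℝ) : Prop :=
  ∃ c : Fin J → ℝ, w = fun x => ∑ j, c j * rescH (lam j) LW6 x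

/-- A function of two real variables as a function of pairs. -/
notation "unc" U:max => fun p : ℝ × ℝ => U (Prod.fst p) (Prod.snd p)

/-! ### Tail integrals -/

theorem Ioi_congr {a : ℝ} {f g : ℝ → ℝ} (h : EqOn f g (Ioi a)) : ∫ r in Ioi a, f r = ∫ r in Ioi a, g r :=
  setIntegral_congr_fun measurableSet_Ioi h

theorem ae_Ioi {a : ℝ} {p : ℝ → Prop} (h : ∀ r, a < r → p r) : ∀ᵐ r ∂volume.restrict (Ioi a), p r :=
  (ae_restrict_iff' measurableSet_Ioi).2 (Eventually.of_forall h)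

theorem abs_tail_integral_le {g : ℝ → ℝ} {r a C : ℝ} (hr : 0 < r) (ha : a < -1)
    (hb : ∀ ρ, r < ρ → |g ρ| ≤ C * ρ ^ a) :
    |∫ ρ in Ioi r, g ρ| ≤ C * (r ^ (a + 1) / (-(a + 1))) := by
  have h1 : |∫ ρ in Ioi r, g ρ| ≤ ∫ ρ in Ioi r, C * ρ ^ a := by
    rw [← norm_eq_abs]
    refine norm_integral_le_of_norm_le ((integrableOn_Ioi_rpow_of_lt ha hr).const_mul C) ?_
    refine ae_Ioi fun ρ hρ => ?_
    exact hb ρ hρ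
  rw [integral_const_mul, integral_Ioi_rpow_of_lt ha hr] at h1
  refine h1.trans (le_of_eq ?_)
  rw [neg_div, div_neg]

theorem tail_integrableOn {g : ℝ → ℝ} {r a C : ℝ} (hr : 0 < r) (ha : a < -1)
    (hc : ContinuousOn g (Ioi r)) (hb : ∀ ρ, r < ρ → |g ρ| ≤ C * ρ ^ a) :
    IntegrableOn g (Ioi r) := by
  refine Integrable.mono' ((integrableOn_Ioi_rpow_of_lt ha hr).const_mul C)
    (hc.aestronglyMeasurable measurableSet_Ioi) ?_
  refine ae_Ioi fun ρ hρ => ?_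
  exact hb ρ hρ

/-- The two-power weight dominating all tails. -/
def wtail (ρ : ℝ) : ℝ := ρ ^ (-(7/4) : ℝ) + ρ ^ (-(5/4) : ℝ)

/-- The two-power growth weight. -/
def wgrow (ρ : ℝ) : ℝ := ρ ^ (1/4 : ℝ) + ρ ^ (3/4 : ℝ)

/-- The integral of `wtail` over `(r,∞)`. -/
def wint (r : ℝ) : ℝ := 4 / 3 * r ^ (-(3/4) : ℝ) + 4 * r ^ (-(1/4) : ℝ)

theorem wtail_pos {ρ : ℝ} (h : 0 < ρ) : 0 < wtail ρ := by unfold wtail; positivity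
theorem wgrow_pos {ρ : ℝ} (h : 0 < ρ) : 0 < wgrow ρ := by unfold wgrow; positivity
theorem wint_pos {ρ : ℝ} (h : 0 < ρ) : 0 < wint ρ := by unfold wint; positivity

theorem wtail_anti {a b : ℝ} (h : 0 < a) (hab : a ≤ b) : wtail b ≤ wtail a := by
  unfold wtail
  exact add_le_add (rpow_le_rpow_of_nonpos h hab (by norm_num))
    (rpow_le_rpow_of_nonpos h hab (by norm_num))

theorem wint_anti {a b : ℝ} (h : 0 < a) (hab : a ≤ b) : wint b ≤ wint a := by
  unfold wint
  have h1 := rpow_le_rpow_of_nonpos h hab (by norm_num : (-(3/4) : ℝ) ≤ 0)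
  have h2 := rpow_le_rpow_of_nonpos h hab (by norm_num : (-(1/4) : ℝ) ≤ 0)
  linarith

theorem wgrow_mul {ρ : ℝ} (h : 0 < ρ) : ρ ^ (-2 : ℝ) * wgrow ρ = wtail ρ := by
  unfold wgrow wtail
  rw [mul_add, ← rpow_add h, ← rpow_add h]; norm_num

theorem rpow_neg_three_half_le {ρ : ℝ} (h : 0 < ρ) : ρ ^ (-(3/2) : ℝ) ≤ wtail ρ := by
  unfold wtail
  rcases le_total ρ 1 with h1 | h1
  · have := rpow_le_rpow_of_exponent_ge h h1 (by norm_num : (-(7/4) : ℝ) ≤ -(3/2))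
    have : 0 < ρ ^ (-(5/4) : ℝ) := by positivity
    linarith
  · have := rpow_le_rpow_of_exponent_le h1 (by norm_num : (-(3/2) : ℝ) ≤ -(5/4))
    have : 0 < ρ ^ (-(7/4) : ℝ) := by positivity
    linarith

theorem rpow_half_le_wgrow {ρ : ℝ} (h : 0 < ρ) : ρ ^ (1/2 : ℝ) ≤ wgrow ρ := by
  unfold wgrow
  rcases le_total ρ 1 with h1 | h1
  · have := rpow_le_rpow_of_exponent_ge h h1 (by norm_num : (1/4 : ℝ) ≤ 1/2)
    have : 0 < ρ ^ (3/4 : ℝ) := by positivity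
    linarith
  · have := rpow_le_rpow_of_exponent_le h1 (by norm_num : (1/2 : ℝ) ≤ 3/4)
    have : 0 < ρ ^ (1/4 : ℝ) := by positivity
    linarith

theorem wtail_integrableOn {r : ℝ} (hr : 0 < r) : IntegrableOn wtail (Ioi r) :=
  (integrableOn_Ioi_rpow_of_lt (by norm_num) hr).add
    (integrableOn_Ioi_rpow_of_lt (by norm_num) hr)

theorem integral_wtail {r : ℝ} (hr : 0 < r) : ∫ ρ in Ioi r, wtail ρ = wint r := by
  unfold wtail wint
  rw [integral_add (integrableOn_Ioi_rpow_of_lt (by norm_num) hr)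
    (integrableOn_Ioi_rpow_of_lt (by norm_num) hr), integral_Ioi_rpow_of_lt (by norm_num) hr,
    integral_Ioi_rpow_of_lt (by norm_num) hr]
  norm_num; ring

theorem abs_integral_le_wint {g : ℝ → ℝ} {r C : ℝ} (hr : 0 < r)
    (hb : ∀ ρ, r < ρ → |g ρ| ≤ C * wtail ρ) :
    |∫ ρ in Ioi r, g ρ| ≤ C * wint r := by
  rw [← integral_wtail hr, ← integral_const_mul, ← norm_eq_abs]
  refine norm_integral_le_of_norm_le ((wtail_integrableOn hr).const_mul C) ?_
  refine ae_Ioi fun ρ hρ => ?_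
  exact hb ρ hρ

theorem integrableOn_of_le_wtail {g : ℝ → ℝ} {r C : ℝ} (hr : 0 < r)
    (hc : ContinuousOn g (Ioi r)) (hb : ∀ ρ, r < ρ → |g ρ| ≤ C * wtail ρ) :
    IntegrableOn g (Ioi r) := by
  refine Integrable.mono' ((wtail_integrableOn hr).const_mul C)
    (hc.aestronglyMeasurable measurableSet_Ioi) ?_
  refine ae_Ioi fun ρ hρ => ?_
  exact hb ρ hρ

theorem integral_Ioi_shift (g : ℝ → ℝ) (r : ℝ) :
    ∫ ρ in Ioi r, g ρ = ∫ σ in Ioi (0 : ℝ), g (r + σ) := by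
  have h := (measurePreserving_add_left volume r).setIntegral_preimage_emb
    (measurableEmbedding_addLeft r) g (Ioi r)
  rw [← h]
  congr 2
  ext x; simp

theorem integrableOn_Ioi_shift {g : ℝ → ℝ} {r : ℝ} :
    IntegrableOn (fun σ => g (r + σ)) (Ioi 0) ↔ IntegrableOn g (Ioi r) := by
  have h := (measurePreserving_add_left volume r).integrableOn_comp_preimage
    (measurableEmbedding_addLeft r) (f := g) (s := Ioi r)
  rw [← h]
  have : (fun x => r + x) ⁻¹' Ioi r = Ioi 0 := by ext x; simp
  rw [this]; rfl

theorem continuousOn_tail {X : Type*} [TopologicalSpace X] [FirstCountableTopology X] {U : Set X}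
    (hU : IsOpen U) {g : X → ℝ → ℝ} {r : X → ℝ} {M : ℝ} (hM : 0 ≤ M)
    (hr : ContinuousOn r U) (hr0 : ∀ p ∈ U, 0 < r p)
    (hg : ContinuousOn (Function.uncurry g) (U ×ˢ Ioi 0))
    (hb : ∀ p ∈ U, ∀ σ, 0 < σ → |g p σ| ≤ M * wtail (r p + σ)) :
    ContinuousOn (fun p => ∫ σ in Ioi (0 : ℝ), g p σ) U := by
  intro p hp
  refine ContinuousAt.continuousWithinAt ?_
  have hrp := hr0 p hp
  have hev : ∀ᶠ q in 𝓝 p, q ∈ U ∧ r p / 2 < r q :=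
    (hU.mem_nhds hp |> fun h => (show ∀ᶠ q in 𝓝 p, q ∈ U from h)).and
      ((hr.continuousAt (hU.mem_nhds hp)).eventually (lt_mem_nhds (by linarith)))
  refine continuousAt_of_dominated (bound := fun σ => M * wtail (r p / 2 + σ)) ?_ ?_ ?_ ?_
  · filter_upwards [hev] with q hq
    refine ContinuousOn.aestronglyMeasurable ?_ measurableSet_Ioi
    exact hg.comp (f := fun σ => (q, σ)) (by fun_prop) (fun σ hσ => ⟨hq.1, hσ⟩)
  · filter_upwards [hev] with q hq
    refine ae_Ioi fun σ hσ => ?_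
    have hσ' : 0 < σ := hσ
    refine (hb q hq.1 σ hσ).trans (mul_le_mul_of_nonneg_left ?_ hM)
    exact wtail_anti (by linarith) (by linarith [hq.2])
  · exact (integrableOn_Ioi_shift.2 (wtail_integrableOn (by linarith))).const_mul M
  · refine ae_Ioi fun σ hσ => ?_
    have : ContinuousAt (Function.uncurry g) (p, σ) :=
      hg.continuousAt ((hU.prod isOpen_Ioi).mem_nhds ⟨hp, hσ⟩)
    exact this.comp (f := fun q => (q, σ)) (by fun_prop)

/-! ### Wave systems in null coordinates -/

/-- The standing bounds for a wave equation `f_tt - f_rr + κ f = -s`, for an even-in-time `f(r,t)`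
written in null coordinates `F (r - t) (r + t) = f(r,t)`. -/
structure PreSys (κ s : ℝ → ℝ) (F : ℝ → ℝ → ℝ) (K B s0 : ℝ) : Prop where
  K0 : 0 ≤ K
  B0 : 0 ≤ B
  ρ0 : 0 ≤ s0
  κc : ContinuousOn κ (Ioi 0)
  sc : ContinuousOn s (Ioi 0)
  κb : ∀ r, 0 < r → |κ r| ≤ K * r ^ (-2 : ℝ)
  sb : ∀ r, 0 < r → |s r| ≤ s0 * r ^ (-(3/2) : ℝ)
  Fc : ContinuousOn (Function.uncurry F) (Ioi 0 ×ˢ Ioi 0)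
  sym : ∀ ξ η, 0 < ξ → 0 < η → F ξ η = F η ξ
  Fb : ∀ ξ η, 0 < ξ → 0 < η → |F ξ η| ≤ B * wgrow ((ξ + η) / 2)

/-- Characteristic form of `f_tt - f_rr + κ f = -s`; `G` is the incoming radiation profile. -/
structure Sys (κ s G : ℝ → ℝ) (F : ℝ → ℝ → ℝ) (K B s0 : ℝ) : Prop
    extends PreSys κ s F K B s0 where
  Gc : ContinuousOn G (Ioi 0)
  der : ∀ ξ η, 0 < ξ → 0 < η → HasDerivAt (fun x => F x η)
    (G ξ - 1 / 2 * ∫ ρ in Ioi ((ξ + η) / 2), (κ ρ * F ξ (2 * ρ - ξ) + s ρ)) ξ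

/-- The outgoing tail integral. -/
def tailI (κ s : ℝ → ℝ) (F : ℝ → ℝ → ℝ) (ξ η : ℝ) : ℝ :=
  ∫ ρ in Ioi ((ξ + η) / 2), (κ ρ * F ξ (2 * ρ - ξ) + s ρ)

namespace PreSys

variable {κ s : ℝ → ℝ} {F : ℝ → ℝ → ℝ} {K B s0 : ℝ}

theorem integrand_bound (h : PreSys κ s F K B s0) {ξ ρ : ℝ} (hξ : 0 < ξ) (hρ : ξ / 2 < ρ) :
    |κ ρ * F ξ (2 * ρ - ξ) + s ρ| ≤ (K * B + s0) * wtail ρ := by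
  have hρ0 : 0 < ρ := by linarith
  have h1 := h.κb ρ hρ0
  have h2 := h.Fb ξ (2 * ρ - ξ) hξ (by linarith)
  rw [show (ξ + (2 * ρ - ξ)) / 2 = ρ by ring] at h2
  have h3 := h.sb ρ hρ0
  have h4 := mul_le_mul_of_nonneg_left (rpow_neg_three_half_le hρ0) h.ρ0
  have h5 : |κ ρ * F ξ (2 * ρ - ξ)| ≤ (K * ρ ^ (-2 : ℝ)) * (B * wgrow ρ) := by
    rw [abs_mul]
    exact mul_le_mul h1 h2 (abs_nonneg _) ((abs_nonneg _).trans h1)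
  have h6 : (K * ρ ^ (-2 : ℝ)) * (B * wgrow ρ) = K * B * wtail ρ := by
    rw [← wgrow_mul hρ0]; ring
  calc _ ≤ |κ ρ * F ξ (2 * ρ - ξ)| + |s ρ| := abs_add_le _ _
    _ ≤ _ := by rw [add_mul]; linarith

theorem M0 (h : PreSys κ s F K B s0) : 0 ≤ K * B + s0 :=
  add_nonneg (mul_nonneg h.K0 h.B0) h.ρ0

theorem line_cont (h : PreSys κ s F K B s0) {ξ : ℝ} (hξ : 0 < ξ) :
    ContinuousOn (fun ρ => F ξ (2 * ρ - ξ)) (Ioi (ξ / 2)) :=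
  h.Fc.comp (f := fun ρ => (ξ, 2 * ρ - ξ)) (by fun_prop)
    (fun ρ hρ => ⟨hξ, by have : ξ / 2 < ρ := hρ; simp only [mem_Ioi]; linarith⟩)

theorem integrand_cont (h : PreSys κ s F K B s0) {ξ : ℝ} (hξ : 0 < ξ) :
    ContinuousOn (fun ρ => κ ρ * F ξ (2 * ρ - ξ) + s ρ) (Ioi (ξ / 2)) := by
  have hsub : Ioi (ξ / 2) ⊆ Ioi 0 := Ioi_subset_Ioi (by linarith)
  exact ((h.κc.mono hsub).mul (h.line_cont hξ)).add (h.sc.mono hsub)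

theorem integrand_int (h : PreSys κ s F K B s0) {ξ r : ℝ} (hξ : 0 < ξ) (hr : ξ / 2 < r) :
    IntegrableOn (fun ρ => κ ρ * F ξ (2 * ρ - ξ) + s ρ) (Ioi r) :=
  integrableOn_of_le_wtail (by linarith)
    ((h.integrand_cont hξ).mono (Ioi_subset_Ioi hr.le))
    (fun ρ hρ => h.integrand_bound hξ (hr.trans hρ))

theorem tailI_bound (h : PreSys κ s F K B s0) {ξ η : ℝ} (hξ : 0 < ξ) (hη : 0 < η) :
    |tailI κ s F ξ η| ≤ (K * B + s0) * wint ((ξ + η) / 2) :=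
  abs_integral_le_wint (by linarith) (fun ρ hρ => h.integrand_bound hξ (by linarith))

theorem tailI_cont (h : PreSys κ s F K B s0) :
    ContinuousOn (fun p : ℝ × ℝ => tailI κ s F p.1 p.2) (Ioi 0 ×ˢ Ioi 0) := by
  have : (fun p : ℝ × ℝ => tailI κ s F p.1 p.2) = fun p : ℝ × ℝ => ∫ σ in Ioi (0 : ℝ),
      (κ ((p.1 + p.2) / 2 + σ) * F p.1 (p.2 + 2 * σ) + s ((p.1 + p.2) / 2 + σ)) := by
    ext p
    unfold tailI
    rw [integral_Ioi_shift]
    congr 1; ext σ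
    rw [show 2 * ((p.1 + p.2) / 2 + σ) - p.1 = p.2 + 2 * σ by ring]
  rw [this]
  refine continuousOn_tail (isOpen_Ioi.prod isOpen_Ioi) (r := fun p : ℝ × ℝ => (p.1 + p.2) / 2)
    h.M0 (by fun_prop) ?_ ?_ ?_
  · rintro ⟨a, b⟩ ⟨ha, hb⟩
    simp only [mem_Ioi] at ha hb ⊢; linarith
  · have e1 : ContinuousOn (fun q : (ℝ × ℝ) × ℝ => (q.1.1 + q.1.2) / 2 + q.2)
        ((Ioi 0 ×ˢ Ioi 0) ×ˢ Ioi 0) := by fun_prop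
    have m1 : MapsTo (fun q : (ℝ × ℝ) × ℝ => (q.1.1 + q.1.2) / 2 + q.2)
        ((Ioi 0 ×ˢ Ioi 0) ×ˢ Ioi 0) (Ioi 0) := by
      rintro ⟨⟨a, b⟩, c⟩ ⟨⟨ha, hb⟩, hc⟩
      simp only [mem_Ioi] at ha hb hc ⊢; linarith
    refine ((h.κc.comp e1 m1).mul (h.Fc.comp
      (f := fun q : (ℝ × ℝ) × ℝ => (q.1.1, q.1.2 + 2 * q.2)) (by fun_prop) ?_)).add
      (h.sc.comp e1 m1)
    rintro ⟨⟨a, b⟩, c⟩ ⟨⟨ha, hb⟩, hc⟩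
    simp only [mem_Ioi] at ha hb hc
    exact ⟨ha, by simp only [mem_Ioi]; linarith⟩
  · rintro ⟨a, b⟩ ⟨ha, hb⟩ σ hσ
    simp only [mem_Ioi] at ha hb
    have := h.integrand_bound (ξ := a) (ρ := (a + b) / 2 + σ) ha (by linarith)
    rwa [show 2 * ((a + b) / 2 + σ) - a = b + 2 * σ by ring] at this

end PreSys

namespace Sys

variable {κ s G : ℝ → ℝ} {F : ℝ → ℝ → ℝ} {K B s0 : ℝ}

theorem der' (h : Sys κ s G F K B s0) {ξ η : ℝ} (hξ : 0 < ξ) (hη : 0 < η) :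
    HasDerivAt (fun x => F x η) (G ξ - 1 / 2 * tailI κ s F ξ η) ξ := h.der ξ η hξ hη

theorem der2 (h : Sys κ s G F K B s0) {ξ η : ℝ} (hξ : 0 < ξ) (hη : 0 < η) :
    HasDerivAt (fun y => F ξ y) (G η - 1 / 2 * tailI κ s F η ξ) η := by
  refine (h.der' hη hξ).congr_of_eventuallyEq ?_
  filter_upwards [Ioi_mem_nhds hη] with y hy
  exact h.sym ξ y hξ hy

/-- The null derivative `∂_ξ F`. -/
def nd (κ s G : ℝ → ℝ) (F : ℝ → ℝ → ℝ) (ξ η : ℝ) : ℝ := G ξ - 1 / 2 * tailI κ s F ξ η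

theorem nd_cont (h : Sys κ s G F K B s0) :
    ContinuousOn (fun p : ℝ × ℝ => nd κ s G F p.1 p.2) (Ioi 0 ×ˢ Ioi 0) := by
  refine ContinuousOn.sub (h.Gc.comp continuousOn_fst (fun p hp => hp.1)) ?_
  exact continuousOn_const.mul h.tailI_cont

theorem hasFDeriv (h : Sys κ s G F K B s0) {ξ η : ℝ} (hξ : 0 < ξ) (hη : 0 < η) :
    HasFDerivAt (Function.uncurry F)
      ((nd κ s G F ξ η) • ContinuousLinearMap.fst ℝ ℝ ℝ +
        (nd κ s G F η ξ) • ContinuousLinearMap.snd ℝ ℝ ℝ) (ξ, η) := by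
  have hopen : IsOpen ((Ioi 0 ×ˢ Ioi 0 : Set (ℝ × ℝ))) := isOpen_Ioi.prod isOpen_Ioi
  have hmem : ((Ioi 0 ×ˢ Ioi 0 : Set (ℝ × ℝ))) ∈ 𝓝 ((ξ, η) : ℝ × ℝ) :=
    hopen.mem_nhds ⟨hξ, hη⟩
  have c1 : ContinuousAt (fun p : ℝ × ℝ => nd κ s G F p.1 p.2) (ξ, η) :=
    h.nd_cont.continuousAt hmem
  have c2 : ContinuousAt (fun p : ℝ × ℝ => nd κ s G F p.2 p.1) (ξ, η) := by
    have : ContinuousAt (fun p : ℝ × ℝ => nd κ s G F p.1 p.2) (η, ξ) :=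
      h.nd_cont.continuousAt (hopen.mem_nhds ⟨hη, hξ⟩)
    exact this.comp (f := fun p : ℝ × ℝ => (p.2, p.1)) (x := (ξ, η)) (by fun_prop)
  have := hasStrictFDerivAt_uncurry_coprod (𝕜 := ℝ) (u := ((ξ, η) : ℝ × ℝ)) (f := F)
    (f₁ := fun a b => (nd κ s G F a b) • ContinuousLinearMap.id ℝ ℝ)
    (f₂ := fun a b => (nd κ s G F b a) • ContinuousLinearMap.id ℝ ℝ)
    (by
      filter_upwards [hmem] with v hv
      refine HasFDerivAt.congr_fderiv (h.der' hv.1 hv.2).hasFDerivAt ?_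
      refine ContinuousLinearMap.ext fun x => ?_
      simp [Function.HasUncurry.uncurry, nd, mul_comm])
    (by
      filter_upwards [hmem] with v hv
      refine HasFDerivAt.congr_fderiv (h.der2 hv.1 hv.2).hasFDerivAt ?_
      refine ContinuousLinearMap.ext fun x => ?_
      simp [Function.HasUncurry.uncurry, nd, mul_comm])
    (c1.smul continuousAt_const) (c2.smul continuousAt_const)
  refine HasFDerivAt.congr_fderiv this.hasFDerivAt ?_
  refine ContinuousLinearMap.ext fun x => ?_
  simp [Function.HasUncurry.uncurry]

end Sys

/-! ### Rigidity of nonradiative systems: polynomial dependence on time -/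

/-- The exterior region `r > a`, `|t| < r`. -/
def Dext (a : ℝ) : Set (ℝ × ℝ) := {p | a < p.1 ∧ |p.2| < p.1}

theorem isOpen_Dext (a : ℝ) : IsOpen (Dext a) :=
  (isOpen_lt continuous_const continuous_fst).inter
    (isOpen_lt (continuous_abs.comp continuous_snd) continuous_fst)

theorem Dext_add {a r t σ : ℝ} (h : (r, t) ∈ Dext a) (hσ : 0 ≤ σ) :
    (r + σ, t + σ) ∈ Dext a ∧ (r + σ, t - σ) ∈ Dext a := by
  obtain ⟨h1, h2⟩ := h
  simp only [] at h1 h2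
  have := abs_lt.1 h2
  refine ⟨⟨?_, abs_lt.2 ⟨?_, ?_⟩⟩, ⟨?_, abs_lt.2 ⟨?_, ?_⟩⟩⟩ <;> simp only <;> linarith

/-- The time-derivative operator of nonradiative systems. -/
def Top6 (κ : ℝ → ℝ) (g : ℝ → ℝ → ℝ) (r t : ℝ) : ℝ :=
  1 / 2 * ∫ σ in Ioi (0 : ℝ), κ (r + σ) * (g (r + σ) (t + σ) - g (r + σ) (t - σ))

/-- Continuity and power bound on an exterior region. -/
structure Nice6 (a : ℝ) (g : ℝ → ℝ → ℝ) (p C : ℝ) : Prop where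
  cont : ContinuousOn (Function.uncurry g) (Dext a)
  bd : ∀ r t, (r, t) ∈ Dext a → |g r t| ≤ C * r ^ p

section

variable {κ : ℝ → ℝ} {K a : ℝ} (ha : 0 < a) (κc : ContinuousOn κ (Ioi 0))
  (κb : ∀ r, 0 < r → |κ r| ≤ K * r ^ (-2 : ℝ)) (K0 : 0 ≤ K)

include ha κb K0 in
theorem Top6_integrand {g : ℝ → ℝ → ℝ} {p C : ℝ} (hg : Nice6 a g p C) {r t σ : ℝ}
    (h : (r, t) ∈ Dext a) (hσ : 0 ≤ σ) :
    |κ (r + σ) * (g (r + σ) (t + σ) - g (r + σ) (t - σ))| ≤ 2 * K * C * (r + σ) ^ (p - 2) := by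
  have hr : 0 < r + σ := by have := h.1; simp only at this; linarith
  have h1 := hg.bd _ _ (Dext_add h hσ).1
  have h2 := hg.bd _ _ (Dext_add h hσ).2
  have h3 := κb _ hr
  have h4 : |g (r + σ) (t + σ) - g (r + σ) (t - σ)| ≤ 2 * (C * (r + σ) ^ p) :=
    (abs_sub _ _).trans (by linarith)
  rw [abs_mul]
  refine (mul_le_mul h3 h4 (abs_nonneg _) ((abs_nonneg _).trans h3)).trans (le_of_eq ?_)
  rw [sub_eq_add_neg p 2, rpow_add hr]; ring

include ha in
theorem rpow_le_wtail {p ρ : ℝ} (hp : p ≤ 3 / 4) (hρ : a ≤ ρ) :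
    ρ ^ (p - 2) ≤ a ^ (p - 3 / 4) * wtail ρ := by
  have hρ0 : 0 < ρ := by linarith
  have h1 : ρ ^ (p - 2) = ρ ^ (p - 3 / 4) * ρ ^ (-(5/4) : ℝ) := by
    rw [← rpow_add hρ0]; congr 1; ring
  rw [h1]
  have h2 : ρ ^ (p - 3 / 4) ≤ a ^ (p - 3 / 4) := rpow_le_rpow_of_nonpos ha hρ (by linarith)
  have h3 : ρ ^ (-(5/4) : ℝ) ≤ wtail ρ := by
    unfold wtail; have : 0 < ρ ^ (-(7/4) : ℝ) := by positivity
    linarith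
  have : 0 < a ^ (p - 3/4) := by positivity
  exact mul_le_mul h2 h3 (by positivity) this.le

include ha κb K0 in
theorem Top6_wtail {g : ℝ → ℝ → ℝ} {p C : ℝ} (hC : 0 ≤ C) (hp : p ≤ 3 / 4)
    (hg : Nice6 a g p C) {r t σ : ℝ} (h : (r, t) ∈ Dext a) (hσ : 0 ≤ σ) :
    |κ (r + σ) * (g (r + σ) (t + σ) - g (r + σ) (t - σ))| ≤
      2 * K * C * a ^ (p - 3 / 4) * wtail (r + σ) := by
  refine (Top6_integrand ha κb K0 hg h hσ).trans ?_
  rw [mul_assoc (2 * K * C)]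
  refine mul_le_mul_of_nonneg_left (rpow_le_wtail ha hp ?_) (by positivity)
  have := h.1; simp only at this; linarith

include κc ha in
theorem Top6_integrand_cont {g : ℝ → ℝ → ℝ} (hg : ContinuousOn (Function.uncurry g) (Dext a)) :
    ContinuousOn (Function.uncurry fun (q : ℝ × ℝ) σ =>
      κ (q.1 + σ) * (g (q.1 + σ) (q.2 + σ) - g (q.1 + σ) (q.2 - σ))) (Dext a ×ˢ Ioi 0) := by
  have k1 : ContinuousOn (fun x : (ℝ × ℝ) × ℝ => κ (x.1.1 + x.2)) (Dext a ×ˢ Ioi 0) := by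
    refine κc.comp (f := fun x : (ℝ × ℝ) × ℝ => x.1.1 + x.2) (by fun_prop) ?_
    rintro ⟨⟨r, t⟩, σ⟩ ⟨h1, h2⟩
    have := h1.1; simp only [mem_Ioi] at *; linarith
  have k2 : ContinuousOn (fun x : (ℝ × ℝ) × ℝ => g (x.1.1 + x.2) (x.1.2 + x.2))
      (Dext a ×ˢ Ioi 0) := by
    refine hg.comp (f := fun x : (ℝ × ℝ) × ℝ => (x.1.1 + x.2, x.1.2 + x.2)) (by fun_prop) ?_
    rintro ⟨⟨r, t⟩, σ⟩ ⟨h1, h2⟩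
    exact (Dext_add h1 (le_of_lt h2)).1
  have k3 : ContinuousOn (fun x : (ℝ × ℝ) × ℝ => g (x.1.1 + x.2) (x.1.2 - x.2))
      (Dext a ×ˢ Ioi 0) := by
    refine hg.comp (f := fun x : (ℝ × ℝ) × ℝ => (x.1.1 + x.2, x.1.2 - x.2)) (by fun_prop) ?_
    rintro ⟨⟨r, t⟩, σ⟩ ⟨h1, h2⟩
    exact (Dext_add h1 (le_of_lt h2)).2
  exact k1.mul (k2.sub k3)

include ha κc κb K0 in
theorem Nice6.top {g : ℝ → ℝ → ℝ} {p C : ℝ} (hC : 0 ≤ C) (hp : p ≤ 3 / 4) (hg : Nice6 a g p C) :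
    Nice6 a (Top6 κ g) (p - 1) (K * C / (1 - p)) := by
  constructor
  · have := continuousOn_tail (isOpen_Dext a) (r := fun q : ℝ × ℝ => q.1)
      (M := 2 * K * C * a ^ (p - 3 / 4)) (by positivity) (by fun_prop)
      (fun q hq => ha.trans hq.1) (Top6_integrand_cont ha κc hg.cont)
      (fun q hq σ hσ => Top6_wtail ha κb K0 hC hp hg hq hσ.le)
    exact continuousOn_const.mul this
  · intro r t h
    have hr : 0 < r := ha.trans h.1
    unfold Top6
    have h1 := abs_tail_integral_le (g := fun ρ => κ ρ * (g ρ (t + (ρ - r)) - g ρ (t - (ρ - r))))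
      (a := p - 2) (C := 2 * K * C) hr (by linarith) (fun ρ hρ => by
        have := Top6_integrand ha κb K0 hg h (σ := ρ - r) (by linarith)
        simpa using this)
    rw [integral_Ioi_shift] at h1
    simp only [add_sub_cancel_left] at h1
    rw [abs_mul, abs_of_pos (by norm_num : (0:ℝ) < 1 / 2)]
    have h2 : p - 2 + 1 = p - 1 := by ring
    rw [h2] at h1
    have : (1 : ℝ) - p ≠ 0 := by intro hh; linarith
    calc _ ≤ 1 / 2 * _ := mul_le_mul_of_nonneg_left h1 (by norm_num)
      _ = _ := by rw [show -(p - 1) = 1 - p by ring]; field_simp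

include ha κc κb K0 in
theorem Nice6.top_der {g g' : ℝ → ℝ → ℝ} {p C C' : ℝ} (hC : 0 ≤ C) (hC' : 0 ≤ C') (hp : p ≤ 3 / 4)
    (hg : Nice6 a g p C) (hg' : Nice6 a g' (p - 1) C')
    (hd : ∀ r t, (r, t) ∈ Dext a → HasDerivAt (g r) (g' r t) t) :
    ∀ r t, (r, t) ∈ Dext a → HasDerivAt (Top6 κ g r) (Top6 κ g' r t) t := by
  intro r t h
  have hr : 0 < r := ha.trans h.1
  have hop : {x : ℝ | (r, x) ∈ Dext a} ∈ 𝓝 t :=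
    ((isOpen_Dext a).preimage (f := fun x : ℝ => (r, x)) (by fun_prop)).mem_nhds h
  have hcl : ∀ {G : ℝ → ℝ → ℝ}, ContinuousOn (Function.uncurry G) (Dext a) →
      ∀ x, (r, x) ∈ Dext a → ContinuousOn (fun σ =>
        κ (r + σ) * (G (r + σ) (x + σ) - G (r + σ) (x - σ))) (Ioi 0) := by
    intro G hG x hx
    exact (Top6_integrand_cont ha κc hG).comp (f := fun σ => ((r, x), σ)) (by fun_prop)
      (fun σ hσ => ⟨hx, hσ⟩)
  have key := hasDerivAt_integral_of_dominated_loc_of_deriv_le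
    (μ := volume.restrict (Ioi (0:ℝ)))
    (F := fun x σ => κ (r + σ) * (g (r + σ) (x + σ) - g (r + σ) (x - σ)))
    (F' := fun x σ => κ (r + σ) * (g' (r + σ) (x + σ) - g' (r + σ) (x - σ)))
    (x₀ := t) (s := {x : ℝ | (r, x) ∈ Dext a})
    (bound := fun σ => 2 * K * C' * a ^ (p - 1 - 3 / 4) * wtail (r + σ)) hop
    (by
      filter_upwards [hop] with x hx
      exact (hcl hg.cont x hx).aestronglyMeasurable measurableSet_Ioi)
    (by
      refine Integrable.mono' ((integrableOn_Ioi_shift.2 (wtail_integrableOn hr)).const_mul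
        (2 * K * C * a ^ (p - 3 / 4))) ((hcl hg.cont t h).aestronglyMeasurable measurableSet_Ioi) ?_
      refine ae_Ioi fun σ hσ => ?_
      exact Top6_wtail ha κb K0 hC hp hg h (le_of_lt hσ))
    ((hcl hg'.cont t h).aestronglyMeasurable measurableSet_Ioi)
    (by
      refine ae_Ioi fun σ hσ x hx => ?_
      exact Top6_wtail ha κb K0 hC' (by linarith) hg' hx (le_of_lt hσ))
    ((integrableOn_Ioi_shift.2 (wtail_integrableOn hr)).const_mul _)
    (by
      refine ae_Ioi fun σ hσ x hx => ?_
      have hσ' : (0:ℝ) ≤ σ := le_of_lt hσ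
      have d1 := (hd _ _ (Dext_add hx hσ').1).comp_add_const x σ
      have d2 := (hd _ _ (Dext_add hx hσ').2).comp_sub_const x σ
      exact (d1.sub d2).const_mul _)
  exact key.2.const_mul _

end

theorem Top6_odd {κ : ℝ → ℝ} {g : ℝ → ℝ → ℝ} {a : ℝ} (hg : ∀ r t, (r, t) ∈ Dext a → g r (-t) = g r t)
    {r t : ℝ} (h : (r, t) ∈ Dext a) : Top6 κ g r (-t) = - Top6 κ g r t := by
  unfold Top6
  rw [← mul_neg, ← integral_neg]
  congr 1
  refine Ioi_congr fun σ hσ => ?_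
  have hh := Dext_add h (le_of_lt hσ)
  rw [← hg _ _ hh.1, ← hg _ _ hh.2, show -(t + σ) = -t - σ by ring, show -(t - σ) = -t + σ by ring]
  ring

theorem Top6_even {κ : ℝ → ℝ} {g : ℝ → ℝ → ℝ} {a : ℝ}
    (hg : ∀ r t, (r, t) ∈ Dext a → g r (-t) = - g r t)
    {r t : ℝ} (h : (r, t) ∈ Dext a) : Top6 κ g r (-t) = Top6 κ g r t := by
  unfold Top6
  congr 1
  refine Ioi_congr fun σ hσ => ?_
  have hh := Dext_add h (le_of_lt hσ)
  have e1 := hg _ _ hh.1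
  have e2 := hg _ _ hh.2
  rw [show -(t + σ) = -t - σ by ring] at e1
  rw [show -(t - σ) = -t + σ by ring] at e2
  rw [e1, e2]; ring

theorem eq_of_deriv_Dext {g g' : ℝ → ℝ → ℝ} {a : ℝ}
    (hd : ∀ r t, (r, t) ∈ Dext a → HasDerivAt (g r) (g' r t) t)
    (c : ℝ → ℝ → ℝ) (c' : ℝ → ℝ → ℝ) (hc : ∀ r t, HasDerivAt (c r) (c' r t) t)
    (he : ∀ r t, (r, t) ∈ Dext a → g' r t = c' r t) (h0 : ∀ r, 0 < r → a < r → g r 0 = c r 0)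
    {r t : ℝ} (h : (r, t) ∈ Dext a) : g r t = c r t := by
  have hr : 0 < r := (abs_nonneg t).trans_lt h.2
  have hconv : Convex ℝ (Ioo (-r) r) := convex_Ioo _ _
  have hm : ∀ x ∈ Ioo (-r) r, (r, x) ∈ Dext a := fun x hx => ⟨h.1, abs_lt.2 hx⟩
  have hdiff : ∀ x ∈ Ioo (-r) r, HasDerivWithinAt (fun x => g r x - c r x) 0 (Ioo (-r) r) x := by
    intro x hx
    have := ((hd r x (hm x hx)).sub (hc r x)).hasDerivWithinAt (s := Ioo (-r) r)
    rwa [he r x (hm x hx), sub_self] at this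
  have h0' : (0:ℝ) ∈ Ioo (-r) r := ⟨by linarith, hr⟩
  have := hconv.norm_image_sub_le_of_norm_hasDerivWithin_le (C := 0) hdiff (by simp) h0'
    (abs_lt.1 h.2)
  simp only [zero_mul, norm_le_zero_iff, h0 r hr h.1, sub_self, sub_zero] at this
  linarith

/-- The fourth iterate vanishes by a contraction argument. -/
theorem contraction_Dext {κ : ℝ → ℝ} {a C : ℝ} (ha : 0 < a) {g g' : ℝ → ℝ → ℝ}
    (κb : ∀ r, 0 < r → |κ r| ≤ 33 / 4 * r ^ (-2 : ℝ)) (hC : 0 ≤ C)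
    (hb : ∀ r t, (r, t) ∈ Dext a → |g' r t| ≤ C * r ^ (-(13/4) : ℝ))
    (hd : ∀ r t, (r, t) ∈ Dext a → HasDerivAt (g r) (g' r t) t)
    (he : ∀ r t, (r, t) ∈ Dext a → g' r t = Top6 κ g r t) :
    ∀ r t, (r, t) ∈ Dext a → |g' r t| ≤ (132 / 221 * C) * r ^ (-(13/4) : ℝ) := by
  intro r t h
  have hr : 0 < r := ha.trans h.1
  rw [he r t h]
  have hdiff : ∀ σ, 0 < σ → |g (r + σ) (t + σ) - g (r + σ) (t - σ)| ≤
      C * (r + σ) ^ (-(13/4) : ℝ) * (2 * σ) := by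
    intro σ hσ
    have hh := Dext_add h hσ.le
    have hrσ : a < r + σ := hh.1.1
    have hm : ∀ x ∈ Icc (t - σ) (t + σ), (r + σ, x) ∈ Dext a := fun x hx =>
      ⟨hrσ, abs_lt.2 ⟨(abs_lt.1 hh.2.2).1.trans_le hx.1, hx.2.trans_lt (abs_lt.1 hh.1.2).2⟩⟩
    have := (convex_Icc (t - σ) (t + σ)).norm_image_sub_le_of_norm_hasDerivWithin_le
      (f := g (r + σ)) (f' := g' (r + σ)) (C := C * (r + σ) ^ (-(13/4) : ℝ))
      (fun x hx => (hd _ _ (hm x hx)).hasDerivWithinAt) (fun x hx => hb _ _ (hm x hx))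
      (left_mem_Icc.2 (by linarith)) (right_mem_Icc.2 (by linarith))
    rw [norm_eq_abs, norm_eq_abs, show t + σ - (t - σ) = 2 * σ by ring,
      abs_of_pos (by linarith : (0:ℝ) < 2 * σ)] at this
    exact this
  have hint : |∫ σ in Ioi (0:ℝ), κ (r + σ) * (g (r + σ) (t + σ) - g (r + σ) (t - σ))| ≤
      ∫ ρ in Ioi r, (33 / 2 * C) * (ρ ^ (-(17/4) : ℝ) - r * ρ ^ (-(21/4) : ℝ)) := by
    rw [integral_Ioi_shift (fun ρ => (33 / 2 * C) * (ρ ^ (-(17/4) : ℝ) - r * ρ ^ (-(21/4) : ℝ))),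
      ← norm_eq_abs]
    have hI : IntegrableOn (fun ρ => (33 / 2 * C) * (ρ ^ (-(17/4) : ℝ) - r * ρ ^ (-(21/4) : ℝ)))
        (Ioi r) :=
      ((integrableOn_Ioi_rpow_of_lt (by norm_num) hr).sub
        ((integrableOn_Ioi_rpow_of_lt (by norm_num) hr).const_mul r)).const_mul _
    refine norm_integral_le_of_norm_le (integrableOn_Ioi_shift.2 hI) ?_
    · refine ae_Ioi fun σ hσ => ?_
      have hσ' : (0:ℝ) < σ := hσ
      have hρ : 0 < r + σ := by linarith
      rw [norm_eq_abs, abs_mul]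
      refine (mul_le_mul (κb _ hρ) (hdiff σ hσ) (abs_nonneg _) (by positivity)).trans (le_of_eq ?_)
      have e1 : (r + σ) ^ (-(17/4) : ℝ) = (r + σ) * (r + σ) ^ (-(21/4) : ℝ) := by
        rw [← rpow_one_add' hρ.le (by norm_num)]; norm_num
      have e2 : (r + σ) ^ (-2 : ℝ) * (r + σ) ^ (-(13/4) : ℝ) = (r + σ) ^ (-(21/4) : ℝ) := by
        rw [← rpow_add hρ]; norm_num
      rw [e1, ← e2]; ring
  have hval : ∫ ρ in Ioi r, (33 / 2 * C) * (ρ ^ (-(17/4) : ℝ) - r * ρ ^ (-(21/4) : ℝ)) =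
      33 / 2 * C * (16 / 221) * r ^ (-(13/4) : ℝ) := by
    rw [integral_const_mul, integral_sub (integrableOn_Ioi_rpow_of_lt (by norm_num) hr)
      ((integrableOn_Ioi_rpow_of_lt (by norm_num) hr).const_mul r), integral_const_mul,
      integral_Ioi_rpow_of_lt (by norm_num) hr, integral_Ioi_rpow_of_lt (by norm_num) hr]
    have e1 : r ^ (-(13/4) : ℝ) = r * r ^ (-(17/4) : ℝ) := by
      rw [← rpow_one_add' hr.le (by norm_num)]; norm_num
    norm_num
    rw [e1]; ring
  unfold Top6
  rw [abs_mul, abs_of_pos (by norm_num : (0:ℝ) < 1 / 2)]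
  rw [hval] at hint
  linarith

theorem zero_of_contraction {D : Set (ℝ × ℝ)} {g : ℝ → ℝ → ℝ} {wt : ℝ → ℝ} {C₀ q : ℝ}
    (hq0 : 0 ≤ q) (hq : q < 1) (hC₀ : 0 ≤ C₀)
    (hb : ∀ r t, (r, t) ∈ D → |g r t| ≤ C₀ * wt r)
    (hstep : ∀ C, 0 ≤ C → (∀ r t, (r, t) ∈ D → |g r t| ≤ C * wt r) →
      ∀ r t, (r, t) ∈ D → |g r t| ≤ (q * C) * wt r) :
    ∀ r t, (r, t) ∈ D → g r t = 0 := by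
  have hn : ∀ n : ℕ, ∀ r t, (r, t) ∈ D → |g r t| ≤ (q ^ n * C₀) * wt r := by
    intro n
    induction n with
    | zero => simpa using hb
    | succ k ih =>
      intro r t h
      have := hstep _ (by positivity) ih r t h
      rwa [← mul_assoc, ← pow_succ'] at this
  intro r t h
  have hlim : Tendsto (fun n : ℕ => (q ^ n * C₀) * wt r) atTop (𝓝 ((0 * C₀) * wt r)) :=
    ((tendsto_pow_atTop_nhds_zero_of_lt_one hq0 hq).mul_const _).mul_const _
  rw [zero_mul, zero_mul] at hlim
  have := ge_of_tendsto' hlim (fun n => hn n r t h)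
  exact abs_nonpos_iff.1 this

namespace Sys

variable {κ s : ℝ → ℝ} {F : ℝ → ℝ → ℝ} {K B s0 : ℝ}

theorem der_time {G : ℝ → ℝ} (h : Sys κ s G F K B s0) {r t : ℝ} (ht : |t| < r) :
    HasDerivAt (fun t => F (r - t) (r + t))
      (G (r + t) - G (r - t) + Top6 κ (fun r t => F (r - t) (r + t)) r t) t := by
  have h1 := abs_lt.1 ht
  have hξ : 0 < r - t := by linarith
  have hη : 0 < r + t := by linarith
  have hF := h.hasFDeriv hξ hη
  have hp : HasDerivAt (fun t : ℝ => ((r - t, r + t) : ℝ × ℝ)) ((-1, 1) : ℝ × ℝ) t :=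
    ((hasDerivAt_id t).const_sub r).prodMk ((hasDerivAt_id t).const_add r)
  have := hF.comp_hasDerivAt t hp
  have e : (fun t => F (r - t) (r + t)) = Function.uncurry F ∘ fun t => (r - t, r + t) := rfl
  rw [e]
  have e1 : (r - t + (r + t)) / 2 = r := by ring
  have e2 : (r + t + (r - t)) / 2 = r := by ring
  have i1 := h.integrand_int hξ (r := r) (by linarith)
  have i2 := h.integrand_int hη (r := r) (by linarith)
  refine HasDerivAt.congr_deriv this ?_
  have key : ∫ σ in Ioi (0:ℝ), κ (r + σ) * (F (r + σ - (t + σ)) (r + σ + (t + σ)) -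
      F (r + σ - (t - σ)) (r + σ + (t - σ))) =
      (∫ ρ in Ioi r, (κ ρ * F (r - t) (2 * ρ - (r - t)) + s ρ)) -
      ∫ ρ in Ioi r, (κ ρ * F (r + t) (2 * ρ - (r + t)) + s ρ) := by
    rw [← integral_sub i1 i2, integral_Ioi_shift _ r]
    refine Ioi_congr fun σ hσ => ?_
    have hσ' : (0:ℝ) < σ := hσ
    rw [show r + σ - (t + σ) = r - t by ring, show r + σ + (t + σ) = 2 * (r + σ) - (r - t) by ring,
      show r + σ + (t - σ) = r + t by ring, show r + σ - (t - σ) = 2 * (r + σ) - (r + t) by ring,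
      h.sym (2 * (r + σ) - (r + t)) (r + t) (by linarith) hη]
    ring
  have e3 : (nd κ s G F (r - t) (r + t) • ContinuousLinearMap.fst ℝ ℝ ℝ +
      nd κ s G F (r + t) (r - t) • ContinuousLinearMap.snd ℝ ℝ ℝ) ((-1, 1) : ℝ × ℝ) =
      nd κ s G F (r + t) (r - t) - nd κ s G F (r - t) (r + t) := by
    change nd κ s G F (r - t) (r + t) * (-1) + nd κ s G F (r + t) (r - t) * 1 = _
    ring
  rw [e3]
  unfold nd tailI Top6
  rw [e1, e2, key]; ring

theorem nice0 {G : ℝ → ℝ} (h : Sys κ s G F K B s0) {a : ℝ} (ha : 0 < a) :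
    Nice6 a (fun r t => F (r - t) (r + t)) (3/4) (B * (1 + a ^ (-(1/2) : ℝ))) := by
  constructor
  · refine h.Fc.comp (f := fun p : ℝ × ℝ => (p.1 - p.2, p.1 + p.2)) (by fun_prop) ?_
    rintro ⟨r, t⟩ ⟨_, h2⟩
    have := abs_lt.1 h2
    constructor <;> simp only [mem_Ioi] at * <;> linarith
  · rintro r t ⟨h1, h2⟩
    have := abs_lt.1 h2
    simp only at h1 h2 this
    have hb := h.Fb (r - t) (r + t) (by linarith) (by linarith)
    rw [show (r - t + (r + t)) / 2 = r by ring] at hb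
    refine hb.trans ?_
    rw [mul_assoc]
    refine mul_le_mul_of_nonneg_left ?_ h.B0
    have hr : 0 < r := ha.trans h1
    have : r ^ (1/4 : ℝ) = r ^ (-(1/2) : ℝ) * r ^ (3/4 : ℝ) := by
      rw [← rpow_add hr]; norm_num
    unfold wgrow
    rw [this]
    have h3 := rpow_le_rpow_of_nonpos ha h1.le (by norm_num : (-(1/2) : ℝ) ≤ 0)
    have : 0 < r ^ (3/4 : ℝ) := by positivity
    nlinarith

/-- Nonradiative systems are quadratic polynomials in time. -/
theorem rigid (h : Sys κ s (fun _ => 0) F (33/4) B s0) :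
    ∃ w : ℝ → ℝ, (∀ r t, |t| < r → F (r - t) (r + t) = F r r + 1 / 2 * t ^ 2 * w r) ∧
      (∀ a, 0 < a → ∃ C, 0 ≤ C ∧ ∀ r, a < r → |w r| ≤ C * r ^ (-(5/4) : ℝ)) ∧
      ContinuousOn w (Ioi 0) ∧
      ∀ r, 0 < r → w r = ∫ ρ in Ioi r, κ ρ * ((ρ - r) * w ρ) := by
  set f0 : ℝ → ℝ → ℝ := fun r t => F (r - t) (r + t) with hf0
  set f1 := Top6 κ f0 with hf1
  set f2 := Top6 κ f1 with hf2
  set f3 := Top6 κ f2 with hf3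
  set f4 := Top6 κ f3 with hf4
  have d0 : ∀ a, ∀ r t, (r, t) ∈ Dext a → HasDerivAt (f0 r) (f1 r t) t := by
    intro a r t hrt
    have := h.der_time (r := r) (t := t) hrt.2
    simpa using this
  have main : ∀ a, 0 < a → (∀ r t, (r, t) ∈ Dext a → f3 r t = 0) ∧
      (∀ r t, (r, t) ∈ Dext a → f2 r t = f2 r 0) ∧ (∀ r t, (r, t) ∈ Dext a → f1 r t = t * f2 r 0) ∧
      (∀ r t, (r, t) ∈ Dext a → f0 r t = f0 r 0 + 1 / 2 * t ^ 2 * f2 r 0) ∧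
      (ContinuousOn (Function.uncurry f2) (Dext a)) ∧
      ∃ C, 0 ≤ C ∧ ∀ r, a < r → |f2 r 0| ≤ C * r ^ (-(5/4) : ℝ) := by
    intro a ha
    have hB := h.B0
    have n0 := h.nice0 ha
    obtain ⟨C0, hC0, n0⟩ : ∃ C, 0 ≤ C ∧ Nice6 a f0 (3/4) C := ⟨_, by positivity, n0⟩
    obtain ⟨C1, hC1, n1⟩ : ∃ C, 0 ≤ C ∧ Nice6 a f1 (3/4 - 1) C :=
      ⟨_, by norm_num; positivity, n0.top ha h.κc h.κb h.K0 hC0 (by norm_num)⟩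
    obtain ⟨C2, hC2, n2⟩ : ∃ C, 0 ≤ C ∧ Nice6 a f2 (3/4 - 1 - 1) C :=
      ⟨_, by norm_num; positivity, n1.top ha h.κc h.κb h.K0 hC1 (by norm_num)⟩
    obtain ⟨C3, hC3, n3⟩ : ∃ C, 0 ≤ C ∧ Nice6 a f3 (3/4 - 1 - 1 - 1) C :=
      ⟨_, by norm_num; positivity, n2.top ha h.κc h.κb h.K0 hC2 (by norm_num)⟩
    obtain ⟨C4, hC4, n4⟩ : ∃ C, 0 ≤ C ∧ Nice6 a f4 (3/4 - 1 - 1 - 1 - 1) C :=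
      ⟨_, by norm_num; positivity, n3.top ha h.κc h.κb h.K0 hC3 (by norm_num)⟩
    have d1 := Nice6.top_der ha h.κc h.κb h.K0 hC0 hC1 (by norm_num) n0 n1 (d0 a)
    have d2 := Nice6.top_der ha h.κc h.κb h.K0 hC1 hC2 (by norm_num) n1 n2 d1
    have d3 := Nice6.top_der ha h.κc h.κb h.K0 hC2 hC3 (by norm_num) n2 n3 d2
    have e0 : ∀ r t, (r, t) ∈ Dext a → f0 r (-t) = f0 r t := by
      intro r t hrt
      have := abs_lt.1 hrt.2
      simp only at this
      simp only [hf0]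
      rw [h.sym _ _ (by linarith) (by linarith)]
      congr 1 <;> ring
    have e1 : ∀ r t, (r, t) ∈ Dext a → f1 r (-t) = - f1 r t := fun r t hrt => Top6_odd e0 hrt
    have e2 : ∀ r t, (r, t) ∈ Dext a → f2 r (-t) = f2 r t := fun r t hrt => Top6_even e1 hrt
    have e3 : ∀ r t, (r, t) ∈ Dext a → f3 r (-t) = - f3 r t := fun r t hrt => Top6_odd e2 hrt
    have z : ∀ {r : ℝ}, 0 < r → a < r → (r, (0:ℝ)) ∈ Dext a := fun hr har => ⟨har, by simpa using hr⟩
    have f4z : ∀ r t, (r, t) ∈ Dext a → f4 r t = 0 := by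
      refine zero_of_contraction (wt := fun r => r ^ (-(13/4) : ℝ)) (q := 132 / 221)
        (by norm_num) (by norm_num) hC4 ?_ ?_
      · intro r t hrt
        have := n4.bd r t hrt
        norm_num at this ⊢; exact this
      · intro C hC hb
        exact contraction_Dext ha h.κb hC hb d3 (fun r t _ => rfl)
    have f3z : ∀ r t, (r, t) ∈ Dext a → f3 r t = 0 := by
      intro r t hrt
      refine eq_of_deriv_Dext d3 (fun _ _ => 0) (fun _ _ => 0) (fun _ _ => hasDerivAt_const _ _)
        f4z ?_ hrt
      intro r hr har
      have := e3 r 0 (z hr har)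
      rw [neg_zero] at this; linarith
    have f2c : ∀ r t, (r, t) ∈ Dext a → f2 r t = f2 r 0 := by
      intro r t hrt
      exact eq_of_deriv_Dext d2 (fun r _ => f2 r 0) (fun _ _ => 0) (fun _ _ => hasDerivAt_const _ _)
        f3z (fun _ _ _ => rfl) hrt
    have f1c : ∀ r t, (r, t) ∈ Dext a → f1 r t = t * f2 r 0 := by
      intro r t hrt
      refine eq_of_deriv_Dext d1 (fun r t => t * f2 r 0) (fun r _ => f2 r 0)
        (fun r t => by simpa using (hasDerivAt_id t).mul_const (f2 r 0)) f2c ?_ hrt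
      intro r hr har
      have := e1 r 0 (z hr har)
      rw [neg_zero] at this; simp only [zero_mul]; linarith
    refine ⟨f3z, f2c, f1c, ?_, n2.cont, C2, hC2, ?_⟩
    · intro r t hrt
      refine eq_of_deriv_Dext (d0 a) (fun r t => f0 r 0 + 1 / 2 * t ^ 2 * f2 r 0)
        (fun r t => t * f2 r 0) ?_ f1c ?_ hrt
      · intro r t
        have := (((hasDerivAt_pow 2 t).const_mul (1/2:ℝ)).mul_const (f2 r 0)).const_add (f0 r 0)
        refine this.congr_deriv ?_
        simp
      · intro r _ _; simp
    · intro r har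
      have := n2.bd r 0 (z (ha.trans har) har)
      norm_num at this ⊢; exact this
  refine ⟨fun r => f2 r 0, ?_, ?_, ?_, ?_⟩
  · intro r t ht
    have hr : 0 < r := (abs_nonneg t).trans_lt ht
    have := (main (r/2) (by linarith)).2.2.2.1 r t ⟨by simp only; linarith, ht⟩
    simpa [hf0] using this
  · intro a ha
    exact (main a ha).2.2.2.2.2
  · intro r hr
    have hr' : (0:ℝ) < r := hr
    have := (main (r/2) (by linarith)).2.2.2.2.1
    have hmem : (r, (0:ℝ)) ∈ Dext (r/2) := ⟨by simp only; linarith, by simpa using hr'⟩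
    have := this.continuousAt ((isOpen_Dext _).mem_nhds hmem)
    exact (this.comp (f := fun r : ℝ => (r, (0:ℝ))) (by fun_prop)).continuousWithinAt
  · intro r hr
    have hm := (main (r/2) (by linarith)).2.2.1
    rw [integral_Ioi_shift]
    have hmem : (r, (0:ℝ)) ∈ Dext (r/2) := ⟨by simp only; linarith, by simpa using hr⟩
    show 1 / 2 * _ = _
    rw [← integral_const_mul]
    refine Ioi_congr fun σ hσ => ?_
    have hh := Dext_add hmem (le_of_lt hσ)
    simp only
    rw [hm _ _ hh.1, hm _ _ hh.2]; ring

end Sys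

/-! ### Second-order linear ODEs on the half line -/

theorem ode2_zero {κ D D' : ℝ → ℝ} (hκ : ContinuousOn κ (Ioi 0))
    (h1 : ∀ r, 0 < r → HasDerivAt D (D' r) r)
    (h2 : ∀ r, 0 < r → HasDerivAt D' (κ r * D r) r) (h01 : D 1 = 0) (h02 : D' 1 = 0) :
    ∀ r, 0 < r → D r = 0 := by
  intro r hr
  set a := min r 1 / 2 with ha
  set b := max r 1 + 1 with hb
  have ha0 : 0 < a := by positivity
  have har : a < r := by have := min_le_left r 1; have := lt_min hr one_pos; linarith
  have ha1 : a < 1 := by have := min_le_right r 1; linarith [lt_min hr one_pos]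
  have hrb : r < b := by have := le_max_left r 1; linarith
  have h1b : 1 < b := by have := le_max_right r 1; linarith
  obtain ⟨M, hM⟩ := isCompact_Icc.exists_bound_of_continuousOn
    (hκ.mono (fun x hx => lt_of_lt_of_le ha0 hx.1) : ContinuousOn κ (Icc a b))
  have hM0 : 0 ≤ M := (norm_nonneg _).trans (hM a ⟨le_rfl, by linarith⟩)
  set v : ℝ → ℝ × ℝ → ℝ × ℝ := fun t p => (p.2, κ t * p.1) with hv
  have hlip : ∀ t ∈ Ioo a b, LipschitzOnWith (Real.toNNReal (max 1 M)) (v t) univ := by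
    intro t ht
    refine LipschitzOnWith.of_dist_le_mul fun x _ y _ => ?_
    rw [Real.coe_toNNReal _ (by positivity)]
    rw [Prod.dist_eq]
    refine max_le ?_ ?_
    · calc dist x.2 y.2 ≤ dist x y := by rw [Prod.dist_eq]; exact le_max_right _ _
        _ ≤ max 1 M * dist x y := le_mul_of_one_le_left dist_nonneg (le_max_left _ _)
    · change dist (κ t * x.1) (κ t * y.1) ≤ _
      rw [dist_eq, ← mul_sub, abs_mul]
      refine mul_le_mul ?_ ?_ (abs_nonneg _) (by positivity)
      · exact (hM t ⟨ht.1.le, ht.2.le⟩).trans (le_max_right _ _)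
      · rw [← dist_eq, Prod.dist_eq]; exact le_max_left _ _
  have := ODE_solution_unique_of_mem_Ioo (v := v) (s := fun _ => univ)
    (K := Real.toNNReal (max 1 M)) (f := fun t => (D t, D' t)) (g := fun _ => (0, 0))
    (a := a) (b := b) (t₀ := 1) hlip ⟨ha1, h1b⟩
    (fun t ht => ⟨(h1 t (ha0.trans ht.1)).prodMk (h2 t (ha0.trans ht.1)), mem_univ _⟩)
    (fun t ht => ⟨by
      have := (hasDerivAt_const t ((0, 0) : ℝ × ℝ))
      refine this.congr_deriv ?_
      simp [hv, Prod.ext_iff], mem_univ _⟩) (by simp [h01, h02])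
  have h := this ⟨har, hrb⟩
  exact (Prod.mk.inj h).1

/-- A function with zero derivative on the half line and tending to zero at infinity vanishes. -/
theorem zero_of_deriv_zero {f : ℝ → ℝ} (hf : ∀ r, 0 < r → HasDerivAt f 0 r)
    (hl : Tendsto f atTop (𝓝 0)) : ∀ r, 0 < r → f r = 0 := by
  have hc : ∀ r s, 0 < r → 0 < s → f r = f s := by
    intro r s hr hs
    have hconv : Convex ℝ (Ioi (0:ℝ)) := convex_Ioi 0
    have := hconv.norm_image_sub_le_of_norm_hasDerivWithin_le (f := f) (f' := fun _ => 0) (C := 0)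
      (fun x hx => (hf x hx).hasDerivWithinAt) (by simp) hs hr
    simp only [zero_mul, norm_le_zero_iff] at this
    linarith
  intro r hr
  have : Tendsto f atTop (𝓝 (f r)) :=
    tendsto_const_nhds.congr' (by filter_upwards [eventually_gt_atTop 0] with x hx using hc r x hr hx)
  exact tendsto_nhds_unique this hl

theorem tail_hasDerivAt {g : ℝ → ℝ} {r : ℝ} (hr : 0 < r) (hc : ContinuousOn g (Ioi 0))
    (hi : ∀ a, 0 < a → IntegrableOn g (Ioi a)) :
    HasDerivAt (fun r => ∫ ρ in Ioi r, g ρ) (-g r) r := by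
  have hr2 : (0:ℝ) < r / 2 := by linarith
  have e : (fun x => ∫ ρ in Ioi x, g ρ) =ᶠ[𝓝 r]
      fun x => (∫ ρ in Ioi (r/2), g ρ) - ∫ ρ in (r/2)..x, g ρ := by
    filter_upwards [Ioi_mem_nhds (show r / 2 < r by linarith)] with x hx
    have := intervalIntegral.integral_Ioi_sub_Ioi (hi (r/2) hr2) (le_of_lt hx)
    linarith
  refine HasDerivAt.congr_of_eventuallyEq ?_ e
  refine ((intervalIntegral.integral_hasDerivAt_right ?_ ?_ ?_).const_sub _).congr_deriv rfl
  · rw [intervalIntegrable_iff_integrableOn_Ioc_of_le (by linarith)]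
    exact (hi _ hr2).mono_set Ioc_subset_Ioi_self
  · exact hc.stronglyMeasurableAtFilter isOpen_Ioi r hr
  · exact hc.continuousAt (Ioi_mem_nhds hr)

namespace Sys

variable {κ s : ℝ → ℝ} {F : ℝ → ℝ → ℝ} {K B s0 : ℝ}

theorem diag_cont {G : ℝ → ℝ} (h : Sys κ s G F K B s0) : ContinuousOn (fun r => F r r) (Ioi 0) :=
  h.Fc.comp (f := fun r => (r, r)) (by fun_prop) (fun _ hr => ⟨hr, hr⟩)

theorem diag_der {G : ℝ → ℝ} (h : Sys κ s G F K B s0) {r : ℝ} (hr : 0 < r) :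
    HasDerivAt (fun r => F r r) (2 * nd κ s G F r r) r := by
  have hp : HasDerivAt (fun r : ℝ => ((r, r) : ℝ × ℝ)) ((1, 1) : ℝ × ℝ) r :=
    (hasDerivAt_id r).prodMk (hasDerivAt_id r)
  have hF := h.hasFDeriv hr hr
  have := HasFDerivAt.comp_hasDerivAt (f := fun r : ℝ => ((r, r) : ℝ × ℝ)) r hF hp
  refine HasDerivAt.congr_deriv this ?_
  change nd κ s G F r r * 1 + nd κ s G F r r * 1 = _
  ring

theorem diag_tail_int {G : ℝ → ℝ} (h : Sys κ s G F K B s0) {r : ℝ} (hr : 0 < r) :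
    IntegrableOn (fun ρ => κ ρ * F ρ ρ + s ρ) (Ioi r) := by
  refine integrableOn_of_le_wtail (C := K * B + s0) hr
    (((h.κc.mul h.diag_cont).add h.sc).mono (fun x hx => hr.trans hx)) fun ρ hρ => ?_
  have hρ0 := hr.trans hρ
  have h1 := h.κb ρ hρ0
  have h2 := h.Fb ρ ρ hρ0 hρ0
  rw [show (ρ + ρ) / 2 = ρ by ring] at h2
  have h3 := (h.sb ρ hρ0).trans (mul_le_mul_of_nonneg_left (rpow_neg_three_half_le hρ0) h.ρ0)
  have h4 : |κ ρ * F ρ ρ| ≤ K * B * wtail ρ := by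
    rw [abs_mul, ← wgrow_mul hρ0]
    calc _ ≤ (K * ρ ^ (-2:ℝ)) * (B * wgrow ρ) := by
          have := h.K0
          gcongr
      _ = _ := by ring
  calc _ ≤ |κ ρ * F ρ ρ| + |s ρ| := abs_add_le _ _
    _ ≤ _ := by rw [add_mul]; exact add_le_add h4 h3

/-- The ODE system satisfied by a nonradiative system. -/
theorem rigid_ode (h : Sys κ s (fun _ => 0) F (33/4) B s0) :
    ∃ w wd m : ℝ → ℝ, (∀ r t, |t| < r → F (r - t) (r + t) = F r r + 1 / 2 * t ^ 2 * w r) ∧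
      (∃ C, 0 ≤ C ∧ ∀ r, 1 < r → |w r| ≤ C * r ^ (-(5/4) : ℝ) ∧ |wd r| ≤ C * r ^ (-(9/4) : ℝ)) ∧
      (∀ r, 0 < r → HasDerivAt w (wd r) r) ∧
      (∀ r, 0 < r → HasDerivAt wd (κ r * w r) r) ∧
      (∀ r, 0 < r → HasDerivAt (fun r => F r r) (m r) r) ∧
      (∀ r, 0 < r → HasDerivAt m (κ r * F r r + s r + w r) r) ∧
      (∃ C, 0 ≤ C ∧ ∀ r, 0 < r → |m r| ≤ C * wint r) := by
  obtain ⟨w, hF, hwb, hwc, hw⟩ := h.rigid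
  have hint : ∀ p : ℝ, 0 ≤ p → p ≤ 2 → ∀ a, 0 < a →
      IntegrableOn (fun ρ => κ ρ * (ρ ^ p * w ρ)) (Ioi a) := by
    intro p hp0 hp a ha
    obtain ⟨C, hC, hb⟩ := hwb a ha
    refine tail_integrableOn (C := 33/4 * C) (a := p - 13/4) ha (by linarith) ?_ ?_
    · exact ((h.κc.mul ((continuousOn_id.rpow_const (fun x hx => Or.inr hp0)).mul hwc))).mono
        (fun x hx => ha.trans hx)
    · intro ρ hρ
      have hρ0 := ha.trans hρ
      rw [abs_mul, abs_mul, abs_of_pos (rpow_pos_of_pos hρ0 p)]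
      calc _ ≤ (33/4 * ρ ^ (-2:ℝ)) * (ρ ^ p * (C * ρ ^ (-(5/4):ℝ))) := by
            gcongr
            · exact h.κb ρ hρ0
            · exact hb ρ hρ
        _ = 33/4 * C * (ρ ^ (-2:ℝ) * ρ ^ p * ρ ^ (-(5/4):ℝ)) := by ring
        _ = _ := by rw [← rpow_add hρ0, ← rpow_add hρ0]; ring_nf
  have i0 : ∀ a, 0 < a → IntegrableOn (fun ρ => κ ρ * w ρ) (Ioi a) := by
    intro a ha; simpa using hint 0 le_rfl (by norm_num) a ha
  have i1 : ∀ a, 0 < a → IntegrableOn (fun ρ => κ ρ * (ρ * w ρ)) (Ioi a) := by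
    intro a ha; simpa using hint 1 (by norm_num) (by norm_num) a ha
  have i2 : ∀ a, 0 < a → IntegrableOn (fun ρ => κ ρ * (ρ ^ 2 * w ρ)) (Ioi a) := by
    intro a ha; simpa using hint 2 (by norm_num) (by norm_num) a ha
  have d0 : ∀ r, 0 < r → HasDerivAt (fun r => ∫ ρ in Ioi r, κ ρ * w ρ) (-(κ r * w r)) r :=
    fun r hr => tail_hasDerivAt hr (h.κc.mul hwc) i0
  have d1 : ∀ r, 0 < r → HasDerivAt (fun r => ∫ ρ in Ioi r, κ ρ * (ρ * w ρ))
      (-(κ r * (r * w r))) r :=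
    fun r hr => tail_hasDerivAt hr (h.κc.mul (continuousOn_id.mul hwc)) i1
  have d2 : ∀ r, 0 < r → HasDerivAt (fun r => ∫ ρ in Ioi r, κ ρ * (ρ ^ 2 * w ρ))
      (-(κ r * (r ^ 2 * w r))) r :=
    fun r hr => tail_hasDerivAt hr (h.κc.mul ((continuousOn_id.pow 2).mul hwc)) i2
  have dv : ∀ r, 0 < r → HasDerivAt (fun r => ∫ ρ in Ioi r, (κ ρ * F ρ ρ + s ρ))
      (-(κ r * F r r + s r)) r :=
    fun r hr => tail_hasDerivAt hr ((h.κc.mul h.diag_cont).add h.sc)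
      (fun a ha => h.diag_tail_int ha)
  set I0 := fun r => ∫ ρ in Ioi r, κ ρ * w ρ with hI0
  set I1 := fun r => ∫ ρ in Ioi r, κ ρ * (ρ * w ρ) with hI1
  set I2 := fun r => ∫ ρ in Ioi r, κ ρ * (ρ ^ 2 * w ρ) with hI2
  set Iv := fun r => ∫ ρ in Ioi r, (κ ρ * F ρ ρ + s ρ) with hIv
  have hw' : ∀ r, 0 < r → w r = I1 r - r * I0 r := by
    intro r hr
    rw [hw r hr, hI0, hI1]
    simp only
    rw [← integral_const_mul, ← integral_sub (i1 r hr) ((i0 r hr).const_mul r)]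
    congr 1; ext ρ; ring
  have hm : ∀ r, 0 < r → 2 * nd κ s (fun _ => 0) F r r =
      -Iv r - 1 / 2 * I2 r + r * I1 r - 1 / 2 * r ^ 2 * I0 r := by
    intro r hr
    unfold nd tailI
    rw [show (r + r) / 2 = r by ring]
    have : ∫ ρ in Ioi r, (κ ρ * F r (2 * ρ - r) + s ρ) =
        ∫ ρ in Ioi r, ((κ ρ * F ρ ρ + s ρ) + 1 / 2 * (κ ρ * (ρ ^ 2 * w ρ)) -
          r * (κ ρ * (ρ * w ρ)) + 1 / 2 * r ^ 2 * (κ ρ * w ρ)) := by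
      refine Ioi_congr fun ρ hρ => ?_
      have hρ' : r < ρ := hρ
      have := hF ρ (ρ - r) (by rw [abs_of_pos] <;> linarith)
      rw [show ρ - (ρ - r) = r by ring, show ρ + (ρ - r) = 2 * ρ - r by ring] at this
      change κ ρ * F r (2 * ρ - r) + s ρ = _
      rw [this]; ring
    rw [this, integral_add, integral_sub, integral_add, integral_const_mul, integral_const_mul,
      integral_const_mul]
    · ring
    · exact h.diag_tail_int hr
    · exact (i2 r hr).const_mul _
    · exact (h.diag_tail_int hr).add ((i2 r hr).const_mul _)
    · exact (i1 r hr).const_mul _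
    · exact ((h.diag_tail_int hr).add ((i2 r hr).const_mul _)).sub ((i1 r hr).const_mul _)
    · exact (i0 r hr).const_mul _
  refine ⟨w, fun r => -I0 r, fun r => 2 * nd κ s (fun _ => 0) F r r, hF, ?_, ?_, ?_, ?_, ?_, ?_⟩
  · obtain ⟨C, hC, hb⟩ := hwb 1 one_pos
    refine ⟨max C (33/4 * C / (9/4)), by positivity, fun r hr => ⟨?_, ?_⟩⟩
    · exact (hb r hr).trans (by gcongr; exact le_max_left _ _)
    · have hr0 : 0 < r := by linarith
      rw [abs_neg]
      have := abs_tail_integral_le (g := fun ρ => κ ρ * w ρ) (C := 33/4 * C) (a := -(13/4)) hr0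
        (by norm_num) (fun ρ hρ => by
          have hρ0 := hr0.trans hρ
          rw [abs_mul]
          calc _ ≤ (33/4 * ρ ^ (-2:ℝ)) * (C * ρ ^ (-(5/4):ℝ)) := by
                gcongr
                · exact h.κb ρ hρ0
                · exact hb ρ (hr.trans hρ)
            _ = 33/4 * C * (ρ ^ (-2:ℝ) * ρ ^ (-(5/4):ℝ)) := by ring
            _ = _ := by rw [← rpow_add hρ0]; norm_num)
      refine this.trans ?_
      rw [show (-(13/4) + 1 : ℝ) = -(9/4) by norm_num, neg_neg]
      have h2 : 33/4 * C / (9/4) ≤ max C (33/4 * C / (9/4)) := le_max_right _ _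
      calc _ = 33/4 * C / (9/4) * r ^ (-(9/4):ℝ) := by ring
        _ ≤ _ := by gcongr
  · intro r hr
    have e : w =ᶠ[𝓝 r] fun r => I1 r - r * I0 r := by
      filter_upwards [Ioi_mem_nhds hr] with x hx using hw' x hx
    refine HasDerivAt.congr_of_eventuallyEq ?_ e
    refine ((d1 r hr).sub ((hasDerivAt_id r).mul (d0 r hr))).congr_deriv ?_
    simp only [id]; ring
  · intro r hr
    exact (d0 r hr).neg.congr_deriv (by simp)
  · intro r hr; exact h.diag_der hr
  · intro r hr
    have e : (fun r => 2 * nd κ s (fun _ => 0) F r r) =ᶠ[𝓝 r]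
        fun r => -Iv r - 1 / 2 * I2 r + r * I1 r - 1 / 2 * r ^ 2 * I0 r := by
      filter_upwards [Ioi_mem_nhds hr] with x hx using hm x hx
    refine HasDerivAt.congr_of_eventuallyEq ?_ e
    have := (((dv r hr).neg.sub ((d2 r hr).const_mul (1/2))).add
      ((hasDerivAt_id r).mul (d1 r hr))).sub
      ((((hasDerivAt_id r).pow 2).const_mul (1/2)).mul (d0 r hr))
    refine HasDerivAt.congr_deriv this ?_
    simp only [id]
    rw [hw' r hr]
    simp
    ring
  · refine ⟨33/4 * B + s0, h.M0, fun r hr => ?_⟩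
    have := h.tailI_bound hr hr
    rw [show (r + r) / 2 = r by ring] at this
    unfold nd
    change |2 * (0 - 1 / 2 * tailI κ s F r r)| ≤ _
    rw [show (2 * (0 - 1 / 2 * tailI κ s F r r)) = - tailI κ s F r r by ring, abs_neg]
    exact this

end Sys

/-! ### The radial potential and the zero mode -/

/-- The radial profile of the rescaled potential. -/
def Vr (l r : ℝ) : ℝ := -(1152 * l ^ 2) / (r ^ 2 + 24 * l ^ 2) ^ 2

/-- The radial profile of the rescaled zero mode `(ΛW)_{(l)}`. -/
def phi (l r : ℝ) : ℝ := 1152 * l ^ 2 * (24 * l ^ 2 - r ^ 2) / (r ^ 2 + 24 * l ^ 2) ^ 3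

/-- The derivative of `phi l`. -/
def phid (l r : ℝ) : ℝ := 4608 * l ^ 2 * r * (r ^ 2 - 48 * l ^ 2) / (r ^ 2 + 24 * l ^ 2) ^ 4

theorem phi_der {l : ℝ} (hl : 0 < l) (r : ℝ) : HasDerivAt (phi l) (phid l r) r := by
  have hD : r ^ 2 + 24 * l ^ 2 ≠ 0 := by positivity
  have h1 : HasDerivAt (fun r : ℝ => 1152 * l ^ 2 * (24 * l ^ 2 - r ^ 2))
      (1152 * l ^ 2 * (-(2 * r))) r := by
    have := ((hasDerivAt_pow 2 r).const_sub (24 * l ^ 2)).const_mul (1152 * l ^ 2)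
    exact this.congr_deriv (by norm_num)
  have h2 : HasDerivAt (fun r : ℝ => (r ^ 2 + 24 * l ^ 2) ^ 3)
      (3 * (r ^ 2 + 24 * l ^ 2) ^ 2 * (2 * r)) r := by
    have := ((hasDerivAt_pow 2 r).add_const (24 * l ^ 2)).pow 3
    exact this.congr_deriv (by norm_num)
  refine (h1.div h2 (by positivity)).congr_deriv ?_
  unfold phid
  field_simp
  ring

theorem phid_der {l : ℝ} (hl : 0 < l) {r : ℝ} (hr : 0 < r) :
    HasDerivAt (phid l) (Vr l r * phi l r - 5 / r * phid l r) r := by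
  have hD : r ^ 2 + 24 * l ^ 2 ≠ 0 := by positivity
  have h1 : HasDerivAt (fun r : ℝ => 4608 * l ^ 2 * r * (r ^ 2 - 48 * l ^ 2))
      (4608 * l ^ 2 * (r ^ 2 - 48 * l ^ 2) + 4608 * l ^ 2 * r * (2 * r)) r := by
    have := ((hasDerivAt_id r).const_mul (4608 * l ^ 2)).mul
      ((hasDerivAt_pow 2 r).sub_const (48 * l ^ 2))
    exact this.congr_deriv (by simp)
  have h2 : HasDerivAt (fun r : ℝ => (r ^ 2 + 24 * l ^ 2) ^ 4)
      (4 * (r ^ 2 + 24 * l ^ 2) ^ 3 * (2 * r)) r := by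
    have := ((hasDerivAt_pow 2 r).add_const (24 * l ^ 2)).pow 4
    exact this.congr_deriv (by norm_num)
  refine (h1.div h2 (by positivity)).congr_deriv ?_
  unfold phid phi Vr
  field_simp
  ring

theorem Vr_neg {l r : ℝ} (hl : 0 < l) : Vr l r < 0 := by
  unfold Vr
  have : 0 < 1152 * l ^ 2 / (r ^ 2 + 24 * l ^ 2) ^ 2 := by positivity
  rw [neg_div]; linarith

theorem abs_Vr (l r : ℝ) : |Vr l r| = 1152 * l ^ 2 / (r ^ 2 + 24 * l ^ 2) ^ 2 := by
  unfold Vr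
  rw [neg_div, abs_neg, abs_of_nonneg (by positivity)]

theorem sq_mul_Vr_le {l r : ℝ} (hl : 0 < l) : r ^ 2 * |Vr l r| ≤ 12 := by
  rw [abs_Vr, mul_div_assoc', div_le_iff₀ (by positivity)]
  nlinarith [sq_nonneg (r ^ 2 - 24 * l ^ 2)]

theorem four_mul_Vr_le {l r : ℝ} (hl : 0 < l) : r ^ 4 * |Vr l r| ≤ 1152 * l ^ 2 := by
  rw [abs_Vr, mul_div_assoc', div_le_iff₀ (by positivity)]
  have : 0 ≤ l ^ 2 * (48 * l ^ 2 * r ^ 2 + 576 * l ^ 4) := by positivity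
  nlinarith

theorem Vr_le {l r : ℝ} (hl : 0 < l) : l ^ 2 * |Vr l r| ≤ 2 := by
  rw [abs_Vr, mul_div_assoc', div_le_iff₀ (by positivity)]
  have : 0 ≤ r ^ 2 * (48 * l ^ 2) + r ^ 4 := by positivity
  nlinarith

theorem abs_phi_le {l : ℝ} (hl : 0 < l) (r : ℝ) :
    |phi l r| ≤ 1152 * l ^ 2 / (r ^ 2 + 24 * l ^ 2) ^ 2 := by
  have hD : 0 < r ^ 2 + 24 * l ^ 2 := by positivity
  unfold phi
  rw [abs_div, abs_mul, abs_of_pos (by positivity : 0 < 1152 * l ^ 2),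
    abs_of_pos (by positivity : 0 < (r ^ 2 + 24 * l ^ 2) ^ 3), div_le_div_iff₀ (by positivity) (by positivity)]
  have : |24 * l ^ 2 - r ^ 2| ≤ r ^ 2 + 24 * l ^ 2 := by
    rw [abs_le]; constructor <;> nlinarith [sq_nonneg r, sq_nonneg l]
  calc _ ≤ 1152 * l ^ 2 * (r ^ 2 + 24 * l ^ 2) * (r ^ 2 + 24 * l ^ 2) ^ 2 := by gcongr
    _ = _ := by ring

theorem abs_phid_le {l r : ℝ} (hl : 0 < l) (hr : 0 ≤ r) :
    |phid l r| ≤ 9216 * l ^ 2 * r / (r ^ 2 + 24 * l ^ 2) ^ 3 := by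
  have hD : 0 < r ^ 2 + 24 * l ^ 2 := by positivity
  unfold phid
  rw [abs_div, abs_mul, abs_of_nonneg (by positivity : 0 ≤ 4608 * l ^ 2 * r),
    abs_of_pos (by positivity : 0 < (r ^ 2 + 24 * l ^ 2) ^ 4), div_le_div_iff₀ (by positivity) (by positivity)]
  have : |r ^ 2 - 48 * l ^ 2| ≤ 2 * (r ^ 2 + 24 * l ^ 2) := by
    rw [abs_le]; constructor <;> nlinarith [sq_nonneg r, sq_nonneg l]
  calc _ ≤ 4608 * l ^ 2 * r * (2 * (r ^ 2 + 24 * l ^ 2)) * (r ^ 2 + 24 * l ^ 2) ^ 3 := by gcongr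
    _ = _ := by ring

theorem abs_phi_le_inv_four {l r : ℝ} (hl : 0 < l) (hr : 0 < r) : |phi l r| ≤ 1152 * l ^ 2 / r ^ 4 := by
  refine (abs_phi_le hl r).trans ?_
  gcongr
  nlinarith [sq_nonneg (r * l), sq_nonneg (l ^ 2)]

theorem abs_phi_le_const {l r : ℝ} (hl : 0 < l) : |phi l r| ≤ 2 / l ^ 2 := by
  refine (abs_phi_le hl r).trans ?_
  rw [div_le_div_iff₀ (by positivity) (by positivity)]
  have : 0 ≤ r ^ 2 * (48 * l ^ 2) + r ^ 4 := by positivity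
  nlinarith

theorem abs_phid_le_inv_five {l r : ℝ} (hl : 0 < l) (hr : 0 < r) :
    |phid l r| ≤ 9216 * l ^ 2 / r ^ 5 := by
  refine (abs_phid_le hl hr.le).trans ?_
  rw [div_le_div_iff₀ (by positivity) (by positivity)]
  have : (r ^ 2) ^ 3 ≤ (r ^ 2 + 24 * l ^ 2) ^ 3 := by gcongr; nlinarith [sq_nonneg l]
  calc _ = 9216 * l ^ 2 * (r ^ 2) ^ 3 := by ring
    _ ≤ _ := by gcongr

theorem abs_phid_le_lin {l r : ℝ} (hl : 0 < l) (hr : 0 < r) : |phid l r| ≤ r / l ^ 4 := by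
  refine (abs_phid_le hl hr.le).trans ?_
  rw [div_le_div_iff₀ (by positivity) (by positivity)]
  have : (24 * l ^ 2) ^ 3 ≤ (r ^ 2 + 24 * l ^ 2) ^ 3 := by gcongr; nlinarith [sq_nonneg r]
  calc _ ≤ r * (24 * l ^ 2) ^ 3 := by
        have : 0 < r * l ^ 6 := by positivity
        nlinarith
    _ ≤ _ := by gcongr

/-- `r^{5/2} phi 1`. -/
def zf (r : ℝ) : ℝ := r ^ (5/2 : ℝ) * phi 1 r

/-- The derivative of `zf`. -/
def zfd (r : ℝ) : ℝ := 5 / 2 * r ^ (3/2 : ℝ) * phi 1 r + r ^ (5/2 : ℝ) * phid 1 r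

theorem zf_der {r : ℝ} (hr : 0 < r) : HasDerivAt zf (zfd r) r := by
  have := (Real.hasDerivAt_rpow_const (x := r) (p := 5/2) (Or.inl hr.ne')).mul (phi_der one_pos r)
  refine this.congr_deriv ?_
  unfold zfd; norm_num

theorem zfd_der {r : ℝ} (hr : 0 < r) :
    HasDerivAt zfd ((15 / (4 * r ^ 2) + Vr 1 r) * zf r) r := by
  have h1 := ((Real.hasDerivAt_rpow_const (x := r) (p := 3/2) (Or.inl hr.ne')).const_mul (5/2)).mul
    (phi_der one_pos r)
  have h2 := (Real.hasDerivAt_rpow_const (x := r) (p := 5/2) (Or.inl hr.ne')).mul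
    (phid_der one_pos hr)
  refine (h1.add h2).congr_deriv ?_
  have e1 : r ^ (5/2 : ℝ) = r ^ 2 * r ^ (1/2:ℝ) := by
    rw [← Real.rpow_natCast, ← rpow_add hr]; norm_num
  have e2 : r ^ (3/2 : ℝ) = r * r ^ (1/2:ℝ) := by
    nth_rw 2 [← rpow_one r]; rw [← rpow_add hr]; norm_num
  have e3 : r ^ (5/2 - 1 : ℝ) = r * r ^ (1/2:ℝ) := by rw [← e2]; norm_num
  have e4 : r ^ (3/2 - 1 : ℝ) = r ^ (1/2:ℝ) := by norm_num
  unfold zf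
  rw [e3, e4, e1, e2]
  field_simp
  ring

theorem abs_zf_le {r : ℝ} (hr : 0 < r) : |zf r| ≤ 1152 * r ^ (-(3/2) : ℝ) := by
  unfold zf
  rw [abs_mul, abs_of_pos (rpow_pos_of_pos hr _)]
  have := abs_phi_le_inv_four one_pos hr
  calc _ ≤ r ^ (5/2:ℝ) * (1152 * 1 ^ 2 / r ^ 4) := by gcongr
    _ = 1152 * (r ^ (5/2:ℝ) * r ^ (-4:ℝ)) := by
      rw [rpow_neg hr.le, show r ^ (4:ℝ) = r ^ 4 from Real.rpow_natCast r 4]; ring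
    _ = _ := by rw [← rpow_add hr]; norm_num

theorem abs_zf_le' {r : ℝ} (hr : 0 < r) : |zf r| ≤ 2 * r ^ (5/2 : ℝ) := by
  unfold zf
  rw [abs_mul, abs_of_pos (rpow_pos_of_pos hr _), mul_comm]
  have := abs_phi_le_const (r := r) one_pos
  gcongr
  simpa using this

theorem abs_zfd_le_add {r : ℝ} (hr : 0 < r) :
    |zfd r| ≤ 5 / 2 * r ^ (3/2 : ℝ) * |phi 1 r| + r ^ (5/2 : ℝ) * |phid 1 r| := by
  refine (abs_add_le _ _).trans_eq ?_
  rw [abs_mul, abs_mul (r ^ (5/2:ℝ)), abs_of_pos (rpow_pos_of_pos hr (5/2)),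
    abs_of_pos (by positivity : 0 < 5/2 * r ^ (3/2:ℝ))]

theorem abs_zfd_le {r : ℝ} (hr : 0 < r) : |zfd r| ≤ 12096 * r ^ (-(5/2) : ℝ) := by
  have h1 := abs_phi_le_inv_four one_pos hr
  have h2 := abs_phid_le_inv_five one_pos hr
  calc _ ≤ _ := abs_zfd_le_add hr
    _ ≤ 5 / 2 * r ^ (3/2 : ℝ) * (1152 * 1 ^ 2 / r ^ 4) + r ^ (5/2 : ℝ) * (9216 * 1 ^ 2 / r ^ 5) := by
      gcongr
    _ = 2880 * (r ^ (3/2:ℝ) * r ^ (-4:ℝ)) + 9216 * (r ^ (5/2:ℝ) * r ^ (-5:ℝ)) := by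
      rw [rpow_neg hr.le, rpow_neg hr.le, show r ^ (4:ℝ) = r ^ 4 from Real.rpow_natCast r 4,
        show r ^ (5:ℝ) = r ^ 5 from Real.rpow_natCast r 5]; ring
    _ = _ := by rw [← rpow_add hr, ← rpow_add hr]; norm_num; ring

theorem abs_zfd_le' {r : ℝ} (hr : 0 < r) (hr1 : r ≤ 1) : |zfd r| ≤ 6 * r ^ (3/2 : ℝ) := by
  have h1 := abs_phi_le_const (r := r) one_pos
  have h2 := abs_phid_le_lin one_pos hr
  have e : r ^ (5/2:ℝ) = r ^ (3/2:ℝ) * r := by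
    nth_rw 3 [← rpow_one r]; rw [← rpow_add hr]; norm_num
  calc _ ≤ _ := abs_zfd_le_add hr
    _ ≤ 5 / 2 * r ^ (3/2 : ℝ) * (2 / 1 ^ 2) + r ^ (5/2 : ℝ) * (r / 1 ^ 4) := by
      gcongr
    _ ≤ _ := by
      rw [e]
      have : 0 < r ^ (3/2:ℝ) := by positivity
      have : r * r ≤ 1 := by nlinarith
      nlinarith

/-! ### Decay helpers -/

theorem tendsto_zero_of_rpow_atTop {f : ℝ → ℝ} {C p : ℝ} (hp : p < 0)
    (hb : ∀ r, 1 < r → |f r| ≤ C * r ^ p) : Tendsto f atTop (𝓝 0) := by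
  have h : Tendsto (fun r : ℝ => C * r ^ p) atTop (𝓝 (C * 0)) := by
    refine Tendsto.const_mul _ ?_
    have := tendsto_rpow_neg_atTop (y := -p) (by linarith)
    simpa using this
  rw [mul_zero] at h
  refine squeeze_zero_norm' ?_ h
  filter_upwards [eventually_gt_atTop 1] with r hr using hb r hr

theorem tendsto_zero_of_rpow_nhds {f : ℝ → ℝ} {C p : ℝ} (hp : 0 < p)
    (hb : ∀ r, 0 < r → r < 1 → |f r| ≤ C * r ^ p) : Tendsto f (𝓝[>] 0) (𝓝 0) := by
  have h : Tendsto (fun r : ℝ => C * r ^ p) (𝓝[>] 0) (𝓝 (C * 0)) := by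
    refine Tendsto.const_mul _ ?_
    have := (Real.continuousAt_rpow_const 0 p (Or.inr hp.le)).tendsto
    rw [zero_rpow hp.ne'] at this
    exact this.mono_left nhdsWithin_le_nhds
  rw [mul_zero] at h
  refine squeeze_zero_norm' ?_ h
  filter_upwards [Ioo_mem_nhdsGT (zero_lt_one' ℝ)] with r hr using hb r hr.1 hr.2

theorem wgrow_le_of_one_le {r : ℝ} (hr : 1 ≤ r) : wgrow r ≤ 2 * r ^ (3/4 : ℝ) := by
  unfold wgrow
  have : r ^ (1/4 : ℝ) ≤ r ^ (3/4:ℝ) := rpow_le_rpow_of_exponent_le hr (by norm_num)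
  linarith

theorem wgrow_le_of_le_one {r : ℝ} (h0 : 0 < r) (hr : r ≤ 1) : wgrow r ≤ 2 * r ^ (1/4 : ℝ) := by
  unfold wgrow
  have : r ^ (3/4 : ℝ) ≤ r ^ (1/4:ℝ) := rpow_le_rpow_of_exponent_ge h0 hr (by norm_num)
  linarith

theorem wint_le_of_one_le {r : ℝ} (hr : 1 ≤ r) : wint r ≤ 6 * r ^ (-(1/4) : ℝ) := by
  unfold wint
  have : r ^ (-(3/4) : ℝ) ≤ r ^ (-(1/4):ℝ) := rpow_le_rpow_of_exponent_le hr (by norm_num)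
  have : 0 < r ^ (-(1/4):ℝ) := by positivity
  linarith

theorem wint_le_of_le_one {r : ℝ} (h0 : 0 < r) (hr : r ≤ 1) : wint r ≤ 6 * r ^ (-(3/4) : ℝ) := by
  unfold wint
  have : r ^ (-(1/4) : ℝ) ≤ r ^ (-(3/4):ℝ) := rpow_le_rpow_of_exponent_ge h0 hr (by norm_num)
  have : 0 < r ^ (-(3/4):ℝ) := by positivity
  linarith

/-- Bound on `a b - c d` from power bounds. -/
theorem abs_wronsk_le {a b c d A B C D r p q p' q' : ℝ} (hr : 0 < r) (ha : |a| ≤ A * r ^ p)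
    (hb : |b| ≤ B * r ^ q) (hc : |c| ≤ C * r ^ p') (hd : |d| ≤ D * r ^ q') (h : p' + q' = p + q) :
    |a * b - c * d| ≤ (A * B + C * D) * r ^ (p + q) := by
  calc |a * b - c * d| ≤ |a| * |b| + |c| * |d| := by
        rw [← abs_mul, ← abs_mul]; exact abs_sub _ _
    _ ≤ (A * r ^ p) * (B * r ^ q) + (C * r ^ p') * (D * r ^ q') := by
        have := (abs_nonneg a).trans ha
        have := (abs_nonneg c).trans hc
        gcongr
    _ = A * B * (r ^ p * r ^ q) + C * D * (r ^ p' * r ^ q') := by ring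
    _ = _ := by rw [← rpow_add hr, ← rpow_add hr, h]; ring

theorem zero_of_mono_limits {f f' : ℝ → ℝ} (hf : ∀ r, 0 < r → HasDerivAt f (f' r) r)
    (hpos : ∀ r, 0 < r → 0 ≤ f' r) (h0 : Tendsto f (𝓝[>] 0) (𝓝 0)) (h1 : Tendsto f atTop (𝓝 0)) :
    ∀ r, 0 < r → f' r = 0 := by
  have hm : MonotoneOn f (Ioi 0) := by
    refine monotoneOn_of_deriv_nonneg (convex_Ioi 0)
      (fun x hx => (hf x hx).continuousAt.continuousWithinAt) ?_ ?_
    · rw [interior_Ioi]; exact fun x hx => (hf x hx).differentiableAt.differentiableWithinAt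
    · rw [interior_Ioi]; intro x hx; rw [(hf x hx).deriv]; exact hpos x hx
  have hz : ∀ r, 0 < r → f r = 0 := by
    intro r hr
    refine le_antisymm ?_ ?_
    · refine ge_of_tendsto h1 ?_
      filter_upwards [eventually_ge_atTop r] with x hx
      exact hm hr (lt_of_lt_of_le hr hx) hx
    · refine le_of_tendsto h0 ?_
      filter_upwards [Ioo_mem_nhdsGT hr] with x hx
      exact hm hx.1 hr hx.2.le
  intro r hr
  have e : f =ᶠ[𝓝 r] fun _ => 0 := by
    filter_upwards [Ioi_mem_nhds hr] with x hx using hz x hx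
  exact (hf r hr).unique ((hasDerivAt_const r (0:ℝ)).congr_of_eventuallyEq e)

theorem zf_one_ne : zf 1 ≠ 0 := by
  unfold zf phi; norm_num

/-- The function `r^{5/2} V φ` of the orthogonality condition. -/
def vphi (l r : ℝ) : ℝ := r ^ (5/2 : ℝ) * (Vr l r * phi l r)

theorem Vr_cont {l : ℝ} (hl : 0 < l) : Continuous (Vr l) := by
  unfold Vr
  refine continuous_const.div (by fun_prop) (fun r => by positivity)

theorem phi_cont {l : ℝ} (hl : 0 < l) : Continuous (phi l) := by
  unfold phi
  refine Continuous.div (by fun_prop) (by fun_prop) (fun r => by positivity)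

theorem abs_vphi_mul_wgrow {r : ℝ} (hr : 0 < r) :
    wgrow r * |vphi 1 r| ≤ 1152 ^ 2 * 16 * (1 + r ^ 2)⁻¹ := by
  have h1 := abs_phi_le one_pos r
  have h2 : |Vr 1 r| ≤ 1152 / (1 + r ^ 2) ^ 2 := by
    rw [abs_Vr, show (1152:ℝ) * 1 ^ 2 = 1152 by norm_num]
    exact div_le_div_of_nonneg_left (by norm_num) (by positivity) (pow_le_pow_left₀ (by positivity) (by linarith) 2)
  have h3 : |phi 1 r| ≤ 1152 / (1 + r ^ 2) ^ 2 := by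
    refine h1.trans ?_
    rw [show (1152:ℝ) * 1 ^ 2 = 1152 by norm_num]
    exact div_le_div_of_nonneg_left (by norm_num) (by positivity) (pow_le_pow_left₀ (by positivity) (by linarith) 2)
  have hu : 1 ≤ 1 + r ^ 2 := by nlinarith
  have hbase : ∀ p : ℝ, 0 < p → p ≤ 1 → r ^ p ≤ 1 + r ^ 2 := by
    intro p hp hp1
    rcases le_total r 1 with h | h
    · exact (rpow_le_one hr.le h hp.le).trans hu
    · calc r ^ p ≤ r ^ (1:ℝ) := rpow_le_rpow_of_exponent_le h hp1
        _ ≤ _ := by rw [Real.rpow_one]; nlinarith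
  have h4 : r ^ (5/2:ℝ) ≤ (1 + r ^ 2) ^ 2 := by
    have : r ^ (5/2:ℝ) = r ^ 2 * r ^ (1/2:ℝ) := by
      rw [← Real.rpow_natCast, ← rpow_add hr]; norm_num
    rw [this, sq (1 + r ^ 2)]
    exact mul_le_mul (by linarith) (hbase _ (by norm_num) (by norm_num)) (by positivity) (by positivity)
  have h5 : wgrow r ≤ 2 * (1 + r ^ 2) := by
    unfold wgrow
    have := hbase (1/4) (by norm_num) (by norm_num)
    have := hbase (3/4) (by norm_num) (by norm_num)
    linarith
  unfold vphi
  rw [abs_mul, abs_mul, abs_of_pos (rpow_pos_of_pos hr (5/2))]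
  have := (wgrow_pos hr).le
  calc _ ≤ (2 * (1 + r ^ 2)) * ((1 + r ^ 2) ^ 2 * (1152 / (1 + r ^ 2) ^ 2 * (1152 / (1 + r ^ 2) ^ 2))) := by
        gcongr
    _ = 1152 ^ 2 * 2 * (1 + r ^ 2)⁻¹ := by field_simp
    _ ≤ _ := by gcongr; norm_num

theorem vphi_cont {l : ℝ} (hl : 0 < l) : Continuous (vphi l) := by
  unfold vphi
  refine Continuous.mul (continuous_id.rpow_const (fun x => Or.inr (by norm_num)))
    ((Vr_cont hl).mul (phi_cont hl))

theorem zf_cont : Continuous zf :=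
  (continuous_id.rpow_const (fun x => Or.inr (by norm_num))).mul (phi_cont one_pos)

theorem zf_vphi_integral_ne : ∫ r in Ioi (0:ℝ), zf r * vphi 1 r ≠ 0 := by
  have hneg : ∀ r, 0 < r → -(zf r * vphi 1 r) = r ^ 5 * (-Vr 1 r) * phi 1 r ^ 2 := by
    intro r hr
    unfold zf vphi
    have : r ^ (5/2:ℝ) * r ^ (5/2:ℝ) = r ^ 5 := by
      rw [← rpow_add hr, ← Real.rpow_natCast]; norm_num
    calc _ = (r ^ (5/2:ℝ) * r ^ (5/2:ℝ)) * (-Vr 1 r) * phi 1 r ^ 2 := by ring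
      _ = _ := by rw [this]
  have hint : IntegrableOn (fun r => zf r * vphi 1 r) (Ioi 0) := by
    refine Integrable.mono' (g := fun r => 1152 * (1152 ^ 2 * 16 * (1 + r ^ 2)⁻¹))
      ((integrable_inv_one_add_sq.integrableOn.const_mul _).const_mul _)
      (zf_cont.mul (vphi_cont one_pos)).aestronglyMeasurable ?_
    refine ae_Ioi fun r hr => ?_
    have hr : 0 < r := hr
    rw [norm_mul]
    refine le_trans ?_ (mul_le_mul_of_nonneg_left (abs_vphi_mul_wgrow hr) (by norm_num))
    rw [← mul_assoc]
    refine mul_le_mul_of_nonneg_right ?_ (norm_nonneg _)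
    rcases le_total r 1 with h | h
    · refine (abs_zf_le' hr).trans ?_
      have : r ^ (5/2:ℝ) ≤ r ^ (1/4:ℝ) := rpow_le_rpow_of_exponent_ge hr h (by norm_num)
      unfold wgrow
      have : 0 < r ^ (3/4:ℝ) := by positivity
      have : 0 < r ^ (1/4:ℝ) := by positivity
      linarith
    · refine (abs_zf_le hr).trans ?_
      have : r ^ (-(3/2):ℝ) ≤ r ^ (1/4:ℝ) := rpow_le_rpow_of_exponent_le h (by norm_num)
      unfold wgrow
      have : 0 < r ^ (3/4:ℝ) := by positivity
      have : 0 < r ^ (1/4:ℝ) := by positivity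
      linarith
  have hpos : 0 < ∫ r in Ioi (0:ℝ), -(zf r * vphi 1 r) := by
    rw [setIntegral_pos_iff_support_of_nonneg_ae]
    · have hsub : Ioo (1:ℝ) 2 ⊆ (Function.support fun r => -(zf r * vphi 1 r)) ∩ Ioi 0 := by
        intro r hr
        have hr0 : 0 < r := by linarith [hr.1]
        refine ⟨?_, hr0⟩
        rw [Function.mem_support, hneg r hr0]
        have h1 := Vr_neg (l := 1) (r := r) one_pos
        have : phi 1 r ≠ 0 := by
          unfold phi
          have : 0 < 24 * (1:ℝ) ^ 2 - r ^ 2 := by nlinarith [hr.2]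
          positivity
        have : 0 < -Vr 1 r := by linarith
        positivity
      refine lt_of_lt_of_le ?_ (measure_mono hsub)
      simp
    · refine ae_Ioi fun r hr => ?_
      refine (?_ : (0:ℝ) ≤ _).trans_eq (hneg r hr).symm
      have h1 := Vr_neg (l := 1) (r := r) one_pos
      have hr : 0 < r := hr
      have : 0 < -Vr 1 r := by linarith
      positivity
    · exact hint.neg
  rw [integral_neg] at hpos
  intro h
  rw [h] at hpos
  simp at hpos

namespace Sys

variable {κ s : ℝ → ℝ} {F : ℝ → ℝ → ℝ} {K B s0 : ℝ}

theorem eq_of_diag {w : ℝ → ℝ}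
    (hF : ∀ r t, |t| < r → F (r - t) (r + t) = F r r + 1 / 2 * t ^ 2 * w r)
    {ξ η : ℝ} (hξ : 0 < ξ) (hη : 0 < η) :
    F ξ η = F ((ξ + η) / 2) ((ξ + η) / 2) + 1 / 2 * ((η - ξ) / 2) ^ 2 * w ((ξ + η) / 2) := by
  have := hF ((ξ + η) / 2) ((η - ξ) / 2) (by rw [abs_lt]; constructor <;> linarith)
  rwa [show (ξ + η) / 2 - (η - ξ) / 2 = ξ by ring, show (ξ + η) / 2 + (η - ξ) / 2 = η by ring] at this

theorem diag_le {G : ℝ → ℝ} (h : Sys κ s G F K B s0) {r : ℝ} (hr : 1 ≤ r) :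
    |F r r| ≤ B * 2 * r ^ (3/4:ℝ) := by
  have := h.Fb r r (by linarith) (by linarith)
  rw [show (r + r) / 2 = r by ring] at this
  refine this.trans ?_
  rw [mul_assoc]; exact mul_le_mul_of_nonneg_left (wgrow_le_of_one_le hr) h.B0

theorem rigid_single (h : Sys κ s (fun _ => 0) F (33/4) B s0)
    (hκ : ∀ r, 0 < r → κ r = 15 / (4 * r ^ 2) + Vr 1 r) (hs : ∀ r, 0 < r → s r = 0)
    (horth : ∫ r in Ioi (0:ℝ), F r r * vphi 1 r = 0) :
    ∀ ξ η, 0 < ξ → 0 < η → F ξ η = 0 := by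
  obtain ⟨w, wd, m, hF, ⟨C, hC, hwb⟩, dw, dwd, dv, dm, ⟨M, hM, mb⟩⟩ := h.rigid_ode
  have hB := h.B0
  have hzd : ∀ r, 0 < r → HasDerivAt zfd (κ r * zf r) r := by
    intro r hr; rw [hκ r hr]; exact zfd_der hr
  have hW : ∀ r, 0 < r → wd r * zf r - w r * zfd r = 0 := by
    refine zero_of_deriv_zero (f := fun r => wd r * zf r - w r * zfd r) (fun r hr => ?_) ?_
    · have := ((dwd r hr).mul (zf_der hr)).sub ((dw r hr).mul (hzd r hr))
      exact this.congr_deriv (by ring)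
    · refine tendsto_zero_of_rpow_atTop (C := C * 1152 + C * 12096) (p := -(9/4) + -(3/2)) (by norm_num) fun r hr => ?_
      have hr0 : 0 < r := by linarith
      exact abs_wronsk_le hr0 (hwb r hr).2 (abs_zf_le hr0) (hwb r hr).1 (abs_zfd_le hr0) (by norm_num)
  set b := w 1 / zf 1 with hb
  have hz1 := zf_one_ne
  have hwz : ∀ r, 0 < r → w r - b * zf r = 0 := by
    refine ode2_zero h.κc (D' := fun r => wd r - b * zfd r)
      (fun r hr => (dw r hr).sub ((zf_der hr).const_mul b))
      (fun r hr => ((dwd r hr).sub ((hzd r hr).const_mul b)).congr_deriv (by ring)) ?_ ?_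
    · rw [hb]; field_simp; ring
    · have := hW 1 one_pos
      rw [hb]; field_simp; linarith
  have hfar : Tendsto (fun r => m r * zf r - F r r * zfd r) atTop (𝓝 0) := by
    refine tendsto_zero_of_rpow_atTop (C := M * 6 * 1152 + B * 2 * 12096) (p := -(1/4) + -(3/2)) (by norm_num) fun r hr => ?_
    have hr0 : 0 < r := by linarith
    refine abs_wronsk_le (p' := 3/4) (q' := -(5/2)) hr0 ?_ (abs_zf_le hr0) (h.diag_le hr.le) (abs_zfd_le hr0) (by norm_num)
    refine (mb r hr0).trans ?_
    rw [mul_assoc]; exact mul_le_mul_of_nonneg_left (wint_le_of_one_le hr.le) hM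
  have hH : ∀ r, 0 < r → b * (w r * zf r) = 0 := by
    refine zero_of_mono_limits (f := fun r => b * (m r * zf r - F r r * zfd r))
      (fun r hr => ?_) (fun r hr => ?_) ?_ ?_
    · have := (((dm r hr).mul (zf_der hr)).sub ((dv r hr).mul (hzd r hr))).const_mul b
      exact this.congr_deriv (by rw [hs r hr]; ring)
    · rw [show w r = b * zf r by linarith [hwz r hr]]
      rw [show b * (b * zf r * zf r) = (b * zf r) ^ 2 by ring]; positivity
    · have : Tendsto (fun r => m r * zf r - F r r * zfd r) (𝓝[>] 0) (𝓝 0) := by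
        refine tendsto_zero_of_rpow_nhds (C := M * 6 * 2 + B * 2 * 6) (p := -(3/4) + 5/2) (by norm_num) fun r hr hr1 => ?_
        refine abs_wronsk_le (p' := 1/4) (q' := 3/2) hr ?_ (abs_zf_le' hr) ?_ (abs_zfd_le' hr hr1.le) (by norm_num)
        · refine (mb r hr).trans ?_
          rw [mul_assoc]; exact mul_le_mul_of_nonneg_left (wint_le_of_le_one hr hr1.le) hM
        · have := h.Fb r r hr hr
          rw [show (r + r) / 2 = r by ring] at this
          refine this.trans ?_
          rw [mul_assoc]; exact mul_le_mul_of_nonneg_left (wgrow_le_of_le_one hr hr1.le) hB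
      simpa using this.const_mul b
    · simpa using hfar.const_mul b
  have hb0 : b = 0 := by
    have h1 := hH 1 one_pos
    rw [show w 1 = b * zf 1 by linarith [hwz 1 one_pos]] at h1
    simpa [hz1] using h1
  have hw0 : ∀ r, 0 < r → w r = 0 := by
    intro r hr; have := hwz r hr; rw [hb0] at this; linarith
  have hH0 : m 1 * zf 1 - F 1 1 * zfd 1 = 0 := by
    refine zero_of_deriv_zero (f := fun r => m r * zf r - F r r * zfd r) (fun r hr => ?_) ?_ 1 one_pos
    · have := ((dm r hr).mul (zf_der hr)).sub ((dv r hr).mul (hzd r hr))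
      exact this.congr_deriv (by rw [hs r hr, hw0 r hr]; ring)
    · exact hfar
  set α := F 1 1 / zf 1 with hα
  have hvz : ∀ r, 0 < r → F r r - α * zf r = 0 := by
    refine ode2_zero (D := fun r => F r r - α * zf r) h.κc (D' := fun r => m r - α * zfd r)
      (fun r hr => (dv r hr).sub ((zf_der hr).const_mul α))
      (fun r hr => ((dm r hr).sub ((hzd r hr).const_mul α)).congr_deriv
        (by rw [hs r hr, hw0 r hr]; ring)) ?_ ?_
    · rw [hα]; field_simp; ring
    · rw [hα]; field_simp; linarith
  have hα0 : α = 0 := by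
    have : ∫ r in Ioi (0:ℝ), F r r * vphi 1 r = α * ∫ r in Ioi (0:ℝ), zf r * vphi 1 r := by
      rw [← integral_const_mul]
      refine Ioi_congr fun r hr => ?_
      have := hvz r hr
      change F r r * vphi 1 r = _
      rw [show F r r = α * zf r by linarith]; ring
    rw [horth] at this
    rcases mul_eq_zero.1 this.symm with h1 | h1
    · exact h1
    · exact absurd h1 zf_vphi_integral_ne
  intro ξ η hξ hη
  have hr : 0 < (ξ + η) / 2 := by linarith
  rw [eq_of_diag hF hξ hη, hw0 _ hr]
  have := hvz _ hr
  rw [hα0] at this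
  linarith

theorem rigid_free (h : Sys κ s (fun _ => 0) F (33/4) B s0)
    (hκ : ∀ r, 0 < r → κ r = 15 / (4 * r ^ 2)) (hs : ∀ r, 0 < r → s r = 0) :
    ∃ β, ∀ r t, |t| < r → F (r - t) (r + t) = β * (r ^ (1/2:ℝ) - 2 * t ^ 2 * r ^ (-(3/2):ℝ)) := by
  obtain ⟨w, wd, m, hF, ⟨C, hC, hwb⟩, dw, dwd, dv, dm, ⟨M, hM, mb⟩⟩ := h.rigid_ode
  have hB := h.B0
  have hp : ∀ p r : ℝ, 0 < r → HasDerivAt (fun r : ℝ => r ^ p) (p * r ^ (p - 1)) r :=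
    fun p r hr => Real.hasDerivAt_rpow_const (Or.inl hr.ne')
  have e2 : ∀ p r : ℝ, 0 < r → r ^ (p - 1 - 1) = r ^ p / r ^ 2 := by
    intro p r hr
    rw [show p - 1 - 1 = p - (2:ℕ) by push_cast; ring, rpow_sub_natCast hr.ne']
  have hz2 : ∀ r, 0 < r → HasDerivAt (fun r : ℝ => -(3/2) * r ^ (-(3/2) - 1 : ℝ))
      (κ r * r ^ (-(3/2):ℝ)) r := by
    intro r hr
    refine ((hp _ r hr).const_mul (-(3/2))).congr_deriv ?_
    rw [e2 _ r hr, hκ r hr]; field_simp; norm_num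
  have hW : ∀ r, 0 < r → wd r * r ^ (-(3/2):ℝ) - w r * (-(3/2) * r ^ (-(3/2) - 1 : ℝ)) = 0 := by
    refine zero_of_deriv_zero
      (f := fun r => wd r * r ^ (-(3/2):ℝ) - w r * (-(3/2) * r ^ (-(3/2) - 1 : ℝ))) (fun r hr => ?_) ?_
    · have := ((dwd r hr).mul (hp (-(3/2)) r hr)).sub ((dw r hr).mul (hz2 r hr))
      exact this.congr_deriv (by ring)
    · refine tendsto_zero_of_rpow_atTop (C := C * 1 + C * (3/2)) (p := -(9/4) + -(3/2)) (by norm_num) fun r hr => ?_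
      have hr0 : 0 < r := by linarith
      refine abs_wronsk_le (q' := -(3/2) - 1) hr0 (hwb r hr).2 ?_ (hwb r hr).1 ?_ (by norm_num)
      · rw [abs_of_pos (rpow_pos_of_pos hr0 _), one_mul]
      · rw [abs_mul, abs_of_pos (rpow_pos_of_pos hr0 _)]; norm_num
  set b := w 1 with hb
  have hwz : ∀ r, 0 < r → w r - b * r ^ (-(3/2):ℝ) = 0 := by
    refine ode2_zero (D := fun r => w r - b * r ^ (-(3/2):ℝ)) h.κc
      (D' := fun r => wd r - b * (-(3/2) * r ^ (-(3/2) - 1 : ℝ)))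
      (fun r hr => (dw r hr).sub ((hp _ r hr).const_mul b))
      (fun r hr => ((dwd r hr).sub ((hz2 r hr).const_mul b)).congr_deriv (by ring)) ?_ ?_
    · simp [hb]
    · have := hW 1 one_pos
      simp only [Real.one_rpow] at this ⊢; linarith
  have hD1 : ∀ r, 0 < r → HasDerivAt (fun r => F r r + b / 4 * r ^ (1/2:ℝ))
      (m r + b / 4 * (1 / 2 * r ^ (1/2 - 1:ℝ))) r :=
    fun r hr => (dv r hr).add ((hp _ r hr).const_mul _)
  have hD2 : ∀ r, 0 < r → HasDerivAt (fun r => m r + b / 4 * (1 / 2 * r ^ (1/2 - 1:ℝ)))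
      (κ r * (F r r + b / 4 * r ^ (1/2:ℝ))) r := by
    intro r hr
    refine ((dm r hr).add (((hp (1/2 - 1) r hr).const_mul (1/2)).const_mul (b/4))).congr_deriv ?_
    rw [hs r hr, e2 _ r hr, show w r = b * r ^ (-(3/2):ℝ) by linarith [hwz r hr]]
    have : r ^ (-(3/2):ℝ) = r ^ (1/2:ℝ) / r ^ 2 := by rw [← e2 _ r hr]; norm_num
    rw [this, hκ r hr]
    ring
  have hH : ∀ r, 0 < r → (m r + b / 4 * (1 / 2 * r ^ (1/2 - 1:ℝ))) * r ^ (-(3/2):ℝ) -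
      (F r r + b / 4 * r ^ (1/2:ℝ)) * (-(3/2) * r ^ (-(3/2) - 1 : ℝ)) = 0 := by
    refine zero_of_deriv_zero
      (f := fun r => (m r + b / 4 * (1 / 2 * r ^ (1/2 - 1:ℝ))) * r ^ (-(3/2):ℝ) -
      (F r r + b / 4 * r ^ (1/2:ℝ)) * (-(3/2) * r ^ (-(3/2) - 1 : ℝ))) (fun r hr => ?_) ?_
    · have := ((hD2 r hr).mul (hp (-(3/2)) r hr)).sub ((hD1 r hr).mul (hz2 r hr))
      exact this.congr_deriv (by ring)
    · refine tendsto_zero_of_rpow_atTop (C := (M * 6 + |b / 4|) * 1 + (B * 2 + |b / 4|) * (3/2))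
        (p := -(1/4) + -(3/2)) (by norm_num) fun r hr => ?_
      have hr0 : 0 < r := by linarith
      refine abs_wronsk_le (p' := 3/4) (q' := -(3/2) - 1) hr0 ?_ ?_ ?_ ?_ (by norm_num)
      · refine (abs_add_le _ _).trans ?_
        rw [add_mul]
        refine add_le_add ?_ ?_
        · refine (mb r hr0).trans ?_
          rw [mul_assoc]; exact mul_le_mul_of_nonneg_left (wint_le_of_one_le hr.le) hM
        · have : r ^ (1/2 - 1:ℝ) ≤ r ^ (-(1/4):ℝ) := rpow_le_rpow_of_exponent_le hr.le (by norm_num)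
          have := rpow_pos_of_pos hr0 (1/2 - 1)
          rw [abs_mul]
          gcongr
          rw [abs_of_pos (by positivity)]
          linarith
      · rw [abs_of_pos (rpow_pos_of_pos hr0 _), one_mul]
      · refine (abs_add_le _ _).trans ?_
        rw [add_mul]
        refine add_le_add ?_ ?_
        · exact h.diag_le hr.le
        · rw [abs_mul, abs_of_pos (rpow_pos_of_pos hr0 _)]
          exact mul_le_mul_of_nonneg_left (rpow_le_rpow_of_exponent_le hr.le (by norm_num)) (abs_nonneg _)
      · rw [abs_mul, abs_of_pos (rpow_pos_of_pos hr0 _)]; norm_num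
  set α := F 1 1 + b / 4 with hα
  have hvz : ∀ r, 0 < r → F r r + b / 4 * r ^ (1/2:ℝ) - α * r ^ (-(3/2):ℝ) = 0 := by
    refine ode2_zero (D := fun r => F r r + b / 4 * r ^ (1/2:ℝ) - α * r ^ (-(3/2):ℝ)) h.κc
      (D' := fun r => m r + b / 4 * (1 / 2 * r ^ (1/2 - 1:ℝ)) - α * (-(3/2) * r ^ (-(3/2) - 1 : ℝ)))
      (fun r hr => (hD1 r hr).sub ((hp _ r hr).const_mul α))
      (fun r hr => ((hD2 r hr).sub ((hz2 r hr).const_mul α)).congr_deriv (by ring)) ?_ ?_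
    · simp [hα]
    · have := hH 1 one_pos
      simp only [Real.one_rpow] at this ⊢; rw [hα]; linarith
  have hα0 : α = 0 := by
    have hlim : Tendsto (fun _ : ℝ => α) (𝓝[>] 0) (𝓝 0) := by
      refine tendsto_zero_of_rpow_nhds (C := B * 2 + |b / 4|) (p := 1/4 + 3/2) (by norm_num) fun r hr hr1 => ?_
      have h1 : α = (F r r + b / 4 * r ^ (1/2:ℝ)) * r ^ (3/2:ℝ) := by
        rw [show F r r + b / 4 * r ^ (1/2:ℝ) = α * r ^ (-(3/2):ℝ) by linarith [hvz r hr], mul_assoc,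
          ← rpow_add hr]; norm_num
      rw [h1, abs_mul, abs_of_pos (rpow_pos_of_pos hr (3/2)), rpow_add hr, ← mul_assoc]
      refine mul_le_mul_of_nonneg_right ?_ (by positivity)
      refine (abs_add_le _ _).trans ?_
      rw [add_mul]
      refine add_le_add ?_ ?_
      · have := h.Fb r r hr hr
        rw [show (r + r) / 2 = r by ring] at this
        refine this.trans ?_
        rw [mul_assoc]; exact mul_le_mul_of_nonneg_left (wgrow_le_of_le_one hr hr1.le) hB
      · rw [abs_mul, abs_of_pos (rpow_pos_of_pos hr _)]
        exact mul_le_mul_of_nonneg_left (rpow_le_rpow_of_exponent_ge hr hr1.le (by norm_num)) (abs_nonneg _)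
    exact tendsto_nhds_unique tendsto_const_nhds hlim
  refine ⟨-(b/4), fun r t ht => ?_⟩
  have hr : 0 < r := lt_of_le_of_lt (abs_nonneg t) ht
  rw [hF r t ht, show w r = b * r ^ (-(3/2):ℝ) by linarith [hwz r hr]]
  have := hvz r hr
  rw [hα0] at this
  linear_combination this

theorem rigid_source (h : Sys κ s (fun _ => 0) F (33/4) B s0)
    (hv : ∀ r, 0 < r → F r r = 0) :
    ∀ r t, |t| < r → F (r - t) (r + t) = - (1 / 2 * t ^ 2 * s r) := by
  obtain ⟨w, wd, m, hF, ⟨C, hC, hwb⟩, dw, dwd, dv, dm, ⟨M, hM, mb⟩⟩ := h.rigid_ode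
  have hm : ∀ r, 0 < r → m r = 0 := by
    intro r hr
    have e : (fun r => F r r) =ᶠ[𝓝 r] fun _ => 0 := by
      filter_upwards [Ioi_mem_nhds hr] with x hx using hv x hx
    exact (dv r hr).unique ((hasDerivAt_const r (0:ℝ)).congr_of_eventuallyEq e)
  intro r t ht
  have hr : 0 < r := lt_of_le_of_lt (abs_nonneg t) ht
  have e : m =ᶠ[𝓝 r] fun _ => 0 := by
    filter_upwards [Ioi_mem_nhds hr] with x hx using hm x hx
  have := (dm r hr).unique ((hasDerivAt_const r (0:ℝ)).congr_of_eventuallyEq e)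
  rw [hF r t ht, hv r hr] at *
  rw [show w r = - s r by linarith]
  ring

end Sys

/-! ### Compactness of sequences of wave systems -/

theorem sq_integral_mul_le {α : Type*} [MeasurableSpace α] {μ : Measure α} {f g : α → ℝ}
    (hf : Integrable (fun x => f x ^ 2) μ) (hg : Integrable (fun x => g x ^ 2) μ) :
    (∫ x, f x * g x ∂μ) ^ 2 ≤ (∫ x, f x ^ 2 ∂μ) * ∫ x, g x ^ 2 ∂μ := by
  have hf0 : 0 ≤ ∫ x, f x ^ 2 ∂μ := integral_nonneg fun x => sq_nonneg _
  have hg0 : 0 ≤ ∫ x, g x ^ 2 ∂μ := integral_nonneg fun x => sq_nonneg _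
  by_cases hfg : Integrable (fun x => f x * g x) μ
  · have := discrim_le_zero (a := ∫ x, f x ^ 2 ∂μ) (b := 2 * ∫ x, f x * g x ∂μ)
      (c := ∫ x, g x ^ 2 ∂μ) (fun x => by
        have h0 : 0 ≤ ∫ y, (x * f y + g y) ^ 2 ∂μ := integral_nonneg fun y => sq_nonneg _
        have e : ∫ y, (x * f y + g y) ^ 2 ∂μ =
            ∫ y, (x * x * f y ^ 2 + 2 * x * (f y * g y) + g y ^ 2) ∂μ := by
          congr 1; ext y; ring
        have i1 : Integrable (fun y => x * x * f y ^ 2) μ := hf.const_mul _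
        have i2 : Integrable (fun y => 2 * x * (f y * g y)) μ := hfg.const_mul _
        have i3 : Integrable (fun y => x * x * f y ^ 2 + 2 * x * (f y * g y)) μ := i1.add i2
        rw [e, integral_add i3 hg, integral_add i1 i2, integral_const_mul,
          integral_const_mul] at h0
        linarith)
    unfold discrim at this
    nlinarith
  · rw [integral_undef hfg]; nlinarith [mul_nonneg hf0 hg0]

theorem abs_integral_le_sqrt {f : ℝ → ℝ} {a b : ℝ} (hab : a ≤ b) (hf : ContinuousOn f (Icc a b)) :
    |∫ x in a..b, f x| ≤ √(∫ x in a..b, f x ^ 2) * √(b - a) := by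
  have h1 : IntegrableOn (fun x => f x ^ 2) (Ioc a b) :=
    (hf.pow 2).integrableOn_Icc.mono_set Ioc_subset_Icc_self
  have h2 : IntegrableOn (fun _ : ℝ => (1:ℝ) ^ 2) (Ioc a b) := by simp
  have := sq_integral_mul_le (f := f) (g := fun _ => 1) h1 h2
  rw [intervalIntegral.integral_of_le hab, intervalIntegral.integral_of_le hab]
  rw [← sqrt_mul (integral_nonneg fun x => sq_nonneg _)]
  refine abs_le_sqrt ?_
  simpa [hab] using this

namespace Sys

variable {κ s G : ℝ → ℝ} {F : ℝ → ℝ → ℝ} {K B s0 : ℝ}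

theorem sub_eq (h : Sys κ s G F K B s0) {ξ ξ' η : ℝ} (hξ : 0 < ξ) (hξ' : ξ ≤ ξ') (hη : 0 < η) :
    F ξ' η - F ξ η = (∫ x in ξ..ξ', G x) - 1 / 2 * ∫ x in ξ..ξ', tailI κ s F x η := by
  have hs : Icc ξ ξ' ⊆ Ioi 0 := fun x hx => hξ.trans_le hx.1
  have c1 : ContinuousOn G (Icc ξ ξ') := h.Gc.mono hs
  have c2 : ContinuousOn (fun x => tailI κ s F x η) (Icc ξ ξ') :=
    h.tailI_cont.comp (f := fun x => (x, η)) (by fun_prop) (fun x hx => ⟨hs hx, hη⟩)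
  rw [← intervalIntegral.integral_const_mul, ← intervalIntegral.integral_sub
    (c1.intervalIntegrable_of_Icc hξ') ((c2.intervalIntegrable_of_Icc hξ').const_mul _)]
  symm
  refine intervalIntegral.integral_eq_sub_of_hasDerivAt (f := fun x => F x η) ?_ ?_
  · intro x hx
    rw [uIcc_of_le hξ'] at hx
    exact h.der' (hs hx) hη
  · exact (c1.intervalIntegrable_of_Icc hξ').sub ((c2.intervalIntegrable_of_Icc hξ').const_mul _)

theorem abs_sub_le (h : Sys κ s G F K B s0) {ξ ξ' η a : ℝ} (hξ : 0 < ξ) (hξ' : ξ ≤ ξ') (hη : 0 < η)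
    (ha : 0 < a) (har : a ≤ (ξ + η) / 2) :
    |F ξ' η - F ξ η| ≤ √(∫ x in ξ..ξ', G x ^ 2) * √(ξ' - ξ) +
      1 / 2 * ((K * B + s0) * wint a) * (ξ' - ξ) := by
  rw [h.sub_eq hξ hξ' hη]
  have h1 := abs_integral_le_sqrt hξ' (h.Gc.mono fun x hx => hξ.trans_le hx.1)
  have h2 : |∫ x in ξ..ξ', tailI κ s F x η| ≤ ((K * B + s0) * wint a) * |ξ' - ξ| := by
    rw [← norm_eq_abs]
    refine intervalIntegral.norm_integral_le_of_norm_le_const fun x hx => ?_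
    rw [uIoc_of_le hξ'] at hx
    refine (h.tailI_bound (hξ.trans hx.1) hη).trans ?_
    exact mul_le_mul_of_nonneg_left (wint_anti ha (by linarith [hx.1])) h.M0
  rw [abs_of_nonneg (sub_nonneg.2 hξ')] at h2
  calc _ ≤ |∫ x in ξ..ξ', G x| + |1 / 2 * ∫ x in ξ..ξ', tailI κ s F x η| := abs_sub _ _
    _ ≤ _ := by
      rw [abs_mul, abs_of_pos (by norm_num : (0:ℝ) < 1 / 2)]
      nlinarith

/-- Modulus of continuity in a box. -/
theorem abs_sub_le_box (h : Sys κ s G F K B s0) {a b E : ℝ} (ha : 0 < a)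
    (hE : ∫ x in a..b, G x ^ 2 ≤ E) {ξ ξ' η η' : ℝ} (hξ : ξ ∈ Icc a b) (hξ' : ξ' ∈ Icc a b)
    (hη : η ∈ Icc a b) (hη' : η' ∈ Icc a b) :
    |F ξ' η' - F ξ η| ≤ √E * (√|ξ' - ξ| + √|η' - η|) +
      1 / 2 * ((K * B + s0) * wint a) * (|ξ' - ξ| + |η' - η|) := by
  have key : ∀ x y z, x ∈ Icc a b → y ∈ Icc a b → z ∈ Icc a b → x ≤ y →
      |F y z - F x z| ≤ √E * √|y - x| + 1 / 2 * ((K * B + s0) * wint a) * |y - x| := by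
    intro x y z hx hy hz hxy
    refine (h.abs_sub_le (ha.trans_le hx.1) hxy (ha.trans_le hz.1) ha
      (by linarith [hx.1, hz.1])).trans ?_
    rw [abs_of_nonneg (sub_nonneg.2 hxy)]
    gcongr
    refine le_trans ?_ hE
    refine intervalIntegral.integral_mono_interval hx.1 hxy hy.2 ?_ ?_
    · exact Eventually.of_forall fun x => sq_nonneg _
    · refine ContinuousOn.intervalIntegrable_of_Icc (hx.1.trans (hxy.trans hy.2)) ?_
      exact (h.Gc.mono fun x hx => ha.trans_le hx.1).pow 2
  have key' : ∀ x y z, x ∈ Icc a b → y ∈ Icc a b → z ∈ Icc a b →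
      |F y z - F x z| ≤ √E * √|y - x| + 1 / 2 * ((K * B + s0) * wint a) * |y - x| := by
    intro x y z hx hy hz
    rcases le_total x y with hxy | hxy
    · exact key x y z hx hy hz hxy
    · rw [abs_sub_comm, abs_sub_comm y x]
      exact key y x z hy hx hz hxy
  have h1 := key' ξ ξ' η hξ hξ' hη
  have h2 := key' η η' ξ' hη hη' hξ'
  rw [h.sym _ _ (ha.trans_le hη'.1) (ha.trans_le hξ'.1),
    h.sym _ _ (ha.trans_le hη.1) (ha.trans_le hξ'.1)] at h2
  calc _ ≤ |F ξ' η' - F ξ' η| + |F ξ' η - F ξ η| := _root_.abs_sub_le _ _ _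
    _ ≤ _ := by linarith

theorem mono (h : Sys κ s G F K B s0) {B' ρ₁ : ℝ} (hB : B ≤ B') (hρ : s0 ≤ ρ₁) :
    Sys κ s G F K B' ρ₁ :=
  { h with
    B0 := h.B0.trans hB
    ρ0 := h.ρ0.trans hρ
    sb := fun r hr => (h.sb r hr).trans (by have := rpow_pos_of_pos hr (-(3/2)); gcongr)
    Fb := fun ξ η hξ hη => (h.Fb ξ η hξ hη).trans
      (mul_le_mul_of_nonneg_right hB (wgrow_pos (by linarith)).le) }

theorem change_K (h : Sys κ s G F K B s0) {K' : ℝ} (hK : 0 ≤ K')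
    (hb : ∀ r, 0 < r → |κ r| ≤ K' * r ^ (-2 : ℝ)) : Sys κ s G F K' B s0 :=
  { h with
    K0 := hK
    κb := hb }

end Sys

theorem Sys.exists_modulus {κ s G : ℕ → ℝ → ℝ} {F : ℕ → ℝ → ℝ → ℝ} {K B s0 : ℝ}
    (h : ∀ n, Sys (κ n) (s n) (G n) (F n) K B s0)
    (hG : ∀ a b, 0 < a → a < b → Tendsto (fun n => ∫ x in a..b, G n x ^ 2) atTop (𝓝 0))
    {a b : ℝ} (ha : 0 < a) (hab : a < b) :
    ∃ ω : ℝ → ℝ, Continuous ω ∧ ω 0 = 0 ∧ ∀ᶠ n in atTop, ∀ ξ ξ' η η', ξ ∈ Icc a b →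
      ξ' ∈ Icc a b → η ∈ Icc a b → η' ∈ Icc a b →
      |F n ξ' η' - F n ξ η| ≤ ω (ξ' - ξ) + ω (η' - η) := by
  refine ⟨fun d => √|d| + 1 / 2 * ((K * B + s0) * wint a) * |d|, by fun_prop, by simp, ?_⟩
  filter_upwards [(hG a b ha hab).eventually (ge_mem_nhds one_pos)] with n hn ξ ξ' η η' h1 h2 h3 h4
  refine ((h n).abs_sub_le_box ha hn h1 h2 h3 h4).trans (le_of_eq ?_)
  rw [sqrt_one]; ring

theorem exists_box {ξ η : ℝ} (hξ : 0 < ξ) (hη : 0 < η) : ∃ a b, 0 < a ∧ a < b ∧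
    Icc a b ∈ 𝓝 ξ ∧ Icc a b ∈ 𝓝 η := by
  refine ⟨min ξ η / 2, max ξ η + 1, by positivity, ?_, ?_, ?_⟩
  · have := min_le_left ξ η
    have := le_max_left ξ η
    have : 0 < min ξ η := by positivity
    linarith
  · refine Icc_mem_nhds ?_ ?_
    · have := min_le_left ξ η
      have : 0 < min ξ η := by positivity
      linarith
    · linarith [le_max_left ξ η]
  · refine Icc_mem_nhds ?_ ?_
    · have := min_le_right ξ η
      have : 0 < min ξ η := by positivity
      linarith
    · linarith [le_max_right ξ η]

/-- Pointwise convergence of coefficients. -/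
structure CoefLim (κ s : ℕ → ℝ → ℝ) (κ' s' : ℝ → ℝ) : Prop where
  κc : ContinuousOn κ' (Ioi 0)
  sc : ContinuousOn s' (Ioi 0)
  κt : ∀ r, 0 < r → Tendsto (fun n => κ n r) atTop (𝓝 (κ' r))
  st : ∀ r, 0 < r → Tendsto (fun n => s n r) atTop (𝓝 (s' r))

theorem CoefLim.comp {κ s : ℕ → ℝ → ℝ} {κ' s' : ℝ → ℝ} (c : CoefLim κ s κ' s') {φ : ℕ → ℕ}
    (hφ : StrictMono φ) : CoefLim (fun n => κ (φ n)) (fun n => s (φ n)) κ' s' :=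
  ⟨c.κc, c.sc, fun r hr => (c.κt r hr).comp hφ.tendsto_atTop,
    fun r hr => (c.st r hr).comp hφ.tendsto_atTop⟩

theorem inv_sq_cont : ContinuousOn (fun r : ℝ => 15 / (4 * r ^ 2)) (Ioi 0) :=
  continuousOn_const.div (by fun_prop) fun r (hr : 0 < r) => by positivity

/-- Pointwise limits of wave systems with vanishing radiation. -/
theorem Sys.limit {κ s G : ℕ → ℝ → ℝ} {F : ℕ → ℝ → ℝ → ℝ} {K B s0 : ℝ} {κ' s' : ℝ → ℝ}
    {F' : ℝ → ℝ → ℝ}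
    (h : ∀ n, Sys (κ n) (s n) (G n) (F n) K B s0)
    (hG : ∀ a b, 0 < a → a < b → Tendsto (fun n => ∫ x in a..b, G n x ^ 2) atTop (𝓝 0))
    (c : CoefLim κ s κ' s')
    (hF : ∀ ξ η, 0 < ξ → 0 < η → Tendsto (fun n => F n ξ η) atTop (𝓝 (F' ξ η))) :
    Sys κ' s' (fun _ => 0) F' K B s0 := by
  have hFc : ContinuousOn (Function.uncurry F') (Ioi 0 ×ˢ Ioi 0) := by
    rintro ⟨ξ, η⟩ ⟨hξ, hη⟩
    simp only [mem_Ioi] at hξ hη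
    obtain ⟨a, b, ha, hab, h1, h2⟩ := exists_box hξ hη
    obtain ⟨ω, ωc, ω0, hω⟩ := Sys.exists_modulus h hG ha hab
    refine ContinuousAt.continuousWithinAt ?_
    refine tendsto_iff_dist_tendsto_zero.2 ?_
    have lim : Tendsto (fun p : ℝ × ℝ => ω (p.1 - ξ) + ω (p.2 - η)) (𝓝 (ξ, η)) (𝓝 0) := by
      have : ContinuousAt (fun p : ℝ × ℝ => ω (p.1 - ξ) + ω (p.2 - η)) (ξ, η) := by fun_prop
      simpa [ContinuousAt, ω0] using this
    refine squeeze_zero' (.of_forall fun _ => dist_nonneg) ?_ lim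
    filter_upwards [prod_mem_nhds h1 h2] with p hp
    have hl := ((hF p.1 p.2 (ha.trans_le hp.1.1) (ha.trans_le hp.2.1)).sub (hF ξ η hξ hη)).abs
    refine le_of_tendsto hl ?_
    filter_upwards [hω] with n hn
    exact hn _ _ _ _ (mem_of_mem_nhds h1) hp.1 (mem_of_mem_nhds h2) hp.2
  have pre : PreSys κ' s' F' K B s0 :=
    { K0 := (h 0).K0
      B0 := (h 0).B0
      ρ0 := (h 0).ρ0
      κc := c.κc
      sc := c.sc
      κb := fun r hr => le_of_tendsto (c.κt r hr).abs (.of_forall fun n => (h n).κb r hr)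
      sb := fun r hr => le_of_tendsto (c.st r hr).abs (.of_forall fun n => (h n).sb r hr)
      Fc := hFc
      sym := fun ξ η hξ hη => tendsto_nhds_unique (hF ξ η hξ hη)
        ((hF η ξ hη hξ).congr fun n => (h n).sym _ _ hη hξ)
      Fb := fun ξ η hξ hη => le_of_tendsto (hF ξ η hξ hη).abs
        (.of_forall fun n => (h n).Fb ξ η hξ hη) }
  have hI : ∀ ξ η, 0 < ξ → 0 < η →
      Tendsto (fun n => tailI (κ n) (s n) (F n) ξ η) atTop (𝓝 (tailI κ' s' F' ξ η)) := by
    intro ξ η hξ hη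
    unfold tailI
    refine tendsto_integral_of_dominated_convergence (fun ρ => (K * B + s0) * wtail ρ)
      (fun n => ((h n).integrand_int hξ (by linarith)).1)
      ((wtail_integrableOn (by linarith)).const_mul _) (fun n => ?_) ?_
    · refine ae_Ioi fun ρ hρ => ?_
      have hρ : (ξ + η) / 2 < ρ := hρ
      exact (h n).integrand_bound hξ (by linarith)
    · refine ae_Ioi fun ρ hρ => ?_
      have hρ : (ξ + η) / 2 < ρ := hρ
      exact ((c.κt ρ (by linarith)).mul (hF ξ _ hξ (by linarith))).add (c.st ρ (by linarith))
  have hsub : ∀ ξ ξ' η, 0 < ξ → ξ ≤ ξ' → 0 < η →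
      F' ξ' η - F' ξ η = - (1 / 2 * ∫ x in ξ..ξ', tailI κ' s' F' x η) := by
    intro ξ ξ' η hξ hξ' hη
    rcases eq_or_lt_of_le hξ' with rfl | hlt
    · simp
    refine tendsto_nhds_unique ((hF ξ' η (hξ.trans hlt) hη).sub (hF ξ η hξ hη)) ?_
    have e : (fun n => F n ξ' η - F n ξ η) = fun n => (∫ x in ξ..ξ', G n x) -
        1 / 2 * ∫ x in ξ..ξ', tailI (κ n) (s n) (F n) x η := by
      ext n; exact (h n).sub_eq hξ hξ' hη
    rw [e]
    have l1 : Tendsto (fun n => ∫ x in ξ..ξ', G n x) atTop (𝓝 0) := by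
      refine squeeze_zero_norm (fun n => abs_integral_le_sqrt hξ'
        ((h n).Gc.mono fun x hx => hξ.trans_le hx.1)) ?_
      simpa using ((hG ξ ξ' hξ hlt).sqrt).mul_const (√(ξ' - ξ))
    have l2 : Tendsto (fun n => ∫ x in ξ..ξ', tailI (κ n) (s n) (F n) x η) atTop
        (𝓝 (∫ x in ξ..ξ', tailI κ' s' F' x η)) := by
      refine intervalIntegral.tendsto_integral_filter_of_dominated_convergence
        (fun _ => (K * B + s0) * wint ((ξ + η) / 2)) (.of_forall fun n => ?_)
        (.of_forall fun n => ?_) intervalIntegrable_const ?_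
      · refine ContinuousOn.aestronglyMeasurable ?_ measurableSet_uIoc
        refine (h n).tailI_cont.comp (f := fun x => (x, η)) (by fun_prop) (fun x hx => ⟨?_, hη⟩)
        rw [uIoc_of_le hξ'] at hx
        exact hξ.trans hx.1
      · refine Eventually.of_forall fun x hx => ?_
        rw [uIoc_of_le hξ'] at hx
        refine ((h n).tailI_bound (hξ.trans hx.1) hη).trans ?_
        exact mul_le_mul_of_nonneg_left (wint_anti (by linarith) (by linarith [hx.1])) (h n).M0
      · refine Eventually.of_forall fun x hx => ?_
        rw [uIoc_of_le hξ'] at hx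
        exact hI x η (hξ.trans hx.1) hη
    have := l1.sub (l2.const_mul (1 / 2))
    rwa [zero_sub] at this
  refine { pre with Gc := continuousOn_const, der := fun ξ η hξ hη => ?_ }
  change HasDerivAt (fun x => F' x η) (0 - 1 / 2 * tailI κ' s' F' ξ η) ξ
  have e : (fun x => F' x η) =ᶠ[𝓝 ξ]
      fun x => F' (ξ / 2) η - 1 / 2 * ∫ y in (ξ / 2)..x, tailI κ' s' F' y η := by
    filter_upwards [Ioi_mem_nhds (show ξ / 2 < ξ by linarith)] with x hx
    have := hsub (ξ / 2) x η (by linarith) (le_of_lt hx) hη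
    linarith
  refine HasDerivAt.congr_of_eventuallyEq ?_ e
  have k : ContinuousOn (fun x => tailI κ' s' F' x η) (Ioi 0) :=
    pre.tailI_cont.comp (f := fun x => (x, η)) (by fun_prop) (fun x hx => ⟨hx, hη⟩)
  refine (((intervalIntegral.integral_hasDerivAt_right ?_ ?_ ?_).const_mul (1/2)).const_sub
    _).congr_deriv (zero_sub _).symm
  · exact (k.mono fun x hx => lt_of_lt_of_le (by linarith : 0 < ξ / 2) hx.1).intervalIntegrable_of_Icc
      (by linarith)
  · exact k.stronglyMeasurableAtFilter isOpen_Ioi ξ hξ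
  · exact k.continuousAt (Ioi_mem_nhds hξ)

/-- Sequences of wave systems with vanishing radiation are precompact. -/
theorem Sys.exists_subseq {κ s G : ℕ → ℝ → ℝ} {F : ℕ → ℝ → ℝ → ℝ} {K B s0 : ℝ} {κ' s' : ℝ → ℝ}
    (h : ∀ n, Sys (κ n) (s n) (G n) (F n) K B s0)
    (hG : ∀ a b, 0 < a → a < b → Tendsto (fun n => ∫ x in a..b, G n x ^ 2) atTop (𝓝 0))
    (c : CoefLim κ s κ' s') :
    ∃ (φ : ℕ → ℕ) (F' : ℝ → ℝ → ℝ), StrictMono φ ∧ Sys κ' s' (fun _ => 0) F' K B s0 ∧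
      ∀ ξ η, 0 < ξ → 0 < η → Tendsto (fun n => F (φ n) ξ η) atTop (𝓝 (F' ξ η)) := by
  let ι := {q : ℚ × ℚ // 0 < q.1 ∧ 0 < q.2}
  let A : ℕ → ι → ℝ := fun n q => F n q.1.1 q.1.2
  have pos1 : ∀ q : ι, 0 < (q.1.1 : ℝ) := fun q => by exact_mod_cast q.2.1
  have pos2 : ∀ q : ι, 0 < (q.1.2 : ℝ) := fun q => by exact_mod_cast q.2.2
  have hcomp : IsCompact (Set.univ.pi fun q : ι =>
      Icc (-(B * wgrow (((q.1.1 : ℝ) + q.1.2) / 2))) (B * wgrow (((q.1.1 : ℝ) + q.1.2) / 2))) :=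
    isCompact_univ_pi fun q => isCompact_Icc
  obtain ⟨L, -, φ, hφ, hL⟩ := hcomp.tendsto_subseq (x := A) (fun n q _ =>
    abs_le.1 ((h n).Fb _ _ (pos1 q) (pos2 q)))
  have hL' : ∀ q : ι, Tendsto (fun n => F (φ n) q.1.1 q.1.2) atTop (𝓝 (L q)) :=
    fun q => (tendsto_pi_nhds.1 hL) q
  have hG' : ∀ a b, 0 < a → a < b →
      Tendsto (fun n => ∫ x in a..b, G (φ n) x ^ 2) atTop (𝓝 0) :=
    fun a b ha hab => (hG a b ha hab).comp hφ.tendsto_atTop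
  have hC : ∀ ξ η, 0 < ξ → 0 < η → ∃ l, Tendsto (fun n => F (φ n) ξ η) atTop (𝓝 l) := by
    intro ξ η hξ hη
    refine cauchySeq_tendsto_of_complete (Metric.cauchySeq_iff.2 fun ε hε => ?_)
    obtain ⟨a, b, ha, hab, h1, h2⟩ := exists_box hξ hη
    obtain ⟨ω, ωc, ω0, hω⟩ := Sys.exists_modulus (fun n => h (φ n)) hG' ha hab
    have ev : ∀ᶠ p : ℝ × ℝ in 𝓝 (ξ, η), ω (p.1 - ξ) + ω (p.2 - η) < ε / 3 := by
      have : ContinuousAt (fun p : ℝ × ℝ => ω (p.1 - ξ) + ω (p.2 - η)) (ξ, η) := by fun_prop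
      refine this.eventually_lt continuousAt_const ?_
      simpa [ω0] using hε
    have dense : DenseRange (fun q : ℚ × ℚ => ((q.1 : ℝ), (q.2 : ℝ))) :=
      Rat.denseRange_cast.prodMap Rat.denseRange_cast
    obtain ⟨q, hq1, hq2⟩ := dense.exists_mem_open isOpen_interior
      ⟨(ξ, η), mem_interior_iff_mem_nhds.2 (ev.and (prod_mem_nhds h1 h2))⟩ |>.imp
        fun q hq => interior_subset hq
    have hq0 : 0 < q.1 ∧ 0 < q.2 := by
      constructor
      · have : 0 < (q.1 : ℝ) := ha.trans_le hq2.1.1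
        exact_mod_cast this
      · have : 0 < (q.2 : ℝ) := ha.trans_le hq2.2.1
        exact_mod_cast this
    obtain ⟨N, hN⟩ := Metric.cauchySeq_iff.1 (hL' ⟨q, hq0⟩).cauchySeq (ε / 3) (by linarith)
    obtain ⟨N', hN'⟩ := eventually_atTop.1 hω
    refine ⟨max N N', fun m hm n hn => ?_⟩
    have a1 := hN m (le_of_max_le_left hm) n (le_of_max_le_left hn)
    have a2 := hN' m (le_of_max_le_right hm) _ _ _ _ (mem_of_mem_nhds h1) hq2.1
      (mem_of_mem_nhds h2) hq2.2
    have a3 := hN' n (le_of_max_le_right hn) _ _ _ _ (mem_of_mem_nhds h1) hq2.1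
      (mem_of_mem_nhds h2) hq2.2
    rw [dist_eq] at a1 ⊢
    simp only at a1 a2 a3 hq1
    rw [abs_lt] at a1 ⊢
    have b2 := abs_le.1 a2
    have b3 := abs_le.1 a3
    constructor <;> linarith [b2.1, b2.2, b3.1, b3.2, a1.1, a1.2]
  choose! F' hF' using hC
  refine ⟨φ, F', hφ, ?_, fun ξ η hξ hη => hF' ξ η hξ hη⟩
  exact Sys.limit (fun n => h (φ n)) hG' (c.comp hφ) (fun ξ η hξ hη => hF' ξ η hξ hη)

theorem Sys.abs_sub_le_far {κ s G : ℝ → ℝ} {F : ℝ → ℝ → ℝ} {K B s0 : ℝ} (h : Sys κ s G F K B s0)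
    {e a : ℝ} (he : ∀ x y, 0 < x → x < y → ∫ z in x..y, G z ^ 2 ≤ e) (he0 : 0 ≤ e) (ha : 0 < a)
    {ξ ξ' η : ℝ} (hξ : 0 < ξ) (hξ' : 0 < ξ') (hη : 0 < η) (h1 : a ≤ (ξ + η) / 2)
    (h2 : a ≤ (ξ' + η) / 2) :
    |F ξ' η - F ξ η| ≤ √e * √|ξ' - ξ| + 1 / 2 * ((K * B + s0) * wint a) * |ξ' - ξ| := by
  have key : ∀ x y, 0 < x → x ≤ y → a ≤ (x + η) / 2 →
      |F y η - F x η| ≤ √e * √|y - x| + 1 / 2 * ((K * B + s0) * wint a) * |y - x| := by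
    intro x y hx hxy hxa
    rw [abs_of_nonneg (sub_nonneg.2 hxy)]
    refine (h.abs_sub_le hx hxy hη ha hxa).trans ?_
    gcongr
    rcases eq_or_lt_of_le hxy with rfl | hlt
    · simpa using he0
    · exact he x y hx hlt
  rcases le_total ξ ξ' with hh | hh
  · exact key ξ ξ' hξ hh h1
  · rw [abs_sub_comm, abs_sub_comm ξ' ξ]
    exact key ξ' ξ hξ' hh h2

theorem Sys.tendsto_zero_at {κ s G : ℕ → ℝ → ℝ} {F : ℕ → ℝ → ℝ → ℝ} {K B s0 : ℝ}
    (h : ∀ n, Sys (κ n) (s n) (G n) (F n) K B s0) {e : ℕ → ℝ}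
    (he : ∀ n x y, 0 < x → x < y → ∫ z in x..y, G n z ^ 2 ≤ e n) (he0 : Tendsto e atTop (𝓝 0))
    (hF : ∀ ξ η, 0 < ξ → 0 < η → Tendsto (fun n => F n ξ η) atTop (𝓝 0))
    {x y : ℕ → ℝ} (hx : ∀ n, 0 < x n) (hy : ∀ n, 0 < y n) {X Y : ℝ}
    (hX : Tendsto x atTop (𝓝 X)) (hY : Tendsto y atTop (𝓝 Y)) (hXY : 0 < X + Y) :
    Tendsto (fun n => F n (x n) (y n)) atTop (𝓝 0) := by
  have hX0 : 0 ≤ X := ge_of_tendsto hX (.of_forall fun n => (hx n).le)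
  have hY0 : 0 ≤ Y := ge_of_tendsto hY (.of_forall fun n => (hy n).le)
  have hen : ∀ n, 0 ≤ e n := fun n => (intervalIntegral.integral_nonneg (by norm_num)
    fun z _ => sq_nonneg _).trans (he n 1 2 one_pos one_lt_two)
  set a := (X + Y) / 4 with ha
  have ha0 : 0 < a := by positivity
  set L := 1 / 2 * ((K * B + s0) * wint a) with hL
  have hL0 : 0 ≤ L := by have := (h 0).M0; have := (wint_pos ha0).le; positivity
  refine Metric.tendsto_nhds.2 fun ε hε => ?_
  obtain ⟨θ, hθ, hθL⟩ : ∃ θ, 0 < θ ∧ L * θ < ε / 8 := by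
    refine ⟨ε / (8 * (L + 1)), by positivity, ?_⟩
    have : L * (ε / (8 * (L + 1))) = L / (L + 1) * (ε / 8) := by field_simp
    rw [this]
    have : L / (L + 1) < 1 := (div_lt_one (by linarith)).2 (by linarith)
    nlinarith
  set X' := max X θ
  set Y' := max Y θ
  have pX : 0 < X' := hθ.trans_le (le_max_right _ _)
  have pY : 0 < Y' := hθ.trans_le (le_max_right _ _)
  have dX : |X - X'| ≤ θ := by
    rw [abs_sub_comm, abs_of_nonneg (sub_nonneg.2 (le_max_left _ _))]
    have : X' ≤ X + θ := max_le (by linarith) (by linarith)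
    linarith
  have dY : |Y - Y'| ≤ θ := by
    rw [abs_sub_comm, abs_of_nonneg (sub_nonneg.2 (le_max_left _ _))]
    have : Y' ≤ Y + θ := max_le (by linarith) (by linarith)
    linarith
  have l1 : Tendsto (fun n => |F n X' Y'| + (√(e n) * √|x n - X'| + L * |x n - X'|) +
      (√(e n) * √|y n - Y'| + L * |y n - Y'|)) atTop
      (𝓝 (|0| + (√0 * √|X - X'| + L * |X - X'|) + (√0 * √|Y - Y'| + L * |Y - Y'|))) := by
    refine Tendsto.add (Tendsto.add (hF X' Y' pX pY).abs ?_) ?_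
    · exact (he0.sqrt.mul (hX.sub_const X').abs.sqrt).add ((hX.sub_const X').abs.const_mul L)
    · exact (he0.sqrt.mul (hY.sub_const Y').abs.sqrt).add ((hY.sub_const Y').abs.const_mul L)
  have hlt : |0| + (√0 * √|X - X'| + L * |X - X'|) + (√0 * √|Y - Y'| + L * |Y - Y'|) < ε := by
    have b1 := mul_le_mul_of_nonneg_left dX hL0
    have b2 := mul_le_mul_of_nonneg_left dY hL0
    simp only [abs_zero, sqrt_zero, zero_mul, zero_add]
    linarith
  have l2 : ∀ᶠ n in atTop, 2 * a ≤ x n + y n :=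
    ((hX.add hY).eventually (lt_mem_nhds (by rw [ha]; linarith : 2 * a < X + Y))).mono
      fun n hn => le_of_lt hn
  have l3 : ∀ᶠ n in atTop, 2 * a ≤ X' + y n := by
    have : 2 * a < X' + Y := by
      have : X ≤ X' := le_max_left _ _
      rw [ha]; linarith
    exact ((hY.const_add X').eventually (lt_mem_nhds this)).mono fun n hn => le_of_lt hn
  filter_upwards [l1.eventually (gt_mem_nhds hlt), l2, l3] with n h1 h2 h3
  rw [dist_eq, sub_zero]
  have c1 := (h n).abs_sub_le_far (he n) (hen n) ha0 pX (hx n) (hy n) (by linarith) (by linarith)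
  have c2 := (h n).abs_sub_le_far (he n) (hen n) ha0 pY (hy n) pX (by
      have : X ≤ X' := le_max_left _ _
      have : Y ≤ Y' := le_max_left _ _
      rw [ha]; linarith) (by linarith)
  rw [(h n).sym _ _ (hy n) pX, (h n).sym _ _ pY pX] at c2
  rw [← hL] at c1 c2
  have := abs_sub_abs_le_abs_sub (F n (x n) (y n)) (F n X' (y n))
  have := abs_sub_abs_le_abs_sub (F n X' (y n)) (F n X' Y')
  linarith

/-- Compactness, together with control at a bounded sequence of points. -/
theorem Sys.compact {κ s G : ℕ → ℝ → ℝ} {F : ℕ → ℝ → ℝ → ℝ} {K B s0 : ℝ} {κ' s' : ℝ → ℝ}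
    (h : ∀ n, Sys (κ n) (s n) (G n) (F n) K B s0) {e : ℕ → ℝ}
    (he : ∀ n x y, 0 < x → x < y → ∫ z in x..y, G n z ^ 2 ≤ e n) (he0 : Tendsto e atTop (𝓝 0))
    (c : CoefLim κ s κ' s')
    {x y : ℕ → ℝ} (hx : ∀ n, 0 < x n) (hy : ∀ n, 0 < y n) {a b : ℝ} (ha : 0 < a)
    (hxy : ∀ n, a ≤ (x n + y n) / 2 ∧ (x n + y n) / 2 ≤ b) :
    ∃ (φ : ℕ → ℕ) (F' : ℝ → ℝ → ℝ), StrictMono φ ∧ Sys κ' s' (fun _ => 0) F' K B s0 ∧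
      (∀ ξ η, 0 < ξ → 0 < η → Tendsto (fun n => F (φ n) ξ η) atTop (𝓝 (F' ξ η))) ∧
      ((∀ ξ η, 0 < ξ → 0 < η → F' ξ η = 0) →
        Tendsto (fun n => F (φ n) (x (φ n)) (y (φ n))) atTop (𝓝 0)) := by
  obtain ⟨p, -, φ, hφ, hp⟩ := (isCompact_Icc (a := ((0 : ℝ), (0 : ℝ))) (b := (2 * b, 2 * b))).tendsto_subseq
    (x := fun n => (x n, y n)) (fun n => ⟨⟨(hx n).le, (hy n).le⟩,
      ⟨by have := hx n; have := hy n; have := (hxy n).2; simp only; linarith,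
       by have := hx n; have := hy n; have := (hxy n).2; simp only; linarith⟩⟩)
  have hX : Tendsto (fun n => x (φ n)) atTop (𝓝 p.1) := (continuous_fst.tendsto p).comp hp
  have hY : Tendsto (fun n => y (φ n)) atTop (𝓝 p.2) := (continuous_snd.tendsto p).comp hp
  have hG : ∀ a b, 0 < a → a < b →
      Tendsto (fun n => ∫ x in a..b, G (φ n) x ^ 2) atTop (𝓝 0) := fun a b ha hab =>
    squeeze_zero (fun n => intervalIntegral.integral_nonneg hab.le fun z _ => sq_nonneg _)
      (fun n => he (φ n) a b ha hab) (he0.comp hφ.tendsto_atTop)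
  obtain ⟨ψ, F', hψ, hS, hl⟩ := Sys.exists_subseq (fun n => h (φ n)) hG (c.comp hφ)
  refine ⟨φ ∘ ψ, F', hφ.comp hψ, hS, hl, fun hz => ?_⟩
  have hXY : 0 < p.1 + p.2 := by
    have : 2 * a ≤ p.1 + p.2 := ge_of_tendsto (hX.add hY)
      (.of_forall fun n => by have := (hxy (φ n)).1; linarith)
    linarith
  refine Sys.tendsto_zero_at (fun n => h (φ (ψ n))) (fun n => he (φ (ψ n)))
    (he0.comp (hφ.comp hψ).tendsto_atTop) (fun ξ η hξ hη => ?_) (fun n => hx _) (fun n => hy _)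
    (hX.comp hψ.tendsto_atTop) (hY.comp hψ.tendsto_atTop) hXY
  rw [← hz ξ η hξ hη]
  exact hl ξ η hξ hη

/-! ### A quasi-conserved linear functional -/

/-- The radial coordinate of the null coordinates `(ξ,η)`. -/
def nr (ξ η : ℝ) : ℝ := (ξ + η) / 2

/-- Adjoint solution of the free equation in null coordinates. -/
def psi (ξ η : ℝ) : ℝ :=
  (6 * ξ * η - ξ ^ 2 - η ^ 2) / (4 * (√ξ * √η * √(nr ξ η) ^ 3))

/-- `∂_η psi`. -/
def psie (ξ η : ℝ) : ℝ :=
  √ξ * (ξ ^ 2 + 10 * ξ * η - 15 * η ^ 2) / (16 * (√η ^ 3 * √(nr ξ η) ^ 5))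

theorem psi_der_right {ξ η : ℝ} (hξ : 0 < ξ) (hη : 0 < η) :
    HasDerivAt (fun y => psi ξ y) (psie ξ η) η := by
  have hr : 0 < nr ξ η := by unfold nr; linarith
  have d1 : HasDerivAt (fun y => √y) (1 / (2 * √η)) η := hasDerivAt_sqrt hη.ne'
  have d2 : HasDerivAt (fun y => nr ξ y) (1 / 2) η := by
    unfold nr; exact (((hasDerivAt_id η).const_add ξ).div_const 2)
  have d3 : HasDerivAt (fun y => √(nr ξ y)) (1 / 2 / (2 * √(nr ξ η))) η := d2.sqrt hr.ne'
  have d4 : HasDerivAt (fun y : ℝ => 6 * ξ * y - ξ ^ 2 - y ^ 2) (6 * ξ - 2 * η) η := by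
    refine ((((hasDerivAt_id η).const_mul (6 * ξ)).sub_const (ξ ^ 2)).sub
      (hasDerivAt_pow 2 η)).congr_deriv ?_
    simp
  have hx := sqrt_pos.2 hξ
  have he := sqrt_pos.2 hη
  have hR := sqrt_pos.2 hr
  refine (d4.div (((d1.const_mul √ξ).mul (d3.pow 3)).const_mul 4) (by simp only [Pi.mul_apply, Pi.pow_apply]; positivity)).congr_deriv ?_
  simp only [psie, Pi.pow_apply, Pi.mul_apply]
  have e1 := sq_sqrt hξ.le
  have e2 := sq_sqrt hη.le
  have e3 : √(nr ξ η) ^ 2 = (√ξ ^ 2 + √η ^ 2) / 2 := by rw [sq_sqrt hr.le, e1, e2]; rfl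
  generalize √(nr ξ η) = R at *
  generalize √ξ = X at *
  generalize √η = Y at *
  rw [← e1, ← e2]
  field_simp
  have e4 : Y ^ 2 = 2 * R ^ 2 - X ^ 2 := by linarith
  norm_num
  simp only [mul_add, mul_sub, show Y ^ 4 = (Y ^ 2) ^ 2 by ring, e4]
  ring_nf

theorem psie_der_left {ξ η : ℝ} (hξ : 0 < ξ) (hη : 0 < η) :
    HasDerivAt (fun x => psie x η) (15 / (16 * nr ξ η ^ 2) * psi ξ η) ξ := by
  have hr : 0 < nr ξ η := by unfold nr; linarith
  have d1 : HasDerivAt (fun y => √y) (1 / (2 * √ξ)) ξ := hasDerivAt_sqrt hξ.ne'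
  have d2 : HasDerivAt (fun y => nr y η) (1 / 2) ξ := by
    unfold nr; exact (((hasDerivAt_id ξ).add_const η).div_const 2)
  have d3 : HasDerivAt (fun y => √(nr y η)) (1 / 2 / (2 * √(nr ξ η))) ξ := d2.sqrt hr.ne'
  have d4 : HasDerivAt (fun y : ℝ => y ^ 2 + 10 * y * η - 15 * η ^ 2) (2 * ξ + 10 * η) ξ := by
    refine (((hasDerivAt_pow 2 ξ).add (((hasDerivAt_id ξ).const_mul 10).mul_const η)).sub_const
      (15 * η ^ 2)).congr_deriv ?_
    simp
  have hx := sqrt_pos.2 hξ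
  have he := sqrt_pos.2 hη
  have hR := sqrt_pos.2 hr
  refine ((d1.mul d4).div (((d3.pow 5).const_mul (√η ^ 3)).const_mul 16)
    (by simp only [Pi.mul_apply, Pi.pow_apply]; positivity)).congr_deriv ?_
  simp only [psi, Pi.pow_apply, Pi.mul_apply]
  have e1 := sq_sqrt hξ.le
  have e2 := sq_sqrt hη.le
  have e3 : √(nr ξ η) ^ 2 = (√ξ ^ 2 + √η ^ 2) / 2 := by rw [sq_sqrt hr.le, e1, e2]; rfl
  have e5 := (sq_sqrt hr.le).symm
  generalize √(nr ξ η) = R at *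
  rw [e5]
  generalize √ξ = X at *
  generalize √η = Y at *
  rw [← e1, ← e2]
  field_simp
  have e4 : Y ^ 2 = 2 * R ^ 2 - X ^ 2 := by linarith
  norm_num
  simp only [mul_add, mul_sub, show Y ^ 4 = (Y ^ 2) ^ 2 by ring, e4]
  ring_nf

theorem nr_pos {ξ η : ℝ} (hξ : 0 < ξ) (hη : 0 < η) : 0 < nr ξ η := by unfold nr; linarith

theorem abs_psi_le {ξ η : ℝ} (hξ : 0 < ξ) (hη : 0 < η) :
    |psi ξ η| ≤ √(nr ξ η) / (√ξ * √η) := by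
  have hr := nr_pos hξ hη
  have hx := sqrt_pos.2 hξ
  have he := sqrt_pos.2 hη
  have hR := sqrt_pos.2 hr
  unfold psi
  rw [abs_div, abs_of_pos (by positivity : 0 < 4 * (√ξ * √η * √(nr ξ η) ^ 3)),
    div_le_div_iff₀ (by positivity) (by positivity)]
  have hP : |6 * ξ * η - ξ ^ 2 - η ^ 2| ≤ 4 * √(nr ξ η) ^ 4 := by
    rw [show √(nr ξ η) ^ 4 = (√(nr ξ η) ^ 2) ^ 2 by ring, sq_sqrt hr.le]
    unfold nr
    rw [abs_le]
    constructor <;> nlinarith [sq_nonneg (ξ - η), mul_pos hξ hη]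
  calc _ ≤ 4 * √(nr ξ η) ^ 4 * (√ξ * √η) := by gcongr
    _ = _ := by ring

theorem abs_psi_le_of_le {ξ η : ℝ} (hξ : 0 < ξ) (hη : ξ ≤ η) : |psi ξ η| ≤ (√ξ)⁻¹ := by
  have hη0 := hξ.trans_le hη
  refine (abs_psi_le hξ hη0).trans ?_
  have he := sqrt_pos.2 hη0
  have hx := sqrt_pos.2 hξ
  have : √(nr ξ η) ≤ √η := sqrt_le_sqrt (by unfold nr; linarith)
  rw [← one_div, div_le_div_iff₀ (by positivity) hx]
  nlinarith

theorem abs_psie_le {ξ η : ℝ} (hξ : 0 < ξ) (hη : 0 < η) : |psie ξ η| ≤ 6 * √ξ / η ^ 2 := by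
  have hr := nr_pos hξ hη
  have hx := sqrt_pos.2 hξ
  have he := sqrt_pos.2 hη
  have hR := sqrt_pos.2 hr
  have e2 := sq_sqrt hη.le
  have e3 := sq_sqrt hr.le
  unfold psie
  rw [abs_div, abs_of_pos (by positivity : 0 < 16 * (√η ^ 3 * √(nr ξ η) ^ 5)), abs_mul,
    abs_of_pos hx, div_le_div_iff₀ (by positivity) (by positivity)]
  have hQ : |ξ ^ 2 + 10 * ξ * η - 15 * η ^ 2| ≤ 60 * √(nr ξ η) ^ 4 := by
    rw [show √(nr ξ η) ^ 4 = (√(nr ξ η) ^ 2) ^ 2 by ring, sq_sqrt hr.le]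
    unfold nr
    rw [abs_le]
    constructor <;> nlinarith [sq_nonneg (ξ - η), mul_pos hξ hη, sq_nonneg ξ, sq_nonneg η]
  have hYR : 60 * √η ≤ 96 * √(nr ξ η) := by
    have : (5 / 8 * √η) ^ 2 ≤ √(nr ξ η) ^ 2 := by
      rw [mul_pow, e2, e3]; unfold nr; linarith
    have := abs_le_of_sq_le_sq' this hR.le
    linarith [this.2]
  have e4 : η ^ 2 = √η ^ 4 := by rw [show √η ^ 4 = (√η ^ 2) ^ 2 by ring, e2]
  rw [e4] at hQ ⊢
  calc _ ≤ √ξ * (60 * √(nr ξ η) ^ 4) * √η ^ 4 := by gcongr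
    _ = √ξ * √(nr ξ η) ^ 4 * √η ^ 3 * (60 * √η) := by ring
    _ ≤ √ξ * √(nr ξ η) ^ 4 * √η ^ 3 * (96 * √(nr ξ η)) := by gcongr
    _ = _ := by ring

theorem psi_diag {ξ : ℝ} (hξ : 0 < ξ) : psi ξ ξ = (√ξ)⁻¹ := by
  have hx := sqrt_pos.2 hξ
  have e := sq_sqrt hξ.le
  unfold psi nr
  rw [show (ξ + ξ) / 2 = ξ by ring]
  generalize √ξ = X at *
  rw [← e]; field_simp; ring

theorem psie_diag {ξ : ℝ} (hξ : 0 < ξ) : psie ξ ξ = -(1 / 4) * ((√ξ)⁻¹ / ξ) := by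
  have hx := sqrt_pos.2 hξ
  have e := sq_sqrt hξ.le
  unfold psie nr
  rw [show (ξ + ξ) / 2 = ξ by ring]
  generalize √ξ = X at *
  rw [← e]; field_simp; ring

theorem tendsto_psi {ξ : ℝ} (hξ : 0 < ξ) :
    Tendsto (fun η => psi ξ η) atTop (𝓝 (-(√ξ)⁻¹ / √2)) := by
  have hx := sqrt_pos.2 hξ
  have h0 : Tendsto (fun η : ℝ => ξ / η) atTop (𝓝 0) := tendsto_const_nhds.div_atTop tendsto_id
  have h1 : Tendsto (fun η : ℝ => (6 * (ξ / η) - (ξ / η) ^ 2 - 1) /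
      (4 * (√ξ * √((ξ / η + 1) / 2) ^ 3))) atTop
      (𝓝 ((6 * 0 - 0 ^ 2 - 1) / (4 * (√ξ * √((0 + 1) / 2) ^ 3)))) := by
    refine Tendsto.div (((h0.const_mul 6).sub (h0.pow 2)).sub_const 1)
      (((((h0.add_const 1).div_const 2).sqrt).pow 3).const_mul √ξ |>.const_mul 4) ?_
    have : (0:ℝ) < √((0 + 1) / 2) := sqrt_pos.2 (by norm_num)
    positivity
  have e : (6 * 0 - 0 ^ 2 - 1) / (4 * (√ξ * √((0 + 1) / 2) ^ 3)) = -(√ξ)⁻¹ / √2 := by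
    have h2 : √((0 + 1) / 2 : ℝ) = (√2)⁻¹ := by
      rw [zero_add, one_div, Real.sqrt_inv]
    rw [h2]
    have h3 := sq_sqrt (show (0:ℝ) ≤ 2 by norm_num)
    have h4 : (0:ℝ) < √2 := by positivity
    field_simp
    nlinarith
  rw [e] at h1
  refine h1.congr' ?_
  filter_upwards [eventually_gt_atTop 0] with η hη
  have he := sqrt_pos.2 hη
  have hs : √(nr ξ η) = √η * √((ξ / η + 1) / 2) := by
    rw [← sqrt_mul hη.le]; congr 1; unfold nr; field_simp
  have hR : 0 < √((ξ / η + 1) / 2) := sqrt_pos.2 (by positivity)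
  unfold psi
  rw [hs]
  have e2 : η = √η ^ 2 := (sq_sqrt hη.le).symm
  generalize √((ξ / η + 1) / 2) = R at *
  generalize √η = Y at *
  rw [e2]; field_simp

theorem psi_psie_cont : ContinuousOn (unc psi) (Ioi 0 ×ˢ Ioi 0) ∧
    ContinuousOn (unc psie) (Ioi 0 ×ˢ Ioi 0) := by
  unfold psi psie nr
  constructor <;> refine ContinuousOn.div (by fun_prop) (by fun_prop) ?_
  all_goals
    rintro ⟨a, b⟩ ⟨ha, hb⟩
    simp only [mem_Ioi] at ha hb
    have := sqrt_pos.2 ha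
    have := sqrt_pos.2 hb
    have := sqrt_pos.2 (show 0 < (a + b) / 2 by linarith)
    simp only; positivity

/-- Differentiation of tail integrals with moving endpoint. -/
theorem hasDerivAt_tail_param {f f' : ℝ → ℝ → ℝ} {a b M x : ℝ} (ha : 0 < a) (hM : 0 ≤ M)
    (hfc : ContinuousOn (Function.uncurry f) (Ioo a b ×ˢ Ioi a))
    (hfc' : ContinuousOn (Function.uncurry f') (Ioo a b ×ˢ Ioi a))
    (hb : ∀ x ∈ Ioo a b, ∀ y, a < y → |f x y| ≤ M * wtail y)
    (hb' : ∀ x ∈ Ioo a b, ∀ y, a < y → |f' x y| ≤ M * wtail y)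
    (hd : ∀ x ∈ Ioo a b, ∀ y, a < y → HasDerivAt (fun z => f z y) (f' x y) x)
    (hx : x ∈ Ioo a b) :
    HasDerivAt (fun z => ∫ y in Ioi z, f z y) ((∫ y in Ioi x, f' x y) - f x x) x := by
  have lc : ∀ {g : ℝ → ℝ → ℝ}, ContinuousOn (Function.uncurry g) (Ioo a b ×ˢ Ioi a) →
      ∀ z ∈ Ioo a b, ContinuousOn (fun y => g z y) (Ioi a) := fun hg z hz =>
    hg.comp (f := fun y => (z, y)) (by fun_prop) (fun y hy => ⟨hz, hy⟩)
  have ii : ∀ {g : ℝ → ℝ → ℝ}, ContinuousOn (Function.uncurry g) (Ioo a b ×ˢ Ioi a) →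
      (∀ x ∈ Ioo a b, ∀ y, a < y → |g x y| ≤ M * wtail y) → ∀ z ∈ Ioo a b, ∀ y, a ≤ y →
      IntegrableOn (g z) (Ioi y) := fun hg hbg z hz y hy =>
    integrableOn_of_le_wtail (by linarith) ((lc hg z hz).mono (Ioi_subset_Ioi hy))
      (fun w hw => hbg z hz w (lt_of_le_of_lt hy hw))
  have hxx : ((x, x) : ℝ × ℝ) ∈ Ioo a b ×ˢ Ioi a := ⟨hx, hx.1⟩
  have hopen : IsOpen (Ioo a b ×ˢ Ioi a : Set (ℝ × ℝ)) := isOpen_Ioo.prod isOpen_Ioi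
  have hmem : (Ioo a b ×ˢ Ioi a : Set (ℝ × ℝ)) ∈ 𝓝 (x, x) := hopen.mem_nhds hxx
  have c1 : ContinuousOn (fun p : ℝ × ℝ => ∫ y in Ioi p.2, f' p.1 y) (Ioo a b ×ˢ Ioi a) := by
    have e : (fun p : ℝ × ℝ => ∫ y in Ioi p.2, f' p.1 y) =
        fun p : ℝ × ℝ => ∫ σ in Ioi (0:ℝ), f' p.1 (p.2 + σ) := by
      ext p; rw [integral_Ioi_shift]
    rw [e]
    refine continuousOn_tail hopen (r := fun p : ℝ × ℝ => p.2) hM (by fun_prop)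
      (fun p hp => ha.trans hp.2) ?_ (fun p hp σ hσ => hb' _ hp.1 _ ?_)
    · refine hfc'.comp (f := fun q : (ℝ × ℝ) × ℝ => (q.1.1, q.1.2 + q.2)) (by fun_prop) ?_
      rintro ⟨⟨p, q⟩, σ⟩ ⟨⟨hp, hq⟩, hσ⟩
      simp only [mem_Ioi] at hq hσ
      exact ⟨hp, by simp only [mem_Ioi]; linarith⟩
    · have : a < p.2 := hp.2
      linarith
  have key := hasStrictFDerivAt_uncurry_coprod (𝕜 := ℝ) (u := ((x, x) : ℝ × ℝ))
    (f := fun z w => ∫ y in Ioi w, f z y)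
    (f₁ := fun z w => (∫ y in Ioi w, f' z y) • ContinuousLinearMap.id ℝ ℝ)
    (f₂ := fun z w => (-f z w) • ContinuousLinearMap.id ℝ ℝ)
    (by
      filter_upwards [hmem] with v hv
      have hv2 : a < v.2 := hv.2
      have := (hasDerivAt_integral_of_dominated_loc_of_deriv_le (μ := volume.restrict (Ioi v.2))
        (F := f) (F' := f') (x₀ := v.1) (s := Ioo a b) (bound := fun y => M * wtail y)
        (Ioo_mem_nhds hv.1.1 hv.1.2)
        (by
          filter_upwards [Ioo_mem_nhds hv.1.1 hv.1.2] with z hz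
          exact (ii hfc hb z hz _ hv2.le).1)
        (ii hfc hb _ hv.1 _ hv2.le) (ii hfc' hb' _ hv.1 _ hv2.le).1
        (by
          refine ae_Ioi fun y hy z hz => ?_
          exact hb' z hz y (hv2.trans hy))
        ((wtail_integrableOn (ha.trans hv2)).const_mul M)
        (by
          refine ae_Ioi fun y hy z hz => ?_
          exact hd z hz y (hv2.trans hy))).2
      refine this.hasFDerivAt.congr_fderiv (ContinuousLinearMap.ext fun x => ?_)
      simp [Function.HasUncurry.uncurry, mul_comm])
    (by
      filter_upwards [hmem] with v hv
      have hv2 : a < v.2 := hv.2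
      have e : (fun z => ∫ y in Ioi z, f v.1 y) =ᶠ[𝓝 v.2]
          fun z => (∫ y in Ioi a, f v.1 y) - ∫ y in a..z, f v.1 y := by
        filter_upwards [Ioi_mem_nhds hv2] with z hz
        have := intervalIntegral.integral_Ioi_sub_Ioi (ii hfc hb _ hv.1 a le_rfl) (le_of_lt hz)
        linarith
      have := HasDerivAt.congr_of_eventuallyEq ((intervalIntegral.integral_hasDerivAt_right
        (by
          rw [intervalIntegrable_iff_integrableOn_Ioc_of_le hv2.le]
          exact (ii hfc hb _ hv.1 a le_rfl).mono_set Ioc_subset_Ioi_self)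
        ((lc hfc _ hv.1).stronglyMeasurableAtFilter isOpen_Ioi _ hv2)
        ((lc hfc _ hv.1).continuousAt (Ioi_mem_nhds hv2))).const_sub
          (∫ y in Ioi a, f v.1 y)) e
      refine this.hasFDerivAt.congr_fderiv (ContinuousLinearMap.ext fun x => ?_)
      simp [Function.HasUncurry.uncurry, mul_comm])
    ((c1.continuousAt hmem).smul continuousAt_const)
    ((hfc.continuousAt hmem).neg.smul continuousAt_const)
  have hp : HasDerivAt (fun r : ℝ => ((r, r) : ℝ × ℝ)) ((1, 1) : ℝ × ℝ) x :=
    (hasDerivAt_id x).prodMk (hasDerivAt_id x)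
  refine HasDerivAt.congr_deriv (HasFDerivAt.comp_hasDerivAt
    (f := fun r : ℝ => ((r, r) : ℝ × ℝ)) x key.hasFDerivAt hp) ?_
  simp [Function.HasUncurry.uncurry]
  ring

theorem wgrow_div_sq {y : ℝ} (hy : 0 < y) : wgrow y / y ^ 2 = wtail y := by
  rw [← wgrow_mul hy, Real.rpow_neg hy.le, show (2 : ℝ) = ((2 : ℕ) : ℝ) by norm_num,
    Real.rpow_natCast]
  field_simp

theorem wgrow_mono {a b : ℝ} (ha : 0 < a) (hab : a ≤ b) : wgrow a ≤ wgrow b := by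
  unfold wgrow; gcongr

theorem wgrow_mul_le {T y : ℝ} (hT : 1 ≤ T) (hy : 0 < y) : wgrow (T * y) ≤ T * wgrow y := by
  unfold wgrow
  have hT0 : 0 < T := by linarith
  rw [Real.mul_rpow hT0.le hy.le, Real.mul_rpow hT0.le hy.le, mul_add]
  have h1 : T ^ (1/4 : ℝ) ≤ T := by
    conv_rhs => rw [← Real.rpow_one T]
    exact Real.rpow_le_rpow_of_exponent_le hT (by norm_num)
  have h2 : T ^ (3/4 : ℝ) ≤ T := by
    conv_rhs => rw [← Real.rpow_one T]
    exact Real.rpow_le_rpow_of_exponent_le hT (by norm_num)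
  gcongr

theorem inv_sq_le_wtail {a y : ℝ} (ha : 0 < a) (hy : a ≤ y) :
    1 / y ^ 2 ≤ (wgrow a)⁻¹ * wtail y := by
  have hy0 := ha.trans_le hy
  rw [← wgrow_div_sq hy0, ← mul_div_assoc]
  gcongr
  rw [inv_mul_eq_div, le_div_iff₀ (wgrow_pos ha), one_mul]
  exact wgrow_mono ha hy

theorem tendsto_wint_atTop : Tendsto wint atTop (𝓝 0) := by
  refine tendsto_zero_of_rpow_atTop (C := 6) (p := -(1/4)) (by norm_num) fun r hr => ?_
  rw [abs_of_pos (wint_pos (by linarith))]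
  exact wint_le_of_one_le hr.le

namespace Sys

variable {κ s G : ℝ → ℝ} {F : ℝ → ℝ → ℝ} {K B s0 : ℝ}

theorem tendsto_nd (h : Sys κ s G F K B s0) {x : ℝ} (hx : 0 < x) :
    Tendsto (fun y => nd κ s G F x y) atTop (𝓝 (G x)) := by
  have h0 : Tendsto (fun y => tailI κ s F x y) atTop (𝓝 0) := by
    have h1 : Tendsto (fun y : ℝ => (x + y) / 2) atTop atTop :=
      (tendsto_atTop_add_const_left _ x tendsto_id).atTop_div_const (by norm_num)
    refine squeeze_zero_norm' ?_ (by simpa using (tendsto_wint_atTop.comp h1).const_mul (K * B + s0))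
    filter_upwards [eventually_gt_atTop 0] with y hy
    exact h.tailI_bound hx hy
  unfold nd
  have h2 := (h0.const_mul (1/2)).const_sub (G x)
  rwa [mul_zero, sub_zero] at h2

theorem nd_der_right (h : Sys κ s G F K B s0) {x y : ℝ} (hx : 0 < x) (hy : 0 < y) :
    HasDerivAt (fun y => nd κ s G F x y) (1 / 4 * (κ (nr x y) * F x y + s (nr x y))) y := by
  have e : (fun y => tailI κ s F x y) = fun y =>
      ∫ ρ in Ioi (y / 2), (κ (x / 2 + ρ) * F x (2 * (x / 2 + ρ) - x) + s (x / 2 + ρ)) := by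
    ext y
    unfold tailI
    rw [integral_Ioi_shift, integral_Ioi_shift (fun ρ => κ (x / 2 + ρ) * F x (2 * (x / 2 + ρ) - x) + s (x / 2 + ρ))]
    simp only [add_div, add_assoc]
  have hy2 : 0 < y / 2 := by linarith
  have d := tail_hasDerivAt (g := fun ρ => κ (x / 2 + ρ) * F x (2 * (x / 2 + ρ) - x) + s (x / 2 + ρ))
    hy2 ((h.toPreSys.integrand_cont hx).comp (f := fun ρ => x / 2 + ρ) (by fun_prop)
      (fun ρ hρ => by have : 0 < ρ := hρ; simp only [mem_Ioi]; linarith)) (fun a ha => by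
      have := h.toPreSys.integrand_int (r := x / 2 + a) hx (by linarith)
      have := (integrableOn_Ioi_shift (g := fun ρ => κ ρ * F x (2 * ρ - x) + s ρ)).2 this
      refine (integrableOn_Ioi_shift (r := a) (g := fun ρ => κ (x / 2 + ρ) * F x (2 * (x / 2 + ρ) - x) + s (x / 2 + ρ))).1 ?_
      simpa only [add_assoc] using this)
  have d2 := (d.comp y ((hasDerivAt_id y).div_const 2))
  unfold nd
  rw [show (fun y => G x - 1 / 2 * tailI κ s F x y) = fun y => G x - 1 / 2 *
      ((fun r => ∫ ρ in Ioi r, (κ (x / 2 + ρ) * F x (2 * (x / 2 + ρ) - x) + s (x / 2 + ρ))) ∘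
        fun y => y / 2) y from by ext y; rw [congrFun e y]; rfl]
  refine ((d2.const_mul (1/2)).const_sub (G x)).congr_deriv ?_
  have e1 : x / 2 + y / 2 = nr x y := by unfold nr; ring
  have e2 : 2 * nr x y - x = y := by unfold nr; ring
  simp only [e1, e2]; ring

/-- A functional which is nearly conserved along solutions. -/
def bf (F : ℝ → ℝ → ℝ) (x : ℝ) : ℝ := 2 * (∫ y in Ioi x, F x y * psie x y) + F x x * (√x)⁻¹

theorem F_psie_bound (h : PreSys κ s F K B s0) {a b x y : ℝ} (ha : 0 < a) (hx : x ∈ Ioo a b)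
    (hy : a < y) : |F x y * psie x y| ≤ 6 * B * ((b / a + 1) / 2) * √b * wtail y := by
  have hx0 := ha.trans hx.1
  have hy0 := ha.trans hy
  have hab : a < b := hx.1.trans hx.2
  have hB := h.B0
  have hT : 1 ≤ (b / a + 1) / 2 := by
    have : 1 ≤ b / a := by rw [le_div_iff₀ ha]; linarith
    linarith
  have hr : (x + y) / 2 ≤ (b / a + 1) / 2 * y := by
    have : b ≤ b / a * y := by
      rw [div_mul_eq_mul_div, le_div_iff₀ ha]; nlinarith [hx.1, hx.2]
    linarith [hx.2]
  have h1 := (h.Fb x y hx0 hy0).trans (mul_le_mul_of_nonneg_left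
    ((wgrow_mono (by linarith) hr).trans (wgrow_mul_le hT hy0)) hB)
  have h2 := abs_psie_le hx0 hy0
  have h3 : √x ≤ √b := sqrt_le_sqrt hx.2.le
  rw [abs_mul, ← wgrow_div_sq hy0]
  calc _ ≤ (B * ((b / a + 1) / 2 * wgrow y)) * (6 * √b / y ^ 2) := by
        refine mul_le_mul h1 (h2.trans (by gcongr)) (abs_nonneg _) ((abs_nonneg _).trans h1)
    _ = _ := by ring

theorem bf_der (h : Sys κ s G F K B s0) {x : ℝ} (hx : 0 < x) :
    HasDerivAt (bf F) (-(√2 * (√x)⁻¹ * G x) - 1 / 2 * ∫ y in Ioi x,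
      ((κ (nr x y) - 15 / (4 * nr x y ^ 2)) * F x y + s (nr x y)) * psi x y) x := by
  obtain ⟨a, b, ha, hxab⟩ : ∃ a b : ℝ, 0 < a ∧ x ∈ Ioo a b := ⟨x / 2, 2 * x, by linarith, by
    constructor <;> linarith⟩
  have hab : a < b := hxab.1.trans hxab.2
  have hb0 : 0 < b := ha.trans hab
  have hM := h.toPreSys.M0
  have hB := h.B0
  obtain ⟨g, hg⟩ := isCompact_Icc.exists_bound_of_continuousOn
    (h.Gc.mono (fun z (hz : z ∈ Icc a b) => ha.trans_le hz.1))
  have hg0 : 0 ≤ g := (norm_nonneg _).trans (hg a ⟨le_rfl, hab.le⟩)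
  set T := (b / a + 1) / 2 with hTd
  have hT : 1 ≤ T := by
    have : 1 ≤ b / a := by rw [le_div_iff₀ ha]; linarith
    rw [hTd]; linarith
  have hrT : ∀ z ∈ Ioo a b, ∀ y, a < y → nr z y ≤ T * y := fun z hz y hy => by
    have : b ≤ b / a * y := by
      rw [div_mul_eq_mul_div, le_div_iff₀ ha]; nlinarith
    unfold nr; rw [hTd]; linarith [hz.2]
  have hFb : ∀ z ∈ Ioo a b, ∀ y, a < y → |F z y| ≤ B * (T * wgrow y) := fun z hz y hy =>
    (h.Fb z y (ha.trans hz.1) (ha.trans hy)).trans (mul_le_mul_of_nonneg_left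
      ((wgrow_mono (nr_pos (ha.trans hz.1) (ha.trans hy)) (hrT z hz y hy)).trans
        (wgrow_mul_le hT (ha.trans hy))) hB)
  have hpsi : ∀ z ∈ Ioo a b, ∀ y, a < y → |psi z y| ≤ √T / √a := fun z hz y hy => by
    have hy0 := ha.trans hy
    have hz0 := ha.trans hz.1
    refine (abs_psi_le hz0 hy0).trans ?_
    have h1 : √(nr z y) ≤ √T * √y := by
      rw [← sqrt_mul (by linarith)]; exact sqrt_le_sqrt (hrT z hz y hy)
    have h2 : √a ≤ √z := sqrt_le_sqrt hz.1.le
    have h3 := sqrt_pos.2 hy0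
    have h4 := sqrt_pos.2 ha
    calc _ ≤ √T * √y / (√a * √y) := by gcongr
      _ = _ := by field_simp
  have hnd : ∀ z ∈ Ioo a b, ∀ y, a < y →
      |nd κ s G F z y * psie z y| ≤ (g + 1 / 2 * ((K * B + s0) * wint a)) * (6 * √b) *
        (wgrow a)⁻¹ * wtail y := fun z hz y hy => by
    have hy0 := ha.trans hy
    have hz0 := ha.trans hz.1
    have h1 := hg z ⟨hz.1.le, hz.2.le⟩
    have h2 := (h.toPreSys.tailI_bound hz0 hy0).trans (mul_le_mul_of_nonneg_left
      (wint_anti ha (show a ≤ (z + y) / 2 by linarith [hz.1])) hM)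
    have h3 : |nd κ s G F z y| ≤ g + 1 / 2 * ((K * B + s0) * wint a) := by
      unfold nd
      refine (_root_.abs_sub _ _).trans ?_
      rw [abs_mul, abs_of_pos (by norm_num : (0:ℝ) < 1 / 2)]
      rw [norm_eq_abs] at h1
      linarith
    have h4 : |psie z y| ≤ 6 * √b * ((wgrow a)⁻¹ * wtail y) := by
      refine (abs_psie_le hz0 hy0).trans ?_
      have h5 := inv_sq_le_wtail ha hy.le
      have h6 : √z ≤ √b := sqrt_le_sqrt hz.2.le
      rw [show 6 * √z / y ^ 2 = 6 * √z * (1 / y ^ 2) by ring]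
      gcongr
    rw [abs_mul]
    refine (mul_le_mul h3 h4 (abs_nonneg _) ((abs_nonneg _).trans h3)).trans (le_of_eq (by ring))
  have hp : ∀ z ∈ Ioo a b, ∀ y, a < y →
      |F z y * (15 / (16 * nr z y ^ 2) * psi z y)| ≤ B * T * 4 * (√T / √a) * wtail y :=
    fun z hz y hy => by
    have hy0 := ha.trans hy
    have hz0 := ha.trans hz.1
    have hr : y / 2 ≤ nr z y := by unfold nr; linarith
    have h1 := hFb z hz y hy
    have h2 : 15 / (16 * nr z y ^ 2) ≤ 4 / y ^ 2 := by
      rw [div_le_div_iff₀ (by have := nr_pos hz0 hy0; positivity) (by positivity)]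
      nlinarith
    rw [abs_mul, abs_mul, abs_of_pos (by have := nr_pos hz0 hy0; positivity :
      0 < 15 / (16 * nr z y ^ 2)), ← wgrow_div_sq hy0]
    calc _ ≤ (B * (T * wgrow y)) * (4 / y ^ 2 * (√T / √a)) := by
          refine mul_le_mul h1 (mul_le_mul h2 (hpsi z hz y hy) (abs_nonneg _) (by positivity))
            (by have := nr_pos hz0 hy0; positivity) ((abs_nonneg _).trans h1)
      _ = _ := by ring
  have hsub : Ioo a b ×ˢ Ioi a ⊆ (Ioi 0 ×ˢ Ioi 0 : Set (ℝ × ℝ)) := fun p hp =>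
    ⟨ha.trans hp.1.1, ha.trans hp.2⟩
  obtain ⟨cpsi, cpsie⟩ := psi_psie_cont
  have cF : ContinuousOn (unc F) (Ioi 0 ×ˢ Ioi 0) := h.Fc
  have cnr : ContinuousOn (fun p : ℝ × ℝ => 15 / (16 * nr p.1 p.2 ^ 2)) (Ioi 0 ×ˢ Ioi 0) := by
    unfold nr
    refine ContinuousOn.div (by fun_prop) (by fun_prop) ?_
    rintro ⟨p, q⟩ ⟨hp, hq⟩
    have := nr_pos hp hq
    unfold nr at this; positivity
  have cf1 : ContinuousOn (fun p : ℝ × ℝ => nd κ s G F p.1 p.2 * psie p.1 p.2) (Ioi 0 ×ˢ Ioi 0) :=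
    h.nd_cont.mul cpsie
  have cf2 : ContinuousOn (fun p : ℝ × ℝ => F p.1 p.2 * (15 / (16 * nr p.1 p.2 ^ 2) * psi p.1 p.2))
    (Ioi 0 ×ˢ Ioi 0) := cF.mul (cnr.mul cpsi)
  have lc : ∀ {f : ℝ → ℝ → ℝ}, ContinuousOn (unc f) (Ioi 0 ×ˢ Ioi 0) →
      ContinuousOn (fun y => f x y) (Ioi x) := fun hf =>
    hf.comp (f := fun y => (x, y)) (by fun_prop) (fun y hy => ⟨hx, hx.trans hy⟩)
  have i1 : IntegrableOn (fun y => nd κ s G F x y * psie x y) (Ioi x) :=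
    integrableOn_of_le_wtail hx (lc (f := fun x y => nd κ s G F x y * psie x y) cf1) fun y hy => hnd x hxab y (hxab.1.trans hy)
  have i2 : IntegrableOn (fun y => F x y * (15 / (16 * nr x y ^ 2) * psi x y)) (Ioi x) :=
    integrableOn_of_le_wtail hx (lc (f := fun x y => F x y * (15 / (16 * nr x y ^ 2) * psi x y)) cf2) fun y hy => hp x hxab y (hxab.1.trans hy)
  have i3 : IntegrableOn (fun y => (κ (nr x y) * F x y + s (nr x y)) * psi x y) (Ioi x) := by
    refine integrableOn_of_le_wtail (C := (K * B + s0) * 4 * (√T / √a)) hx ?_ fun y hy => ?_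
    · have cn : ContinuousOn (unc nr) (Ioi 0 ×ˢ Ioi 0) := by
        unfold nr; fun_prop
      have mn : MapsTo (unc nr) (Ioi 0 ×ˢ Ioi 0) (Ioi 0) :=
        fun p hp => nr_pos hp.1 hp.2
      exact lc (f := fun x y => (κ (nr x y) * F x y + s (nr x y)) * psi x y)
        ((((h.κc.comp cn mn).mul cF).add (h.sc.comp cn mn)).mul cpsi)
    · have hy' : a < y := hxab.1.trans hy
      have hy0 : 0 < y := ha.trans hy'
      have h1 := h.toPreSys.integrand_bound (ξ := x) (ρ := nr x y) hx (by unfold nr; linarith)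
      rw [show 2 * nr x y - x = y by unfold nr; ring] at h1
      have h2 : wtail (nr x y) ≤ 4 * wtail y := by
        have hx' : x < y := hy
        refine (wtail_anti (by linarith) (show y / 2 ≤ nr x y by unfold nr; linarith)).trans ?_
        rw [← wgrow_div_sq hy0, ← wgrow_div_sq (by linarith)]
        have := wgrow_mono (show 0 < y / 2 by linarith) (show y / 2 ≤ y by linarith)
        calc _ ≤ wgrow y / (y / 2) ^ 2 := by gcongr
          _ = _ := by field_simp; ring
      rw [abs_mul]
      calc _ ≤ ((K * B + s0) * (4 * wtail y)) * (√T / √a) :=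
            mul_le_mul (h1.trans (mul_le_mul_of_nonneg_left h2 hM)) (hpsi x hxab y hy')
              (abs_nonneg _) (by have := wtail_pos hy0; positivity)
        _ = _ := by ring
  have D1 : HasDerivAt (fun z => ∫ y in Ioi z, F z y * psie z y)
      ((∫ y in Ioi x, (nd κ s G F x y * psie x y + F x y * (15 / (16 * nr x y ^ 2) * psi x y))) -
        F x x * psie x x) x := by
    refine hasDerivAt_tail_param (f := fun z y => F z y * psie z y)
      (f' := fun x y => nd κ s G F x y * psie x y + F x y * (15 / (16 * nr x y ^ 2) * psi x y))
      (M := 6 * B * T * √b + ((g + 1 / 2 * ((K * B + s0) * wint a)) * (6 * √b) *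
        (wgrow a)⁻¹ + B * T * 4 * (√T / √a))) ha
      (by have := wint_pos ha; have := wgrow_pos ha; positivity)
      ((cF.mul cpsie).mono hsub) ((cf1.add cf2).mono hsub) ?_ ?_ ?_ hxab
    · intro z hz y hy
      refine (F_psie_bound h.toPreSys ha hz hy).trans ?_
      have := wint_pos ha; have := wgrow_pos ha
      refine mul_le_mul_of_nonneg_right ?_ (wtail_pos (ha.trans hy)).le
      refine le_add_of_nonneg_right (by positivity)
    · intro z hz y hy
      refine (abs_add_le _ _).trans ((add_le_add (hnd z hz y hy) (hp z hz y hy)).trans ?_)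
      rw [← add_mul]
      refine mul_le_mul_of_nonneg_right ?_ (wtail_pos (ha.trans hy)).le
      refine le_add_of_nonneg_left (by positivity)
    · intro z hz y hy
      have hy0 := ha.trans hy
      have hz0 := ha.trans hz.1
      exact (h.der' hz0 hy0).mul (psie_der_left hz0 hy0)
  have IBP : ∫ y in Ioi x, (1 / 4 * ((κ (nr x y) * F x y + s (nr x y)) * psi x y) +
      nd κ s G F x y * psie x y) = G x * (-(√x)⁻¹ / √2) - nd κ s G F x x * (√x)⁻¹ := by
    have := integral_Ioi_of_hasDerivAt_of_tendsto (a := x)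
      (f := fun y => nd κ s G F x y * psi x y)
      (f' := fun y => 1 / 4 * ((κ (nr x y) * F x y + s (nr x y)) * psi x y) +
        nd κ s G F x y * psie x y) (m := G x * (-(√x)⁻¹ / √2))
      ((h.nd_der_right hx hx).mul (psi_der_right hx hx)).continuousAt.continuousWithinAt
      (fun y hy => ((h.nd_der_right hx (hx.trans hy)).mul
        (psi_der_right hx (hx.trans hy))).congr_deriv (by ring))
      ((i3.const_mul (1/4)).add i1) ((h.tendsto_nd hx).mul (tendsto_psi hx))
    rw [this]; simp only [psi_diag hx]
  rw [integral_add (i3.const_mul (1/4)) i1, integral_const_mul] at IBP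
  rw [integral_add i1 i2] at D1
  have D2 : HasDerivAt (fun z => (√z)⁻¹) (-(1 / (2 * √x)) / √x ^ 2) x :=
    (hasDerivAt_sqrt hx.ne').inv (sqrt_pos.2 hx).ne'
  have D := (D1.const_mul 2).add ((h.diag_der hx).mul D2)
  have E : ∫ y in Ioi x, ((κ (nr x y) - 15 / (4 * nr x y ^ 2)) * F x y + s (nr x y)) * psi x y =
      (∫ y in Ioi x, (κ (nr x y) * F x y + s (nr x y)) * psi x y) -
      4 * ∫ y in Ioi x, F x y * (15 / (16 * nr x y ^ 2) * psi x y) := by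
    rw [← integral_const_mul, ← integral_sub i3 (i2.const_mul 4)]
    refine Ioi_congr fun y hy => ?_
    have := (nr_pos hx (hx.trans hy)).ne'
    field_simp; ring
  refine D.congr_deriv ?_
  rw [E, psie_diag hx]
  have hs := sqrt_pos.2 hx
  have e2 := sq_sqrt (show (0:ℝ) ≤ 2 by norm_num)
  have h2 : (0:ℝ) < √2 := by positivity
  have e3 : (√x)⁻¹ / √2 = √2 * (√x)⁻¹ / 2 := by field_simp; linarith
  rw [neg_div, e3] at IBP
  have e4 : -(1 / (2 * √x)) / √x ^ 2 = - (1/2) * ((√x)⁻¹ / x) := by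
    rw [sq_sqrt hx.le]; field_simp
  rw [e4]
  linear_combination 2 * IBP

end Sys

/-! ### Logarithmic distance to the scales -/

/-- `inf_j ⟨log (r/λ_j)⟩`. -/
def om {J : ℕ} (lam : Fin J → ℝ) (r : ℝ) : ℝ := ⨅ j, √(1 + Real.log (r / lam j) ^ 2)

/-- The one-dimensional potential of the multisoliton. -/
def kap {J : ℕ} (lam : Fin J → ℝ) (r : ℝ) : ℝ := 15 / (4 * r ^ 2) + ∑ j, Vr (lam j) r

theorem om_le {J : ℕ} (lam : Fin J → ℝ) (r : ℝ) (j : Fin J) :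
    om lam r ≤ √(1 + Real.log (r / lam j) ^ 2) :=
  ciInf_le (Set.finite_range _).bddBelow j

theorem exists_om_eq {J : ℕ} (hJ : 0 < J) (lam : Fin J → ℝ) (r : ℝ) :
    ∃ j, om lam r = √(1 + Real.log (r / lam j) ^ 2) := by
  have : Nonempty (Fin J) := ⟨⟨0, hJ⟩⟩
  obtain ⟨j, hj⟩ := exists_eq_ciInf_of_finite (f := fun j => √(1 + Real.log (r / lam j) ^ 2))
  exact ⟨j, hj.symm⟩

theorem one_le_om {J : ℕ} (hJ : 0 < J) (lam : Fin J → ℝ) (r : ℝ) : 1 ≤ om lam r := by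
  obtain ⟨j, hj⟩ := exists_om_eq hJ lam r
  rw [hj, Real.one_le_sqrt]
  nlinarith [sq_nonneg (Real.log (r / lam j))]

theorem sqrt_one_add_sq_add_le (a b : ℝ) : √(1 + (a + b) ^ 2) ≤ √(1 + a ^ 2) + |b| := by
  have h1 : |a| ≤ √(1 + a ^ 2) := abs_le_sqrt (by linarith)
  have h2 := sq_sqrt (show 0 ≤ 1 + a ^ 2 by positivity)
  refine sqrt_le_iff.2 ⟨by positivity, ?_⟩
  have h3 : a * b ≤ |a| * |b| := by rw [← abs_mul]; exact le_abs_self _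
  have h4 := mul_le_mul_of_nonneg_right h1 (abs_nonneg b)
  nlinarith [sq_abs b]

theorem sqrt_one_add_sq_le (a : ℝ) : √(1 + a ^ 2) ≤ 1 + |a| := by
  simpa using sqrt_one_add_sq_add_le 0 a

theorem om_mul_le {J : ℕ} (hJ : 0 < J) {lam : Fin J → ℝ} (hl : ∀ j, 0 < lam j) {σ r : ℝ}
    (hσ : 0 < σ) (hr : 0 < r) : om lam (σ * r) ≤ om lam σ + |Real.log r| := by
  obtain ⟨j, hj⟩ := exists_om_eq hJ lam σ
  rw [hj]
  refine (om_le lam _ j).trans ?_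
  rw [show σ * r / lam j = σ / lam j * r by ring,
    Real.log_mul (div_pos hσ (hl j)).ne' hr.ne']
  exact sqrt_one_add_sq_add_le _ _

theorem om_scale {J : ℕ} (lam : Fin J → ℝ) (σ r : ℝ) :
    om (fun j => lam j / σ) r = om lam (σ * r) := by
  unfold om
  congr 1; ext j
  rw [div_div_eq_mul_div, mul_comm r σ]

theorem kap_scale {J : ℕ} (lam : Fin J → ℝ) {σ r : ℝ} (hσ : 0 < σ) (hr : 0 < r) :
    kap (fun j => lam j / σ) r = σ ^ 2 * kap lam (σ * r) := by
  unfold kap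
  rw [mul_add, Finset.mul_sum]
  congr 1
  · field_simp
  · refine Finset.sum_congr rfl fun j _ => ?_
    unfold Vr
    have : 0 < r ^ 2 + 24 * lam j ^ 2 / σ ^ 2 := by positivity
    have h2 : 0 < (σ * r) ^ 2 + 24 * lam j ^ 2 := by positivity
    field_simp


theorem abs_kap_le {J : ℕ} {lam : Fin J → ℝ} (hl : ∀ j, 0 < lam j) {r : ℝ} (hr : 0 < r) :
    |kap lam r| ≤ (15 / 4 + 12 * J) * r ^ (-2 : ℝ) := by
  have e : r ^ (-2 : ℝ) = 1 / r ^ 2 := by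
    rw [Real.rpow_neg hr.le, show (2 : ℝ) = ((2 : ℕ) : ℝ) by norm_num, Real.rpow_natCast, one_div]
  rw [e]
  unfold kap
  have h1 : |∑ j, Vr (lam j) r| ≤ ∑ _j : Fin J, 12 / r ^ 2 := by
    refine (Finset.abs_sum_le_sum_abs _ _).trans (Finset.sum_le_sum fun j _ => ?_)
    rw [le_div_iff₀ (by positivity), mul_comm]
    exact sq_mul_Vr_le (hl j)
  have h2 : |15 / (4 * r ^ 2)| = 15 / 4 / r ^ 2 := by
    rw [abs_of_pos (by positivity)]; field_simp
  refine (abs_add_le _ _).trans ?_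
  rw [h2]
  refine (add_le_add_right h1 _).trans (le_of_eq ?_)
  rw [Finset.sum_const, Finset.card_univ, Fintype.card_fin, nsmul_eq_mul]
  ring

theorem one_add_abs_log_le {z : ℝ} (hz : 0 < z) :
    1 + |Real.log z| ≤ 4 * (z ^ (1/4 : ℝ) + (z ^ (1/4 : ℝ))⁻¹) := by
  have hq : 0 < z ^ (1/4 : ℝ) := by positivity
  have e : Real.log z = 4 * Real.log (z ^ (1/4 : ℝ)) := by rw [Real.log_rpow hz]; ring
  have h1 := Real.log_le_sub_one_of_pos hq
  have h2 := Real.log_le_sub_one_of_pos (inv_pos.2 hq)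
  rw [Real.log_inv] at h2
  have := inv_pos.2 hq
  rcases abs_cases (Real.log z) with h | h <;> rw [h.1] <;> linarith

theorem sqrt_mul_log_le {r : ℝ} (hr : 0 < r) : √r * (1 + |Real.log r|) ≤ 4 * wgrow r := by
  have h := one_add_abs_log_le hr
  have e1 : √r * r ^ (1/4 : ℝ) = r ^ (3/4 : ℝ) := by
    rw [sqrt_eq_rpow, ← Real.rpow_add hr]; norm_num
  have e2 : √r * (r ^ (1/4 : ℝ))⁻¹ = r ^ (1/4 : ℝ) := by
    rw [sqrt_eq_rpow, ← Real.rpow_neg hr.le, ← Real.rpow_add hr]; norm_num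
  calc _ ≤ √r * (4 * (r ^ (1/4 : ℝ) + (r ^ (1/4 : ℝ))⁻¹)) := by gcongr
    _ = 4 * (√r * (r ^ (1/4 : ℝ))⁻¹ + √r * r ^ (1/4 : ℝ)) := by ring
    _ = _ := by rw [e1, e2]; rfl

/-- Localization weight at scale one. -/
def hw (z : ℝ) : ℝ := z ^ (1/4 : ℝ) / (1 + (z ^ (1/4 : ℝ)) ^ 2)

theorem hw_pos {z : ℝ} (hz : 0 < z) : 0 < hw z := by unfold hw; positivity

theorem hw_mul_le {z T : ℝ} (hz : 0 < z) (hT : 1 ≤ T) : hw (T * z) ≤ T ^ (1/4 : ℝ) * hw z := by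
  unfold hw
  rw [Real.mul_rpow (by linarith) hz.le, mul_div_assoc]
  have h1 : 1 ≤ T ^ (1/4 : ℝ) := Real.one_le_rpow hT (by norm_num)
  have : z ^ (1/4 : ℝ) ≤ T ^ (1/4 : ℝ) * z ^ (1/4 : ℝ) := le_mul_of_one_le_left (by positivity) h1
  gcongr

theorem Vr_log_le {l r : ℝ} (hl : 0 < l) (hr : 0 < r) :
    |Vr l r| * (1 + |Real.log (r / l)|) ≤ 18432 / r ^ 2 * hw (r / l) := by
  have hz : 0 < r / l := div_pos hr hl
  have h := one_add_abs_log_le hz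
  have hq : 0 < (r / l) ^ (1/4 : ℝ) := by positivity
  have e : ((r / l) ^ (1/4 : ℝ)) ^ 4 = r / l := by
    rw [← Real.rpow_natCast, ← Real.rpow_mul hz.le]; norm_num
  have hr' : r = ((r / l) ^ (1/4 : ℝ)) ^ 4 * l := by rw [e]; field_simp
  have hV : |Vr l r| = 1152 * l ^ 2 / (r ^ 2 + 24 * l ^ 2) ^ 2 := abs_Vr l r
  rw [hV]
  unfold hw
  refine (mul_le_mul_of_nonneg_left h (by positivity)).trans ?_
  generalize (r / l) ^ (1/4 : ℝ) = q at *
  subst hr'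
  have e2 : 1152 * l ^ 2 / ((q ^ 4 * l) ^ 2 + 24 * l ^ 2) ^ 2 * (4 * (q + q⁻¹)) =
      4608 * (q ^ 2 + 1) / (l ^ 2 * q * (q ^ 8 + 24) ^ 2) := by
    field_simp; ring
  have e3 : 18432 / (q ^ 4 * l) ^ 2 * (q / (1 + q ^ 2)) = 18432 / (l ^ 2 * q ^ 7 * (1 + q ^ 2)) := by
    field_simp
  rw [e2, e3, div_le_div_iff₀ (by positivity) (by positivity)]
  have h3 : q ^ 3 + q ^ 5 ≤ 2 * (q ^ 8 + 24) := by
    rcases le_total q 1 with h1 | h1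
    · have := pow_le_one₀ (n := 3) hq.le h1
      have := pow_le_one₀ (n := 5) hq.le h1
      have := pow_pos hq 8
      linarith
    · have := pow_le_pow_right₀ h1 (show 3 ≤ 8 by norm_num)
      have := pow_le_pow_right₀ h1 (show 5 ≤ 8 by norm_num)
      linarith
  have h4 : (q ^ 3 + q ^ 5) ^ 2 ≤ (2 * (q ^ 8 + 24)) ^ 2 := by gcongr
  have h5 : 0 < l ^ 2 * q := by positivity
  calc _ = 4608 * (l ^ 2 * q) * (q ^ 3 + q ^ 5) ^ 2 := by ring
    _ ≤ 4608 * (l ^ 2 * q) * (2 * (q ^ 8 + 24)) ^ 2 := by gcongr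
    _ = _ := by ring

theorem hasDerivAt_arctan_scale {l x : ℝ} (hl : 0 < l) (hx : 0 < x) :
    HasDerivAt (fun x => arctan ((x / l) ^ (1/4 : ℝ))) (1 / 4 * (hw (x / l) / x)) x := by
  have hz : 0 < x / l := div_pos hx hl
  have d := (((hasDerivAt_id x).div_const l).rpow_const (p := 1/4) (Or.inl hz.ne')).arctan
  refine d.congr_deriv ?_
  unfold hw
  simp only [id]
  rw [Real.rpow_sub_one hz.ne']
  field_simp

namespace Sys

variable {s G : ℝ → ℝ} {F : ℝ → ℝ → ℝ} {K B s0 N : ℝ} {J : ℕ} {lam : Fin J → ℝ}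

/-- The remainder in the derivative of `bf`. -/
theorem abs_bf_rest_le (hl : ∀ j, 0 < lam j) (h : Sys (kap lam) s G F K B s0) (hN : 0 ≤ N)
    (hF : ∀ ξ η, 0 < ξ → 0 < η → |F ξ η| ≤ N * (√(nr ξ η) * om lam (nr ξ η))) {x : ℝ}
    (hx : 0 < x) :
    |∫ y in Ioi x, ((kap lam (nr x y) - 15 / (4 * nr x y ^ 2)) * F x y + s (nr x y)) * psi x y| ≤
      16 * ((18432 * N * ∑ j, hw (x / lam j)) + s0) / x := by
  have hS : 0 ≤ ∑ j, hw (x / lam j) :=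
    Finset.sum_nonneg fun j _ => (hw_pos (div_pos hx (hl j))).le
  have hρ := h.ρ0
  have hD : 0 ≤ 18432 * N * (∑ j, hw (x / lam j)) + s0 := by positivity
  have key := abs_tail_integral_le (a := -(5/4))
    (C := (18432 * N * (∑ j, hw (x / lam j)) + s0) * (4 * x ^ (-(1/4) : ℝ) * (√x)⁻¹))
    (g := fun y => ((kap lam (nr x y) - 15 / (4 * nr x y ^ 2)) * F x y + s (nr x y)) * psi x y)
    hx (by norm_num) (fun y hy => ?_)
  · refine key.trans (le_of_eq ?_)
    have e : x ^ (-(1/4) : ℝ) * x ^ (-(5/4) + 1 : ℝ) * (√x)⁻¹ = 1 / x := by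
      rw [sqrt_eq_rpow, ← Real.rpow_neg hx.le, ← Real.rpow_add hx, ← Real.rpow_add hx,
        one_div x, ← Real.rpow_neg_one x]
      congr 1; norm_num
    calc _ = 16 * (18432 * N * (∑ j, hw (x / lam j)) + s0) *
          (x ^ (-(1/4) : ℝ) * x ^ (-(5/4) + 1 : ℝ) * (√x)⁻¹) := by ring
      _ = _ := by rw [e]; ring
  · have hy0 : 0 < y := hx.trans hy
    set r := nr x y with hrd
    have hr : 0 < r := nr_pos hx hy0
    have hxr : x ≤ r := by rw [hrd]; unfold nr; linarith
    have hyr : y / 2 ≤ r := by rw [hrd]; unfold nr; linarith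
    have hpsi := abs_psi_le_of_le hx hy.le
    have e0 : r ^ (-(3/2) : ℝ) = √r / r ^ 2 := by
      rw [sqrt_eq_rpow, ← Real.rpow_natCast, ← Real.rpow_sub hr]; norm_num
    have e1 : kap lam r - 15 / (4 * r ^ 2) = ∑ j, Vr (lam j) r := by unfold kap; ring
    have h1 : |(kap lam r - 15 / (4 * r ^ 2)) * F x y| ≤
        N * r ^ (-(3/2) : ℝ) * (18432 * ∑ j, hw (r / lam j)) := by
      rw [e1, Finset.sum_mul, e0, Finset.mul_sum, Finset.mul_sum]
      refine (Finset.abs_sum_le_sum_abs _ _).trans (Finset.sum_le_sum fun j _ => ?_)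
      have h2 := hF x y hx hy0
      have h3 : om lam r ≤ 1 + |Real.log (r / lam j)| :=
        (om_le lam r j).trans (sqrt_one_add_sq_le _)
      have h4 := Vr_log_le (hl j) hr
      rw [abs_mul]
      calc _ ≤ |Vr (lam j) r| * (N * (√r * (1 + |Real.log (r / lam j)|))) := by
            gcongr; exact h2.trans (by gcongr)
        _ = N * √r * (|Vr (lam j) r| * (1 + |Real.log (r / lam j)|)) := by ring
        _ ≤ N * √r * (18432 / r ^ 2 * hw (r / lam j)) := by gcongr
        _ = _ := by ring
    have hT : 1 ≤ r / x := by rwa [le_div_iff₀ hx, one_mul]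
    have h2 : ∑ j, hw (r / lam j) ≤ (r / x) ^ (1/4 : ℝ) * ∑ j, hw (x / lam j) := by
      rw [Finset.mul_sum]
      refine Finset.sum_le_sum fun j _ => ?_
      rw [show r / lam j = r / x * (x / lam j) by field_simp]
      exact hw_mul_le (div_pos hx (hl j)) hT
    have h3 := h.sb r hr
    have h4 : 1 ≤ (r / x) ^ (1/4 : ℝ) := Real.one_le_rpow hT (by norm_num)
    have h5 : |(kap lam r - 15 / (4 * r ^ 2)) * F x y + s r| ≤
        (18432 * N * (∑ j, hw (x / lam j)) + s0) * (r ^ (-(3/2) : ℝ) * (r / x) ^ (1/4 : ℝ)) := by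
      refine (abs_add_le _ _).trans ?_
      have h6 : N * r ^ (-(3/2) : ℝ) * (18432 * ∑ j, hw (r / lam j)) ≤
          N * r ^ (-(3/2) : ℝ) * (18432 * ((r / x) ^ (1/4 : ℝ) * ∑ j, hw (x / lam j))) := by
        gcongr
      have h7 : s0 * r ^ (-(3/2) : ℝ) * 1 ≤ s0 * r ^ (-(3/2) : ℝ) * (r / x) ^ (1/4 : ℝ) := by
        gcongr
      rw [mul_one] at h7
      exact (add_le_add (h1.trans h6) (h3.trans h7)).trans (le_of_eq (by ring))
    have h6 : r ^ (-(3/2) : ℝ) * (r / x) ^ (1/4 : ℝ) ≤ 4 * x ^ (-(1/4) : ℝ) * y ^ (-(5/4) : ℝ) := by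
      have e2 : r ^ (-(3/2) : ℝ) * (r / x) ^ (1/4 : ℝ) = x ^ (-(1/4) : ℝ) * r ^ (-(5/4) : ℝ) := by
        rw [Real.div_rpow hr.le hx.le, Real.rpow_neg hx.le,
          show (-(5/4) : ℝ) = -(3/2) + 1/4 by norm_num, Real.rpow_add hr]
        ring
      have h7 : r ^ (-(5/4) : ℝ) ≤ (y / 2) ^ (-(5/4) : ℝ) :=
        Real.rpow_le_rpow_of_nonpos (by linarith) hyr (by norm_num)
      have h8 : (y / 2) ^ (-(5/4) : ℝ) = y ^ (-(5/4) : ℝ) * 2 ^ (5/4 : ℝ) := by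
        rw [Real.div_rpow hy0.le (by norm_num), Real.rpow_neg (by norm_num : (0:ℝ) ≤ 2), div_inv_eq_mul]
      have h9 : (2:ℝ) ^ (5/4 : ℝ) ≤ 4 := by
        calc (2:ℝ) ^ (5/4 : ℝ) ≤ 2 ^ (2 : ℝ) :=
              Real.rpow_le_rpow_of_exponent_le (by norm_num) (by norm_num)
          _ = 4 := by norm_num
      rw [e2]
      calc _ ≤ x ^ (-(1/4) : ℝ) * (y ^ (-(5/4) : ℝ) * 4) := by
            rw [h8] at h7; gcongr; exact h7.trans (by gcongr)
        _ = _ := by ring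
    rw [abs_mul]
    calc _ ≤ ((18432 * N * (∑ j, hw (x / lam j)) + s0) *
          (4 * x ^ (-(1/4) : ℝ) * y ^ (-(5/4) : ℝ))) * (√x)⁻¹ := by
          refine mul_le_mul (h5.trans (mul_le_mul_of_nonneg_left h6 hD)) hpsi (abs_nonneg _)
            (by positivity)
      _ = _ := by ring

theorem abs_bf_scale_le (hl : ∀ j, 0 < lam j) (hN : 0 ≤ N)
    (hF : ∀ ξ η, 0 < ξ → 0 < η → |F ξ η| ≤ N * (√(nr ξ η) * om lam (nr ξ η))) (j : Fin J) :
    |bf F (lam j)| ≤ 385 * N := by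
  set x := lam j with hxd
  have hx : 0 < x := hl j
  have key := abs_tail_integral_le (a := -(5/4)) (C := 48 * N * x ^ (1/4 : ℝ))
    (g := fun y => F x y * psie x y) hx (by norm_num) (fun y hy => ?_)
  · have h2 := hF x x hx hx
    have h3 : om lam x ≤ 1 := by
      refine (om_le lam x j).trans ?_
      rw [← hxd, div_self hx.ne']; simp
    rw [show nr x x = x by unfold nr; ring] at h2
    have h4 : |F x x * (√x)⁻¹| ≤ N := by
      have hs := sqrt_pos.2 hx
      rw [abs_mul, abs_of_pos (inv_pos.2 hs), ← div_eq_mul_inv, div_le_iff₀ hs]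
      refine h2.trans ?_
      have : √x * om lam x ≤ √x * 1 := by gcongr
      nlinarith
    have e : x ^ (1/4 : ℝ) * x ^ (-(5/4) + 1 : ℝ) = 1 := by
      rw [← Real.rpow_add hx]; norm_num
    unfold bf
    refine (abs_add_le _ _).trans ?_
    rw [abs_mul, abs_of_pos (by norm_num : (0:ℝ) < 2)]
    have : 48 * N * x ^ (1/4 : ℝ) * (x ^ (-(5/4) + 1 : ℝ) / (-(-(5/4) + 1))) = 192 * N := by
      calc _ = 192 * N * (x ^ (1/4 : ℝ) * x ^ (-(5/4) + 1 : ℝ)) := by ring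
        _ = _ := by rw [e, mul_one]
    linarith
  · have hy0 : 0 < y := hx.trans hy
    set r := nr x y with hrd
    have hr : 0 < r := nr_pos hx hy0
    have hxr : x ≤ r := by rw [hrd]; unfold nr; linarith
    have hry : r ≤ y := by rw [hrd]; unfold nr; linarith
    have h1 := hF x y hx hy0
    have hz : 1 ≤ r / x := by rwa [le_div_iff₀ hx, one_mul]
    have h2 : om lam r ≤ 8 * (r / x) ^ (1/4 : ℝ) := by
      refine ((om_le lam r j).trans (sqrt_one_add_sq_le _)).trans
        ((one_add_abs_log_le (by positivity)).trans ?_)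
      have := Real.one_le_rpow hz (show (0:ℝ) ≤ 1/4 by norm_num)
      have := inv_le_one_of_one_le₀ this
      rw [← hxd]; linarith
    have h3 := abs_psie_le hx hy0
    have h4 : √r * om lam r ≤ 8 * x ^ (-(1/4) : ℝ) * y ^ (3/4 : ℝ) := by
      calc _ ≤ √r * (8 * (r / x) ^ (1/4 : ℝ)) := by gcongr
        _ = 8 * x ^ (-(1/4) : ℝ) * r ^ (3/4 : ℝ) := by
          rw [Real.div_rpow hr.le hx.le, Real.rpow_neg hx.le, div_eq_mul_inv,
            show (3/4 : ℝ) = 1/2 + 1/4 by norm_num, Real.rpow_add hr, sqrt_eq_rpow]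
          ring
        _ ≤ _ := by gcongr
    have e : x ^ (-(1/4) : ℝ) * y ^ (3/4 : ℝ) * (√x / y ^ 2) =
        x ^ (1/4 : ℝ) * y ^ (-(5/4) : ℝ) := by
      have e1 : x ^ (-(1/4) : ℝ) * √x = x ^ (1/4 : ℝ) := by
        rw [sqrt_eq_rpow, ← Real.rpow_add hx]; norm_num
      have e2 : y ^ (3/4 : ℝ) / y ^ 2 = y ^ (-(5/4) : ℝ) := by
        rw [← Real.rpow_natCast, ← Real.rpow_sub hy0]; norm_num
      rw [← e1, ← e2]; ring
    rw [abs_mul]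
    calc _ ≤ (N * (8 * x ^ (-(1/4) : ℝ) * y ^ (3/4 : ℝ))) * (6 * √x / y ^ 2) := by
          refine mul_le_mul (h1.trans (by gcongr)) h3 (abs_nonneg _) (by positivity)
      _ = 48 * N * (x ^ (-(1/4) : ℝ) * y ^ (3/4 : ℝ) * (√x / y ^ 2)) := by ring
      _ = _ := by rw [e]; ring

theorem abs_integral_inv_sqrt_mul_le {ε x : ℝ} (hG : ContinuousOn G (Ioi 0)) (hε : 0 ≤ ε)
    (hg : ∀ x y, 0 < x → x < y → ∫ z in x..y, G z ^ 2 ≤ ε ^ 2) (hx : 0 < x) :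
    |∫ z in x..1, (√z)⁻¹ * G z| ≤ ε * √|Real.log x| := by
  have main : ∀ a b, 0 < a → a < b → |∫ z in a..b, (√z)⁻¹ * G z| ≤ ε * √(Real.log (b / a)) := by
    intro a b ha hab
    have hsub : uIcc a b ⊆ Ioi 0 := by
      rw [uIcc_of_le hab.le]; exact fun z hz => ha.trans_le hz.1
    have hs : Ioc a b ⊆ Ioi 0 := fun z hz => ha.trans hz.1
    have c1 : ContinuousOn (fun z : ℝ => (√z)⁻¹) (Ioi 0) :=
      ContinuousOn.inv₀ (by fun_prop) fun z hz => (sqrt_pos.2 hz).ne'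
    have ii : ∀ {f : ℝ → ℝ}, ContinuousOn f (Ioi 0) → IntegrableOn f (Ioc a b) := fun hf =>
      ((hf.mono hsub).intervalIntegrable).1
    have cs := sq_integral_mul_le (μ := volume.restrict (Ioc a b)) (f := fun z => (√z)⁻¹) (g := G)
      (ii (c1.pow 2)) (ii (hG.pow 2))
    have e1 : ∫ z in Ioc a b, ((√z)⁻¹) ^ 2 = Real.log (b / a) := by
      rw [← integral_inv_of_pos ha (ha.trans hab), intervalIntegral.integral_of_le hab.le]
      refine setIntegral_congr_fun measurableSet_Ioc fun z hz => ?_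
      simp only [inv_pow, sq_sqrt (ha.trans hz.1).le]
    have hg' := hg a b ha hab
    rw [intervalIntegral.integral_of_le hab.le] at hg' ⊢
    have hlog : 0 ≤ Real.log (b / a) := Real.log_nonneg (by rw [le_div_iff₀ ha]; linarith)
    rw [e1] at cs
    have : (∫ z in Ioc a b, (√z)⁻¹ * G z) ^ 2 ≤ (ε * √(Real.log (b / a))) ^ 2 := by
      rw [mul_pow, sq_sqrt hlog]
      refine cs.trans ?_
      rw [mul_comm]; gcongr
    exact abs_le_of_sq_le_sq this (by positivity)
  rcases lt_trichotomy x 1 with h | h | h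
  · have := main x 1 hx h
    rwa [one_div, Real.log_inv, ← abs_of_nonpos (Real.log_nonpos hx.le h.le)] at this
  · subst h; simp
  · have := main 1 x one_pos h
    rw [intervalIntegral.integral_symm, abs_neg, abs_of_nonneg (Real.log_nonneg h.le)]
    rwa [div_one] at this

theorem abs_bf_one_le (hJ : 0 < J) (hl : ∀ j, 0 < lam j) (h : Sys (kap lam) s G F K B s0)
    (hN : 0 ≤ N)
    (hF : ∀ ξ η, 0 < ξ → 0 < η → |F ξ η| ≤ N * (√(nr ξ η) * om lam (nr ξ η)))
    {ε : ℝ} (hε : 0 ≤ ε) (hg : ∀ x y, 0 < x → x < y → ∫ z in x..y, G z ^ 2 ≤ ε ^ 2) :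
    |bf F 1| ≤ (385 + 1200000 * J) * N + (2 * ε + 8 * s0) * om lam 1 := by
  obtain ⟨j, hj⟩ := exists_om_eq hJ lam 1
  set x₀ := lam j with hx0d
  have hx0 : 0 < x₀ := hl j
  have hρ := h.ρ0
  have hlog : |Real.log x₀| ≤ om lam 1 := by
    rw [hj, one_div, Real.log_inv, neg_sq]
    exact abs_le_sqrt (by linarith)
  have hom1 := one_le_om hJ lam 1
  have c1 : ContinuousOn (fun z : ℝ => (√z)⁻¹ * G z) (Ioi 0) :=
    (ContinuousOn.inv₀ (by fun_prop) fun z hz => (sqrt_pos.2 hz).ne').mul h.Gc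
  set R : ℝ → ℝ := fun x => ∫ y in Ioi x,
    ((kap lam (nr x y) - 15 / (4 * nr x y ^ 2)) * F x y + s (nr x y)) * psi x y with hR
  set D : ℝ → ℝ := fun x => bf F x - √2 * ∫ z in x..1, (√z)⁻¹ * G z with hD
  set P : ℝ → ℝ := fun x => 8 * (18432 * N * ∑ k, 4 * arctan ((x / lam k) ^ (1/4 : ℝ)) +
    s0 * Real.log x) with hP
  have dD : ∀ x, 0 < x → HasDerivAt D (-(1 / 2) * R x) x := fun x hx => by
    have hsub : uIcc x 1 ⊆ Ioi 0 := by
      intro z hz; exact lt_of_lt_of_le (lt_min hx one_pos) hz.1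
    have d2 := intervalIntegral.integral_hasDerivAt_left (a := x) (b := 1)
      ((c1.mono hsub).intervalIntegrable)
      (c1.stronglyMeasurableAtFilter isOpen_Ioi x hx) (c1.continuousAt (Ioi_mem_nhds hx))
    refine ((h.bf_der hx).sub (d2.const_mul √2)).congr_deriv ?_
    simp only [hR]; ring
  have dP : ∀ x, 0 < x → HasDerivAt P
      (8 * ((18432 * N * ∑ k, hw (x / lam k)) + s0) / x) x := fun x hx => by
    have d1 : HasDerivAt (fun x => ∑ k, 4 * arctan ((x / lam k) ^ (1/4 : ℝ)))
        (∑ k, 4 * (1 / 4 * (hw (x / lam k) / x))) x := by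
      exact HasDerivAt.fun_sum fun k _ => (hasDerivAt_arctan_scale (hl k) hx).const_mul 4
    refine (((d1.const_mul (18432 * N)).add ((Real.hasDerivAt_log hx.ne').const_mul s0)).const_mul
      8).congr_deriv ?_
    have : ∑ k, 4 * (1 / 4 * (hw (x / lam k) / x)) = (∑ k, hw (x / lam k)) / x := by
      rw [Finset.sum_div]; exact Finset.sum_congr rfl fun k _ => by ring
    rw [this]; ring
  have hRb : ∀ x, 0 < x → |-(1 / 2) * R x| ≤ 8 * ((18432 * N * ∑ k, hw (x / lam k)) + s0) / x :=
    fun x hx => by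
    have := abs_bf_rest_le hl h hN hF hx
    rw [abs_mul, abs_neg, abs_of_pos (by norm_num : (0:ℝ) < 1 / 2)]
    calc _ ≤ 1 / 2 * (16 * ((18432 * N * ∑ k, hw (x / lam k)) + s0) / x) := by gcongr
      _ = _ := by ring
  have m1 : MonotoneOn (fun x => P x - D x) (Ioi 0) :=
    monotoneOn_of_hasDerivWithinAt_nonneg (convex_Ioi 0)
      (fun x hx => ((dP x hx).sub (dD x hx)).continuousAt.continuousWithinAt)
      (fun x hx => by
        rw [interior_Ioi] at hx
        exact ((dP x hx).sub (dD x hx)).hasDerivWithinAt)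
      (fun x hx => by
        rw [interior_Ioi] at hx
        linarith [(abs_le.1 (hRb x hx)).2])
  have m2 : MonotoneOn (fun x => P x + D x) (Ioi 0) :=
    monotoneOn_of_hasDerivWithinAt_nonneg (convex_Ioi 0)
      (fun x hx => ((dP x hx).add (dD x hx)).continuousAt.continuousWithinAt)
      (fun x hx => by
        rw [interior_Ioi] at hx
        exact ((dP x hx).add (dD x hx)).hasDerivWithinAt)
      (fun x hx => by
        rw [interior_Ioi] at hx
        linarith [(abs_le.1 (hRb x hx)).1])
  have hDP : |D 1 - D x₀| ≤ |P 1 - P x₀| := by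
    have o : (1:ℝ) ∈ Ioi (0:ℝ) := mem_Ioi.2 one_pos
    have o' : x₀ ∈ Ioi (0:ℝ) := hx0
    rcases le_total x₀ 1 with hc | hc
    · have a1 := m1 o' o hc
      have a2 := m2 o' o hc
      simp only at a1 a2
      exact (abs_le.2 ⟨by linarith, by linarith⟩).trans (le_abs_self _)
    · have a1 := m1 o o' hc
      have a2 := m2 o o' hc
      simp only at a1 a2
      exact (abs_le.2 ⟨by linarith, by linarith⟩).trans (neg_le_abs _)
  have hPb : |P 1 - P x₀| ≤ 8 * (18432 * N * (J * 8) + s0 * |Real.log x₀|) := by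
    have e : P 1 - P x₀ = 8 * (18432 * N * (∑ k, 4 * (arctan ((1 / lam k) ^ (1/4 : ℝ)) -
        arctan ((x₀ / lam k) ^ (1/4 : ℝ)))) - s0 * Real.log x₀) := by
      simp only [hP, mul_sub, Finset.sum_sub_distrib, Real.log_one]; ring
    have e2 : |∑ k, 4 * (arctan ((1 / lam k) ^ (1/4 : ℝ)) -
        arctan ((x₀ / lam k) ^ (1/4 : ℝ)))| ≤ J * 8 := by
      refine (Finset.abs_sum_le_sum_abs _ _).trans ((Finset.sum_le_card_nsmul _ _ 8
        fun k _ => ?_).trans (by simp))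
      have b1 := Real.arctan_lt_pi_div_two ((1 / lam k) ^ (1/4 : ℝ))
      have b2 := Real.arctan_lt_pi_div_two ((x₀ / lam k) ^ (1/4 : ℝ))
      have b3 := Real.arctan_nonneg.2 (show 0 ≤ (1 / lam k) ^ (1/4 : ℝ) by
        have := hl k; positivity)
      have b4 := Real.arctan_nonneg.2 (show 0 ≤ (x₀ / lam k) ^ (1/4 : ℝ) by
        have := hl k; positivity)
      have := Real.pi_lt_four
      rw [abs_le]; constructor <;> linarith
    rw [e, abs_mul, abs_of_pos (by norm_num : (0:ℝ) < 8)]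
    refine mul_le_mul_of_nonneg_left ((_root_.abs_sub _ _).trans ?_) (by norm_num)
    rw [abs_mul, abs_mul s0, abs_of_nonneg hρ, abs_of_nonneg (by positivity : 0 ≤ 18432 * N)]
    gcongr
  have hI := abs_integral_inv_sqrt_mul_le h.Gc hε hg hx0
  have hb0 := abs_bf_scale_le hl hN hF j
  have e : bf F 1 = (D 1 - D x₀) + bf F x₀ - √2 * ∫ z in x₀..1, (√z)⁻¹ * G z := by
    simp only [hD, intervalIntegral.integral_same]; ring
  have hsq : √|Real.log x₀| ≤ om lam 1 := by
    refine sqrt_le_iff.2 ⟨by linarith, hlog.trans ?_⟩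
    nlinarith
  have h2 : √2 ≤ 2 := by
    rw [sqrt_le_iff]; norm_num
  have h3 : |√2 * ∫ z in x₀..1, (√z)⁻¹ * G z| ≤ 2 * ε * om lam 1 := by
    rw [abs_mul, abs_of_nonneg (sqrt_nonneg 2), mul_assoc]
    refine mul_le_mul h2 (hI.trans (by gcongr)) (abs_nonneg _) (by norm_num)
  have h4 : s0 * |Real.log x₀| ≤ s0 * om lam 1 := by gcongr
  have hJN : 0 ≤ (J : ℝ) * N := by positivity
  rw [e]
  calc _ ≤ |D 1 - D x₀| + |bf F x₀| + |√2 * ∫ z in x₀..1, (√z)⁻¹ * G z| :=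
        (_root_.abs_sub _ _).trans (add_le_add_left (abs_add_le _ _) _)
    _ ≤ 8 * (18432 * N * (J * 8) + s0 * om lam 1) + 385 * N + 2 * ε * om lam 1 := by
        refine add_le_add (add_le_add (hDP.trans (hPb.trans (by gcongr))) hb0) h3
    _ ≤ _ := by nlinarith

end Sys

/-! ### The value of the functional on the free mode -/

/-- An antiderivative for the free mode. -/
def modeA (s : ℝ) : ℝ :=
  (-15 * s ^ 6 + 35 * s ^ 4 - 13 * s ^ 2 + 1) / (2 * s * (1 + s ^ 2) ^ 3) + 1 / (2 * s) +
    4 * arctan s - 4 * (s ^ 3 - s) / (1 + s ^ 2) ^ 2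

theorem modeA_der {s : ℝ} (hs : 0 < s) : HasDerivAt modeA
    ((6 * s ^ 2 - 1 - s ^ 4) * (1 + 10 * s ^ 2 - 15 * s ^ 4) / (s ^ 2 * (1 + s ^ 2) ^ 4)) s := by
  have hp : ∀ n : ℕ, HasDerivAt (fun s : ℝ => s ^ n) (n * s ^ (n - 1)) s := fun n => hasDerivAt_pow n s
  have dq : HasDerivAt (fun s : ℝ => 1 + s ^ 2) (2 * s) s :=
    ((hp 2).const_add 1).congr_deriv (by norm_num)
  have d1 : HasDerivAt (fun s : ℝ => -15 * s ^ 6 + 35 * s ^ 4 - 13 * s ^ 2 + 1)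
      (-90 * s ^ 5 + 140 * s ^ 3 - 26 * s) s :=
    (((((hp 6).const_mul (-15)).add ((hp 4).const_mul 35)).sub ((hp 2).const_mul 13)).add_const
      1).congr_deriv (by norm_num; ring)
  have d2 : HasDerivAt (fun s : ℝ => 2 * s * (1 + s ^ 2) ^ 3)
      (2 * (1 + s ^ 2) ^ 3 + 2 * s * (3 * (1 + s ^ 2) ^ 2 * (2 * s))) s :=
    (((hasDerivAt_id s).const_mul 2).mul (dq.pow 3)).congr_deriv (by simp)
  have d3 : HasDerivAt (fun s : ℝ => 1 / (2 * s)) (-2 / (2 * s) ^ 2) s :=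
    (((hasDerivAt_const s (1:ℝ)).div ((hasDerivAt_id s).const_mul 2) (by simp [hs.ne']))).congr_deriv
      (by simp)
  have d4 := (Real.hasDerivAt_arctan s).const_mul 4
  have d5 : HasDerivAt (fun s : ℝ => 4 * (s ^ 3 - s)) (4 * (3 * s ^ 2 - 1)) s :=
    (((hp 3).sub (hasDerivAt_id s)).const_mul 4).congr_deriv (by norm_num)
  have d6 : HasDerivAt (fun s : ℝ => (1 + s ^ 2) ^ 2) (2 * (1 + s ^ 2) * (2 * s)) s :=
    (dq.pow 2).congr_deriv (by simp)
  have hq : 0 < 1 + s ^ 2 := by positivity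
  refine ((((d1.div d2 (by positivity)).add d3).add d4).sub (d5.div d6 (by positivity))).congr_deriv ?_
  field_simp
  ring

theorem tendsto_modeA : Tendsto modeA atTop (𝓝 (2 * π)) := by
  have h1 : ∀ s : ℝ, 1 ≤ s → |modeA s - 4 * arctan s| ≤ 73 / s := by
    intro s hs
    have hs0 : 0 < s := by linarith
    have e : modeA s - 4 * arctan s =
        (-15 * s ^ 6 + 35 * s ^ 4 - 13 * s ^ 2 + 1) / (2 * s * (1 + s ^ 2) ^ 3) + 1 / (2 * s) -
          4 * (s ^ 3 - s) / (1 + s ^ 2) ^ 2 := by unfold modeA; ring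
    have hq : 0 < 1 + s ^ 2 := by positivity
    have e2 : 2 * s * (1 + s ^ 2) ^ 3 * (modeA s - 4 * arctan s) =
        (-15 * s ^ 6 + 35 * s ^ 4 - 13 * s ^ 2 + 1) + (1 + s ^ 2) ^ 3 -
          8 * s * (s ^ 3 - s) * (1 + s ^ 2) := by
      rw [e]; field_simp; ring
    have e3 : modeA s - 4 * arctan s = ((-15 * s ^ 6 + 35 * s ^ 4 - 13 * s ^ 2 + 1) +
        (1 + s ^ 2) ^ 3 - 8 * s * (s ^ 3 - s) * (1 + s ^ 2)) / (2 * s * (1 + s ^ 2) ^ 3) := by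
      rw [_root_.eq_div_iff (by positivity), ← e2]; ring
    rw [e3, abs_div, abs_of_pos (by positivity : 0 < 2 * s * (1 + s ^ 2) ^ 3),
      div_le_div_iff₀ (by positivity) hs0]
    have : |(-15 * s ^ 6 + 35 * s ^ 4 - 13 * s ^ 2 + 1) +
        (1 + s ^ 2) ^ 3 - 8 * s * (s ^ 3 - s) * (1 + s ^ 2)| ≤ 73 * (2 * (1 + s ^ 2) ^ 3) := by
      rw [abs_le]
      have h2 : 0 ≤ s ^ 2 := by positivity
      have h4 : 0 ≤ s ^ 4 := by positivity
      have h6 : 0 ≤ s ^ 6 := by positivity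
      constructor <;> ring_nf <;> nlinarith
    calc _ ≤ 73 * (2 * (1 + s ^ 2) ^ 3) * s := by gcongr
      _ = _ := by ring
  have h2 : Tendsto (fun s => modeA s - 4 * arctan s) atTop (𝓝 0) := by
    refine squeeze_zero_norm' ?_ ((tendsto_const_nhds (x := (73:ℝ))).div_atTop tendsto_id)
    filter_upwards [eventually_ge_atTop 1] with s hs using h1 s hs
  have h3 : Tendsto (fun s => 4 * arctan s) atTop (𝓝 (4 * (π / 2))) :=
    ((tendsto_arctan_atTop).mono_right nhdsWithin_le_nhds).const_mul 4
  have := h2.add h3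
  simp only [sub_add_cancel] at this
  rwa [show 0 + 4 * (π / 2) = 2 * π by ring] at this

theorem modeA_one : modeA 1 = 1 + π := by
  unfold modeA; rw [Real.arctan_one]; norm_num; ring

namespace Sys

variable {κ s G : ℝ → ℝ} {F : ℝ → ℝ → ℝ} {K B s0 : ℝ}

theorem integrableOn_psie (h : PreSys κ s F K B s0) :
    IntegrableOn (fun y => F 1 y * psie 1 y) (Ioi 1) := by
  refine integrableOn_of_le_wtail (C := 6 * B * ((2 / (1/2) + 1) / 2) * √2) one_pos ?_ fun y hy =>
    F_psie_bound h (a := 1/2) (b := 2) (by norm_num) (by constructor <;> norm_num)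
      (by have : (1:ℝ) < y := hy; linarith)
  refine ContinuousOn.mul ?_ ?_
  · exact h.Fc.comp (by fun_prop : ContinuousOn (fun y : ℝ => ((1:ℝ), y)) (Ioi 1)) fun y hy =>
      ⟨mem_Ioi.2 one_pos, one_pos.trans (mem_Ioi.1 hy)⟩
  · have hc : ContinuousOn (fun y => psie 1 y) (Ioi 1) := by
      unfold psie nr
      refine ContinuousOn.div (by fun_prop) (by fun_prop) fun y hy => ?_
      have hy' : 0 < y := one_pos.trans (mem_Ioi.1 hy)
      have : 0 < √y := sqrt_pos.2 hy'
      have : 0 < √((1 + y) / 2) := sqrt_pos.2 (by linarith)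
      positivity
    exact hc

/-- The functional `bf` does not vanish on the free mode. -/
theorem bf_mode (h : PreSys κ s F K B s0) {β : ℝ}
    (hF : ∀ r t, |t| < r → F (r - t) (r + t) = β * (r ^ (1/2:ℝ) - 2 * t ^ 2 * r ^ (-(3/2):ℝ))) :
    bf F 1 = β * π := by
  have hFy : ∀ y, 1 ≤ y → F 1 y = β * ((6 * y - 1 - y ^ 2) / (4 * √(nr 1 y) ^ 3)) := by
    intro y hy
    have hr : 0 < nr 1 y := nr_pos one_pos (by linarith)
    have := hF (nr 1 y) ((y - 1) / 2) (by
      unfold nr; rw [abs_of_nonneg (by linarith)]; linarith)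
    rw [show nr 1 y - (y - 1) / 2 = 1 by unfold nr; ring,
      show nr 1 y + (y - 1) / 2 = y by unfold nr; ring] at this
    rw [this]
    congr 1
    have hR := sqrt_pos.2 hr
    have e1 : nr 1 y ^ (1/2 : ℝ) = √(nr 1 y) := (sqrt_eq_rpow _).symm
    have e2 : nr 1 y ^ (-(3/2) : ℝ) = (√(nr 1 y) ^ 3)⁻¹ := by
      rw [Real.rpow_neg hr.le, sqrt_eq_rpow, ← Real.rpow_natCast, ← Real.rpow_mul hr.le]
      norm_num
    rw [e1, e2]
    have e3 : √(nr 1 y) ^ 4 = (nr 1 y) ^ 2 := by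
      rw [show √(nr 1 y) ^ 4 = (√(nr 1 y) ^ 2) ^ 2 by ring, sq_sqrt hr.le]
    rw [_root_.eq_div_iff (by positivity)]
    have : (√(nr 1 y) - 2 * ((y - 1) / 2) ^ 2 * (√(nr 1 y) ^ 3)⁻¹) * (4 * √(nr 1 y) ^ 3) =
        4 * √(nr 1 y) ^ 4 - 8 * ((y - 1) / 2) ^ 2 := by field_simp; ring
    rw [this, e3]; unfold nr; ring
  have hi := (integrableOn_psie h).const_mul 2
  have key := integral_Ioi_of_hasDerivAt_of_tendsto (a := 1) (f := fun y => β * modeA √y)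
    (f' := fun y => 2 * (F 1 y * psie 1 y)) (m := β * (2 * π)) ?_ (fun y hy => ?_) hi ?_
  · rw [integral_const_mul] at key
    have h1 := hFy 1 le_rfl
    unfold bf
    rw [key, h1]
    simp only [sqrt_one, modeA_one, nr]
    norm_num; ring
  · have h1 : ContinuousAt (fun y : ℝ => β * modeA √y) 1 := by
      have : ContinuousAt modeA √1 := (modeA_der (by simp)).continuousAt
      exact (ContinuousAt.comp (f := fun y : ℝ => √y) this
        Real.continuous_sqrt.continuousAt).const_mul β
    exact h1.continuousWithinAt
  · have hy1 : (1:ℝ) < y := hy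
    have hy0 : 0 < y := by linarith
    have hs := sqrt_pos.2 hy0
    have hr := nr_pos one_pos hy0
    have hR := sqrt_pos.2 hr
    have d := ((modeA_der hs).comp y (hasDerivAt_sqrt hy0.ne')).const_mul β
    refine d.congr_deriv ?_
    rw [hFy y hy1.le]
    unfold psie
    rw [sqrt_one]
    have e1 := sq_sqrt hy0.le
    have e3 : √(nr 1 y) ^ 2 = (1 + √y ^ 2) / 2 := by rw [sq_sqrt hr.le, e1]; rfl
    generalize √(nr 1 y) = R at *
    generalize √y = Y at *
    rw [← e1]
    have e4 : R ^ 8 = (1 + Y ^ 2) ^ 4 / 16 := by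
      rw [show R ^ 8 = (R ^ 2) ^ 4 by ring, e3]; ring
    have e5 : 2 * (β * ((6 * Y ^ 2 - 1 - (Y ^ 2) ^ 2) / (4 * R ^ 3)) *
        (1 * (1 ^ 2 + 10 * 1 * Y ^ 2 - 15 * (Y ^ 2) ^ 2) / (16 * (Y ^ 3 * R ^ 5)))) =
        β * ((6 * Y ^ 2 - 1 - Y ^ 4) * (1 + 10 * Y ^ 2 - 15 * Y ^ 4)) / (32 * Y ^ 3 * R ^ 8) := by
      field_simp; ring
    rw [e5, e4]
    have hq : 0 < 1 + Y ^ 2 := by positivity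
    field_simp
    ring
  · exact ((tendsto_modeA.comp Real.tendsto_sqrt_atTop).const_mul β)

/-- Pointwise limits pass through `bf`. -/
theorem tendsto_bf {κ s : ℕ → ℝ → ℝ} {F : ℕ → ℝ → ℝ → ℝ} {F' : ℝ → ℝ → ℝ}
    (h : ∀ n, PreSys (κ n) (s n) (F n) K B s0)
    (hF : ∀ ξ η, 0 < ξ → 0 < η → Tendsto (fun n => F n ξ η) atTop (𝓝 (F' ξ η))) :
    Tendsto (fun n => bf (F n) 1) atTop (𝓝 (bf F' 1)) := by
  unfold bf
  refine Tendsto.add (Tendsto.const_mul 2 ?_) ((hF 1 1 one_pos one_pos).mul_const _)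
  refine tendsto_integral_of_dominated_convergence
    (fun y => 6 * B * ((2 / (1/2) + 1) / 2) * √2 * wtail y) (fun n => (integrableOn_psie (h n)).1)
    ((wtail_integrableOn one_pos).const_mul _) (fun n => ?_) ?_
  · refine ae_Ioi fun y hy => ?_
    exact F_psie_bound (h n) (a := 1/2) (b := 2) (by norm_num) (by constructor <;> norm_num)
      (by have : (1:ℝ) < y := hy; linarith)
  · refine ae_Ioi fun y hy => ?_
    exact (hF 1 y one_pos (one_pos.trans (mem_Ioi.1 hy))).mul_const _

end Sys

/-! ### Scaling -/

theorem Sys.scale {κ κ' s G : ℝ → ℝ} {F : ℝ → ℝ → ℝ} {K B B' s0 σ M : ℝ}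
    (h : Sys κ s G F K B s0) (hσ : 0 < σ) (hM : 0 < M)
    (hκ : ∀ r, 0 < r → κ' r = σ ^ 2 * κ (σ * r)) (hB : 0 ≤ B')
    (hFb : ∀ ξ η, 0 < ξ → 0 < η →
      |F (σ * ξ) (σ * η) / (√σ * M)| ≤ B' * wgrow ((ξ + η) / 2)) :
    Sys κ' (fun r => σ * √σ / M * s (σ * r)) (fun x => √σ / M * G (σ * x))
      (fun ξ η => F (σ * ξ) (σ * η) / (√σ * M)) K B' (s0 / M) := by
  have hs := sqrt_pos.2 hσ
  have hss := Real.mul_self_sqrt hσ.le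
  have hm : MapsTo (fun r : ℝ => σ * r) (Ioi 0) (Ioi 0) := fun r hr => mul_pos hσ hr
  have hc : ContinuousOn (fun r : ℝ => σ * r) (Ioi 0) := by fun_prop
  constructor
  · constructor
    · exact h.K0
    · exact hB
    · exact div_nonneg h.ρ0 hM.le
    · exact ((h.κc.comp hc hm).const_mul (σ ^ 2)).congr fun r hr => hκ r hr
    · exact (h.sc.comp hc hm).const_mul _
    · intro r hr
      rw [hκ r hr, abs_mul, abs_of_pos (by positivity : 0 < σ ^ 2)]
      have := h.κb (σ * r) (mul_pos hσ hr)
      rw [Real.mul_rpow hσ.le hr.le] at this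
      have e : σ ^ 2 * σ ^ (-2 : ℝ) = 1 := by
        rw [← Real.rpow_natCast, ← Real.rpow_add hσ]; norm_num
      calc _ ≤ σ ^ 2 * (K * (σ ^ (-2 : ℝ) * r ^ (-2 : ℝ))) := by gcongr
        _ = K * r ^ (-2 : ℝ) * (σ ^ 2 * σ ^ (-2 : ℝ)) := by ring
        _ = _ := by rw [e, mul_one]
    · intro r hr
      rw [abs_mul, abs_of_pos (by positivity : 0 < σ * √σ / M)]
      have := h.sb (σ * r) (mul_pos hσ hr)
      rw [Real.mul_rpow hσ.le hr.le] at this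
      have e : σ * √σ * σ ^ (-(3/2) : ℝ) = 1 := by
        have : σ * √σ = σ ^ (3/2 : ℝ) := by
          rw [sqrt_eq_rpow, show (3/2 : ℝ) = 1 + 1/2 by norm_num, Real.rpow_add hσ,
            Real.rpow_one]
        rw [this, ← Real.rpow_add hσ]; norm_num
      calc _ ≤ σ * √σ / M * (s0 * (σ ^ (-(3/2) : ℝ) * r ^ (-(3/2) : ℝ))) := by gcongr
        _ = s0 / M * r ^ (-(3/2) : ℝ) * (σ * √σ * σ ^ (-(3/2) : ℝ)) := by ring
        _ = _ := by rw [e, mul_one]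
    · refine ContinuousOn.div_const (h.Fc.comp
        (f := fun p : ℝ × ℝ => (σ * p.1, σ * p.2)) (by fun_prop) ?_) _
      exact fun p hp => ⟨mul_pos hσ hp.1, mul_pos hσ hp.2⟩
    · intro ξ η hξ hη
      simp only [h.sym _ _ (mul_pos hσ hξ) (mul_pos hσ hη)]
    · exact hFb
  · exact (h.Gc.comp hc hm).const_mul _
  · intro ξ η hξ hη
    have d := h.der (σ * ξ) (σ * η) (mul_pos hσ hξ) (mul_pos hσ hη)
    have d1 : HasDerivAt (fun x : ℝ => σ * x) σ ξ := by
      simpa using (hasDerivAt_id ξ).const_mul σ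
    have d' := (HasDerivAt.comp (h := fun x : ℝ => σ * x) ξ d d1).div_const (√σ * M)
    refine d'.congr_deriv ?_
    have e := integral_comp_mul_left_Ioi
      (fun ρ => κ ρ * F (σ * ξ) (2 * ρ - σ * ξ) + s ρ) ((ξ + η) / 2) hσ
    rw [show σ * ((ξ + η) / 2) = (σ * ξ + σ * η) / 2 by ring, smul_eq_mul] at e
    have e2 : ∫ ρ in Ioi ((ξ + η) / 2), (κ' ρ * (F (σ * ξ) (σ * (2 * ρ - ξ)) / (√σ * M)) +
        σ * √σ / M * s (σ * ρ)) = (σ * √σ / M) * ∫ ρ in Ioi ((ξ + η) / 2),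
        (κ (σ * ρ) * F (σ * ξ) (2 * (σ * ρ) - σ * ξ) + s (σ * ρ)) := by
      rw [← integral_const_mul]
      refine Ioi_congr fun ρ hρ => ?_
      have hρ' : 0 < ρ := by have : (ξ + η) / 2 < ρ := hρ; linarith
      simp only [hκ ρ hρ']
      rw [show σ * (2 * ρ - ξ) = 2 * (σ * ρ) - σ * ξ by ring]
      field_simp
      rw [show √σ ^ 2 = σ by rw [sq, hss]]
      ring
    rw [e2, e]
    field_simp
    rw [show √σ ^ 2 = σ by rw [sq, hss]]
    ring

theorem gam_bound {J : ℕ} (lam : Fin J → ℝ) {i j : Fin J} (hl : ∀ j, 0 < lam j)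
    (ha : StrictAnti lam) (hij : i < j) : lam j ≤ gam lam * lam i := by
  have hi : (i : ℕ) + 1 < J := lt_of_le_of_lt (Nat.succ_le_of_lt hij) j.2
  have h1 : lam j ≤ lam ⟨(i : ℕ) + 1, hi⟩ := ha.antitone (by
    rw [Fin.le_def]; exact Nat.succ_le_of_lt hij)
  have hfin : {g | ∃ (j : Fin J) (h : (j : ℕ) + 1 < J), g = lam ⟨(j : ℕ) + 1, h⟩ / lam j}.Finite := by
    refine (Set.finite_range (fun j : Fin J =>
      if h : (j : ℕ) + 1 < J then lam ⟨(j : ℕ) + 1, h⟩ / lam j else 0)).subset ?_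
    rintro g ⟨j, h, rfl⟩
    exact ⟨j, by simp [h]⟩
  have h2 : lam ⟨(i : ℕ) + 1, hi⟩ / lam i ≤ gam lam := le_csSup hfin.bddAbove ⟨i, hi, rfl⟩
  rw [div_le_iff₀ (hl i)] at h2
  exact h1.trans h2

theorem gam_nonneg {J : ℕ} (lam : Fin J → ℝ) (hl : ∀ j, 0 < lam j) : 0 ≤ gam lam := by
  refine Real.sSup_nonneg fun g hg => ?_
  obtain ⟨j, h, rfl⟩ := hg
  exact (div_pos (hl _) (hl _)).le

theorem abs_Vr_le_exp {l r : ℝ} (hl : 0 < l) (hr : 0 < r) :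
    |Vr l r| ≤ (1152 / r ^ 4 + 2) * exp (-|Real.log l|) ^ 2 := by
  rw [abs_Vr]
  have hE := exp_pos (-|Real.log l|)
  rcases le_total l 1 with h | h
  · rw [abs_of_nonpos (Real.log_nonpos hl.le h), neg_neg, Real.exp_log hl]
    calc _ ≤ 1152 * l ^ 2 / r ^ 4 := by
          refine div_le_div_of_nonneg_left (by positivity) (by positivity) ?_
          nlinarith [mul_pos (pow_pos hr 2) (pow_pos hl 2), pow_pos hl 4]
      _ = 1152 / r ^ 4 * l ^ 2 := by ring
      _ ≤ _ := by gcongr; linarith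
  · rw [abs_of_nonneg (Real.log_nonneg h), Real.exp_neg, Real.exp_log hl]
    calc _ ≤ 1152 * l ^ 2 / (24 * l ^ 2) ^ 2 := by
          refine div_le_div_of_nonneg_left (by positivity) (by positivity) ?_
          gcongr; nlinarith
      _ = 2 * l⁻¹ ^ 2 := by field_simp; norm_num
      _ ≤ _ := by gcongr; linarith [show 0 < 1152 / r ^ 4 by positivity]

theorem tendsto_Vr_zero {l : ℕ → ℝ} (hl : ∀ n, 0 < l n)
    (h : Tendsto (fun n => |Real.log (l n)|) atTop atTop) {r : ℝ} (hr : 0 < r) :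
    Tendsto (fun n => Vr (l n) r) atTop (𝓝 0) := by
  refine squeeze_zero_norm' (.of_forall fun n => abs_Vr_le_exp (hl n) hr) ?_
  have h1 := ((Real.tendsto_exp_atBot.comp (tendsto_neg_atTop_atBot.comp h)).pow 2).const_mul
    (1152 / r ^ 4 + 2)
  simpa using h1

theorem vphi_scale {l r : ℝ} (hl : 0 < l) (hr : 0 < r) :
    vphi l (l * r) = (l * √l)⁻¹ * vphi 1 r := by
  unfold vphi
  have e1 : Vr l (l * r) = (l ^ 2)⁻¹ * Vr 1 r := by unfold Vr; field_simp
  have e2 : phi l (l * r) = (l ^ 2)⁻¹ * phi 1 r := by unfold phi; field_simp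
  have e3 : (l * r) ^ (5/2 : ℝ) = l ^ 2 * √l * r ^ (5/2 : ℝ) := by
    rw [Real.mul_rpow hl.le hr.le, show (5/2 : ℝ) = (2:ℕ) + 1/2 by norm_num, Real.rpow_add hl,
      Real.rpow_natCast, ← sqrt_eq_rpow]
  have hs := sqrt_pos.2 hl
  have := sq_sqrt hl.le
  rw [e1, e2, e3]
  field_simp
  rw [this]

/-! ### The exterior estimate for the one-dimensional system -/

/-- A system normalized in the weighted sup norm, which is almost attained at `(x,y)`. -/
structure Nrm {J : ℕ} (lam : Fin J → ℝ) (s G : ℝ → ℝ) (F : ℝ → ℝ → ℝ) (K B s0 ε x y : ℝ) : Prop where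
  hl : ∀ j, 0 < lam j
  sys : Sys (kap lam) s G F K B s0
  ε0 : 0 ≤ ε
  Gb : ∀ x y, 0 < x → x < y → ∫ z in x..y, G z ^ 2 ≤ ε ^ 2
  Fb : ∀ ξ η, 0 < ξ → 0 < η → |F ξ η| ≤ √(nr ξ η) * om lam (nr ξ η)
  orth : ∀ i, ∫ r in Ioi (0:ℝ), F r r * vphi (lam i) r = 0
  x0 : 0 < x
  y0 : 0 < y
  big : 3 / 4 * (√(nr x y) * om lam (nr x y)) ≤ |F x y|

namespace Nrm

variable {J : ℕ} {lam : Fin J → ℝ} {s G : ℝ → ℝ} {F : ℝ → ℝ → ℝ} {K B s0 ε x y σ M : ℝ}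

theorem nr_scale (σ ξ η : ℝ) : nr (σ * ξ) (σ * η) = σ * nr ξ η := by unfold nr; ring

theorem dil_bound (h : Nrm lam s G F K B s0 ε x y) (hσ : 0 < σ) (hM : 1 ≤ M) :
    ∀ ξ η, 0 < ξ → 0 < η → |F (σ * ξ) (σ * η) / (√σ * M)| ≤
      1 / M * (√(nr ξ η) * om (fun j => lam j / σ) (nr ξ η)) := by
  intro ξ η hξ hη
  have hs := sqrt_pos.2 hσ
  have hM0 : 0 < M := by linarith
  rw [om_scale, abs_div, abs_of_pos (by positivity : 0 < √σ * M), div_le_iff₀ (by positivity)]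
  refine (h.Fb _ _ (mul_pos hσ hξ) (mul_pos hσ hη)).trans (le_of_eq ?_)
  rw [nr_scale, sqrt_mul hσ.le]
  field_simp

theorem dil (hJ : 0 < J) (h : Nrm lam s G F K B s0 ε x y) (hσ : 0 < σ) (hM : 1 ≤ M)
    (ho : om lam σ ≤ M) :
    Sys (kap (fun j => lam j / σ)) (fun r => σ * √σ / M * s (σ * r))
      (fun x => √σ / M * G (σ * x)) (fun ξ η => F (σ * ξ) (σ * η) / (√σ * M))
      (15 / 4 + 12 * J) 4 (s0 / M) := by
  have hM0 : 0 < M := by linarith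
  refine Sys.scale (h.sys.change_K (K' := 15 / 4 + 12 * J) (by positivity)
    fun r hr => abs_kap_le h.hl hr) hσ hM0 (fun r hr => kap_scale lam hσ hr) (by norm_num)
    fun ξ η hξ hη => ?_
  refine (h.dil_bound hσ hM ξ η hξ hη).trans ?_
  have hr := nr_pos hξ hη
  refine le_trans ?_ (sqrt_mul_log_le hr)
  rw [om_scale]
  have h1 := om_mul_le hJ h.hl hσ hr
  have h2 : om lam (σ * nr ξ η) ≤ M * (1 + |Real.log (nr ξ η)|) := by
    have := abs_nonneg (Real.log (nr ξ η))
    nlinarith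
  calc _ ≤ 1 / M * (√(nr ξ η) * (M * (1 + |Real.log (nr ξ η)|))) := by gcongr
    _ = √(nr ξ η) * (1 + |Real.log (nr ξ η)|) := by field_simp
    _ = _ := rfl

theorem dil_G (h : Nrm lam s G F K B s0 ε x y) (hσ : 0 < σ) (hM : 0 < M) :
    ∀ x y, 0 < x → x < y → ∫ z in x..y, (√σ / M * G (σ * z)) ^ 2 ≤ (ε / M) ^ 2 := by
  intro x y hx hxy
  have e : ∀ z, (√σ / M * G (σ * z)) ^ 2 = σ / M ^ 2 * G (σ * z) ^ 2 := fun z => by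
    rw [mul_pow, div_pow, sq_sqrt hσ.le]
  simp only [e]
  rw [intervalIntegral.integral_const_mul,
    intervalIntegral.integral_comp_mul_left (fun z => G z ^ 2) hσ.ne', smul_eq_mul]
  have := h.Gb (σ * x) (σ * y) (mul_pos hσ hx) (mul_lt_mul_of_pos_left hxy hσ)
  calc _ = 1 / M ^ 2 * ∫ z in (σ * x)..(σ * y), G z ^ 2 := by field_simp
    _ ≤ 1 / M ^ 2 * ε ^ 2 := by gcongr
    _ = _ := by rw [div_pow]; ring

theorem dil_orth (h : Nrm lam s G F K B s0 ε x y) (i : Fin J) :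
    ∫ r in Ioi (0:ℝ), F (lam i * r) (lam i * r) / (√(lam i) * M) * vphi 1 r = 0 := by
  have hl := h.hl i
  have hs := sqrt_pos.2 hl
  have e := integral_comp_mul_left_Ioi (fun r => F r r * vphi (lam i) r) 0 hl
  rw [mul_zero, h.orth i, smul_zero] at e
  have e2 : ∫ r in Ioi (0:ℝ), F (lam i * r) (lam i * r) / (√(lam i) * M) * vphi 1 r =
      (lam i / M) * ∫ r in Ioi (0:ℝ), F (lam i * r) (lam i * r) * vphi (lam i) (lam i * r) := by
    rw [← integral_const_mul]
    refine Ioi_congr fun r hr => ?_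
    simp only [vphi_scale hl hr]
    have := sq_sqrt hl.le
    field_simp
  rw [e2, e, mul_zero]

end Nrm

theorem abs_single_le {κ : ℝ → ℝ} {r v : ℝ} (hr : 0 < r) (hκ : κ r = 15 / (4 * r ^ 2) + v)
    (h0 : v ≤ 0) (h1 : r ^ 2 * |v| ≤ 12) : |κ r| ≤ 33 / 4 * r ^ (-2 : ℝ) := by
  have e : r ^ (-2 : ℝ) = 1 / r ^ 2 := by
    rw [Real.rpow_neg hr.le, show (2 : ℝ) = ((2 : ℕ) : ℝ) by norm_num, Real.rpow_natCast, one_div]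
  rw [abs_of_nonpos h0] at h1
  have h2 : -(12 / r ^ 2) ≤ v := by
    have : -v ≤ 12 / r ^ 2 := by rw [le_div_iff₀ (by positivity)]; linarith
    linarith
  rw [hκ, e, abs_le]
  have e3 : 15 / (4 * r ^ 2) = 15 / 4 * (1 / r ^ 2) := by ring
  have e4 : 12 / r ^ 2 = 12 * (1 / r ^ 2) := by ring
  have : 0 < 1 / r ^ 2 := by positivity
  rw [e3]
  rw [e4] at h2
  constructor <;> linarith

section Sequences

variable {J : ℕ} {lam : ℕ → Fin J → ℝ} {s G : ℕ → ℝ → ℝ} {F : ℕ → ℝ → ℝ → ℝ}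
  {K B s0 ε x y : ℕ → ℝ}

theorem tendsto_source_zero {s : ℕ → ℝ → ℝ} {κ : ℕ → ℝ → ℝ} {G : ℕ → ℝ → ℝ} {F : ℕ → ℝ → ℝ → ℝ}
    {K B s0 : ℕ → ℝ} (h : ∀ n, Sys (κ n) (s n) (G n) (F n) (K n) (B n) (s0 n))
    (hρ : Tendsto s0 atTop (𝓝 0)) {r : ℝ} (hr : 0 < r) :
    Tendsto (fun n => s n r) atTop (𝓝 0) := by
  refine squeeze_zero_norm' (.of_forall fun n => (h n).sb r hr) ?_
  simpa using hρ.mul_const (r ^ (-(3/2) : ℝ))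

theorem not_nrm_near (hJ : 0 < J) (h : ∀ n, Nrm (lam n) (s n) (G n) (F n) (K n) (B n) (s0 n) (ε n) (x n) (y n))
    (ha : ∀ n, StrictAnti (lam n)) (hg : Tendsto (fun n => gam (lam n)) atTop (𝓝 0))
    (hε : Tendsto ε atTop (𝓝 0)) (hρ : Tendsto s0 atTop (𝓝 0)) (hρ1 : ∀ n, s0 n ≤ 1)
    (j : Fin J) (L : ℝ) (hL : ∀ n, |Real.log (nr (x n) (y n) / lam n j)| ≤ L) : False := by
  have hl := fun n i => (h n).hl i
  have hr : ∀ n, 0 < nr (x n) (y n) := fun n => nr_pos (h n).x0 (h n).y0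
  have ho : ∀ n, om (lam n) (lam n j) ≤ 1 := fun n => by
    refine (om_le _ _ j).trans ?_
    rw [div_self (hl n j).ne']; simp
  have S := fun n => (h n).dil hJ (hl n j) le_rfl (ho n)
  have hκ : ∀ r, 0 < r → Tendsto (fun n => kap (fun i => lam n i / lam n j) r) atTop
      (𝓝 (15 / (4 * r ^ 2) + Vr 1 r)) := by
    intro r hr0
    unfold kap
    refine tendsto_const_nhds.add ?_
    rw [show Vr 1 r = ∑ i, if i = j then Vr 1 r else 0 by simp]
    refine tendsto_finsetSum _ fun i _ => ?_
    by_cases hij : i = j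
    · subst hij
      simp only [div_self (hl _ i).ne', if_true]
      exact tendsto_const_nhds
    · rw [if_neg hij]
      refine tendsto_Vr_zero (fun n => div_pos (hl n i) (hl n j)) ?_ hr0
      rw [tendsto_atTop]
      intro A
      have h1 : ∀ᶠ n in atTop, gam (lam n) < exp (-A) := hg.eventually_lt_const (exp_pos _)
      filter_upwards [h1] with n hn
      rcases lt_or_gt_of_ne hij with hlt | hlt
      · have h2 := gam_bound (lam n) (hl n) (ha n) hlt
        have h3 : exp A ≤ lam n i / lam n j := by
          rw [le_div_iff₀ (hl n j)]
          have : exp A * lam n j ≤ exp A * (exp (-A) * lam n i) := by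
            have := hl n i
            gcongr; exact h2.trans (by gcongr)
          rwa [← mul_assoc, ← Real.exp_add, add_neg_cancel, Real.exp_zero, one_mul] at this
        exact ((Real.le_log_iff_exp_le (div_pos (hl n i) (hl n j))).2 h3).trans (le_abs_self _)
      · have h2 := gam_bound (lam n) (hl n) (ha n) hlt
        have h3 : lam n i / lam n j ≤ exp (-A) := by
          rw [div_le_iff₀ (hl n j)]
          have := hl n j
          exact h2.trans (by gcongr)
        have := (Real.log_le_iff_le_exp (div_pos (hl n i) (hl n j))).2 h3
        exact (by linarith : A ≤ -Real.log (lam n i / lam n j)).trans (neg_le_abs _)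
  have hrσ : ∀ n, exp (-L) ≤ nr (x n) (y n) / lam n j ∧ nr (x n) (y n) / lam n j ≤ exp L :=
    fun n => ⟨(Real.le_log_iff_exp_le (div_pos (hr n) (hl n j))).1 (abs_le.1 (hL n)).1,
      (Real.log_le_iff_le_exp (div_pos (hr n) (hl n j))).1 (abs_le.1 (hL n)).2⟩
  have hxy : ∀ n, (x n / lam n j + y n / lam n j) / 2 = nr (x n) (y n) / lam n j := fun n => by
    unfold nr; ring
  obtain ⟨φ, F', hφ, S', hF', hc⟩ := Sys.compact (s' := fun _ => 0) (e := fun n => (ε n / 1) ^ 2)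
    (κ' := fun r => 15 / (4 * r ^ 2) + Vr 1 r)
    (fun n => (S n).mono (B' := 4) (ρ₁ := 1) le_rfl (by rw [div_one]; exact hρ1 n))
    (fun n => (h n).dil_G (hl n j) one_pos) (by simpa using hε.pow 2)
    ⟨inv_sq_cont.add (Vr_cont one_pos).continuousOn, continuousOn_const, hκ,
      fun r hr => tendsto_source_zero S (by simpa using hρ) hr⟩
    (x := fun n => x n / lam n j) (y := fun n => y n / lam n j)
    (fun n => div_pos (h n).x0 (hl n j)) (fun n => div_pos (h n).y0 (hl n j))
    (a := exp (-L)) (b := exp L) (exp_pos _) (fun n => by rw [hxy]; exact hrσ n)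
  have S'' : Sys (fun r => 15 / (4 * r ^ 2) + Vr 1 r) (fun _ => 0) (fun _ => 0) F' (33/4) 4 1 :=
    S'.change_K (by norm_num) fun r hr =>
      abs_single_le (κ := fun r => 15 / (4 * r ^ 2) + Vr 1 r) hr rfl (Vr_neg one_pos).le
        (sq_mul_Vr_le one_pos)
  have horth : ∫ r in Ioi (0:ℝ), F' r r * vphi 1 r = 0 := by
    have hlim : Tendsto (fun n => ∫ r in Ioi (0:ℝ), F (φ n) (lam (φ n) j * r) (lam (φ n) j * r) /
        (√(lam (φ n) j) * 1) * vphi 1 r) atTop (𝓝 (∫ r in Ioi (0:ℝ), F' r r * vphi 1 r)) := by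
      refine tendsto_integral_of_dominated_convergence
        (fun r => 4 * (1152 ^ 2 * 16 * (1 + r ^ 2)⁻¹)) (fun n => ?_)
        ((integrable_inv_one_add_sq.const_mul _).const_mul _).integrableOn (fun n => ?_) ?_
      · refine ContinuousOn.aestronglyMeasurable (ContinuousOn.mul ?_
          (vphi_cont one_pos).continuousOn) measurableSet_Ioi
        exact (S (φ n)).Fc.comp (f := fun r : ℝ => (r, r)) (by fun_prop) fun r hr => ⟨hr, hr⟩
      · refine ae_Ioi fun r hr => ?_
        have h1 := (S (φ n)).Fb r r hr hr
        rw [show (r + r) / 2 = r by ring] at h1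
        rw [norm_mul]
        calc _ ≤ (4 * wgrow r) * |vphi 1 r| := by
              refine mul_le_mul_of_nonneg_right h1 (abs_nonneg _)
          _ = 4 * (wgrow r * |vphi 1 r|) := by ring
          _ ≤ _ := mul_le_mul_of_nonneg_left (abs_vphi_mul_wgrow hr) (by norm_num)
      · refine ae_Ioi fun r hr => ?_
        exact (hF' r r hr hr).mul_const _
    simp only [fun n => (h (φ n)).dil_orth (M := 1) j] at hlim
    exact tendsto_nhds_unique hlim tendsto_const_nhds
  have hz := S''.rigid_single (fun r _ => rfl) (fun r _ => rfl) horth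
  have ht := (hc hz).abs
  rw [abs_zero] at ht
  have hlow : ∀ n, 3 / 4 * √(exp (-L)) ≤ |F n (lam n j * (x n / lam n j))
      (lam n j * (y n / lam n j)) / (√(lam n j) * 1)| := fun n => by
    have hs := sqrt_pos.2 (hl n j)
    rw [mul_div_cancel₀ _ (hl n j).ne', mul_div_cancel₀ _ (hl n j).ne', mul_one, abs_div, abs_of_pos hs,
      le_div_iff₀ hs]
    refine le_trans ?_ (h n).big
    have h1 := one_le_om hJ (lam n) (nr (x n) (y n))
    have h2 := sqrt_le_sqrt (hrσ n).1
    rw [Real.sqrt_div (hr n).le, le_div_iff₀ hs] at h2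
    have h3 := sqrt_nonneg (nr (x n) (y n))
    nlinarith
  have := ge_of_tendsto' ht fun n => hlow (φ n)
  have := sqrt_pos.2 (exp_pos (-L))
  linarith

theorem not_nrm_far (hJ : 0 < J) (h : ∀ n, Nrm (lam n) (s n) (G n) (F n) (K n) (B n) (s0 n) (ε n) (x n) (y n))
    (hε : Tendsto ε atTop (𝓝 0)) (hρ : Tendsto s0 atTop (𝓝 0)) (hρ1 : ∀ n, s0 n ≤ 1)
    (hL : ∀ j, Tendsto (fun n => |Real.log (nr (x n) (y n) / lam n j)|) atTop atTop) : False := by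
  have hl := fun n i => (h n).hl i
  set σ : ℕ → ℝ := fun n => nr (x n) (y n) with hσd
  have hσ : ∀ n, 0 < σ n := fun n => nr_pos (h n).x0 (h n).y0
  set M : ℕ → ℝ := fun n => om (lam n) (σ n) with hMd
  have hM : ∀ n, 1 ≤ M n := fun n => one_le_om hJ _ _
  have hM0 : ∀ n, 0 < M n := fun n => one_pos.trans_le (hM n)
  have hMt : Tendsto M atTop atTop := by
    rw [tendsto_atTop]
    intro A
    have : ∀ᶠ n in atTop, ∀ j, A ≤ |Real.log (σ n / lam n j)| :=
      eventually_all.2 fun j => (tendsto_atTop.1 (hL j)) A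
    filter_upwards [this] with n hn
    obtain ⟨j, hj⟩ := exists_om_eq hJ (lam n) (σ n)
    simp only [hMd]
    rw [hj]
    exact (hn j).trans (abs_le_sqrt (by linarith))
  have S := fun n => (h n).dil hJ (hσ n) (hM n) le_rfl
  have hκ : ∀ r, 0 < r → Tendsto (fun n => kap (fun i => lam n i / σ n) r) atTop
      (𝓝 (15 / (4 * r ^ 2))) := by
    intro r hr0
    unfold kap
    have : Tendsto (fun n => ∑ i, Vr (lam n i / σ n) r) atTop (𝓝 (∑ i : Fin J, 0)) := by
      refine tendsto_finsetSum _ fun i _ => ?_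
      refine tendsto_Vr_zero (fun n => div_pos (hl n i) (hσ n)) ?_ hr0
      refine (hL i).congr fun n => ?_
      rw [← abs_neg, ← Real.log_inv, inv_div]
    simpa using this.const_add (15 / (4 * r ^ 2))
  have hρM : ∀ n, s0 n / M n ≤ s0 n := fun n => div_le_self (h n).sys.ρ0 (hM n)
  have hρM0 : ∀ n, 0 ≤ s0 n / M n := fun n => div_nonneg (h n).sys.ρ0 (hM0 n).le
  have hεM : ∀ n, ε n / M n ≤ ε n := fun n => div_le_self (h n).ε0 (hM n)
  have hεM0 : ∀ n, 0 ≤ ε n / M n := fun n => div_nonneg (h n).ε0 (hM0 n).le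
  have hρMt : Tendsto (fun n => s0 n / M n) atTop (𝓝 0) := squeeze_zero hρM0 hρM hρ
  have hεMt : Tendsto (fun n => ε n / M n) atTop (𝓝 0) := squeeze_zero hεM0 hεM hε
  have hxy : ∀ n, (x n / σ n + y n / σ n) / 2 = 1 := fun n => by
    rw [← add_div, div_div, mul_comm, ← div_div]; exact div_self (hσ n).ne'
  obtain ⟨φ, F', hφ, S', hF', hc⟩ := Sys.compact (s' := fun _ => 0) (e := fun n => (ε n / M n) ^ 2)
    (κ' := fun r => 15 / (4 * r ^ 2))
    (fun n => (S n).mono (B' := 4) (ρ₁ := 1) le_rfl ((hρM n).trans (hρ1 n)))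
    (fun n => (h n).dil_G (hσ n) (hM0 n)) (by simpa using hεMt.pow 2)
    ⟨inv_sq_cont, continuousOn_const, hκ, fun r hr => tendsto_source_zero S hρMt hr⟩
    (x := fun n => x n / σ n) (y := fun n => y n / σ n)
    (fun n => div_pos (h n).x0 (hσ n)) (fun n => div_pos (h n).y0 (hσ n))
    (a := 1) (b := 1) one_pos (fun n => by rw [hxy]; simp)
  have S'' : Sys (fun r => 15 / (4 * r ^ 2)) (fun _ => 0) (fun _ => 0) F' (33/4) 4 1 :=
    S'.change_K (by norm_num) fun r hr =>
      abs_single_le (κ := fun r => 15 / (4 * r ^ 2)) (v := 0) hr (by simp) le_rfl (by simp)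
  obtain ⟨β, hβ⟩ := S''.rigid_free (fun r _ => rfl) (fun r _ => rfl)
  have hb : β = 0 := by
    have h1 := Sys.tendsto_bf (fun n => ((S (φ n)).mono (B' := 4) (ρ₁ := 1) le_rfl
      ((hρM _).trans (hρ1 _))).change_K (K' := 15 / 4 + 12 * J) (by positivity)
        (fun r hr => abs_kap_le (fun j => div_pos (hl _ j) (hσ _)) hr) |>.toPreSys) hF'
    have h2 : ∀ n, |Sys.bf (fun ξ η => F n (σ n * ξ) (σ n * η) / (√(σ n) * M n)) 1| ≤
        (385 + 1200000 * J) * (1 / M n) + (2 * ε n + 8 * s0 n) := fun n => by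
      refine (Sys.abs_bf_one_le hJ (fun j => div_pos (hl n j) (hσ n)) (S n)
        (by have := hM0 n; positivity) ((h n).dil_bound (hσ n) (hM n)) (hεM0 n)
        ((h n).dil_G (hσ n) (hM0 n))).trans (le_of_eq ?_)
      rw [om_scale, mul_one]
      have := hM0 n
      change _ + (2 * (ε n / M n) + 8 * (s0 n / M n)) * M n = _
      field_simp
    have h3 : Tendsto (fun n => (385 + 1200000 * (J:ℝ)) * (1 / M n) + (2 * ε n + 8 * s0 n)) atTop
        (𝓝 0) := by
      have := (((tendsto_const_nhds (x := (1:ℝ))).div_atTop hMt).const_mul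
        (385 + 1200000 * (J:ℝ))).add ((hε.const_mul 2).add (hρ.const_mul 8))
      simpa using this
    have h4 := squeeze_zero_norm' (.of_forall fun n => (norm_eq_abs _).trans_le (h2 n)) h3
    have h5 := tendsto_nhds_unique h1 (h4.comp hφ.tendsto_atTop)
    rw [Sys.bf_mode S''.toPreSys hβ] at h5
    exact (mul_eq_zero.1 h5).resolve_right Real.pi_ne_zero
  have hz : ∀ ξ η, 0 < ξ → 0 < η → F' ξ η = 0 := by
    intro ξ η hξ hη
    have := hβ ((ξ + η) / 2) ((η - ξ) / 2) (by rw [abs_lt]; constructor <;> linarith)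
    rwa [hb, zero_mul, show (ξ + η) / 2 - (η - ξ) / 2 = ξ by ring,
      show (ξ + η) / 2 + (η - ξ) / 2 = η by ring] at this
  have ht := (hc hz).abs
  rw [abs_zero] at ht
  have hlow : ∀ n, 3 / 4 ≤ |F n (σ n * (x n / σ n)) (σ n * (y n / σ n)) / (√(σ n) * M n)| :=
    fun n => by
    have hs := sqrt_pos.2 (hσ n)
    have := hM0 n
    rw [mul_div_cancel₀ _ (hσ n).ne', mul_div_cancel₀ _ (hσ n).ne', abs_div,
      abs_of_pos (by positivity : 0 < √(σ n) * M n), le_div_iff₀ (by positivity)]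
    exact (h n).big
  have := ge_of_tendsto' ht fun n => hlow (φ n)
  linarith

end Sequences

theorem exists_nrm {J : ℕ} (hJ : 0 < J) {lam : Fin J → ℝ} (hl : ∀ j, 0 < lam j) {s G : ℝ → ℝ}
    {F : ℝ → ℝ → ℝ} {K B s0 ε C C' x₀ y₀ : ℝ} (h : Sys (kap lam) s G F K B s0) (hε : 0 ≤ ε)
    (hG : ∀ x y, 0 < x → x < y → ∫ z in x..y, G z ^ 2 ≤ ε ^ 2)
    (hF : ∀ ξ η, 0 < ξ → 0 < η → |F ξ η| ≤ C' * √(nr ξ η))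
    (ho : ∀ i, ∫ r in Ioi (0:ℝ), F r r * vphi (lam i) r = 0) (hC : 0 < C) (hx₀ : 0 < x₀)
    (hy₀ : 0 < y₀) (hv : C * (ε + s0) * (√(nr x₀ y₀) * om lam (nr x₀ y₀)) < |F x₀ y₀|) :
    ∃ s' G' F' B' ρ' ε' x y, Nrm lam s' G' F' K B' ρ' ε' x y ∧ ε' + ρ' ≤ 1 / C := by
  have hom := fun r => one_le_om hJ lam r
  have hpos : ∀ ξ η, 0 < ξ → 0 < η → 0 < √(nr ξ η) * om lam (nr ξ η) := fun ξ η hξ hη =>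
    mul_pos (sqrt_pos.2 (nr_pos hξ hη)) (one_pos.trans_le (hom _))
  set S : Set ℝ := {v | ∃ ξ η, 0 < ξ ∧ 0 < η ∧ v = |F ξ η| / (√(nr ξ η) * om lam (nr ξ η))} with hS
  have hC' : 0 ≤ C' := by
    have := (abs_nonneg _).trans (hF 1 1 one_pos one_pos)
    exact nonneg_of_mul_nonneg_left this (sqrt_pos.2 (nr_pos one_pos one_pos))
  have hbdd : BddAbove S := by
    refine ⟨C', ?_⟩
    rintro v ⟨ξ, η, hξ, hη, rfl⟩
    rw [div_le_iff₀ (hpos ξ η hξ hη)]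
    refine (hF ξ η hξ hη).trans ?_
    have := sqrt_nonneg (nr ξ η)
    have := hom (nr ξ η)
    gcongr; exact le_mul_of_one_le_right ‹_› this
  set N := sSup S with hN
  have hNv : C * (ε + s0) < N := by
    refine lt_of_lt_of_le ?_ (le_csSup hbdd ⟨x₀, y₀, hx₀, hy₀, rfl⟩)
    rwa [lt_div_iff₀ (hpos _ _ hx₀ hy₀)]
  have hρ := h.ρ0
  have hN0 : 0 < N := lt_of_le_of_lt (by positivity) hNv
  have hne : S.Nonempty := ⟨_, x₀, y₀, hx₀, hy₀, rfl⟩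
  obtain ⟨_, ⟨x, y, hx, hy, rfl⟩, hxy⟩ := exists_lt_of_lt_csSup hne (show 3 / 4 * N < N by linarith)
  have hFN : ∀ ξ η, 0 < ξ → 0 < η → |F ξ η| ≤ N * (√(nr ξ η) * om lam (nr ξ η)) := by
    intro ξ η hξ hη
    rw [← div_le_iff₀ (hpos ξ η hξ hη)]
    exact le_csSup hbdd ⟨ξ, η, hξ, hη, rfl⟩
  refine ⟨fun r => 1 * √1 / N * s (1 * r), fun x => √1 / N * G (1 * x),
    fun ξ η => F (1 * ξ) (1 * η) / (√1 * N), B / N, s0 / N, ε / N, x, y, ?_, ?_⟩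
  · constructor
    · exact hl
    · refine h.scale one_pos hN0 (by simp) (div_nonneg h.B0 hN0.le) fun ξ η hξ hη => ?_
      rw [one_mul, one_mul, sqrt_one, one_mul, abs_div, abs_of_pos hN0, div_mul_eq_mul_div]
      exact div_le_div_of_nonneg_right (h.Fb ξ η hξ hη) hN0.le
    · positivity
    · intro a b ha hab
      simp only [one_mul, sqrt_one, mul_pow]
      rw [intervalIntegral.integral_const_mul, div_pow, div_pow, one_pow, div_mul_eq_mul_div, one_mul]
      exact div_le_div_of_nonneg_right (hG a b ha hab) (by positivity)
    · intro ξ η hξ hη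
      rw [one_mul, one_mul, sqrt_one, one_mul, abs_div, abs_of_pos hN0, div_le_iff₀ hN0,
        mul_comm _ N]
      exact hFN ξ η hξ hη
    · intro i
      have : ∀ r, F (1 * r) (1 * r) / (√1 * N) * vphi (lam i) r =
          N⁻¹ * (F r r * vphi (lam i) r) := fun r => by
        rw [one_mul, sqrt_one, one_mul]; ring
      simp only [this]
      rw [integral_const_mul, ho i, mul_zero]
    · exact hx
    · exact hy
    · rw [one_mul, one_mul, sqrt_one, one_mul, abs_div, abs_of_pos hN0, le_div_iff₀ hN0]
      rw [lt_div_iff₀ (hpos x y hx hy)] at hxy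
      linarith
  · rw [← add_div, div_le_div_iff₀ hN0 hC]
    linarith

/-- The exterior estimate: a system orthogonal to the zero modes is controlled by its radiation
and its source. -/
theorem ext_estimate {J : ℕ} (hJ : 0 < J) : ∃ δ C : ℝ, 0 < δ ∧ 0 < C ∧ ∀ lam : Fin J → ℝ,
    (∀ j, 0 < lam j) → StrictAnti lam → gam lam ≤ δ → ∀ (s G : ℝ → ℝ) (F : ℝ → ℝ → ℝ)
    (K B s0 ε C' : ℝ), Sys (kap lam) s G F K B s0 → 0 ≤ ε →
    (∀ x y, 0 < x → x < y → ∫ z in x..y, G z ^ 2 ≤ ε ^ 2) →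
    (∀ ξ η, 0 < ξ → 0 < η → |F ξ η| ≤ C' * √(nr ξ η)) →
    (∀ i, ∫ r in Ioi (0:ℝ), F r r * vphi (lam i) r = 0) →
    ∀ ξ η, 0 < ξ → 0 < η → |F ξ η| ≤ C * (ε + s0) * (√(nr ξ η) * om lam (nr ξ η)) := by
  by_contra hcon
  push Not at hcon
  have step : ∀ n : ℕ, ∃ (lam : Fin J → ℝ) (s G : ℝ → ℝ) (F : ℝ → ℝ → ℝ) (K B s0 ε x y : ℝ),
      StrictAnti lam ∧ gam lam ≤ 1 / ((n:ℝ) + 1) ∧ Nrm lam s G F K B s0 ε x y ∧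
        ε + s0 ≤ 1 / ((n:ℝ) + 1) := by
    intro n
    obtain ⟨lam, hl, ha, hg, s, G, F, K, B, s0, ε, C', h, hε, hG, hF, ho, x₀, y₀, hx, hy, hv⟩ :=
      hcon (1 / ((n:ℝ) + 1)) ((n:ℝ) + 1) (by positivity) (by positivity)
    obtain ⟨s', G', F', B', ρ', ε', x, y, hn, hle⟩ :=
      exists_nrm hJ hl h hε hG hF ho (by positivity) hx hy hv
    exact ⟨lam, s', G', F', K, B', ρ', ε', x, y, ha, hg, hn, hle⟩
  choose lam s G F K B s0 ε x y ha hg h hle using step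
  have h0 : Tendsto (fun n : ℕ => 1 / ((n:ℝ) + 1)) atTop (𝓝 0) := tendsto_one_div_add_atTop_nhds_zero_nat
  have hgt : Tendsto (fun n => gam (lam n)) atTop (𝓝 0) :=
    squeeze_zero (fun n => gam_nonneg _ (h n).hl) hg h0
  have hεt : Tendsto ε atTop (𝓝 0) :=
    squeeze_zero (fun n => (h n).ε0) (fun n => by linarith [hle n, (h n).sys.ρ0]) h0
  have hρt : Tendsto s0 atTop (𝓝 0) :=
    squeeze_zero (fun n => (h n).sys.ρ0) (fun n => by linarith [hle n, (h n).ε0]) h0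
  have hρ1 : ∀ n, s0 n ≤ 1 := fun n => by
    have : 1 / ((n:ℝ) + 1) ≤ 1 := by
      rw [div_le_one (by positivity)]; linarith [Nat.cast_nonneg (α := ℝ) n]
    linarith [hle n, (h n).ε0]
  by_cases hc : ∃ (j : Fin J) (L : ℝ), ∃ᶠ n in atTop, |Real.log (nr (x n) (y n) / lam n j)| ≤ L
  · obtain ⟨j, L, hL⟩ := hc
    obtain ⟨φ, hφ, hφL⟩ := extraction_of_frequently_atTop hL
    have ht := hφ.tendsto_atTop
    exact not_nrm_near hJ (fun n => h (φ n)) (fun n => ha (φ n)) (hgt.comp ht) (hεt.comp ht)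
      (hρt.comp ht) (fun n => hρ1 (φ n)) j L hφL
  · push Not at hc
    refine not_nrm_far hJ h hεt hρt hρ1 fun j => ?_
    rw [tendsto_atTop]
    intro A
    filter_upwards [hc j A] with n hn using hn.le

/-! ### Radial functions on `ℝ⁶` -/

/-- Partial derivative in the first variable. -/
def dT (U : ℝ → ℝ → ℝ) (t r : ℝ) : ℝ := deriv (fun t' => U t' r) t

/-- Partial derivative in the second variable. -/
def dR (U : ℝ → ℝ → ℝ) (t r : ℝ) : ℝ := deriv (fun r' => U t r') r

/-- Restriction of a function to a half line. -/
def prof (f : E6 → ℝ) (r : ℝ) : ℝ := f (r • EuclideanSpace.single 0 1)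

/-- Six times the volume of the unit ball. -/
def c6 : ℝ := 6 * (volume : Measure E6).real (Metric.ball 0 1)

theorem c6_pos : 0 < c6 := by
  unfold c6
  have : 0 < (volume : Measure E6).real (Metric.ball 0 1) :=
    ENNReal.toReal_pos (Metric.measure_ball_pos _ _ one_pos).ne' measure_ball_lt_top.ne
  positivity

theorem integral_radial (g : ℝ → ℝ) : ∫ x : E6, g ‖x‖ = c6 * ∫ r in Ioi (0:ℝ), r ^ 5 * g r := by
  rw [integral_fun_norm_addHaar]
  simp [c6, mul_assoc]

theorem integrable_radial {g : ℝ → ℝ} :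
    Integrable (fun x : E6 => g ‖x‖) ↔ IntegrableOn (fun r => r ^ 5 * g r) (Ioi (0:ℝ)) := by
  rw [integrable_fun_norm_addHaar]
  simp

theorem norm_smul_single {r : ℝ} (hr : 0 ≤ r) :
    ‖r • (EuclideanSpace.single 0 1 : E6)‖ = r := by
  simp [norm_smul, abs_of_nonneg hr]

theorem eq_prof {f : E6 → ℝ} (hf : ∀ x y, ‖x‖ = ‖y‖ → f x = f y) (x : E6) : f x = prof f ‖x‖ :=
  hf _ _ (norm_smul_single (norm_nonneg x)).symm

theorem hasFDerivAt_norm6 {x : E6} (hx : x ≠ 0) :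
    HasFDerivAt (fun y : E6 => ‖y‖) (‖x‖⁻¹ • innerSL ℝ x) x := by
  have h := (hasStrictFDerivAt_norm_sq x).hasFDerivAt
  have hx0 : ‖x‖ ≠ 0 := norm_ne_zero_iff.2 hx
  have h2 := h.sqrt (pow_ne_zero 2 hx0)
  simp only [Real.sqrt_sq (norm_nonneg _)] at h2
  refine h2.congr_fderiv ?_
  ext v
  simp
  field_simp

theorem hasGradientAt_radial {f : E6 → ℝ} {g : ℝ → ℝ} {d : ℝ} {x : E6} (hx : x ≠ 0)
    (hf : ∀ᶠ y in 𝓝 x, f y = g ‖y‖) (hg : HasDerivAt g d ‖x‖) :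
    HasGradientAt f ((d / ‖x‖) • x) x := by
  rw [hasGradientAt_iff_hasFDerivAt]
  have h := hg.comp_hasFDerivAt x (hasFDerivAt_norm6 hx)
  refine (h.congr_of_eventuallyEq hf).congr_fderiv ?_
  ext v
  simp
  ring

/-- The Laplacian of a radial function. -/
theorem lap6_radial {f : E6 → ℝ} {g g' : ℝ → ℝ} {d : ℝ} (hf : ∀ y, f y = g ‖y‖)
    (hg : ∀ r, 0 < r → HasDerivAt g (g' r) r) {x : E6} (hx : x ≠ 0)
    (hg' : HasDerivAt g' d ‖x‖) : lap6 f x = d + 5 / ‖x‖ * g' ‖x‖ := by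
  have hn : 0 < ‖x‖ := norm_pos_iff.2 hx
  have hev : ∀ᶠ y : E6 in 𝓝 x, y ≠ 0 := isOpen_ne.mem_nhds hx
  have h1 : ∀ i : Fin 6, (fun y => fderiv ℝ f y (EuclideanSpace.single i 1)) =ᶠ[𝓝 x]
      fun y => g' ‖y‖ / ‖y‖ * y i := by
    intro i
    filter_upwards [hev] with y hy
    have := hasGradientAt_radial hy (Eventually.of_forall hf) (hg _ (norm_pos_iff.2 hy))
    rw [hasGradientAt_iff_hasFDerivAt] at this
    rw [this.fderiv]
    simp [EuclideanSpace.inner_single_right]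
  have h2 : ∀ i : Fin 6, HasFDerivAt (fun y : E6 => g' ‖y‖ / ‖y‖ * y i)
      ((g' ‖x‖ / ‖x‖) • (EuclideanSpace.proj i : E6 →L[ℝ] ℝ) +
        (x i) • (((d * ‖x‖ - g' ‖x‖ * 1) / ‖x‖ ^ 2) • (‖x‖⁻¹ • innerSL ℝ x))) x := by
    intro i
    have ha : HasDerivAt (fun r => g' r / r) ((d * ‖x‖ - g' ‖x‖ * 1) / ‖x‖ ^ 2) ‖x‖ :=
      hg'.div (hasDerivAt_id _) hn.ne'
    have hb := ha.comp_hasFDerivAt x (hasFDerivAt_norm6 hx)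
    exact hb.mul (EuclideanSpace.proj i : E6 →L[ℝ] ℝ).hasFDerivAt
  have h3 : ∀ i : Fin 6, fderiv ℝ (fun y => fderiv ℝ f y (EuclideanSpace.single i 1)) x
      (EuclideanSpace.single i 1) =
      g' ‖x‖ / ‖x‖ + (x i) ^ 2 * ((d * ‖x‖ - g' ‖x‖) / ‖x‖ ^ 2 * ‖x‖⁻¹) := by
    intro i
    rw [(h1 i).fderiv_eq, (h2 i).fderiv]
    simp [EuclideanSpace.inner_single_right]
    ring
  unfold lap6
  rw [Finset.sum_congr rfl fun i _ => h3 i, Finset.sum_add_distrib, ← Finset.sum_mul]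
  have h4 : ∑ i, x i ^ 2 = ‖x‖ ^ 2 := by
    rw [EuclideanSpace.norm_sq_eq]; simp
  rw [h4]
  simp
  field_simp
  ring

/-- A twice differentiable function of two variables: the partial derivatives are `C¹` and the
mixed ones agree. -/
theorem C2_partials {U : ℝ → ℝ → ℝ} (h : ContDiff ℝ 2 (unc U)) :
    ContDiff ℝ 1 (fun p : ℝ × ℝ => dT U p.1 p.2) ∧ ContDiff ℝ 1 (fun p : ℝ × ℝ => dR U p.1 p.2) ∧
    (∀ p : ℝ × ℝ, HasFDerivAt (unc U)
      (dT U p.1 p.2 • ContinuousLinearMap.fst ℝ ℝ ℝ +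
        dR U p.1 p.2 • ContinuousLinearMap.snd ℝ ℝ ℝ) p) ∧
    (∀ t r, dR (dT U) t r = dT (dR U) t r) := by
  set f := unc U with hf
  have hd : Differentiable ℝ f := h.differentiable (by norm_num)
  have e1 : ∀ p : ℝ × ℝ, dT U p.1 p.2 = fderiv ℝ f p (1, 0) := by
    intro p
    have := (hd p).hasFDerivAt.comp_hasDerivAt p.1
      (f := fun t' => ((t', p.2) : ℝ × ℝ)) (f' := ((1, 0) : ℝ × ℝ))
      ((hasDerivAt_id _).prodMk (hasDerivAt_const _ _))
    exact this.deriv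
  have e2 : ∀ p : ℝ × ℝ, dR U p.1 p.2 = fderiv ℝ f p (0, 1) := by
    intro p
    have := (hd p).hasFDerivAt.comp_hasDerivAt p.2
      (f := fun r' => ((p.1, r') : ℝ × ℝ)) (f' := ((0, 1) : ℝ × ℝ))
      ((hasDerivAt_const _ _).prodMk (hasDerivAt_id _))
    exact this.deriv
  have hc : ContDiff ℝ 1 (fderiv ℝ f) := h.fderiv_right (by norm_num)
  have hd' : Differentiable ℝ (fderiv ℝ f) := hc.differentiable (by norm_num)
  refine ⟨?_, ?_, ?_, ?_⟩
  · rw [show (fun p : ℝ × ℝ => dT U p.1 p.2) = fun p => fderiv ℝ f p (1, 0) from funext e1]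
    exact hc.clm_apply contDiff_const
  · rw [show (fun p : ℝ × ℝ => dR U p.1 p.2) = fun p => fderiv ℝ f p (0, 1) from funext e2]
    exact hc.clm_apply contDiff_const
  · intro p
    refine (hd p).hasFDerivAt.congr_fderiv ?_
    ext <;> simp [e1, e2]
  · intro t r
    have s := (h.contDiffAt (x := (t, r))).isSymmSndFDerivAt (by simp)
    have a1 : dR (dT U) t r = fderiv ℝ (fderiv ℝ f) (t, r) (0, 1) (1, 0) := by
      have hh : (fun r' => dT U t r') = fun r' => fderiv ℝ f (t, r') (1, 0) :=
        funext fun r' => e1 (t, r')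
      have := ((hd' (t, r)).hasFDerivAt.comp_hasDerivAt r
        (f := fun r' => ((t, r') : ℝ × ℝ)) (f' := ((0, 1) : ℝ × ℝ))
        ((hasDerivAt_const _ _).prodMk (hasDerivAt_id _))).clm_apply
          (hasDerivAt_const r ((1, 0) : ℝ × ℝ))
      unfold dR; rw [hh]
      refine (HasDerivAt.deriv this).trans ?_
      simp
    have a2 : dT (dR U) t r = fderiv ℝ (fderiv ℝ f) (t, r) (1, 0) (0, 1) := by
      have hh : (fun t' => dR U t' r) = fun t' => fderiv ℝ f (t', r) (0, 1) :=
        funext fun t' => e2 (t', r)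
      have := ((hd' (t, r)).hasFDerivAt.comp_hasDerivAt t
        (f := fun t' => ((t', r) : ℝ × ℝ)) (f' := ((1, 0) : ℝ × ℝ))
        ((hasDerivAt_id _).prodMk (hasDerivAt_const _ _))).clm_apply
          (hasDerivAt_const t ((0, 1) : ℝ × ℝ))
      unfold dT; rw [hh]
      refine (HasDerivAt.deriv this).trans ?_
      simp
    rw [a1, a2]
    exact s _ _

/-- Radial `C²` solutions of a wave equation with potential, in polar coordinates. -/
structure RadWave (p S : ℝ → ℝ) (U : ℝ → ℝ → ℝ) : Prop where
  smooth : ContDiff ℝ 2 (unc U)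
  eq : ∀ t r, 0 < r →
    dT (dT U) t r - dR (dR U) t r - 5 / r * dR U t r + p r * U t r = -S r

theorem RadWave.dtt {p S : ℝ → ℝ} {U : ℝ → ℝ → ℝ} (h : RadWave p S U) {t r : ℝ} (hr : 0 < r) :
    dT (dT U) t r = dR (dR U) t r + 5 / r * dR U t r - p r * U t r - S r := by
  linarith [h.eq t r hr]

theorem hasDerivAt_dR {U : ℝ → ℝ → ℝ} (h : ContDiff ℝ 1 (unc U)) (t r : ℝ) :
    HasDerivAt (fun r' => U t r') (dR U t r) r := by
  have : DifferentiableAt ℝ (fun r' => U t r') r :=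
    ((h.comp (contDiff_const.prodMk contDiff_id)).differentiable (by norm_num)) r
  exact this.hasDerivAt

theorem hasDerivAt_dT {U : ℝ → ℝ → ℝ} (h : ContDiff ℝ 1 (unc U)) (t r : ℝ) :
    HasDerivAt (fun t' => U t' r) (dT U t r) t := by
  have : DifferentiableAt ℝ (fun t' => U t' r) t :=
    ((h.comp (contDiff_id.prodMk contDiff_const)).differentiable (by norm_num)) t
  exact this.hasDerivAt

section
variable {P : E6 → ℝ} {p : ℝ → ℝ} {u : ℝ → E6 → ℝ}

theorem IsRadSolOf.contDiff_prof (h : IsRadSolOf P u) :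
    ContDiff ℝ 2 (fun q : ℝ × ℝ => prof (u q.1) q.2) :=
  h.1.comp (contDiff_fst.prodMk (contDiff_snd.smul contDiff_const))

theorem IsRadSolOf.radWave (h : IsRadSolOf P u) (hP : ∀ x, P x = p ‖x‖) :
    RadWave p (fun _ => 0) (fun t => prof (u t)) := by
  have hsm := h.contDiff_prof
  obtain ⟨hs, hr, he, -⟩ := h
  refine ⟨hsm, fun t r hr0 => ?_⟩
  obtain ⟨p1, p2, -, -⟩ := C2_partials (U := fun t => prof (u t)) hsm
  have hx : r • (EuclideanSpace.single 0 1 : E6) ≠ 0 := by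
    rw [← norm_ne_zero_iff, norm_smul_single hr0.le]; exact hr0.ne'
  have hl := lap6_radial (f := u t) (g := prof (u t)) (eq_prof (hr t))
    (fun r' _ => hasDerivAt_dR (U := fun t => prof (u t)) (hsm.of_le (by norm_num)) t r') hx
    (hasDerivAt_dR p2 t _)
  have := he t (r • EuclideanSpace.single 0 1)
  rw [hl, hP, norm_smul_single hr0.le] at this
  rw [neg_zero, ← this]
  have e : dttu u t (r • EuclideanSpace.single 0 1) = dT (dT fun t => prof (u t)) t r := rfl
  rw [e]
  unfold prof
  ring

theorem IsRadSolOf.eDensity_eq (h : IsRadSolOf P u) (t : ℝ) {x : E6} (hx : x ≠ 0) :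
    eDensity u t x = dT (fun t => prof (u t)) t ‖x‖ ^ 2 + dR (fun t => prof (u t)) t ‖x‖ ^ 2 := by
  have hsm := h.contDiff_prof
  obtain ⟨hs, hr, -, -⟩ := h
  unfold eDensity
  have h1 : dtu u t x = dT (fun t => prof (u t)) t ‖x‖ := by
    unfold dtu dT
    congr 1
    ext s
    exact eq_prof (hr s) x
  rw [h1, (hasGradientAt_radial hx (Eventually.of_forall (eq_prof (hr t)))
    (hasDerivAt_dR (U := fun t => prof (u t)) (hsm.of_le (by norm_num)) t _)).gradient,
    norm_smul, norm_div, norm_norm, div_mul_cancel₀ _ (norm_ne_zero_iff.2 hx), norm_eq_abs,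
    sq_abs]

/-- The exterior energy in polar coordinates. -/
theorem IsRadSolOf.exterior (h : IsRadSolOf P u) (t : ℝ) :
    ∫ x in {x : E6 | |t| ≤ ‖x‖}, eDensity u t x =
      c6 * ∫ r in Ioi |t|, r ^ 5 *
        (dT (fun t => prof (u t)) t r ^ 2 + dR (fun t => prof (u t)) t r ^ 2) := by
  have hm : MeasurableSet {x : E6 | |t| ≤ ‖x‖} := measurableSet_le measurable_const measurable_norm
  set e : ℝ → ℝ := fun r => dT (fun t => prof (u t)) t r ^ 2 + dR (fun t => prof (u t)) t r ^ 2
  have hae : ∀ᵐ x : E6, x ≠ 0 := by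
    simp [ae_iff]
  have h1 : ∫ x in {x : E6 | |t| ≤ ‖x‖}, eDensity u t x
      = ∫ x : E6, (Ici |t|).indicator e ‖x‖ := by
    rw [← integral_indicator hm]
    refine integral_congr_ae ?_
    filter_upwards [hae] with x hx
    by_cases hxt : |t| ≤ ‖x‖
    · rw [indicator_of_mem (by exact hxt), indicator_of_mem (by exact hxt), h.eDensity_eq t hx]
    · rw [indicator_of_notMem (by exact hxt), indicator_of_notMem (by exact hxt)]
  rw [h1, integral_radial]
  congr 1
  have h2 : ∀ r, r ^ 5 * (Ici |t|).indicator e r = (Ici |t|).indicator (fun r => r ^ 5 * e r) r := by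
    intro r
    by_cases hr : r ∈ Ici |t| <;> simp [hr]
  simp only [h2]
  rw [setIntegral_indicator measurableSet_Ici]
  refine setIntegral_congr_set ?_
  have : (Ioi 0 ∩ Ici |t| : Set ℝ) =ᵐ[volume] (Ioi 0 ∩ Ioi |t| : Set ℝ) :=
    (ae_eq_refl _).inter Ioi_ae_eq_Ici.symm
  rwa [inter_eq_right.2 (Ioi_subset_Ioi (abs_nonneg t))] at this

theorem IsRadSolOf.energy_zero (h : IsRadSolOf P u) :
    IntegrableOn (fun r => r ^ 5 *
        (dT (fun t => prof (u t)) 0 r ^ 2 + dR (fun t => prof (u t)) 0 r ^ 2)) (Ioi 0) := by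
  rw [← integrable_radial (g := fun r => dT (fun t => prof (u t)) 0 r ^ 2 +
    dR (fun t => prof (u t)) 0 r ^ 2)]
  refine h.2.2.2.congr ?_
  have hae : ∀ᵐ x : E6, x ≠ 0 := by
    simp [ae_iff]
  filter_upwards [hae] with x hx
  exact h.eDensity_eq 0 hx

end

/-! ### Null coordinates -/

/-- A solution of `4 ∂_ξ∂_η F = κ F + s` with its first derivatives. -/
structure NullWave (κ s : ℝ → ℝ) (F A B : ℝ → ℝ → ℝ) : Prop where
  κc : ContinuousOn κ (Ioi 0)
  sc : ContinuousOn s (Ioi 0)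
  cF : ContinuousOn (Function.uncurry F) (Ioi 0 ×ˢ Ioi 0)
  cA : ContinuousOn (Function.uncurry A) (Ioi 0 ×ˢ Ioi 0)
  cB : ContinuousOn (Function.uncurry B) (Ioi 0 ×ˢ Ioi 0)
  dF : ∀ ξ η, 0 < ξ → 0 < η → HasDerivAt (fun x => F x η) (A ξ η) ξ
  dF' : ∀ ξ η, 0 < ξ → 0 < η → HasDerivAt (fun y => F ξ y) (B ξ η) η
  dA : ∀ ξ η, 0 < ξ → 0 < η →
    HasDerivAt (fun y => A ξ y) ((κ (nr ξ η) * F ξ η + s (nr ξ η)) / 4) η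
  dB : ∀ ξ η, 0 < ξ → 0 < η →
    HasDerivAt (fun x => B x η) ((κ (nr ξ η) * F ξ η + s (nr ξ η)) / 4) ξ

/-- `r^{5/2} U` in null coordinates. -/
def Fn (U : ℝ → ℝ → ℝ) (ξ η : ℝ) : ℝ := nr ξ η ^ (5/2 : ℝ) * U ((η - ξ) / 2) (nr ξ η)

/-- The `ξ`-derivative of `Fn U`. -/
def An (U : ℝ → ℝ → ℝ) (ξ η : ℝ) : ℝ := nr ξ η ^ (5/2 : ℝ) *
  ((dR U ((η - ξ) / 2) (nr ξ η) - dT U ((η - ξ) / 2) (nr ξ η)) / 2 +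
    5 / 4 * U ((η - ξ) / 2) (nr ξ η) / nr ξ η)

/-- The `η`-derivative of `Fn U`. -/
def Bn (U : ℝ → ℝ → ℝ) (ξ η : ℝ) : ℝ := nr ξ η ^ (5/2 : ℝ) *
  ((dR U ((η - ξ) / 2) (nr ξ η) + dT U ((η - ξ) / 2) (nr ξ η)) / 2 +
    5 / 4 * U ((η - ξ) / 2) (nr ξ η) / nr ξ η)

theorem C1_hasFDerivAt {U : ℝ → ℝ → ℝ} (h : ContDiff ℝ 1 (unc U)) (p : ℝ × ℝ) :
    HasFDerivAt (unc U)
      (dT U p.1 p.2 • ContinuousLinearMap.fst ℝ ℝ ℝ +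
        dR U p.1 p.2 • ContinuousLinearMap.snd ℝ ℝ ℝ) p := by
  have hd : DifferentiableAt ℝ (unc U) p := (h.differentiable (by norm_num)) p
  refine hd.hasFDerivAt.congr_fderiv ?_
  have h1 := hd.hasFDerivAt.comp_hasDerivAt p.1
      (f := fun t' => ((t', p.2) : ℝ × ℝ)) (f' := ((1, 0) : ℝ × ℝ))
      ((hasDerivAt_id _).prodMk (hasDerivAt_const _ _))
  have h2 := hd.hasFDerivAt.comp_hasDerivAt p.2
      (f := fun r' => ((p.1, r') : ℝ × ℝ)) (f' := ((0, 1) : ℝ × ℝ))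
      ((hasDerivAt_const _ _).prodMk (hasDerivAt_id _))
  have e1 : dT U p.1 p.2 = _ := h1.deriv
  have e2 : dR U p.1 p.2 = _ := h2.deriv
  ext <;> simp [e1, e2]

theorem hasDerivAt_null_left {U : ℝ → ℝ → ℝ} (h : ContDiff ℝ 1 (unc U))
    (ξ η : ℝ) : HasDerivAt (fun x => U ((η - x) / 2) (nr x η))
      ((dR U ((η - ξ) / 2) (nr ξ η) - dT U ((η - ξ) / 2) (nr ξ η)) / 2) ξ := by
  have h1 : HasDerivAt (fun x => (((η - x) / 2, nr x η) : ℝ × ℝ)) ((-1 / 2, 1 / 2) : ℝ × ℝ) ξ :=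
    (((hasDerivAt_id ξ).const_sub η).div_const 2).prodMk
      (((hasDerivAt_id ξ).add_const η).div_const 2)
  refine ((C1_hasFDerivAt h ((η - ξ) / 2, nr ξ η)).comp_hasDerivAt ξ h1).congr_deriv ?_
  simp
  ring

theorem hasDerivAt_null_right {U : ℝ → ℝ → ℝ} (h : ContDiff ℝ 1 (unc U))
    (ξ η : ℝ) : HasDerivAt (fun y => U ((y - ξ) / 2) (nr ξ y))
      ((dR U ((η - ξ) / 2) (nr ξ η) + dT U ((η - ξ) / 2) (nr ξ η)) / 2) η := by
  have h1 : HasDerivAt (fun y => (((y - ξ) / 2, nr ξ y) : ℝ × ℝ)) ((1 / 2, 1 / 2) : ℝ × ℝ) η :=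
    (((hasDerivAt_id η).sub_const ξ).div_const 2).prodMk
      (((hasDerivAt_id η).const_add ξ).div_const 2)
  refine ((C1_hasFDerivAt h ((η - ξ) / 2, nr ξ η)).comp_hasDerivAt η h1).congr_deriv ?_
  simp
  ring

theorem hasDerivAt_nr_left {ξ η : ℝ} (hξ : 0 < ξ) (hη : 0 < η) :
    HasDerivAt (fun x => nr x η ^ (5/2 : ℝ)) (5 / 4 * (nr ξ η ^ (5/2 : ℝ) / nr ξ η)) ξ := by
  have hr := nr_pos hξ hη
  have h1 : HasDerivAt (fun x => nr x η) (1 / 2) ξ := ((hasDerivAt_id ξ).add_const η).div_const 2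
  refine (h1.rpow_const (Or.inl hr.ne')).congr_deriv ?_
  rw [Real.rpow_sub_one hr.ne']
  ring

theorem hasDerivAt_nr_right {ξ η : ℝ} (hξ : 0 < ξ) (hη : 0 < η) :
    HasDerivAt (fun y => nr ξ y ^ (5/2 : ℝ)) (5 / 4 * (nr ξ η ^ (5/2 : ℝ) / nr ξ η)) η := by
  have hr := nr_pos hξ hη
  have h1 : HasDerivAt (fun y => nr ξ y) (1 / 2) η := ((hasDerivAt_id η).const_add ξ).div_const 2
  refine (h1.rpow_const (Or.inl hr.ne')).congr_deriv ?_
  rw [Real.rpow_sub_one hr.ne']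
  ring

theorem RadWave.null {p S : ℝ → ℝ} {U : ℝ → ℝ → ℝ} (h : RadWave p S U)
    (hp : ContinuousOn p (Ioi 0)) (hS : ContinuousOn S (Ioi 0)) :
    NullWave (fun r => 15 / (4 * r ^ 2) + p r) (fun r => r ^ (5/2 : ℝ) * S r)
      (Fn U) (An U) (Bn U) := by
  obtain ⟨hT, hR, -, hm⟩ := C2_partials h.smooth
  have hs := h.smooth.of_le (show (1 : WithTop ℕ∞) ≤ 2 by norm_num)
  have hn : Continuous (fun q : ℝ × ℝ => nr q.1 q.2) := by unfold nr; fun_prop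
  have hpow : ContinuousOn (fun q : ℝ × ℝ => nr q.1 q.2 ^ (5/2 : ℝ)) (Ioi 0 ×ˢ Ioi 0) :=
    hn.continuousOn.rpow_const fun q hq => Or.inl (nr_pos hq.1 hq.2).ne'
  have hcomp : ∀ H : ℝ → ℝ → ℝ, Continuous (unc H) →
      Continuous (fun q : ℝ × ℝ => H ((q.2 - q.1) / 2) (nr q.1 q.2)) := fun H hH =>
    hH.comp (f := fun q : ℝ × ℝ => (((q.2 - q.1) / 2, nr q.1 q.2) : ℝ × ℝ))
      (Continuous.prodMk (by fun_prop) hn)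
  have hcU := hcomp _ hs.continuous
  have hcT := hcomp _ hT.continuous
  have hcR := hcomp _ hR.continuous
  refine ⟨?_, ?_, ?_, ?_, ?_, ?_, ?_, ?_, ?_⟩
  · exact inv_sq_cont.add hp
  · exact (continuousOn_id.rpow_const fun r hr => Or.inl (ne_of_gt hr)).mul hS
  · exact hpow.mul hcU.continuousOn
  · refine hpow.mul (ContinuousOn.add ((hcR.sub hcT).div_const 2).continuousOn
      (ContinuousOn.div (hcU.const_mul _).continuousOn hn.continuousOn
      fun q hq => (nr_pos hq.1 hq.2).ne'))
  · refine hpow.mul (ContinuousOn.add ((hcR.add hcT).div_const 2).continuousOn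
      (ContinuousOn.div (hcU.const_mul _).continuousOn hn.continuousOn
      fun q hq => (nr_pos hq.1 hq.2).ne'))
  · intro ξ η hξ hη
    refine ((hasDerivAt_nr_left hξ hη).mul (hasDerivAt_null_left hs ξ η)).congr_deriv ?_
    unfold An
    ring
  · intro ξ η hξ hη
    refine ((hasDerivAt_nr_right hξ hη).mul (hasDerivAt_null_right hs ξ η)).congr_deriv ?_
    unfold Bn
    ring
  · intro ξ η hξ hη
    have hr := nr_pos hξ hη
    have h1 : HasDerivAt (fun y => nr ξ y) (1 / 2) η := ((hasDerivAt_id η).const_add ξ).div_const 2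
    have hd := (hasDerivAt_nr_right hξ hη).mul
      ((((hasDerivAt_null_right hR ξ η).sub (hasDerivAt_null_right hT ξ η)).div_const 2).add
      (((hasDerivAt_null_right hs ξ η).const_mul (5 / 4)).div h1 hr.ne'))
    refine hd.congr_deriv ?_
    have he := h.dtt (t := (η - ξ) / 2) hr
    rw [hm]
    unfold Fn
    simp only [Pi.sub_apply, Pi.add_apply, Pi.div_apply]
    set r := nr ξ η
    set t := (η - ξ) / 2
    rw [he]
    field_simp
    ring
  · intro ξ η hξ hη
    have hr := nr_pos hξ hη
    have h1 : HasDerivAt (fun x => nr x η) (1 / 2) ξ := ((hasDerivAt_id ξ).add_const η).div_const 2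
    have hd := (hasDerivAt_nr_left hξ hη).mul
      ((((hasDerivAt_null_left hR ξ η).add (hasDerivAt_null_left hT ξ η)).div_const 2).add
      (((hasDerivAt_null_left hs ξ η).const_mul (5 / 4)).div h1 hr.ne'))
    refine hd.congr_deriv ?_
    have he := h.dtt (t := (η - ξ) / 2) hr
    rw [hm]
    unfold Fn
    simp only [Pi.add_apply, Pi.div_apply]
    set r := nr ξ η
    set t := (η - ξ) / 2
    rw [he]
    field_simp
    ring

/-! ### Functions with finite radial energy -/

theorem pow_five_inv_integral {r : ℝ} (hr : 0 < r) :
    IntegrableOn (fun ρ : ℝ => (ρ ^ 5)⁻¹) (Ioi r) ∧ ∫ ρ in Ioi r, (ρ ^ 5)⁻¹ = (r ^ 4)⁻¹ / 4 := by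
  have e : EqOn (fun ρ : ℝ => (ρ ^ 5)⁻¹) (fun ρ => ρ ^ (-5 : ℝ)) (Ioi r) := by
    intro ρ hρ
    have : (0:ℝ) < ρ := hr.trans hρ
    simp only
    rw [Real.rpow_neg this.le]
    norm_cast
  refine ⟨(integrableOn_Ioi_rpow_of_lt (by norm_num) hr).congr_fun e.symm measurableSet_Ioi, ?_⟩
  rw [Ioi_congr e, integral_Ioi_rpow_of_lt (by norm_num) hr]
  norm_num

/-- A function with finite radial energy has a limit at infinity, with a rate. -/
theorem limit_of_energy {g g' : ℝ → ℝ} {a : ℝ} (ha : 0 < a)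
    (hg : ∀ r, a ≤ r → HasDerivAt g (g' r) r) (hc : ContinuousOn g' (Ici a))
    (hi : IntegrableOn (fun r => r ^ 5 * g' r ^ 2) (Ioi a)) :
    ∃ c, Tendsto g atTop (𝓝 c) ∧
      ∀ r, a ≤ r → |g r - c| ≤ (r ^ 2)⁻¹ / 2 * √(∫ ρ in Ioi r, ρ ^ 5 * g' ρ ^ 2) := by
  have hsq : ∀ r, a ≤ r → IntegrableOn (fun ρ => (√(ρ ^ 5) * g' ρ) ^ 2) (Ioi r) := by
    intro r hr
    refine (hi.mono_set (Ioi_subset_Ioi hr)).congr_fun (fun ρ hρ => ?_) measurableSet_Ioi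
    have : (0:ℝ) < ρ := (ha.trans_le hr).trans hρ
    simp only
    rw [mul_pow, sq_sqrt (by positivity)]
  have hsq2 : ∀ r, a ≤ r → IntegrableOn (fun ρ : ℝ => ((√(ρ ^ 5))⁻¹) ^ 2) (Ioi r) := by
    intro r hr
    refine (pow_five_inv_integral (ha.trans_le hr)).1.congr_fun (fun ρ hρ => ?_) measurableSet_Ioi
    have : (0:ℝ) < ρ := (ha.trans_le hr).trans hρ
    simp only
    rw [inv_pow, sq_sqrt (by positivity)]
  have hint : IntegrableOn g' (Ioi a) := by
    refine Integrable.mono' (hi.add (pow_five_inv_integral ha).1)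
      ((hc.mono Ioi_subset_Ici_self).aestronglyMeasurable measurableSet_Ioi) ?_
    refine ae_Ioi fun ρ hρ => ?_
    have h0 : (0:ℝ) < ρ := ha.trans hρ
    have h5 : (0:ℝ) < ρ ^ 5 := by positivity
    simp only [Pi.add_apply]
    rw [norm_eq_abs]
    have : ρ ^ 5 * g' ρ ^ 2 + (ρ ^ 5)⁻¹ - |g' ρ| = (ρ ^ 5)⁻¹ * ((ρ ^ 5 * |g' ρ|- 1 / 2) ^ 2 + 3 / 4) := by
      rw [← sq_abs (g' ρ)]
      field_simp
      ring
    have : 0 ≤ ρ ^ 5 * g' ρ ^ 2 + (ρ ^ 5)⁻¹ - |g' ρ| := by rw [this]; positivity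
    linarith
  have hlim := tendsto_limUnder_of_hasDerivAt_of_integrableOn_Ioi
    (fun x hx => hg x (le_of_lt hx)) hint
  refine ⟨_, hlim, fun r hr => ?_⟩
  have h0 : 0 < r := ha.trans_le hr
  have h1 := integral_Ioi_of_hasDerivAt_of_tendsto (hg r hr).continuousAt.continuousWithinAt
    (fun x hx => hg x (hr.trans (le_of_lt hx))) (hint.mono_set (Ioi_subset_Ioi hr)) hlim
  rw [abs_sub_comm, ← h1]
  have h2 := sq_integral_mul_le (μ := volume.restrict (Ioi r)) (f := fun ρ => √(ρ ^ 5) * g' ρ)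
    (g := fun ρ => (√(ρ ^ 5))⁻¹) (hsq r hr) (hsq2 r hr)
  have e1 : ∫ ρ in Ioi r, (√(ρ ^ 5) * g' ρ) * (√(ρ ^ 5))⁻¹ = ∫ ρ in Ioi r, g' ρ := by
    refine Ioi_congr fun ρ hρ => ?_
    have : (0:ℝ) < ρ := h0.trans hρ
    have : 0 < √(ρ ^ 5) := by positivity
    field_simp
  have e2 : ∫ ρ in Ioi r, (√(ρ ^ 5) * g' ρ) ^ 2 = ∫ ρ in Ioi r, ρ ^ 5 * g' ρ ^ 2 := by
    refine Ioi_congr fun ρ hρ => ?_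
    have : (0:ℝ) < ρ := h0.trans hρ
    rw [mul_pow, sq_sqrt (by positivity)]
  have e3 : ∫ ρ in Ioi r, ((√(ρ ^ 5))⁻¹) ^ 2 = (r ^ 4)⁻¹ / 4 := by
    rw [← (pow_five_inv_integral h0).2]
    refine Ioi_congr fun ρ hρ => ?_
    have : (0:ℝ) < ρ := h0.trans hρ
    rw [inv_pow, sq_sqrt (by positivity)]
  rw [e1, e2, e3] at h2
  have hE : 0 ≤ ∫ ρ in Ioi r, ρ ^ 5 * g' ρ ^ 2 := setIntegral_nonneg measurableSet_Ioi
    fun ρ hρ => by have : (0:ℝ) < ρ := h0.trans hρ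
                   positivity
  refine abs_le_of_sq_le_sq (h2.trans (le_of_eq ?_)) (by positivity)
  rw [mul_pow, sq_sqrt hE]
  field_simp
  ring

/-- Hardy's inequality for the energy, at infinity. -/
theorem hardy_weighted {g g' : ℝ → ℝ} {a M : ℝ} (ha : 0 < a)
    (hg : ∀ r, a ≤ r → HasDerivAt g (g' r) r) (hc : ContinuousOn g' (Ici a))
    (hi : IntegrableOn (fun r => r ^ 5 * g' r ^ 2) (Ioi a))
    (hb : ∀ r, a ≤ r → r ^ 4 * g r ^ 2 ≤ M) :
    IntegrableOn (fun r => r ^ 3 * g r ^ 2) (Ioi a) := by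
  have hgc : ContinuousOn g (Ici a) := fun r hr => (hg r hr).continuousAt.continuousWithinAt
  refine integrableOn_Ioi_of_intervalIntegral_norm_bounded (l := atTop) (b := fun i => i)
    (M + ∫ r in Ioi a, r ^ 5 * g' r ^ 2) a (fun i => ?_) tendsto_id ?_
  · exact ((ContinuousOn.mul (by fun_prop) (hgc.pow 2)).mono Icc_subset_Ici_self).integrableOn_Icc.mono_set
      Ioc_subset_Icc_self
  · filter_upwards [eventually_ge_atTop a] with L hL
    have hu : uIcc a L ⊆ Ici a := by rw [uIcc_of_le hL]; exact Icc_subset_Ici_self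
    have c1 : IntervalIntegrable (fun r => r ^ 3 * g r ^ 2) volume a L :=
      ((ContinuousOn.mul (by fun_prop) (hgc.pow 2)).mono hu).intervalIntegrable
    have c2 : IntervalIntegrable (fun r => r ^ 5 * g' r ^ 2) volume a L :=
      ((ContinuousOn.mul (by fun_prop) (hc.pow 2)).mono hu).intervalIntegrable
    have c3 : IntervalIntegrable (fun r => 4 * r ^ 3 * g r ^ 2 + r ^ 4 * (2 * g r * g' r)) volume a L :=
      ((ContinuousOn.add (ContinuousOn.mul (by fun_prop) (hgc.pow 2))
        (ContinuousOn.mul (by fun_prop) ((hgc.const_mul 2).mul hc))).mono hu).intervalIntegrable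
    have ftc := intervalIntegral.integral_eq_sub_of_hasDerivAt (f := fun r => r ^ 4 * g r ^ 2)
      (f' := fun r => 4 * r ^ 3 * g r ^ 2 + r ^ 4 * (2 * g r * g' r)) (a := a) (b := L)
      (fun r hr => ((hasDerivAt_pow 4 r).mul ((hg r (hu hr)).pow 2)).congr_deriv (by simp)) c3
    have hle : ∫ r in a..L, r ^ 3 * g r ^ 2 ≤
        ∫ r in a..L, ((4 * r ^ 3 * g r ^ 2 + r ^ 4 * (2 * g r * g' r)) + r ^ 5 * g' r ^ 2) := by
      refine intervalIntegral.integral_mono_on hL c1 (c3.add c2) fun r hr => ?_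
      have h0 : 0 < r := ha.trans_le hr.1
      nlinarith [mul_nonneg (pow_nonneg h0.le 3) (sq_nonneg (g r + r * g' r)),
        mul_nonneg (pow_nonneg h0.le 3) (sq_nonneg (g r))]
    rw [intervalIntegral.integral_add c3 c2, ftc] at hle
    have h3 : ∫ r in a..L, r ^ 5 * g' r ^ 2 ≤ ∫ r in Ioi a, r ^ 5 * g' r ^ 2 := by
      rw [intervalIntegral.integral_of_le hL]
      refine setIntegral_mono_set hi ?_ Ioc_subset_Ioi_self.eventuallyLE
      refine ae_Ioi fun ρ hρ => ?_
      have : (0:ℝ) < ρ := ha.trans hρ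
      simp only [Pi.zero_apply]
      positivity
    have h4 : ∫ r in a..L, ‖r ^ 3 * g r ^ 2‖ = ∫ r in a..L, r ^ 3 * g r ^ 2 := by
      refine intervalIntegral.integral_congr fun r hr => ?_
      have : 0 < r := ha.trans_le (hu hr)
      rw [norm_of_nonneg (by positivity)]
    rw [h4]
    have h5 := hb L hL
    have h6 : 0 ≤ a ^ 4 * g a ^ 2 := by positivity
    linarith

/-- Hardy's inequality on an interval. -/
theorem hardy_interval {f f' : ℝ → ℝ} {a L : ℝ} (ha : 0 < a) (hL : a ≤ L)
    (hf : ∀ r ∈ Icc a L, HasDerivAt f (f' r) r) (hc : ContinuousOn f' (Icc a L)) :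
    ∫ r in a..L, f r ^ 2 / r ^ 2 ≤ 2 * f a ^ 2 / a + 4 * ∫ r in a..L, f' r ^ 2 := by
  have hfc : ContinuousOn f (Icc a L) := fun r hr => (hf r hr).continuousAt.continuousWithinAt
  have hne : ∀ r ∈ Icc a L, r ≠ 0 := fun r hr => (ha.trans_le hr.1).ne'
  have hu : uIcc a L = Icc a L := uIcc_of_le hL
  have c1 : IntervalIntegrable (fun r => f r ^ 2 / r ^ 2) volume a L := by
    refine ContinuousOn.intervalIntegrable ?_
    rw [hu]
    exact (hfc.pow 2).div (by fun_prop) fun r hr => pow_ne_zero 2 (hne r hr)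
  have c2 : IntervalIntegrable (fun r => f' r ^ 2) volume a L := by
    refine ContinuousOn.intervalIntegrable ?_
    rw [hu]
    exact hc.pow 2
  have c3 : IntervalIntegrable (fun r => (2 * f r * f' r * r - f r ^ 2 * 1) / r ^ 2) volume a L := by
    refine ContinuousOn.intervalIntegrable ?_
    rw [hu]
    exact ((((hfc.const_mul 2).mul hc).mul continuousOn_id).sub ((hfc.pow 2).mul continuousOn_const)).div
      (by fun_prop) fun r hr => pow_ne_zero 2 (hne r hr)
  have ftc := intervalIntegral.integral_eq_sub_of_hasDerivAt (f := fun r => f r ^ 2 / r)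
      (f' := fun r => (2 * f r * f' r * r - f r ^ 2 * 1) / r ^ 2) (a := a) (b := L)
      (fun r hr => by
        rw [hu] at hr
        exact (((hf r hr).pow 2).div (hasDerivAt_id r) (hne r hr)).congr_deriv (by simp)) c3
  have hle : ∫ r in a..L, f r ^ 2 / r ^ 2 ≤
      ∫ r in a..L, (4 * f' r ^ 2 - 2 * ((2 * f r * f' r * r - f r ^ 2 * 1) / r ^ 2)) := by
    refine intervalIntegral.integral_mono_on hL c1 ((c2.const_mul 4).sub (c3.const_mul 2))
      fun r hr => ?_
    have h0 : 0 < r := ha.trans_le hr.1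
    have : 4 * f' r ^ 2 - 2 * ((2 * f r * f' r * r - f r ^ 2 * 1) / r ^ 2) - f r ^ 2 / r ^ 2 =
        (2 * f' r - f r / r) ^ 2 := by
      field_simp
      ring
    nlinarith [sq_nonneg (2 * f' r - f r / r)]
  rw [intervalIntegral.integral_sub (c2.const_mul 4) (c3.const_mul 2),
    intervalIntegral.integral_const_mul, intervalIntegral.integral_const_mul, ftc] at hle
  have : 0 ≤ f L ^ 2 / L := by have := ha.trans_le hL; positivity
  have e : 2 * f a ^ 2 / a = 2 * (f a ^ 2 / a) := by ring
  linarith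

/-- Hardy's inequality at infinity. -/
theorem hardy_Ioi {f f' : ℝ → ℝ} {a : ℝ} (ha : 0 < a)
    (hf : ∀ r, a ≤ r → HasDerivAt f (f' r) r) (hc : ContinuousOn f' (Ici a))
    (hi : IntegrableOn (fun r => f' r ^ 2) (Ioi a)) :
    IntegrableOn (fun r => f r ^ 2 / r ^ 2) (Ioi a) := by
  have hfc : ContinuousOn f (Ici a) := fun r hr => (hf r hr).continuousAt.continuousWithinAt
  have hcq : ContinuousOn (fun r => f r ^ 2 / r ^ 2) (Ici a) :=
    (hfc.pow 2).div (by fun_prop) fun r hr => pow_ne_zero 2 (ha.trans_le hr).ne'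
  refine integrableOn_Ioi_of_intervalIntegral_norm_bounded (l := atTop) (b := fun i => i)
    (2 * f a ^ 2 / a + 4 * ∫ r in Ioi a, f' r ^ 2) a (fun i => ?_) tendsto_id ?_
  · exact (hcq.mono Icc_subset_Ici_self).integrableOn_Icc.mono_set Ioc_subset_Icc_self
  · filter_upwards [eventually_ge_atTop a] with L hL
    have h1 := hardy_interval ha hL (fun r hr => hf r hr.1) (hc.mono Icc_subset_Ici_self)
    have h3 : ∫ r in a..L, f' r ^ 2 ≤ ∫ r in Ioi a, f' r ^ 2 := by
      rw [intervalIntegral.integral_of_le hL]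
      exact setIntegral_mono_set hi (.of_forall fun ρ => sq_nonneg _)
        Ioc_subset_Ioi_self.eventuallyLE
    have h4 : ∫ r in a..L, ‖f r ^ 2 / r ^ 2‖ = ∫ r in a..L, f r ^ 2 / r ^ 2 := by
      refine intervalIntegral.integral_congr fun r _ => ?_
      rw [norm_of_nonneg (by positivity)]
    rw [h4]
    linarith

/-! ### A priori bounds in null coordinates -/

theorem integral_exp_sub_le {α x y : ℝ} (hα : 0 < α) :
    ∫ z in x..y, exp (α * (z - x)) ≤ exp (α * (y - x)) / α := by
  have h : ∀ z ∈ uIcc x y, HasDerivAt (fun z => exp (α * (z - x)) / α)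
      (exp (α * (z - x))) z := fun z _ => by
    have h1 : HasDerivAt (fun z => α * (z - x)) α z := by
      simpa using ((hasDerivAt_id z).sub_const x).const_mul α
    exact (h1.exp.div_const α).congr_deriv (by field_simp)
  rw [intervalIntegral.integral_eq_sub_of_hasDerivAt h (Continuous.intervalIntegrable (by fun_prop) _ _)]
  simp
  positivity

theorem integral_exp_sub_le' {α x y : ℝ} (hα : 0 < α) :
    ∫ z in x..y, exp (α * (y - z)) ≤ exp (α * (y - x)) / α := by
  have h : ∀ z ∈ uIcc x y, HasDerivAt (fun z => -(exp (α * (y - z)) / α))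
      (exp (α * (y - z))) z := fun z _ => by
    have h1 : HasDerivAt (fun z => α * (y - z)) (-α) z := by
      simpa using ((hasDerivAt_id z).const_sub y).const_mul α
    exact (h1.exp.div_const α).neg.congr_deriv (by field_simp)
  rw [intervalIntegral.integral_eq_sub_of_hasDerivAt h (Continuous.intervalIntegrable (by fun_prop) _ _)]
  simp
  positivity

namespace NullWave

variable {κ s : ℝ → ℝ} {F A B : ℝ → ℝ → ℝ} {K s0 D : ℝ}

theorem swap (h : NullWave κ s F A B) :
    NullWave κ s (fun x y => F y x) (fun x y => B y x) (fun x y => A y x) := by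
  have hs : ContinuousOn (Prod.swap : ℝ × ℝ → ℝ × ℝ) (Ioi 0 ×ˢ Ioi 0) := continuous_swap.continuousOn
  have hm : MapsTo (Prod.swap : ℝ × ℝ → ℝ × ℝ) (Ioi 0 ×ˢ Ioi 0) (Ioi 0 ×ˢ Ioi 0) :=
    fun q hq => ⟨hq.2, hq.1⟩
  have hn : ∀ x y, nr y x = nr x y := fun x y => by unfold nr; ring
  refine ⟨h.κc, h.sc, h.cF.comp hs hm, h.cB.comp hs hm, h.cA.comp hs hm,
    fun ξ η hξ hη => h.dF' η ξ hη hξ, fun ξ η hξ hη => h.dF η ξ hη hξ, fun ξ η hξ hη => ?_,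
    fun ξ η hξ hη => ?_⟩
  · rw [hn η ξ]; exact h.dB η ξ hη hξ
  · rw [hn η ξ]; exact h.dA η ξ hη hξ

theorem cF_right (h : NullWave κ s F A B) {ξ : ℝ} (hξ : 0 < ξ) : ContinuousOn (F ξ) (Ioi 0) :=
  fun y hy => (h.dF' ξ y hξ hy).continuousAt.continuousWithinAt

theorem cB_right (h : NullWave κ s F A B) {ξ : ℝ} (hξ : 0 < ξ) : ContinuousOn (B ξ) (Ioi 0) :=
  h.cB.comp (Continuous.continuousOn (by fun_prop : Continuous fun y : ℝ => (ξ, y)))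
    fun _ hy => ⟨hξ, hy⟩

theorem src_right (h : NullWave κ s F A B) {ξ : ℝ} (hξ : 0 < ξ) :
    ContinuousOn (fun y => (κ (nr ξ y) * F ξ y + s (nr ξ y)) / 4) (Ioi 0) := by
  have hn : ContinuousOn (fun y => nr ξ y) (Ioi 0) := by unfold nr; fun_prop
  have hm : MapsTo (fun y => nr ξ y) (Ioi 0) (Ioi 0) := fun y hy => nr_pos hξ hy
  exact (((h.κc.comp hn hm).mul (h.cF_right hξ)).add (h.sc.comp hn hm)).div_const 4

theorem cAB_diag (h : NullWave κ s F A B) :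
    ContinuousOn (fun x => A x x) (Ioi 0) ∧ ContinuousOn (fun x => B x x) (Ioi 0) := by
  have hd : ContinuousOn (fun x : ℝ => (x, x)) (Ioi 0) := by fun_prop
  exact ⟨h.cA.comp hd fun x hx => ⟨hx, hx⟩, h.cB.comp hd fun x hx => ⟨hx, hx⟩⟩

/-- Pointwise bound of the source by the solution, away from the origin. -/
theorem src_le {M : ℝ} (hK : 0 ≤ K)
    (hκ : ∀ r, 0 < r → |κ r| ≤ K * r ^ (-2 : ℝ)) (hs : ∀ r, 0 < r → |s r| ≤ s0 * r ^ (-(3/2) : ℝ))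
    {x y : ℝ} (hr : 1 ≤ nr x y) (hM : |F x y| ≤ M * √(nr x y)) :
    |(κ (nr x y) * F x y + s (nr x y)) / 4| ≤ (K * M + s0) / 4 * nr x y ^ (-(3/2) : ℝ) := by
  have h0 : 0 < nr x y := one_pos.trans_le hr
  have e : nr x y ^ (-2 : ℝ) * √(nr x y) = nr x y ^ (-(3/2) : ℝ) := by
    rw [sqrt_eq_rpow, ← Real.rpow_add h0]; norm_num
  rw [abs_div, abs_of_pos (show (0:ℝ) < 4 by norm_num)]
  have h1 : |κ (nr x y) * F x y| ≤ K * M * nr x y ^ (-(3/2) : ℝ) := by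
    rw [abs_mul, ← e]
    calc _ ≤ K * nr x y ^ (-2 : ℝ) * (M * √(nr x y)) :=
          mul_le_mul (hκ _ h0) hM (abs_nonneg _) (by positivity)
      _ = _ := by ring
  have h2 := abs_add_le (κ (nr x y) * F x y) (s (nr x y))
  have h3 := hs _ h0
  linarith

/-- Growth of a solution off the diagonal `ξ = η`. -/
theorem apriori_aux (h : NullWave κ s F A B) (hK : 0 ≤ K) (hρ : 0 ≤ s0) (hD : 0 ≤ D)
    (hκ : ∀ r, 0 < r → |κ r| ≤ K * r ^ (-2 : ℝ)) (hs : ∀ r, 0 < r → |s r| ≤ s0 * r ^ (-(3/2) : ℝ))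
    (h1 : ∀ x, 1 ≤ x → |F x x| ≤ D * √x)
    (h2 : ∀ a b, 1 ≤ a → a ≤ b → ∫ x in a..b, B x x ^ 2 ≤ D ^ 2)
    {ξ η : ℝ} (hξ : 1 ≤ ξ) (hη : ξ ≤ η) :
    |F ξ η| ≤ (4 * D + s0) * exp ((1 + K) * (η - ξ)) * √(nr ξ η) := by
  set α := 1 + K with hα
  have hα0 : 0 < α := by positivity
  set T : Set (ℝ × ℝ) := {q | ξ ≤ q.1 ∧ q.1 ≤ q.2 ∧ q.2 ≤ η} with hT
  have hTc : IsCompact T := by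
    refine IsCompact.of_isClosed_subset (isCompact_Icc (a := (ξ, ξ)) (b := (η, η))) ?_ ?_
    · exact (isClosed_le continuous_const continuous_fst).inter
        ((isClosed_le continuous_fst continuous_snd).inter (isClosed_le continuous_snd continuous_const))
    · rintro ⟨x, y⟩ ⟨a, b, c⟩
      exact ⟨⟨a, a.trans b⟩, ⟨b.trans c, c⟩⟩
  have hpos : ∀ q ∈ T, 1 ≤ q.1 ∧ 1 ≤ q.2 ∧ 1 ≤ nr q.1 q.2 := by
    rintro ⟨x, y⟩ ⟨a, b, c⟩
    simp only at a b c ⊢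
    refine ⟨by linarith, by linarith, ?_⟩
    unfold nr; linarith
  set w : ℝ × ℝ → ℝ := fun q => exp (α * (q.2 - q.1)) * √(nr q.1 q.2) with hw
  have hw0 : ∀ q ∈ T, 0 < w q := fun q hq => by
    have := (hpos q hq).2.2
    have : 0 < nr q.1 q.2 := by linarith
    simp only [hw]; positivity
  have hwc : Continuous w := by simp only [hw, nr]; fun_prop
  have hFc : ContinuousOn (fun q : ℝ × ℝ => |F q.1 q.2| / w q) T :=
    (h.cF.mono fun q hq => ⟨one_pos.trans_le (hpos q hq).1, one_pos.trans_le (hpos q hq).2.1⟩).abs.div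
      hwc.continuousOn fun q hq => (hw0 q hq).ne'
  obtain ⟨⟨x₀, y₀⟩, hq0, hmax⟩ := hTc.exists_isMaxOn ⟨(ξ, η), le_refl _, hη, le_refl _⟩ hFc
  set M := |F x₀ y₀| / w (x₀, y₀) with hM
  have hM0 : 0 ≤ M := div_nonneg (abs_nonneg _) (hw0 _ hq0).le
  have hMF : ∀ x y, (x, y) ∈ T → |F x y| ≤ M * exp (α * (y - x)) * √(nr x y) := by
    intro x y hxy
    have : |F x y| / w (x, y) ≤ M := hmax hxy
    rw [div_le_iff₀ (hw0 _ hxy)] at this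
    simp only [hw] at this
    linarith
  suffices hMD : M ≤ 4 * D + s0 by
    refine (hMF ξ η ⟨le_refl _, hη, le_refl _⟩).trans ?_
    gcongr
  obtain ⟨hx0, hy0, hr0⟩ := hpos _ hq0
  obtain ⟨ha, hb, hc⟩ := hq0
  simp only at ha hb hc hx0 hy0 hr0
  have hsrc : ∀ x y, (x, y) ∈ T → |(κ (nr x y) * F x y + s (nr x y)) / 4| ≤
      (K * M + s0) / 4 * exp (α * (y - x)) := by
    intro x y hxy
    have hr := (hpos _ hxy).2.2
    refine (src_le hK hκ hs hr (hMF x y hxy)).trans ?_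
    have e1 : 1 ≤ exp (α * (y - x)) :=
      Real.one_le_exp (mul_nonneg hα0.le (sub_nonneg.2 hxy.2.1))
    have e2 : nr x y ^ (-(3/2) : ℝ) ≤ 1 := Real.rpow_le_one_of_one_le_of_nonpos hr (by norm_num)
    calc _ ≤ (K * (M * exp (α * (y - x))) + s0 * exp (α * (y - x))) / 4 * 1 := by
          gcongr
          exact le_mul_of_one_le_right hρ e1
      _ = _ := by ring
  have hBy : ∀ y ∈ Icc x₀ y₀, |B x₀ y - B y y| ≤
      (K * M + s0) / (4 * α) * exp (α * (y - x₀)) := by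
    intro y hy
    have hy1 : 0 < y := by linarith [hy.1]
    have hsub : uIcc x₀ y ⊆ Icc x₀ y := by rw [uIcc_of_le hy.1]
    have hc' : ContinuousOn (fun x => (κ (nr x y) * F x y + s (nr x y)) / 4) (Icc x₀ y) := by
      have := h.swap.src_right hy1
      have hn : ∀ x, nr y x = nr x y := fun x => by unfold nr; ring
      simp only [hn] at this
      exact this.mono fun x hx => (by linarith [hx.1] : (0:ℝ) < x)
    have ftc := intervalIntegral.integral_eq_sub_of_hasDerivAt (f := fun x => B x y)
      (fun x hx => h.dB x y (by linarith [(hsub hx).1]) hy1) (hc'.mono hsub).intervalIntegrable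
    rw [abs_sub_comm, ← ftc]
    have := intervalIntegral.norm_integral_le_of_norm_le (μ := volume)
      (f := fun x => (κ (nr x y) * F x y + s (nr x y)) / 4)
      (g := fun x => (K * M + s0) / 4 * exp (α * (y - x))) hy.1
      (.of_forall fun x hx =>
        hsrc x y ⟨ha.trans hx.1.le, hx.2, hy.2.trans hc⟩) (Continuous.intervalIntegrable (by fun_prop) _ _)
    refine this.trans ?_
    rw [intervalIntegral.integral_const_mul]
    calc _ ≤ (K * M + s0) / 4 * (exp (α * (y - x₀)) / α) := by
          gcongr
          exact integral_exp_sub_le' hα0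
      _ = _ := by field_simp
  have hsub : uIcc x₀ y₀ ⊆ Icc x₀ y₀ := by rw [uIcc_of_le hb]
  have hp : Icc x₀ y₀ ⊆ Ioi 0 := fun y hy => (by linarith [hy.1] : (0:ℝ) < y)
  have cB1 : IntervalIntegrable (fun y => B x₀ y) volume x₀ y₀ :=
    ((h.cB_right (by linarith)).mono (hsub.trans hp)).intervalIntegrable
  have cB2 : IntervalIntegrable (fun y => B y y) volume x₀ y₀ :=
    (h.cAB_diag.2.mono (hsub.trans hp)).intervalIntegrable
  have ftc := intervalIntegral.integral_eq_sub_of_hasDerivAt (f := fun y => F x₀ y)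
      (fun y hy => h.dF' x₀ y (by linarith) (hp (hsub hy))) cB1
  have i1 : |∫ y in x₀..y₀, (B x₀ y - B y y)| ≤
      (K * M + s0) / (4 * α ^ 2) * exp (α * (y₀ - x₀)) := by
    have := intervalIntegral.norm_integral_le_of_norm_le (μ := volume)
      (f := fun y => B x₀ y - B y y)
      (g := fun y => (K * M + s0) / (4 * α) * exp (α * (y - x₀))) hb
      (.of_forall fun y hy => hBy y ⟨hy.1.le, hy.2⟩) (Continuous.intervalIntegrable (by fun_prop) _ _)
    refine this.trans ?_
    rw [intervalIntegral.integral_const_mul]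
    calc _ ≤ (K * M + s0) / (4 * α) * (exp (α * (y₀ - x₀)) / α) := by
          gcongr
          exact integral_exp_sub_le hα0
      _ = _ := by field_simp
  have i2 : |∫ y in x₀..y₀, B y y| ≤ D * √(y₀ - x₀) := by
    refine (abs_integral_le_sqrt hb (h.cAB_diag.2.mono hp)).trans ?_
    gcongr
    exact sqrt_le_iff.2 ⟨hD, h2 _ _ hx0 hb⟩
  rw [intervalIntegral.integral_sub cB1 cB2, ftc] at i1
  have i3 := h1 x₀ hx0
  have hr1 : 1 ≤ √(nr x₀ y₀) := by rwa [Real.one_le_sqrt]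
  have j1 : √x₀ ≤ √(nr x₀ y₀) := sqrt_le_sqrt (by unfold nr; linarith)
  have j2 : √(y₀ - x₀) ≤ 2 * √(nr x₀ y₀) := by
    refine sqrt_le_iff.2 ⟨by positivity, ?_⟩
    rw [mul_pow, sq_sqrt (by linarith)]
    unfold nr; linarith
  have hE : 1 ≤ exp (α * (y₀ - x₀)) :=
    Real.one_le_exp (mul_nonneg hα0.le (sub_nonneg.2 hb))
  have htot : |F x₀ y₀| ≤ (3 * D + (K * M + s0) / (4 * α ^ 2)) *
      (exp (α * (y₀ - x₀)) * √(nr x₀ y₀)) := by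
    have t1 : |F x₀ y₀| ≤ |F x₀ x₀| + |∫ y in x₀..y₀, B y y| +
        |F x₀ y₀ - F x₀ x₀ - ∫ y in x₀..y₀, B y y| := by
      have := abs_add_three (F x₀ x₀) (∫ y in x₀..y₀, B y y)
        (F x₀ y₀ - F x₀ x₀ - ∫ y in x₀..y₀, B y y)
      rwa [show F x₀ x₀ + (∫ y in x₀..y₀, B y y) +
        (F x₀ y₀ - F x₀ x₀ - ∫ y in x₀..y₀, B y y) = F x₀ y₀ by ring] at this
    have t2 : D * √x₀ + D * √(y₀ - x₀) ≤ 3 * D * (exp (α * (y₀ - x₀)) * √(nr x₀ y₀)) := by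
      have : √(nr x₀ y₀) ≤ exp (α * (y₀ - x₀)) * √(nr x₀ y₀) :=
        le_mul_of_one_le_left (by positivity) hE
      nlinarith
    have t3 : (K * M + s0) / (4 * α ^ 2) * exp (α * (y₀ - x₀)) ≤
        (K * M + s0) / (4 * α ^ 2) * (exp (α * (y₀ - x₀)) * √(nr x₀ y₀)) := by
      gcongr
      exact le_mul_of_one_le_right (by positivity) hr1
    linarith
  have hMle : M ≤ 3 * D + (K * M + s0) / (4 * α ^ 2) := by
    rw [hM, div_le_iff₀ (hw0 _ ⟨ha, hb, hc⟩)]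
    exact htot
  have hα2 : (K * M + s0) / (4 * α ^ 2) ≤ (M + s0) / 4 := by
    rw [div_le_div_iff₀ (by positivity) (by norm_num)]
    have : K ≤ α ^ 2 := by rw [hα]; nlinarith
    have : 1 ≤ α ^ 2 := by rw [hα]; nlinarith
    nlinarith
  linarith

end NullWave

theorem rpow_five_half {r : ℝ} (hr : 0 < r) : r ^ (5/2 : ℝ) = r ^ 2 * √r := by
  rw [sqrt_eq_rpow, ← Real.rpow_natCast r 2, ← Real.rpow_add hr]
  norm_num

theorem rpow_five_half_sq {r : ℝ} (hr : 0 < r) : (r ^ (5/2 : ℝ)) ^ 2 = r ^ 5 := by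
  rw [rpow_five_half hr, mul_pow, sq_sqrt hr.le]
  ring

namespace NullWave

variable {κ s : ℝ → ℝ} {F A B : ℝ → ℝ → ℝ} {K s0 D : ℝ}

/-- Growth of a solution off the diagonal. -/
theorem apriori (h : NullWave κ s F A B) (hK : 0 ≤ K) (hρ : 0 ≤ s0) (hD : 0 ≤ D)
    (hκ : ∀ r, 0 < r → |κ r| ≤ K * r ^ (-2 : ℝ)) (hs : ∀ r, 0 < r → |s r| ≤ s0 * r ^ (-(3/2) : ℝ))
    (h1 : ∀ x, 1 ≤ x → |F x x| ≤ D * √x)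
    (hA : ∀ a b, 1 ≤ a → a ≤ b → ∫ x in a..b, A x x ^ 2 ≤ D ^ 2)
    (hB : ∀ a b, 1 ≤ a → a ≤ b → ∫ x in a..b, B x x ^ 2 ≤ D ^ 2)
    {ξ η : ℝ} (hξ : 1 ≤ ξ) (hη : 1 ≤ η) :
    |F ξ η| ≤ (4 * D + s0) * exp ((1 + K) * |η - ξ|) * √(nr ξ η) := by
  rcases le_total ξ η with hle | hle
  · rw [abs_of_nonneg (sub_nonneg.2 hle)]
    exact h.apriori_aux hK hρ hD hκ hs h1 hB hξ hle
  · rw [abs_sub_comm, abs_of_nonneg (sub_nonneg.2 hle), show nr ξ η = nr η ξ by unfold nr; ring]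
    exact h.swap.apriori_aux hK hρ hD hκ hs h1 hA hη hle

theorem abs_A_sub_le (h : NullWave κ s F A B) (hK : 0 ≤ K) (hρ : 0 ≤ s0)
    (hκ : ∀ r, 0 < r → |κ r| ≤ K * r ^ (-2 : ℝ)) (hs : ∀ r, 0 < r → |s r| ≤ s0 * r ^ (-(3/2) : ℝ))
    {M ξ η m : ℝ} (hM0 : 0 ≤ M) (hm : 1 ≤ m) (hξ : m ≤ ξ) (hη : m ≤ η)
    (hM : ∀ y, 1 ≤ y → |y - ξ| ≤ |η - ξ| → |F ξ y| ≤ M * √(nr ξ y)) :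
    |A ξ η - A ξ ξ| ≤ (K * M + s0) / 4 * m ^ (-(3/2) : ℝ) * |η - ξ| := by
  have hm0 : 0 < m := one_pos.trans_le hm
  have hlow : ∀ y ∈ uIcc ξ η, m ≤ y := fun y hy => (le_min hξ hη).trans hy.1
  refine Convex.norm_image_sub_le_of_norm_hasDerivWithin_le (f := A ξ) (s := uIcc ξ η)
    (fun y hy => (h.dA ξ y (by linarith) (by linarith [hlow y hy])).hasDerivWithinAt) (fun y hy => ?_)
    (convex_uIcc _ _) left_mem_uIcc right_mem_uIcc
  have hy := hlow y hy
  have hr : m ≤ nr ξ y := by unfold nr; linarith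
  have hyd : |y - ξ| ≤ |η - ξ| := by
    rename_i hy'
    exact abs_sub_left_of_mem_uIcc hy'
  refine (src_le hK hκ hs (hm.trans hr) (hM y (hm.trans hy) hyd)).trans ?_
  exact mul_le_mul_of_nonneg_left (Real.rpow_le_rpow_of_nonpos hm0 hr (by norm_num)) (by positivity)

/-- Square integrability of the incoming derivative on a time slice. -/
theorem slice_integrable (h : NullWave κ s F A B) (hK : 0 ≤ K) (hρ : 0 ≤ s0)
    (hκ : ∀ r, 0 < r → |κ r| ≤ K * r ^ (-2 : ℝ)) (hs : ∀ r, 0 < r → |s r| ≤ s0 * r ^ (-(3/2) : ℝ))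
    {M T : ℝ} (hM0 : 0 ≤ M)
    (hM : ∀ x y, 1 ≤ x → 1 ≤ y → |y - x| ≤ 2 * |T| → |F x y| ≤ M * √(nr x y))
    (hi : IntegrableOn (fun x => A x x ^ 2) (Ioi 1)) :
    IntegrableOn (fun r => A (r - T) (r + T) ^ 2) (Ioi (1 + |T|)) := by
  have hT := neg_abs_le T
  have hT' := le_abs_self T
  set C := (K * M + s0) / 4 * (2 * |T|)
  have hshift : IntegrableOn (fun r => A (r - T) (r - T) ^ 2) (Ioi (1 + |T|)) := by
    have h1 : IntegrableOn (fun x => A x x ^ 2) (Ioi (1 + |T| - T)) :=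
      hi.mono_set (Ioi_subset_Ioi (by linarith))
    have := (measurePreserving_sub_right volume T).integrableOn_comp_preimage
      (MeasurableEquiv.subRight T).measurableEmbedding (f := fun x => A x x ^ 2)
      (s := Ioi (1 + |T| - T))
    rw [show (fun x => x - T) ⁻¹' Ioi (1 + |T| - T) = Ioi (1 + |T|) by ext x; simp] at this
    exact this.2 h1
  have hdec : IntegrableOn (fun r => (r - |T|) ^ (-3 : ℝ)) (Ioi (1 + |T|)) := by
    have h1 := integrableOn_Ioi_rpow_of_lt (show (-3:ℝ) < -1 by norm_num) one_pos
    have := (measurePreserving_sub_right volume |T|).integrableOn_comp_preimage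
      (MeasurableEquiv.subRight |T|).measurableEmbedding (f := fun x : ℝ => x ^ (-3 : ℝ))
      (s := Ioi 1)
    rw [show (fun x => x - |T|) ⁻¹' Ioi 1 = Ioi (1 + |T|) by ext x; simp] at this
    exact this.2 h1
  refine Integrable.mono' ((hshift.const_mul 2).add (hdec.const_mul (2 * C ^ 2))) ?_ ?_
  · refine ContinuousOn.aestronglyMeasurable ?_ measurableSet_Ioi
    refine ContinuousOn.pow ?_ 2
    refine h.cA.comp (Continuous.continuousOn (by fun_prop : Continuous fun r : ℝ => (r - T, r + T)))
      fun r hr => ?_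
    have : 1 + |T| < r := hr
    exact ⟨show 0 < r - T by linarith, show 0 < r + T by linarith⟩
  · refine ae_Ioi fun r hr => ?_
    have hr : 1 + |T| < r := hr
    have e : r + T - (r - T) = 2 * T := by ring
    have hb := h.abs_A_sub_le hK hρ hκ hs (ξ := r - T) (η := r + T) (m := r - |T|) hM0 (by linarith)
      (by linarith) (by linarith) (fun y hy hyd => hM _ _ (by linarith) hy (by
        rw [e, abs_mul, abs_two] at hyd; exact hyd))
    rw [e, abs_mul, abs_two] at hb
    have e3 : (r - |T|) ^ (-3 : ℝ) = ((r - |T|) ^ (-(3/2) : ℝ)) ^ 2 := by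
      rw [← Real.rpow_natCast, ← Real.rpow_mul (by linarith)]; norm_num
    simp only [Pi.add_apply]
    rw [norm_eq_abs, abs_of_nonneg (sq_nonneg _), e3]
    have hb2 : |A (r - T) (r + T) - A (r - T) (r - T)| ≤ C * (r - |T|) ^ (-(3/2) : ℝ) := by
      refine hb.trans (le_of_eq ?_); simp only [C]; ring
    have := sq_le_sq' (neg_le_of_abs_le hb2) (le_of_abs_le hb2)
    nlinarith [sq_nonneg (A (r - T) (r + T) - 2 * A (r - T) (r - T))]

end NullWave

theorem Fn_eq {U : ℝ → ℝ → ℝ} (t r : ℝ) : Fn U (r - t) (r + t) = r ^ (5/2 : ℝ) * U t r := by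
  unfold Fn nr
  rw [show (r - t + (r + t)) / 2 = r by ring, show (r + t - (r - t)) / 2 = t by ring]

theorem An_eq {U : ℝ → ℝ → ℝ} (t r : ℝ) : An U (r - t) (r + t) =
    r ^ (5/2 : ℝ) * ((dR U t r - dT U t r) / 2 + 5 / 4 * U t r / r) := by
  unfold An nr
  rw [show (r - t + (r + t)) / 2 = r by ring, show (r + t - (r - t)) / 2 = t by ring]

theorem Bn_eq {U : ℝ → ℝ → ℝ} (t r : ℝ) : Bn U (r - t) (r + t) =
    r ^ (5/2 : ℝ) * ((dR U t r + dT U t r) / 2 + 5 / 4 * U t r / r) := by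
  unfold Bn nr
  rw [show (r - t + (r + t)) / 2 = r by ring, show (r + t - (r - t)) / 2 = t by ring]

/-- Persistence of decay and of finite energy for radial waves. -/
theorem RadWave.apriori {p S : ℝ → ℝ} {H : ℝ → ℝ → ℝ} {K s0 : ℝ} (h : RadWave p S H)
    (hp : ContinuousOn p (Ioi 0)) (hS : ContinuousOn S (Ioi 0)) (hK : 0 ≤ K) (hρ : 0 ≤ s0)
    (hκ : ∀ r, 0 < r → |15 / (4 * r ^ 2) + p r| ≤ K * r ^ (-2 : ℝ))
    (hs : ∀ r, 0 < r → |r ^ (5/2 : ℝ) * S r| ≤ s0 * r ^ (-(3/2) : ℝ))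
    (hE : IntegrableOn (fun r => r ^ 5 * (dT H 0 r ^ 2 + dR H 0 r ^ 2)) (Ioi 1))
    (hlim : Tendsto (H 0) atTop (𝓝 0)) :
    (∀ T, ∃ M, ∀ t r, |t| ≤ T → 1 + |t| ≤ r → |H t r| ≤ M * (r ^ 2)⁻¹) ∧
    (∀ t, IntegrableOn (fun r => r ^ 5 * (dT H t r ^ 2 + dR H t r ^ 2)) (Ioi |t|)) := by
  obtain ⟨hT, hR, -, -⟩ := C2_partials h.smooth
  have hsm := h.smooth.of_le (show (1 : WithTop ℕ∞) ≤ 2 by norm_num)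
  have hN := h.null hp hS
  have cl : ∀ (X : ℝ → ℝ → ℝ) (t : ℝ), Continuous (unc X) → Continuous (X t) :=
    fun X t hX => hX.comp (f := fun r : ℝ => (t, r)) (by fun_prop)
  have hER : IntegrableOn (fun r => r ^ 5 * dR H 0 r ^ 2) (Ioi 1) := by
    refine Integrable.mono' hE ?_ ?_
    · exact (Continuous.aestronglyMeasurable (by
        have := cl _ 0 hR.continuous
        fun_prop))
    · refine ae_Ioi fun r hr => ?_
      have : (0:ℝ) < r := one_pos.trans hr
      rw [norm_of_nonneg (by positivity)]
      have : 0 ≤ r ^ 5 * dT H 0 r ^ 2 := by positivity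
      linarith
  set E0 := ∫ r in Ioi (1:ℝ), r ^ 5 * dR H 0 r ^ 2 with hE0
  have hb0 : ∀ r, 1 ≤ r → |H 0 r| ≤ (r ^ 2)⁻¹ / 2 * √E0 := by
    obtain ⟨c, hc1, hc2⟩ := limit_of_energy one_pos (fun r _ => hasDerivAt_dR hsm 0 r)
      (cl _ 0 hR.continuous).continuousOn hER
    rw [tendsto_nhds_unique hc1 hlim] at hc2
    intro r hr
    have := hc2 r hr
    rw [sub_zero] at this
    refine this.trans ?_
    gcongr
    refine setIntegral_mono_set hER ?_ (Ioi_subset_Ioi hr).eventuallyLE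
    refine ae_Ioi fun r hr => ?_
    have : (0:ℝ) < r := one_pos.trans hr
    simp only [Pi.zero_apply]
    positivity
  have hH3 : IntegrableOn (fun r => r ^ 3 * H 0 r ^ 2) (Ioi 1) := by
    refine hardy_weighted (M := E0) one_pos (fun r _ => hasDerivAt_dR hsm 0 r)
      (cl _ 0 hR.continuous).continuousOn hER fun r hr => ?_
    have h0 : (0:ℝ) < r := one_pos.trans_le hr
    have hE00 : 0 ≤ E0 := setIntegral_nonneg measurableSet_Ioi fun r hr => by
      have : (0:ℝ) < r := one_pos.trans hr
      positivity
    have h1 := hb0 r hr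
    have h2 : r ^ 2 * |H 0 r| ≤ √E0 := by
      calc _ ≤ r ^ 2 * ((r ^ 2)⁻¹ / 2 * √E0) := by gcongr
        _ = √E0 / 2 := by field_simp
        _ ≤ √E0 := by linarith [sqrt_nonneg E0]
    have h3 := pow_le_pow_left₀ (by positivity) h2 2
    rw [sq_sqrt hE00, mul_pow, sq_abs] at h3
    calc _ = (r ^ 2) ^ 2 * H 0 r ^ 2 := by ring
      _ ≤ _ := h3
  have hmaj : IntegrableOn (fun r => r ^ 5 * (dT H 0 r ^ 2 + dR H 0 r ^ 2) +
      25 / 8 * (r ^ 3 * H 0 r ^ 2)) (Ioi 1) := hE.add (hH3.const_mul _)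
  have hzz : ∀ r : ℝ, An H r r = r ^ (5/2 : ℝ) * ((dR H 0 r - dT H 0 r) / 2 + 5 / 4 * H 0 r / r) ∧
      Bn H r r = r ^ (5/2 : ℝ) * ((dR H 0 r + dT H 0 r) / 2 + 5 / 4 * H 0 r / r) := fun r => by
    have h1 := An_eq (U := H) 0 r
    have h2 := Bn_eq (U := H) 0 r
    rw [sub_zero, add_zero] at h1 h2
    exact ⟨h1, h2⟩
  have alg : ∀ r : ℝ, 0 < r → ∀ a b c : ℝ, (r ^ (5/2 : ℝ) * ((a + b) / 2 + 5 / 4 * c / r)) ^ 2 ≤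
      r ^ 5 * (b ^ 2 + a ^ 2) + 25 / 8 * (r ^ 3 * c ^ 2) := by
    intro r hr a b c
    rw [mul_pow, rpow_five_half_sq hr]
    have : r ^ 5 * (b ^ 2 + a ^ 2) + 25 / 8 * (r ^ 3 * c ^ 2) -
        r ^ 5 * ((a + b) / 2 + 5 / 4 * c / r) ^ 2 =
        r ^ 5 * ((a - b) ^ 2 / 2 + ((a + b) / 2 - 5 / 4 * c / r) ^ 2) := by
      field_simp
      ring
    have : 0 ≤ r ^ 5 * ((a - b) ^ 2 / 2 + ((a + b) / 2 - 5 / 4 * c / r) ^ 2) := by positivity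
    linarith
  have hAle : ∀ r : ℝ, 0 < r → An H r r ^ 2 ≤ r ^ 5 * (dT H 0 r ^ 2 + dR H 0 r ^ 2) +
      25 / 8 * (r ^ 3 * H 0 r ^ 2) := fun r hr => by
    have := alg r hr (dR H 0 r) (-dT H 0 r) (H 0 r)
    rw [(hzz r).1, ← neg_sq (dT H 0 r), sub_eq_add_neg]
    exact this
  have hBle : ∀ r : ℝ, 0 < r → Bn H r r ^ 2 ≤ r ^ 5 * (dT H 0 r ^ 2 + dR H 0 r ^ 2) +
      25 / 8 * (r ^ 3 * H 0 r ^ 2) := fun r hr => by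
    rw [(hzz r).2]
    exact alg r hr (dR H 0 r) (dT H 0 r) (H 0 r)
  have one_sub : Ioi (1:ℝ) ⊆ Ioi 0 := Ioi_subset_Ioi zero_le_one
  have hAi : IntegrableOn (fun x => An H x x ^ 2) (Ioi 1) := by
    refine Integrable.mono' hmaj (((hN.cAB_diag.1.mono one_sub).pow 2).aestronglyMeasurable
      measurableSet_Ioi) (ae_Ioi (fun r hr => ?_))
    rw [norm_eq_abs, abs_of_nonneg (sq_nonneg _)]
    exact hAle r (one_sub hr)
  have hBi : IntegrableOn (fun x => Bn H x x ^ 2) (Ioi 1) := by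
    refine Integrable.mono' hmaj (((hN.cAB_diag.2.mono one_sub).pow 2).aestronglyMeasurable
      measurableSet_Ioi) (ae_Ioi (fun r hr => ?_))
    rw [norm_eq_abs, abs_of_nonneg (sq_nonneg _)]
    exact hBle r (one_sub hr)
  set IA := ∫ x in Ioi (1:ℝ), An H x x ^ 2
  set IB := ∫ x in Ioi (1:ℝ), Bn H x x ^ 2
  have hIA : 0 ≤ IA := integral_nonneg fun x => sq_nonneg _
  have hIB : 0 ≤ IB := integral_nonneg fun x => sq_nonneg _
  set D := √IA + √IB + √E0 with hD
  have hD0 : 0 ≤ D := by positivity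
  have hint : ∀ (g : ℝ → ℝ), IntegrableOn (fun x => g x ^ 2) (Ioi 1) →
      √(∫ x in Ioi (1:ℝ), g x ^ 2) ≤ D → ∀ a b, 1 ≤ a → a ≤ b → ∫ x in a..b, g x ^ 2 ≤ D ^ 2 := by
    intro g hg hgD a b ha hab
    have h1 : ∫ x in a..b, g x ^ 2 ≤ ∫ x in Ioi (1:ℝ), g x ^ 2 := by
      rw [intervalIntegral.integral_of_le hab]
      exact setIntegral_mono_set hg (.of_forall fun ρ => sq_nonneg _)
        (Ioc_subset_Ioi_self.trans (Ioi_subset_Ioi ha)).eventuallyLE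
    exact h1.trans ((sqrt_le_iff.1 hgD).2)
  have hA2 := hint (fun x => An H x x) hAi (by
    change √IA ≤ D
    linarith [sqrt_nonneg IB, sqrt_nonneg E0])
  have hB2 := hint (fun x => Bn H x x) hBi (by
    change √IB ≤ D
    linarith [sqrt_nonneg IA, sqrt_nonneg E0])
  have hF1 : ∀ x, 1 ≤ x → |Fn H x x| ≤ D * √x := by
    intro x hx
    have h0 : 0 < x := one_pos.trans_le hx
    have := Fn_eq (U := H) 0 x
    rw [sub_zero, add_zero] at this
    rw [this, abs_mul, abs_of_pos (by positivity), rpow_five_half h0]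
    calc _ ≤ x ^ 2 * √x * ((x ^ 2)⁻¹ / 2 * √E0) := by gcongr; exact hb0 x hx
      _ = √E0 / 2 * √x := by field_simp
      _ ≤ D * √x := by
        gcongr
        linarith [sqrt_nonneg IA, sqrt_nonneg IB, sqrt_nonneg E0]
  have hap : ∀ ξ η : ℝ, 1 ≤ ξ → 1 ≤ η → |Fn H ξ η| ≤
      (4 * D + s0) * exp ((1 + K) * |η - ξ|) * √(nr ξ η) := fun ξ η hξ hη =>
    hN.apriori hK hρ hD0 hκ hs hF1 hA2 hB2 hξ hη
  have part1 : ∀ T, ∃ M, 0 ≤ M ∧ ∀ ξ η : ℝ, 1 ≤ ξ → 1 ≤ η → |η - ξ| ≤ 2 * T →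
      |Fn H ξ η| ≤ M * √(nr ξ η) := by
    intro T
    refine ⟨(4 * D + s0) * exp ((1 + K) * (2 * T)), by positivity, fun ξ η hξ hη hd => ?_⟩
    refine (hap ξ η hξ hη).trans ?_
    gcongr
  refine ⟨fun T => ?_, fun t => ?_⟩
  · obtain ⟨M, hM0, hM⟩ := part1 T
    refine ⟨M, fun t r ht hr => ?_⟩
    have ha := neg_abs_le t
    have hb := le_abs_self t
    have h0 : 0 < r := by linarith [abs_nonneg t]
    have hm := hM (r - t) (r + t) (by linarith) (by linarith) (by
      rw [show r + t - (r - t) = 2 * t by ring, abs_mul, abs_two]; linarith)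
    rw [Fn_eq, show nr (r - t) (r + t) = r by unfold nr; ring, abs_mul,
      abs_of_pos (by positivity), rpow_five_half h0] at hm
    have hq : 0 < √r := sqrt_pos.2 h0
    rw [← div_eq_mul_inv, le_div_iff₀ (by positivity)]
    refine le_of_mul_le_mul_right ?_ hq
    linarith
  · obtain ⟨M, hM0, hM⟩ := part1 |t|
    have hsA := hN.slice_integrable hK hρ hκ hs (T := t) hM0 hM hAi
    have hsB := hN.swap.slice_integrable hK hρ hκ hs (T := -t) hM0
      (fun x y hx hy hd => by
        rw [show nr x y = nr y x by unfold nr; ring]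
        exact hM y x hy hx (by rwa [abs_sub_comm, ← abs_neg t])) hBi
    simp only [abs_neg, sub_neg_eq_add, ← sub_eq_add_neg, An_eq, Bn_eq] at hsA hsB
    set f : ℝ → ℝ := fun r => r ^ (5/2 : ℝ) * H t r with hf
    set f' : ℝ → ℝ := fun r => r ^ (5/2 : ℝ) * (dR H t r + 5 / 2 * H t r / r) with hf'
    have cH := cl _ t hsm.continuous
    have cR := cl _ t hR.continuous
    have cT := cl _ t hT.continuous
    have h1t : 0 < 1 + |t| := by positivity
    have cpow : ContinuousOn (fun r : ℝ => r ^ (5/2 : ℝ)) (Ioi 0) :=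
      continuousOn_id.rpow_const fun r hr => Or.inl (ne_of_gt hr)
    have cdiv : ContinuousOn (fun r : ℝ => 5 / 2 * H t r / r) (Ioi 0) :=
      (cH.const_mul _).continuousOn.div continuousOn_id fun r hr => ne_of_gt hr
    have cf' : ContinuousOn f' (Ioi 0) := cpow.mul (cR.continuousOn.add cdiv)
    have sub1 : Ici (1 + |t|) ⊆ Ioi 0 := fun r hr => h1t.trans_le hr
    have sub2 : Ioi (1 + |t|) ⊆ Ioi 0 := fun r hr => h1t.trans hr
    have hfd : ∀ r, 1 + |t| ≤ r → HasDerivAt f (f' r) r := by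
      intro r hr
      have h0 : 0 < r := sub1 hr
      refine ((Real.hasDerivAt_rpow_const (p := 5 / 2) (Or.inl h0.ne')).mul
        (hasDerivAt_dR hsm t r)).congr_deriv ?_
      rw [Real.rpow_sub_one h0.ne']
      simp only [hf']
      field_simp
      ring
    have hf'i : IntegrableOn (fun r => f' r ^ 2) (Ioi (1 + |t|)) := by
      refine Integrable.mono' ((hsA.const_mul 2).add (hsB.const_mul 2))
        (((cf'.mono sub2).pow 2).aestronglyMeasurable measurableSet_Ioi)
        (ae_Ioi (fun r hr => ?_))
      rw [norm_eq_abs, abs_of_nonneg (sq_nonneg _)]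
      simp only [hf', Pi.add_apply]
      have : ∀ P a b c : ℝ, (P * (a + c)) ^ 2 ≤ 2 * (P * ((a - b) / 2 + c / 2)) ^ 2 +
          2 * (P * ((a + b) / 2 + c / 2)) ^ 2 := by
        intro P a b c
        nlinarith [sq_nonneg (P * b)]
      refine (this _ _ (dT H t r) _).trans (le_of_eq ?_)
      ring
    have hff := hardy_Ioi h1t hfd (cf'.mono sub1) hf'i
    have hbig : IntegrableOn (fun r => r ^ 5 * (dT H t r ^ 2 + dR H t r ^ 2)) (Ioi (1 + |t|)) := by
      refine Integrable.mono' (((hsA.const_mul 2).add (hsB.const_mul 2)).add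
        ((hf'i.const_mul 2).add (hff.const_mul (25 / 2))))
        (Continuous.aestronglyMeasurable (by fun_prop))
        (ae_Ioi (fun r hr => ?_))
      have h0 : 0 < r := sub2 hr
      rw [norm_of_nonneg (by positivity)]
      simp only [Pi.add_apply, hf', hf]
      simp only [mul_pow, rpow_five_half_sq h0]
      have : (2 * (r ^ 5 * ((dR H t r - dT H t r) / 2 + 5 / 4 * H t r / r) ^ 2) +
          2 * (r ^ 5 * ((dR H t r + dT H t r) / 2 + 5 / 4 * H t r / r) ^ 2)) +
          (2 * (r ^ 5 * (dR H t r + 5 / 2 * H t r / r) ^ 2) +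
            25 / 2 * (r ^ 5 * H t r ^ 2 / r ^ 2)) - r ^ 5 * (dT H t r ^ 2 + dR H t r ^ 2) =
          r ^ 5 * (((dR H t r + 5 / 2 * H t r / r)) ^ 2 + (dR H t r + 5 * H t r / r) ^ 2) := by
        field_simp
        ring
      have : 0 ≤ r ^ 5 * (((dR H t r + 5 / 2 * H t r / r)) ^ 2 + (dR H t r + 5 * H t r / r) ^ 2) := by
        positivity
      linarith
    have hsmall : IntegrableOn (fun r => r ^ 5 * (dT H t r ^ 2 + dR H t r ^ 2)) (Ioc |t| (1 + |t|)) :=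
      (Continuous.integrableOn_Icc (by fun_prop)).mono_set Ioc_subset_Icc_self
    have := hsmall.union hbig
    rwa [Ioc_union_Ioi_eq_Ioi (by linarith)] at this

/-- The radial energy density. -/
def eden (U : ℝ → ℝ → ℝ) (t r : ℝ) : ℝ := r ^ 5 * (dT U t r ^ 2 + dR U t r ^ 2)

theorem eden_nonneg {U : ℝ → ℝ → ℝ} {t r : ℝ} (hr : 0 ≤ r) : 0 ≤ eden U t r := by
  unfold eden; positivity

theorem continuous_slice {X : ℝ → ℝ → ℝ} (hX : Continuous (unc X)) (t : ℝ) :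
    Continuous (X t) := hX.comp (f := fun r : ℝ => (t, r)) (by fun_prop)

theorem eden_continuous {U : ℝ → ℝ → ℝ} (h : ContDiff ℝ 2 (unc U)) (t : ℝ) :
    Continuous (eden U t) := by
  obtain ⟨hT, hR, -, -⟩ := C2_partials h
  have h1 := continuous_slice hT.continuous t
  have h2 := continuous_slice hR.continuous t
  unfold eden
  fun_prop

theorem integrableOn_dR_of_eden {U : ℝ → ℝ → ℝ} (h : ContDiff ℝ 2 (unc U))
    {t a : ℝ} (ha : 0 ≤ a) (hE : IntegrableOn (eden U t) (Ioi a)) :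
    IntegrableOn (fun r => r ^ 5 * dR U t r ^ 2) (Ioi a) ∧
      ∫ r in Ioi a, r ^ 5 * dR U t r ^ 2 ≤ ∫ r in Ioi a, eden U t r := by
  obtain ⟨hT, hR, -, -⟩ := C2_partials h
  have hle : ∀ r ∈ Ioi a, r ^ 5 * dR U t r ^ 2 ≤ eden U t r := fun r hr => by
    have : (0:ℝ) < r := ha.trans_lt hr
    have : 0 ≤ r ^ 5 * dT U t r ^ 2 := by positivity
    unfold eden
    linarith
  have hi : IntegrableOn (fun r => r ^ 5 * dR U t r ^ 2) (Ioi a) := by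
    refine Integrable.mono' hE ?_ ?_
    · exact (Continuous.aestronglyMeasurable (by
        have := continuous_slice hR.continuous t
        fun_prop))
    · refine ae_Ioi fun r hr => ?_
      have : (0:ℝ) < r := ha.trans_lt hr
      rw [norm_of_nonneg (by positivity)]
      exact hle r hr
  exact ⟨hi, setIntegral_mono_on hi hE measurableSet_Ioi hle⟩

/-- Outside the light cone, a radial wave of finite energy approaches its limit at spatial infinity
at a uniform quadratic rate. -/
theorem RadWave.exists_limit {p : ℝ → ℝ} {U : ℝ → ℝ → ℝ} {K s0 T₀ E₀ : ℝ}
    (h : RadWave p (fun _ => 0) U)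
    (hp : ContinuousOn p (Ioi 0)) (hK : 0 ≤ K) (hρ : 0 ≤ s0) (hT₀ : 0 < T₀)
    (hκ : ∀ r, 0 < r → |15 / (4 * r ^ 2) + p r| ≤ K * r ^ (-2 : ℝ))
    (hs : ∀ r, 0 < r → |r ^ (5/2 : ℝ) * p r| ≤ s0 * r ^ (-(3/2) : ℝ))
    (hE : IntegrableOn (eden U 0) (Ioi 0))
    (hbd : ∀ t, T₀ ≤ |t| → ∫ r in Ioi |t|, eden U t r ≤ E₀) :
    ∃ c M, 0 ≤ M ∧ (∀ t r, |t| ≤ r → 0 < r → |U t r - c| ≤ M * (r ^ 2)⁻¹) ∧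
      ∀ t, IntegrableOn (eden U t) (Ioi |t|) := by
  have hsm := h.smooth.of_le (show (1 : WithTop ℕ∞) ≤ 2 by norm_num)
  obtain ⟨hT, hR, -, -⟩ := C2_partials h.smooth
  have hR0 := (integrableOn_dR_of_eden h.smooth le_rfl hE).1.mono_set
    (Ioi_subset_Ioi (zero_le_one (α := ℝ)))
  obtain ⟨c, hc, -⟩ := limit_of_energy one_pos (fun r _ => hasDerivAt_dR hsm 0 r)
      (continuous_slice hR.continuous 0).continuousOn hR0
  have eT : dT (fun t r => U t r - c) = dT U := by
    funext t r; simp [dT]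
  have eR : dR (fun t r => U t r - c) = dR U := by
    funext t r; simp [dR]
  have hH : RadWave p (fun r => c * p r) (fun t r => U t r - c) := by
    refine ⟨h.smooth.sub contDiff_const, fun t r hr => ?_⟩
    have := h.eq t r hr
    rw [eT, eR]
    linear_combination this
  have hap := hH.apriori (K := K) (s0 := |c| * s0) hp (hp.const_mul c |>.congr fun _ _ => rfl)
    hK (by positivity) hκ
    (fun r hr => by
      have := hs r hr
      rw [show r ^ (5/2:ℝ) * (c * p r) = c * (r ^ (5/2:ℝ) * p r) by ring, abs_mul, mul_assoc]
      gcongr)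
    (by rw [eT, eR]; exact hE.mono_set (Ioi_subset_Ioi zero_le_one))
    (by have := hc.sub_const c; rwa [sub_self] at this)
  rw [eT, eR] at hap
  obtain ⟨hb, hi⟩ := hap
  obtain ⟨M1, hM1⟩ := hb T₀
  have hE0 : 0 ≤ E₀ := by
    refine le_trans ?_ (hbd T₀ (le_abs_self _))
    exact setIntegral_nonneg measurableSet_Ioi fun r hr =>
      eden_nonneg ((abs_nonneg _).trans (le_of_lt hr))
  obtain ⟨M2, hM2⟩ := (IsCompact.prod (isCompact_Icc (a := -T₀) (b := T₀))
    (isCompact_Icc (a := (0:ℝ)) (b := 1 + T₀))).exists_bound_of_continuousOn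
      (f := fun q : ℝ × ℝ => q.2 ^ 2 * (U q.1 q.2 - c))
      (by have := h.smooth.continuous; exact Continuous.continuousOn (by fun_prop))
  refine ⟨c, |M1| + |M2| + √E₀, by positivity, fun t r htr hr => ?_, hi⟩
  have hr2 : 0 < (r ^ 2)⁻¹ := by positivity
  have hs0 := sqrt_nonneg E₀
  have key : ∀ M', |U t r - c| ≤ M' * (r ^ 2)⁻¹ → M' ≤ |M1| + |M2| + √E₀ →
      |U t r - c| ≤ (|M1| + |M2| + √E₀) * (r ^ 2)⁻¹ := fun M' h1 h2 =>
    h1.trans (mul_le_mul_of_nonneg_right h2 hr2.le)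
  rcases le_total T₀ |t| with h1 | h1
  · have ht0 : 0 < |t| := hT₀.trans_le h1
    obtain ⟨i1, i2⟩ := integrableOn_dR_of_eden h.smooth (abs_nonneg t) (hi t)
    obtain ⟨c', hc1, hc2⟩ := limit_of_energy ht0 (fun r _ => hasDerivAt_dR hsm t r)
      (continuous_slice hR.continuous t).continuousOn i1
    have hcc : c' = c := by
      obtain ⟨M3, hM3⟩ := hb |t|
      refine tendsto_nhds_unique hc1 ?_
      rw [tendsto_iff_norm_sub_tendsto_zero]
      have hz : Tendsto (fun r : ℝ => M3 * (r ^ 2)⁻¹) atTop (𝓝 0) := by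
        have := (tendsto_inv_atTop_zero.comp (tendsto_pow_atTop (α := ℝ) two_ne_zero)).const_mul M3
        rwa [mul_zero] at this
      refine squeeze_zero' (.of_forall fun _ => norm_nonneg _) ?_ hz
      filter_upwards [eventually_ge_atTop (1 + |t|)] with r hr
      exact hM3 t r le_rfl hr
    rw [hcc] at hc2
    refine key (√E₀) ((hc2 r htr).trans ?_) (by linarith [abs_nonneg M1, abs_nonneg M2])
    have : √(∫ ρ in Ioi r, ρ ^ 5 * dR U t ρ ^ 2) ≤ √E₀ := by
      refine sqrt_le_sqrt (le_trans (setIntegral_mono_set i1 ?_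
        (Ioi_subset_Ioi htr).eventuallyLE) (i2.trans (hbd t h1)))
      refine ae_Ioi fun ρ hρ => ?_
      have : (0:ℝ) < ρ := ht0.trans hρ
      simp only [Pi.zero_apply]
      positivity
    nlinarith
  · rcases le_total (1 + |t|) r with h2 | h2
    · exact key M1 (hM1 t r h1 h2) (by linarith [le_abs_self M1, abs_nonneg M2])
    · refine key M2 ?_ (by linarith [le_abs_self M2, abs_nonneg M1])
      have := hM2 (t, r) ⟨⟨by linarith [neg_abs_le t], by linarith [le_abs_self t]⟩, hr.le, by linarith⟩
      rw [norm_eq_abs, abs_mul, abs_of_nonneg (by positivity)] at this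
      rw [← div_eq_mul_inv, le_div_iff₀ (by positivity), mul_comm]
      exact this

theorem tail_hasDerivAt_of_lt {g : ℝ → ℝ} {b r : ℝ} (hr : b < r) (hc : ContinuousOn g (Ioi b))
    (hi : ∀ a, b < a → IntegrableOn g (Ioi a)) :
    HasDerivAt (fun r => ∫ ρ in Ioi r, g ρ) (-g r) r := by
  have e : ∀ x, ∫ ρ in Ioi x, g ρ = ∫ ρ in Ioi (x - b), g (b + ρ) := fun x => by
    rw [integral_Ioi_shift g x, integral_Ioi_shift (fun ρ => g (b + ρ)) (x - b)]
    congr 1; ext σ; congr 1; ring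
  simp only [e]
  have h1 := tail_hasDerivAt (g := fun ρ => g (b + ρ)) (sub_pos.2 hr)
    (hc.comp (f := fun ρ => b + ρ) (by fun_prop) fun ρ hρ => by
      have : 0 < ρ := hρ
      simpa using this)
    (fun a ha => by
      have h2 := (integrableOn_Ioi_shift (g := g) (r := b + a)).2 (hi _ (by linarith))
      rw [← integrableOn_Ioi_shift (g := fun ρ => g (b + ρ)) (r := a)]
      refine h2.congr_fun (fun σ _ => ?_) measurableSet_Ioi
      change g (b + a + σ) = g (b + (a + σ))
      rw [add_assoc])
  rw [show b + (r - b) = r by ring] at h1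
  refine (HasDerivAt.comp (h₂ := fun x => ∫ ρ in Ioi x, g (b + ρ)) r h1
    ((hasDerivAt_id r).sub_const b)).congr_deriv (by simp)

/-- The incoming radiation field of a radial wave. -/
def rad (κ s : ℝ → ℝ) (H : ℝ → ℝ → ℝ) (x : ℝ) : ℝ := An H x x + 1 / 2 * tailI κ s (Fn H) x x

section
variable {p S : ℝ → ℝ} {H : ℝ → ℝ → ℝ} {K M s0 : ℝ}

theorem abs_Fn_le (hM : ∀ t r, |t| ≤ r → 0 < r → |H t r| ≤ M * (r ^ 2)⁻¹) {ξ η : ℝ}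
    (hξ : 0 < ξ) (hη : 0 < η) : |Fn H ξ η| ≤ M * √(nr ξ η) := by
  have hr := nr_pos hξ hη
  have := hM ((η - ξ) / 2) (nr ξ η) (by rw [abs_le]; unfold nr; constructor <;> linarith) hr
  unfold Fn
  rw [abs_mul, abs_of_pos (by positivity), rpow_five_half hr]
  calc nr ξ η ^ 2 * √(nr ξ η) * |H ((η - ξ) / 2) (nr ξ η)|
      ≤ nr ξ η ^ 2 * √(nr ξ η) * (M * (nr ξ η ^ 2)⁻¹) := by gcongr
    _ = _ := by field_simp

/-- An even radial wave with quadratic decay outside the light cone, for a potential and a source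
bounded by powers. -/
structure RadBound (p S : ℝ → ℝ) (H : ℝ → ℝ → ℝ) (K M s0 : ℝ) : Prop extends RadWave p S H where
  even : ∀ t r, H (-t) r = H t r
  pc : ContinuousOn p (Ioi 0)
  Sc : ContinuousOn S (Ioi 0)
  K0 : 0 ≤ K
  s00 : 0 ≤ s0
  M0 : 0 ≤ M
  κb : ∀ r, 0 < r → |15 / (4 * r ^ 2) + p r| ≤ K * r ^ (-2 : ℝ)
  sb : ∀ r, 0 < r → |r ^ (5/2 : ℝ) * S r| ≤ s0 * r ^ (-(3/2) : ℝ)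
  Hb : ∀ t r, |t| ≤ r → 0 < r → |H t r| ≤ M * (r ^ 2)⁻¹

/-- An even radial wave with quadratic decay outside the light cone gives an exterior system in null
coordinates. -/
theorem RadBound.sys (h : RadBound p S H K M s0) :
    Sys (fun r => 15 / (4 * r ^ 2) + p r) (fun r => r ^ (5/2 : ℝ) * S r)
      (rad (fun r => 15 / (4 * r ^ 2) + p r) (fun r => r ^ (5/2 : ℝ) * S r) H) (Fn H) K M s0 ∧
    ∀ ξ η, 0 < ξ → 0 < η → An H ξ η =
      rad (fun r => 15 / (4 * r ^ 2) + p r) (fun r => r ^ (5/2 : ℝ) * S r) H ξ -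
      1 / 2 * tailI (fun r => 15 / (4 * r ^ 2) + p r) (fun r => r ^ (5/2 : ℝ) * S r) (Fn H) ξ η := by
  obtain ⟨h, heven, hp, hS, hK, hρ, hM0, hκ, hs, hM⟩ := h
  have hN := h.null hp hS
  set κ := fun r => 15 / (4 * r ^ 2) + p r
  set s := fun r => r ^ (5/2 : ℝ) * S r
  have hP : PreSys κ s (Fn H) K M s0 := by
    refine ⟨hK, hM0, hρ, hN.κc, hN.sc, hκ, hs, hN.cF, fun ξ η _ _ => ?_, fun ξ η hξ hη => ?_⟩
    · unfold Fn
      rw [show nr η ξ = nr ξ η by unfold nr; ring, show (ξ - η) / 2 = -((η - ξ) / 2) by ring, heven]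
    · refine (abs_Fn_le hM hξ hη).trans (mul_le_mul_of_nonneg_left ?_ hM0)
      rw [sqrt_eq_rpow]
      exact rpow_half_le_wgrow (nr_pos hξ hη)
  have dtail : ∀ ξ η, 0 < ξ → 0 < η → HasDerivAt (fun y => tailI κ s (Fn H) ξ y)
      (-(κ (nr ξ η) * Fn H ξ η + s (nr ξ η)) / 2) η := by
    intro ξ η hξ hη
    have h1 := tail_hasDerivAt_of_lt (g := fun ρ => κ ρ * Fn H ξ (2 * ρ - ξ) + s ρ)
      (b := ξ / 2) (r := (ξ + η) / 2) (by linarith) (hP.integrand_cont hξ)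
      (fun a ha => hP.integrand_int hξ ha)
    have h2 : HasDerivAt (fun y : ℝ => (ξ + y) / 2) (1 / 2) η :=
      ((hasDerivAt_id η).const_add ξ).div_const 2
    refine (HasDerivAt.comp (h₂ := fun x => ∫ ρ in Ioi x, (κ ρ * Fn H ξ (2 * ρ - ξ) + s ρ))
      η h1 h2).congr_deriv ?_
    rw [show 2 * ((ξ + η) / 2) - ξ = η by ring]
    unfold nr
    ring
  have hA : ∀ ξ η, 0 < ξ → 0 < η →
      An H ξ η = rad κ s H ξ - 1 / 2 * tailI κ s (Fn H) ξ η := by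
    intro ξ η hξ hη
    have hd : ∀ y ∈ Ioi (0:ℝ), HasDerivWithinAt
        (fun y => An H ξ y + 1 / 2 * tailI κ s (Fn H) ξ y) 0 (Ioi 0) y := fun y hy =>
      ((hN.dA ξ y hξ hy).add ((dtail ξ y hξ hy).const_mul (1/2))).congr_deriv (by ring)
        |>.hasDerivWithinAt
    have := Convex.norm_image_sub_le_of_norm_hasDerivWithin_le (C := 0) hd (fun _ _ => by simp)
      (convex_Ioi 0) (mem_Ioi.2 hξ) (mem_Ioi.2 hη)
    rw [zero_mul, norm_le_zero_iff, sub_eq_zero] at this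
    unfold rad
    linarith
  refine ⟨⟨hP, ?_, fun ξ η hξ hη => ?_⟩, hA⟩
  · unfold rad
    exact (hN.cA.comp (f := fun x : ℝ => (x, x)) (by fun_prop) fun x hx => ⟨hx, hx⟩).add
      (continuousOn_const.mul
        (hP.tailI_cont.comp (f := fun x : ℝ => (x, x)) (by fun_prop) fun x hx => ⟨hx, hx⟩))
  · have := hN.dF ξ η hξ hη
    rw [hA ξ η hξ hη] at this
    exact this

/-- The radiation field is controlled by the asymptotic exterior energy. -/
theorem RadBound.rad_le {E : ℝ} (h : RadBound p S H K M s0)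
    (hi : ∀ t, IntegrableOn (eden H t) (Ioi |t|))
    (hE : ∀ δ, 0 < δ → ∀ᶠ T in atTop, ∫ r in Ioi |T|, eden H T r ≤ E + δ)
    {x y : ℝ} (hx : 0 < x) (hxy : x < y) :
    ∫ z in x..y, rad (fun r => 15 / (4 * r ^ 2) + p r) (fun r => r ^ (5/2 : ℝ) * S r) H z ^ 2
      ≤ E := by
  have hM0 := h.M0
  obtain ⟨hsys, hA⟩ := h.sys
  obtain ⟨hT, hR, -, -⟩ := C2_partials h.smooth
  set κ := fun r => 15 / (4 * r ^ 2) + p r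
  set s := fun r => r ^ (5/2 : ℝ) * S r
  set G := rad κ s H
  have hGi : IntervalIntegrable (fun z => G z ^ 2) volume x y :=
    ((hsys.Gc.mono fun z hz => hx.trans_le hz.1).pow 2).intervalIntegrable_of_Icc hxy.le
  set D := K * M + s0
  have hD : 0 ≤ D := hsys.M0
  -- pointwise bound at a late time
  have pt : ∀ T z, 0 < T → x < z → G z ^ 2 ≤ eden H T (z + T) +
      2 * (5 / 4 * M * (√T)⁻¹ + 1 / 2 * D * wint T) ^ 2 := by
    intro T z hT0 hz
    have hz0 : 0 < z := hx.trans hz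
    have hr : 0 < z + T := by linarith
    have e1 := hA z (z + 2 * T) hz0 (by linarith)
    have e2 := An_eq (U := H) T (z + T)
    rw [show z + T - T = z by ring, show z + T + T = z + 2 * T by ring] at e2
    have b1 := hsys.tailI_bound hz0 (show 0 < z + 2 * T by linarith)
    rw [show (z + (z + 2 * T)) / 2 = z + T by ring] at b1
    have b2 : wint (z + T) ≤ wint T := wint_anti hT0 (by linarith)
    have b3 := h.Hb T (z + T) (by rw [abs_of_pos hT0]; linarith) hr
    set r := z + T
    have hTr : T ≤ r := by simp only [r]; linarith
    set g := r ^ (5/2 : ℝ) * ((dR H T r - dT H T r) / 2)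
    set e := r ^ (5/2 : ℝ) * (5 / 4 * H T r / r) + 1 / 2 * tailI κ s (Fn H) z (z + 2 * T)
    have hG : G z = g + e := by simp only [g, e]; linear_combination -e1 + e2
    have hg : g ^ 2 ≤ eden H T r / 2 := by
      simp only [g, eden]
      rw [mul_pow, rpow_five_half_sq hr]
      have : ((dR H T r - dT H T r) / 2) ^ 2 ≤ (dT H T r ^ 2 + dR H T r ^ 2) / 2 := by
        nlinarith [sq_nonneg (dR H T r + dT H T r)]
      have h5 : 0 < r ^ 5 := by positivity
      nlinarith
    have he1 : |r ^ (5/2 : ℝ) * (5 / 4 * H T r / r)| ≤ 5 / 4 * M * (√T)⁻¹ := by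
      rw [abs_mul, abs_div, abs_mul, abs_of_pos (show 0 < r ^ (5/2:ℝ) by positivity), abs_of_pos hr,
        abs_of_pos (show (0:ℝ) < 5/4 by norm_num), rpow_five_half hr]
      have hq : √r ^ 2 = r := sq_sqrt hr.le
      have hq0 : 0 < √r := sqrt_pos.2 hr
      calc r ^ 2 * √r * (5 / 4 * |H T r| / r) ≤ r ^ 2 * √r * (5 / 4 * (M * (r ^ 2)⁻¹) / r) := by
            gcongr
        _ = 5 / 4 * M * (√r / r) := by field_simp
        _ = 5 / 4 * M * (√r)⁻¹ := by
            congr 1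
            rw [div_eq_iff hr.ne', inv_mul_eq_div, eq_comm, _root_.div_eq_iff hq0.ne']
            linarith
        _ ≤ 5 / 4 * M * (√T)⁻¹ := by
            have := sqrt_pos.2 hT0
            gcongr
    have he : |e| ≤ 5 / 4 * M * (√T)⁻¹ + 1 / 2 * D * wint T := by
      refine (abs_add_le _ _).trans (add_le_add he1 ?_)
      rw [abs_mul, abs_of_pos (by norm_num), mul_assoc]
      refine mul_le_mul_of_nonneg_left (b1.trans ?_) (by norm_num)
      exact mul_le_mul_of_nonneg_left b2 hD
    have he' : e ^ 2 ≤ (5 / 4 * M * (√T)⁻¹ + 1 / 2 * D * wint T) ^ 2 := by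
      rw [← sq_abs e]; gcongr
    rw [hG]
    nlinarith [sq_nonneg (g - e)]
  have bd : ∀ T, 0 < T → ∫ z in x..y, G z ^ 2 ≤ (∫ r in Ioi |T|, eden H T r) +
      2 * (5 / 4 * M * (√T)⁻¹ + 1 / 2 * D * wint T) ^ 2 * (y - x) := by
    intro T hT0
    have hec := eden_continuous h.smooth T
    calc ∫ z in x..y, G z ^ 2 ≤ ∫ z in x..y, (eden H T (z + T) +
          2 * (5 / 4 * M * (√T)⁻¹ + 1 / 2 * D * wint T) ^ 2) := by
          refine intervalIntegral.integral_mono_on_of_le_Ioo hxy.le hGi ?_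
            fun z hz => pt T z hT0 hz.1
          exact Continuous.intervalIntegrable (by fun_prop) _ _
      _ = (∫ z in x..y, eden H T (z + T)) +
          2 * (5 / 4 * M * (√T)⁻¹ + 1 / 2 * D * wint T) ^ 2 * (y - x) := by
          rw [intervalIntegral.integral_add (Continuous.intervalIntegrable (by fun_prop) _ _)
            (by simp), intervalIntegral.integral_const, smul_eq_mul]
          ring
      _ ≤ _ := by
          refine add_le_add_left ?_ _
          rw [intervalIntegral.integral_comp_add_right (fun z => eden H T z),
            intervalIntegral.integral_of_le (by linarith)]
          refine setIntegral_mono_set (hi T) ?_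
            (Ioc_subset_Ioi_self.trans (Ioi_subset_Ioi ?_)).eventuallyLE
          · refine ae_Ioi fun r hr => ?_
            exact eden_nonneg ((abs_nonneg _).trans (le_of_lt hr))
          · rw [abs_of_pos hT0]; linarith
  have lim : Tendsto (fun T => 2 * (5 / 4 * M * (√T)⁻¹ + 1 / 2 * D * wint T) ^ 2 * (y - x))
      atTop (𝓝 0) := by
    have h1 : Tendsto (fun T : ℝ => (√T)⁻¹) atTop (𝓝 0) :=
      tendsto_inv_atTop_zero.comp Real.tendsto_sqrt_atTop
    have := ((((h1.const_mul (5/4*M)).add (tendsto_wint_atTop.const_mul (1/2*D))).pow 2).const_mul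
      2).mul_const (y - x)
    simpa using this
  refine le_of_forall_pos_le_add fun δ hδ => ?_
  have := ((hE (δ/2) (by linarith)).and ((lim.eventually (gt_mem_nhds (show 0 < δ/2 by
    linarith))).and (eventually_gt_atTop 0))).exists
  obtain ⟨T, h1, h2, h3⟩ := this
  linarith [bd T h3]

end

section
variable {p S : ℝ → ℝ} {H : ℝ → ℝ → ℝ} {K M s0 : ℝ}

theorem tendsto_sq_mul_of_eden (h : ContDiff ℝ 2 (unc H))
    (hM : ∀ t r, |t| ≤ r → 0 < r → |H t r| ≤ M * (r ^ 2)⁻¹)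
    (hi : IntegrableOn (eden H 0) (Ioi 0)) :
    Tendsto (fun r => r ^ 2 * H 0 r) atTop (𝓝 0) := by
  have hsm := h.of_le (show (1 : WithTop ℕ∞) ≤ 2 by norm_num)
  obtain ⟨hT, hR, -, -⟩ := C2_partials h
  have hR0 := (integrableOn_dR_of_eden h le_rfl hi).1
  obtain ⟨c, hc, hb⟩ := limit_of_energy one_pos (fun r _ => hasDerivAt_dR hsm 0 r)
      (continuous_slice hR.continuous 0).continuousOn
      (hR0.mono_set (Ioi_subset_Ioi zero_le_one))
  have hz : Tendsto (fun r : ℝ => M * (r ^ 2)⁻¹) atTop (𝓝 0) := by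
    have := (tendsto_inv_atTop_zero.comp (tendsto_pow_atTop (α := ℝ) two_ne_zero)).const_mul M
    rwa [mul_zero] at this
  have hc0 : c = 0 := by
    refine tendsto_nhds_unique hc (squeeze_zero_norm' ?_ hz)
    filter_upwards [eventually_gt_atTop 0] with r hr
    exact hM 0 r (by rw [abs_zero]; exact hr.le) hr
  rw [hc0] at hb
  have htail : Tendsto (fun r => ∫ ρ in Ioi r, ρ ^ 5 * dR H 0 ρ ^ 2) atTop (𝓝 0) := by
    have h1 := (intervalIntegral_tendsto_integral_Ioi 0 hR0 tendsto_id).const_sub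
      (∫ ρ in Ioi 0, ρ ^ 5 * dR H 0 ρ ^ 2)
    rw [sub_self] at h1
    refine h1.congr' ?_
    filter_upwards [eventually_ge_atTop 0] with r hr
    have := intervalIntegral.integral_Ioi_sub_Ioi hR0 hr
    simp only [id]
    linarith
  have h2 := htail.sqrt.const_mul (1/2)
  rw [sqrt_zero, mul_zero] at h2
  refine squeeze_zero_norm' ?_ h2
  filter_upwards [eventually_ge_atTop 1] with r hr
  have := hb r hr
  rw [sub_zero] at this
  rw [norm_eq_abs, abs_mul, abs_of_nonneg (by positivity)]
  calc r ^ 2 * |H 0 r| ≤ r ^ 2 * ((r ^ 2)⁻¹ / 2 * √(∫ ρ in Ioi r, ρ ^ 5 * dR H 0 ρ ^ 2)) := by gcongr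
    _ = _ := by
      have : r ≠ 0 := by linarith
      field_simp

theorem sq_sub_le_eden (h : ContDiff ℝ 2 (unc H)) {σ : ℝ} (hσ : 0 < σ)
    (hi : IntegrableOn (eden H σ) (Ioi |σ|)) :
    (σ ^ 2 * H σ (σ * 3) - σ ^ 2 * H σ (σ * 2)) ^ 2 ≤ ∫ r in Ioi |σ|, eden H σ r := by
  have hsm := h.of_le (show (1 : WithTop ℕ∞) ≤ 2 by norm_num)
  obtain ⟨hT, hR, -, -⟩ := C2_partials h
  have hRc := continuous_slice hR.continuous σ
  have hle : σ * 2 ≤ σ * 3 := by linarith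
  have e : H σ (σ * 3) - H σ (σ * 2) = ∫ r in (σ*2)..(σ*3), dR H σ r :=
    (intervalIntegral.integral_eq_sub_of_hasDerivAt (f := H σ) (fun r _ => hasDerivAt_dR hsm σ r)
      (hRc.intervalIntegrable _ _)).symm
  have h1 := abs_integral_le_sqrt hle hRc.continuousOn
  rw [← e, show σ * 3 - σ * 2 = σ by ring] at h1
  have hI0 : 0 ≤ ∫ r in (σ*2)..(σ*3), dR H σ r ^ 2 :=
    intervalIntegral.integral_nonneg hle fun _ _ => sq_nonneg _
  have h2 : (H σ (σ * 3) - H σ (σ * 2)) ^ 2 ≤ (∫ r in (σ*2)..(σ*3), dR H σ r ^ 2) * σ := by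
    have := pow_le_pow_left₀ (abs_nonneg _) h1 2
    rwa [sq_abs, mul_pow, sq_sqrt hI0, sq_sqrt hσ.le] at this
  obtain ⟨i1, i2⟩ := integrableOn_dR_of_eden h (abs_nonneg σ) hi
  have h3 : σ ^ 5 * ∫ r in (σ*2)..(σ*3), dR H σ r ^ 2 ≤ ∫ r in Ioi |σ|, eden H σ r := by
    refine le_trans ?_ i2
    rw [← intervalIntegral.integral_const_mul]
    calc ∫ r in (σ*2)..(σ*3), σ ^ 5 * dR H σ r ^ 2
        ≤ ∫ r in (σ*2)..(σ*3), r ^ 5 * dR H σ r ^ 2 := by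
          refine intervalIntegral.integral_mono_on hle
            (Continuous.intervalIntegrable (by fun_prop) _ _)
            (Continuous.intervalIntegrable (by fun_prop) _ _) fun r hr => ?_
          have : σ ≤ r := by linarith [hr.1]
          gcongr
      _ ≤ _ := by
          rw [intervalIntegral.integral_of_le hle]
          refine setIntegral_mono_set i1 ?_ (Ioc_subset_Ioi_self.trans (Ioi_subset_Ioi ?_)).eventuallyLE
          · refine ae_Ioi fun r hr => ?_
            have : 0 < r := (abs_nonneg σ).trans_lt hr
            simp only [Pi.zero_apply]
            positivity
          · rw [abs_of_pos hσ]; linarith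
  calc (σ ^ 2 * H σ (σ * 3) - σ ^ 2 * H σ (σ * 2)) ^ 2
      = σ ^ 4 * (H σ (σ * 3) - H σ (σ * 2)) ^ 2 := by ring
    _ ≤ σ ^ 4 * ((∫ r in (σ*2)..(σ*3), dR H σ r ^ 2) * σ) := by gcongr
    _ = σ ^ 5 * ∫ r in (σ*2)..(σ*3), dR H σ r ^ 2 := by ring
    _ ≤ _ := h3

theorem tendsto_integral_far {G : ℝ → ℝ} {E : ℝ} (hG : ContinuousOn G (Ioi 0))
    (hE : ∀ x y, 0 < x → x < y → ∫ z in x..y, G z ^ 2 ≤ E) {a b : ℝ} (ha : 0 < a) (hb : 0 < b)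
    {σ : ℕ → ℝ} (hσ : Tendsto σ atTop atTop) :
    Tendsto (fun n => ∫ z in (σ n * a)..(σ n * b), G z ^ 2) atTop (𝓝 0) := by
  have hGI : ∀ x y, 0 < x → 0 < y → IntervalIntegrable (fun z => G z ^ 2) volume x y :=
    fun x y hx hy => ContinuousOn.intervalIntegrable
      ((hG.mono fun z hz => (lt_min hx hy).trans_le hz.1).pow 2)
  have hint : IntegrableOn (fun z => G z ^ 2) (Ioi 1) := by
    refine integrableOn_Ioi_of_intervalIntegral_norm_bounded (b := id) E 1 (fun i => ?_) tendsto_id ?_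
    · rcases le_total i 1 with h | h
      · simp [Ioc_eq_empty_of_le h]
      · exact (intervalIntegrable_iff_integrableOn_Ioc_of_le h).1 (hGI 1 i one_pos (by linarith))
    · filter_upwards [eventually_gt_atTop 1] with i hi
      simp only [norm_eq_abs, abs_sq, id]
      exact hE 1 i one_pos hi
  have h1 := intervalIntegral_tendsto_integral_Ioi 1 hint (hσ.atTop_mul_const hb)
  have h2 := intervalIntegral_tendsto_integral_Ioi 1 hint (hσ.atTop_mul_const ha)
  have h3 := h1.sub h2
  rw [sub_self] at h3
  refine h3.congr' ?_
  filter_upwards [hσ.eventually_gt_atTop 0] with n hn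
  exact intervalIntegral.integral_interval_sub_left (hGI _ _ one_pos (mul_pos hn hb))
    (hGI _ _ one_pos (mul_pos hn ha))

/-- The leading coefficient of the source at infinity is controlled by the asymptotic exterior
energy. -/
theorem RadBound.source_limit_le {E c : ℝ} (h : RadBound p S H K M s0)
    (hi : ∀ t, IntegrableOn (eden H t) (Ioi |t|))
    (hE : ∀ δ, 0 < δ → ∀ᶠ T in atTop, ∫ r in Ioi |T|, eden H T r ≤ E + δ)
    (hplim : Tendsto (fun r => r ^ 2 * p r) atTop (𝓝 0))
    (hSlim : Tendsto (fun r => r ^ 4 * S r) atTop (𝓝 c)) : c ^ 2 ≤ 1600 * E := by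
  obtain ⟨hsys, -⟩ := h.sys
  have hG := fun x y hx hxy => h.rad_le hi hE (x := x) (y := y) hx hxy
  set κ := fun r => 15 / (4 * r ^ 2) + p r with hκdef
  set s := fun r => r ^ (5/2 : ℝ) * S r with hsdef
  set G := rad κ s H
  have hi0 := hi 0
  rw [abs_zero] at hi0
  have hH0 := tendsto_sq_mul_of_eden h.smooth h.Hb hi0
  set σ : ℕ → ℝ := fun n => (n : ℝ) + 1 with hσdef
  have hσ : ∀ n, 0 < σ n := fun n => by simp only [σ]; positivity
  have hσt : Tendsto σ atTop atTop := tendsto_atTop_add_const_right _ _ tendsto_natCast_atTop_atTop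
  have hσr : ∀ r, 0 < r → Tendsto (fun n => σ n * r) atTop atTop := fun r hr =>
    hσt.atTop_mul_const hr
  have hsc : ∀ n, Sys (fun r => σ n ^ 2 * κ (σ n * r)) (fun r => σ n * √(σ n) / 1 * s (σ n * r))
      (fun x => √(σ n) / 1 * G (σ n * x)) (fun ξ η => Fn H (σ n * ξ) (σ n * η) / (√(σ n) * 1))
      K M (s0 / 1) := fun n => by
    refine hsys.scale (hσ n) one_pos (fun r _ => rfl) h.M0 fun ξ η hξ hη => ?_
    have h1 := abs_Fn_le h.Hb (mul_pos (hσ n) hξ) (mul_pos (hσ n) hη)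
    rw [show nr (σ n * ξ) (σ n * η) = σ n * nr ξ η by unfold nr; ring,
      sqrt_mul (hσ n).le] at h1
    have hq := sqrt_pos.2 (hσ n)
    rw [mul_one, abs_div, abs_of_pos hq, div_le_iff₀ hq]
    have h2 : √(nr ξ η) ≤ wgrow ((ξ + η) / 2) := by
      rw [sqrt_eq_rpow]; exact rpow_half_le_wgrow (nr_pos hξ hη)
    have h3 := mul_le_mul_of_nonneg_left h2 (mul_nonneg h.M0 hq.le)
    linarith
  have g1 : ∀ a b, 0 < a → a < b → Tendsto (fun n => ∫ x in a..b,
      (√(σ n) / 1 * G (σ n * x)) ^ 2) atTop (𝓝 0) := by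
    intro a b ha hab
    refine (tendsto_integral_far hsys.Gc hG ha (ha.trans hab) hσt).congr fun n => ?_
    have := intervalIntegral.mul_integral_comp_mul_left (a := a) (b := b)
      (f := fun z => G z ^ 2) (σ n)
    rw [← this, ← intervalIntegral.integral_const_mul]
    congr 1; ext z
    rw [div_one, mul_pow, sq_sqrt (hσ n).le]
  have g3 : ContinuousOn (fun r : ℝ => c * (√r / r ^ 2)) (Ioi 0) :=
    continuousOn_const.mul (ContinuousOn.div (by fun_prop) (by fun_prop)
      fun r (hr : 0 < r) => by positivity)
  have g4 : ∀ r, 0 < r → Tendsto (fun n => σ n ^ 2 * κ (σ n * r)) atTop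
      (𝓝 (15 / (4 * r ^ 2))) := by
    intro r hr
    have := ((hplim.comp (hσr r hr)).div_const (r ^ 2)).const_add (15 / (4 * r ^ 2))
    rw [zero_div, add_zero] at this
    refine this.congr fun n => ?_
    have := hσ n
    simp only [Function.comp, hκdef]
    field_simp
  have g5 : ∀ r, 0 < r → Tendsto (fun n => σ n * √(σ n) / 1 * s (σ n * r)) atTop
      (𝓝 (c * (√r / r ^ 2))) := by
    intro r hr
    refine ((hSlim.comp (hσr r hr)).mul_const (√r / r ^ 2)).congr fun n => ?_
    have h0 := hσ n
    have hq := sq_sqrt h0.le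
    simp only [Function.comp, hsdef]
    rw [rpow_five_half (by positivity), sqrt_mul h0.le]
    field_simp
    rw [hq]
    ring
  obtain ⟨φ, F', hφ, hS', hF'⟩ := Sys.exists_subseq hsc g1 ⟨inv_sq_cont, g3, g4, g5⟩
  -- values of the rescaled functions
  have hval : ∀ n t r, 0 < r → Fn H (σ n * (r - t)) (σ n * (r + t)) / (√(σ n) * 1) =
      r ^ 2 * √r * (σ n ^ 2 * H (σ n * t) (σ n * r)) := by
    intro n t r hr
    have h0 := hσ n
    have := sqrt_pos.2 h0
    rw [mul_sub, mul_add, Fn_eq, rpow_five_half (by positivity), sqrt_mul h0.le]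
    field_simp
  have hdiag : ∀ r, 0 < r → F' r r = 0 := by
    intro r hr
    refine tendsto_nhds_unique (hF' r r hr hr) ?_
    have := ((hH0.comp (hσr r hr)).comp hφ.tendsto_atTop).const_mul √r
    rw [mul_zero] at this
    refine this.congr fun n => ?_
    have := hval (φ n) 0 r hr
    rw [sub_zero, add_zero, mul_zero] at this
    simp only [Function.comp]
    rw [this]
    ring
  have hrig := (hS'.change_K (K' := 33/4) (by norm_num) fun r hr => by
    rw [abs_of_pos (by positivity), Real.rpow_neg hr.le, Real.rpow_two, ← div_eq_mul_inv,
      div_le_div_iff₀ (by positivity) (by positivity)]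
    nlinarith [sq_nonneg r]).rigid_source hdiag
  have lim : ∀ r, 1 < r → Tendsto (fun n => σ (φ n) ^ 2 * H (σ (φ n)) (σ (φ n) * r)) atTop
      (𝓝 (-(1 / 2 * c / r ^ 4))) := by
    intro r hr
    have hr0 : 0 < r := by linarith
    have h1 := hF' (r - 1) (r + 1) (by linarith) (by linarith)
    rw [hrig r 1 (by rw [abs_one]; exact hr)] at h1
    have h2 := h1.mul_const ((r ^ 2 * √r)⁻¹)
    have hq := sqrt_pos.2 hr0
    have e : -(1 / 2 * 1 ^ 2 * (c * (√r / r ^ 2))) * (r ^ 2 * √r)⁻¹ = -(1 / 2 * c / r ^ 4) := by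
      field_simp
    rw [e] at h2
    refine h2.congr fun n => ?_
    rw [hval (φ n) 1 r hr0, mul_one]
    field_simp
  have l3 := ((lim 3 (by norm_num)).sub (lim 2 (by norm_num))).pow 2
  have hfin : (-(1 / 2 * c / 3 ^ 4) - -(1 / 2 * c / 2 ^ 4)) ^ 2 ≤ E := by
    refine le_of_forall_pos_le_add fun δ hδ => ?_
    refine le_of_tendsto l3 ?_
    filter_upwards [(hσt.comp hφ.tendsto_atTop).eventually (hE δ hδ)] with n hn
    exact (sq_sub_le_eden h.smooth (hσ _) (hi _)).trans hn
  nlinarith [sq_nonneg c]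

end

/-! ### The multisoliton potential and the resonances as radial functions -/

theorem rescH_V6 {l : ℝ} (hl : 0 < l) (x : E6) : rescH l V6 x = Vr l ‖x‖ := by
  have : 0 < ‖x‖ ^ 2 + 24 * l ^ 2 := by positivity
  simp only [rescH, V6, W6, Vr, norm_smul, norm_inv, norm_eq_abs, abs_of_pos hl]
  field_simp
  ring

theorem LW6_eq (x : E6) : LW6 x = 2 * (1 - ‖x‖ ^ 2 / 24) / (1 + ‖x‖ ^ 2 / 24) ^ 3 := by
  have hp : 0 < 1 + ‖x‖ ^ 2 / 24 := by positivity
  have h1 := (hasStrictFDerivAt_norm_sq x).hasFDerivAt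
  have h2 : HasDerivAt (fun s : ℝ => ((1 + s / 24) ^ 2)⁻¹)
      (-(2 * (1 + ‖x‖ ^ 2 / 24) * (1 / 24)) / ((1 + ‖x‖ ^ 2 / 24) ^ 2) ^ 2) (‖x‖ ^ 2) := by
    have h3 : HasDerivAt (fun s : ℝ => (1 + s / 24) ^ 2) (2 * (1 + ‖x‖ ^ 2 / 24) * (1 / 24))
        (‖x‖ ^ 2) := by
      refine ((((hasDerivAt_id (‖x‖ ^ 2)).div_const 24).const_add 1).pow 2).congr_deriv ?_
      simp
    exact h3.inv (by positivity)
  have h3 := h2.comp_hasFDerivAt x h1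
  unfold LW6
  rw [show fderiv ℝ W6 x = _ from h3.fderiv]
  simp [W6]
  field_simp
  ring

theorem rescH_LW6 {l : ℝ} (hl : 0 < l) (x : E6) : rescH l LW6 x = phi l ‖x‖ := by
  have : 0 < ‖x‖ ^ 2 + 24 * l ^ 2 := by positivity
  simp only [rescH, LW6_eq, phi, norm_smul, norm_inv, norm_eq_abs, abs_of_pos hl]
  field_simp
  ring

/-- The multisoliton potential as a function of the radius. -/
def pot {J : ℕ} (lam : Fin J → ℝ) (r : ℝ) : ℝ := ∑ j, Vr (lam j) r

/-- A combination of resonances. -/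
def res {J : ℕ} (lam a : Fin J → ℝ) (r : ℝ) : ℝ := ∑ j, a j * phi (lam j) r

/-- The derivative of a combination of resonances. -/
def resd {J : ℕ} (lam a : Fin J → ℝ) (r : ℝ) : ℝ := ∑ j, a j * phid (lam j) r

/-- The source created by a constant and by the interaction of distinct resonances. -/
def src {J : ℕ} (lam a : Fin J → ℝ) (c r : ℝ) : ℝ :=
  c * pot lam r + ∑ j, a j * ((pot lam r - Vr (lam j) r) * phi (lam j) r)

/-- The even part of `U`, with a constant and a combination of resonances removed. -/
def rmd {J : ℕ} (U : ℝ → ℝ → ℝ) (lam a : Fin J → ℝ) (c t r : ℝ) : ℝ :=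
  (U t r + U (-t) r) / 2 - c - res lam a r

section
variable {J : ℕ} {lam : Fin J → ℝ} (hl : ∀ j, 0 < lam j) (a : Fin J → ℝ) {U : ℝ → ℝ → ℝ}
include hl

theorem Vmulti_eq (x : E6) : Vmulti lam x = pot lam ‖x‖ :=
  Finset.sum_congr rfl fun j _ => rescH_V6 (hl j) x

theorem hasDerivAt_res (r : ℝ) : HasDerivAt (res lam a) (resd lam a r) r :=
  (HasDerivAt.fun_sum fun j _ => (phi_der (hl j) r).const_mul (a j))

theorem hasDerivAt_resd {r : ℝ} (hr : 0 < r) : HasDerivAt (resd lam a)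
    (∑ j, a j * (Vr (lam j) r * phi (lam j) r - 5 / r * phid (lam j) r)) r :=
  (HasDerivAt.fun_sum fun j _ => (phid_der (hl j) hr).const_mul (a j))

theorem contDiff_res : ContDiff ℝ 2 (res lam a) := by
  refine ContDiff.sum fun j _ => contDiff_const.mul ?_
  have := hl j
  refine ContDiff.div (by fun_prop) (by fun_prop) fun r => ?_
  positivity

theorem continuous_resd : Continuous (resd lam a) := by
  refine continuous_finsetSum _ fun j _ => continuous_const.mul ?_
  have := hl j
  refine Continuous.div (by fun_prop) (by fun_prop) fun r => ?_
  positivity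

theorem continuous_pot : Continuous (pot lam) :=
  continuous_finsetSum _ fun j _ => Vr_cont (hl j)

theorem continuous_src (c : ℝ) : Continuous (src lam a c) := by
  have h1 := continuous_pot hl
  refine (continuous_const.mul h1).add (continuous_finsetSum _ fun j _ =>
    continuous_const.mul ((h1.sub (Vr_cont (hl j))).mul (phi_cont (hl j))))

theorem dT_rmd (h : ContDiff ℝ 2 (unc U)) (c t r : ℝ) :
    dT (rmd U lam a c) t r = (dT U t r - dT U (-t) r) / 2 := by
  have h1 := hasDerivAt_dT (h.of_le one_le_two) t r
  have h2 := (hasDerivAt_dT (h.of_le one_le_two) (-t) r).comp (h₂ := fun t' => U t' r) t (hasDerivAt_neg t)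
  refine HasDerivAt.deriv ((((h1.add h2).div_const 2).sub_const c).sub_const (res lam a r)
    |>.congr_deriv ?_)
  ring

theorem dR_rmd (h : ContDiff ℝ 2 (unc U)) (c t r : ℝ) :
    dR (rmd U lam a c) t r = (dR U t r + dR U (-t) r) / 2 - resd lam a r := by
  have h1 := hasDerivAt_dR (h.of_le one_le_two) t r
  have h2 := hasDerivAt_dR (h.of_le one_le_two) (-t) r
  exact HasDerivAt.deriv ((((h1.add h2).div_const 2).sub_const c).sub (hasDerivAt_res hl a r))

theorem RadWave.rmd (h : RadWave (pot lam) (fun _ => 0) U) (c : ℝ) :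
    RadWave (pot lam) (src lam a c) (rmd U lam a c) where
  smooth := by
    have h1 := h.smooth
    have h2 : ContDiff ℝ 2 (fun p : ℝ × ℝ => U (-p.1) p.2) :=
      h1.comp (g := unc U) (f := fun p : ℝ × ℝ => (-p.1, p.2)) (by fun_prop)
    exact (((h1.add h2).div_const 2).sub contDiff_const).sub
      ((contDiff_res hl a).comp (g := res lam a) (f := Prod.snd) contDiff_snd)
  eq := by
    intro t r hr
    obtain ⟨g1, g2, -, -⟩ := C2_partials h.smooth
    have e1 : dT (dT (_root_.rmd U lam a c)) t r = (dT (dT U) t r + dT (dT U) (-t) r) / 2 := by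
      have h1 := hasDerivAt_dT g1 t r
      have h2 := (hasDerivAt_dT g1 (-t) r).comp (h₂ := fun t' => dT U t' r) t (hasDerivAt_neg t)
      rw [show dT (_root_.rmd U lam a c) = fun t r => (dT U t r - dT U (-t) r) / 2 from
        funext fun t => funext fun r => dT_rmd hl a h.smooth c t r]
      refine HasDerivAt.deriv (((h1.sub h2).div_const 2).congr_deriv ?_)
      ring
    have e2 : dR (dR (_root_.rmd U lam a c)) t r = (dR (dR U) t r + dR (dR U) (-t) r) / 2 -
        ∑ j, a j * (Vr (lam j) r * phi (lam j) r - 5 / r * phid (lam j) r) := by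
      have h1 := hasDerivAt_dR g2 t r
      have h2 := hasDerivAt_dR g2 (-t) r
      rw [show dR (_root_.rmd U lam a c) = fun t r => (dR U t r + dR U (-t) r) / 2 - resd lam a r from
        funext fun t => funext fun r => dR_rmd hl a h.smooth c t r]
      exact HasDerivAt.deriv (((h1.add h2).div_const 2).sub (hasDerivAt_resd hl a hr))
    rw [e1, e2, dR_rmd hl a h.smooth]
    have e3 := h.eq t r hr
    have e4 := h.eq (-t) r hr
    have e5 : ∑ j, a j * (Vr (lam j) r * phi (lam j) r - 5 / r * phid (lam j) r) =
        ∑ j, a j * (Vr (lam j) r * phi (lam j) r) - 5 / r * resd lam a r := by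
      simp only [resd, Finset.mul_sum, ← Finset.sum_sub_distrib]
      exact Finset.sum_congr rfl fun j _ => by ring
    have e6 : src lam a c r = c * pot lam r + (pot lam r * res lam a r -
        ∑ j, a j * (Vr (lam j) r * phi (lam j) r)) := by
      simp only [src, res, Finset.mul_sum, ← Finset.sum_sub_distrib]
      congr 1
      exact Finset.sum_congr rfl fun j _ => by ring
    rw [e5, e6]
    simp only [_root_.rmd]
    linear_combination (e3 + e4) / 2

end

theorem rmd_neg {J : ℕ} (U : ℝ → ℝ → ℝ) (lam a : Fin J → ℝ) (c t r : ℝ) :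
    rmd U lam a c (-t) r = rmd U lam a c t r := by
  simp only [rmd, neg_neg]; ring

/-! ### Bounds for the source -/

theorem sq_mul_phi_le {l : ℝ} (hl : 0 < l) {r : ℝ} (hr : 0 < r) : |phi l r| ≤ 12 * (r ^ 2)⁻¹ := by
  have h1 : |24 * l ^ 2 - r ^ 2| ≤ r ^ 2 + 24 * l ^ 2 := by
    rw [abs_le]; constructor <;> nlinarith [sq_nonneg l, sq_nonneg r]
  have hD : 0 < r ^ 2 + 24 * l ^ 2 := by positivity
  have h2 : |phi l r| = 1152 * l ^ 2 * |24 * l ^ 2 - r ^ 2| / (r ^ 2 + 24 * l ^ 2) ^ 3 := by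
    rw [phi, abs_div, abs_mul, abs_of_pos (pow_pos hD 3), abs_of_nonneg (by positivity)]
  rw [h2, ← div_eq_mul_inv, div_le_div_iff₀ (pow_pos hD 3) (by positivity)]
  calc 1152 * l ^ 2 * |24 * l ^ 2 - r ^ 2| * r ^ 2
      ≤ 1152 * l ^ 2 * (r ^ 2 + 24 * l ^ 2) * r ^ 2 := by gcongr
    _ ≤ 12 * (r ^ 2 + 24 * l ^ 2) ^ 3 := by
        nlinarith [mul_nonneg hD.le (sq_nonneg (r ^ 2 - 24 * l ^ 2))]

theorem rpow_source {S ρ r : ℝ} (hr : 0 < r) (h : |S| ≤ ρ * (r ^ 4)⁻¹) :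
    |r ^ (5/2 : ℝ) * S| ≤ ρ * r ^ (-(3/2) : ℝ) := by
  have h5 : 0 < r ^ (5/2 : ℝ) := Real.rpow_pos_of_pos hr _
  rw [abs_mul, abs_of_pos h5]
  calc r ^ (5/2 : ℝ) * |S| ≤ r ^ (5/2 : ℝ) * (ρ * (r ^ 4)⁻¹) := by gcongr
    _ = ρ * r ^ (-(3/2) : ℝ) := by
        rw [show (r ^ 4)⁻¹ = r ^ (-4 : ℝ) by rw [Real.rpow_neg hr.le]; norm_cast,
          mul_left_comm, ← Real.rpow_add hr]
        norm_num

section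
variable {J : ℕ} {lam : Fin J → ℝ} (hl : ∀ j, 0 < lam j) (ha : StrictAnti lam) {a : Fin J → ℝ}
  {A : ℝ} (hA : ∀ j, |a j| ≤ A)

include hl in
theorem abs_rmd_le {U : ℝ → ℝ → ℝ} {c M : ℝ}
    (hM : ∀ t r, |t| ≤ r → 0 < r → |U t r - c| ≤ M * (r ^ 2)⁻¹) (t r : ℝ) (ht : |t| ≤ r) (hr : 0 < r) :
    |rmd U lam a c t r| ≤ (M + ∑ j, |a j| * 12) * (r ^ 2)⁻¹ := by
  have h1 : |res lam a r| ≤ (∑ j, |a j| * 12) * (r ^ 2)⁻¹ := by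
    rw [Finset.sum_mul]
    refine (Finset.abs_sum_le_sum_abs _ _).trans (Finset.sum_le_sum fun j _ => ?_)
    rw [abs_mul, mul_assoc]
    exact mul_le_mul_of_nonneg_left (sq_mul_phi_le (hl j) hr) (abs_nonneg _)
  have h2 := hM t r ht hr
  have h3 := hM (-t) r (by rwa [abs_neg]) hr
  rw [abs_le] at h1 h2 h3 ⊢
  unfold rmd
  constructor <;> linarith [h1.1, h1.2, h2.1, h2.2, h3.1, h3.2]

include hl in
theorem abs_pot_le {r : ℝ} (hr : 0 < r) : |pot lam r| ≤ 1152 * (∑ j, lam j ^ 2) * (r ^ 4)⁻¹ := by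
  unfold pot
  rw [Finset.mul_sum, Finset.sum_mul]
  refine (Finset.abs_sum_le_sum_abs _ _).trans (Finset.sum_le_sum fun j _ => ?_)
  rw [← div_eq_mul_inv, le_div_iff₀ (by positivity), mul_comm]
  exact four_mul_Vr_le (hl j)

include hl ha in
theorem abs_Vr_mul_phi_le {j k : Fin J} (hjk : k ≠ j) {r : ℝ} (hr : 0 < r) :
    |Vr (lam k) r * phi (lam j) r| ≤ 2304 * gam lam ^ 2 * (r ^ 4)⁻¹ := by
  have hj := hl j
  have hk := hl k
  have e1 : |Vr (lam k) r| ≤ 1152 * lam k ^ 2 * (r ^ 4)⁻¹ := by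
    rw [← div_eq_mul_inv, le_div_iff₀ (by positivity), mul_comm]; exact four_mul_Vr_le hk
  have e2 : |Vr (lam k) r| ≤ 2 * (lam k ^ 2)⁻¹ := by
    rw [← div_eq_mul_inv, le_div_iff₀ (by positivity), mul_comm]; exact Vr_le hk
  have e3 := abs_phi_le_inv_four (r := r) hj hr
  have e4 := abs_phi_le_const (r := r) hj
  rw [div_eq_mul_inv] at e3 e4
  rw [abs_mul]
  have key : ∀ x y : ℝ, 0 < x → 0 < y → y ≤ gam lam * x →
      2304 * (y ^ 2 * (x ^ 2)⁻¹) * (r ^ 4)⁻¹ ≤ 2304 * gam lam ^ 2 * (r ^ 4)⁻¹ := by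
    intro x y hx hy h
    have : y ^ 2 * (x ^ 2)⁻¹ ≤ gam lam ^ 2 := by
      rw [← div_eq_mul_inv, div_le_iff₀ (by positivity), ← mul_pow]
      gcongr
    gcongr
  rcases lt_or_gt_of_ne hjk with h | h
  · refine le_trans ?_ (key _ _ hk hj (gam_bound lam hl ha h))
    calc _ ≤ (2 * (lam k ^ 2)⁻¹) * (1152 * lam j ^ 2 * (r ^ 4)⁻¹) := by gcongr
      _ = _ := by ring
  · refine le_trans ?_ (key _ _ hj hk (gam_bound lam hl ha h))
    calc _ ≤ (1152 * lam k ^ 2 * (r ^ 4)⁻¹) * (2 * (lam j ^ 2)⁻¹) := by gcongr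
      _ = _ := by ring

theorem pot_sub (j : Fin J) (r : ℝ) : (pot lam r - Vr (lam j) r) * phi (lam j) r =
    ∑ k ∈ Finset.univ.erase j, Vr (lam k) r * phi (lam j) r := by
  rw [pot, ← Finset.add_sum_erase _ _ (Finset.mem_univ j), add_sub_cancel_left, Finset.sum_mul]

include hl ha hA in
theorem abs_src_le (c : ℝ) {r : ℝ} (hr : 0 < r) :
    |src lam a c r| ≤ (1152 * |c| * (∑ j, lam j ^ 2) + 2304 * J ^ 2 * gam lam ^ 2 * A) * (r ^ 4)⁻¹ := by
  unfold src
  rw [add_mul]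
  refine (abs_add_le _ _).trans (add_le_add ?_ ?_)
  · rw [abs_mul]
    calc _ ≤ |c| * (1152 * (∑ j, lam j ^ 2) * (r ^ 4)⁻¹) := by gcongr; exact abs_pot_le hl hr
      _ = _ := by ring
  · refine (Finset.abs_sum_le_sum_abs _ _).trans ?_
    have : ∀ j ∈ Finset.univ, |a j * ((pot lam r - Vr (lam j) r) * phi (lam j) r)| ≤
        A * (J * (2304 * gam lam ^ 2 * (r ^ 4)⁻¹)) := by
      intro j _
      rw [abs_mul, pot_sub]
      have hA0 : 0 ≤ A := (abs_nonneg _).trans (hA j)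
      refine mul_le_mul (hA j) ?_ (abs_nonneg _) hA0
      refine (Finset.abs_sum_le_sum_abs _ _).trans ((Finset.sum_le_sum fun k hk =>
        abs_Vr_mul_phi_le hl ha (Finset.ne_of_mem_erase hk) hr).trans ?_)
      rw [Finset.sum_const, nsmul_eq_mul]
      have : ((Finset.univ.erase j).card : ℝ) ≤ J := by
        exact_mod_cast (Finset.card_erase_le).trans (by simp)
      gcongr
    refine (Finset.sum_le_sum this).trans ?_
    rw [Finset.sum_const, nsmul_eq_mul, Finset.card_univ, Fintype.card_fin]
    apply le_of_eq
    ring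

theorem tendsto_four_mul_Vr (l : ℝ) :
    Tendsto (fun r => r ^ 4 * Vr l r) atTop (𝓝 (-(1152 * l ^ 2))) := by
  have h1 : Tendsto (fun r : ℝ => 1 + 24 * l ^ 2 * (r ^ 2)⁻¹) atTop (𝓝 (1 + 24 * l ^ 2 * 0)) :=
    ((tendsto_inv_atTop_zero.comp (tendsto_pow_atTop two_ne_zero)).const_mul _).const_add _
  have h2 := (tendsto_const_nhds (x := -(1152 * l ^ 2))).div (h1.pow 2) (by norm_num)
  rw [mul_zero, add_zero, one_pow, div_one] at h2
  refine h2.congr' ?_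
  filter_upwards [eventually_gt_atTop 0] with r hr
  have : 0 < r ^ 2 + 24 * l ^ 2 := by positivity
  simp only [Vr, Pi.div_apply]
  field_simp

theorem tendsto_inv_pow_zero {n : ℕ} (hn : n ≠ 0) : Tendsto (fun r : ℝ => (r ^ n)⁻¹) atTop (𝓝 0) :=
  tendsto_inv_atTop_zero.comp (tendsto_pow_atTop hn)

include hl in
theorem tendsto_src (c : ℝ) : Tendsto (fun r => r ^ 4 * src lam a c r) atTop
    (𝓝 (-(1152 * c * ∑ j, lam j ^ 2))) := by
  have h1 : Tendsto (fun r => r ^ 4 * pot lam r) atTop (𝓝 (∑ j, -(1152 * lam j ^ 2))) := by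
    simp only [pot, Finset.mul_sum]
    exact tendsto_finsetSum _ fun j _ => tendsto_four_mul_Vr _
  have h2 : ∀ j, Tendsto (phi (lam j)) atTop (𝓝 0) := fun j => by
    refine squeeze_zero_norm' ?_
      (by simpa using (tendsto_inv_pow_zero two_ne_zero).const_mul 12)
    filter_upwards [eventually_gt_atTop 0] with r hr
    exact sq_mul_phi_le (hl j) hr
  have h3 := (h1.const_mul c).add (tendsto_finsetSum Finset.univ fun j _ =>
    (((h1.sub (tendsto_four_mul_Vr (lam j))).mul (h2 j)).const_mul (a j)))
  simp only [mul_zero, Finset.sum_const_zero, add_zero, Finset.sum_neg_distrib,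
    ← Finset.mul_sum] at h3
  rw [show c * -(1152 * ∑ j, lam j ^ 2) = -(1152 * c * ∑ j, lam j ^ 2) by ring] at h3
  refine h3.congr fun r => ?_
  simp only [src, mul_add, Finset.mul_sum]
  congr 1
  · ring
  · exact Finset.sum_congr rfl fun j _ => by ring

include hl in
theorem tendsto_pot : Tendsto (fun r => r ^ 2 * pot lam r) atTop (𝓝 0) := by
  refine squeeze_zero_norm' (a := fun r => 1152 * (∑ j, lam j ^ 2) * (r ^ 2)⁻¹) ?_
    (by simpa using (tendsto_inv_pow_zero two_ne_zero).const_mul (1152 * ∑ j, lam j ^ 2))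
  filter_upwards [eventually_gt_atTop 0] with r hr
  rw [norm_mul, norm_eq_abs, norm_eq_abs, abs_of_pos (by positivity)]
  calc _ ≤ r ^ 2 * (1152 * (∑ j, lam j ^ 2) * (r ^ 4)⁻¹) := by gcongr; exact abs_pot_le hl hr
    _ = _ := by field_simp

end

/-! ### The energy of the remainder -/

section
variable {J : ℕ} {lam : Fin J → ℝ} (hl : ∀ j, 0 < lam j) (a : Fin J → ℝ)
include hl

theorem exists_resd_bound : ∃ C, 0 ≤ C ∧ ∀ r, 0 < r → r ^ 5 * resd lam a r ^ 2 ≤ C * (r ^ 5)⁻¹ := by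
  refine ⟨(∑ j, |a j| * (9216 * lam j ^ 2)) ^ 2, by positivity, fun r hr => ?_⟩
  have h1 : |resd lam a r| ≤ (∑ j, |a j| * (9216 * lam j ^ 2)) * (r ^ 5)⁻¹ := by
    rw [Finset.sum_mul]
    refine (Finset.abs_sum_le_sum_abs _ _).trans (Finset.sum_le_sum fun j _ => ?_)
    rw [abs_mul, mul_assoc, ← div_eq_mul_inv]
    exact mul_le_mul_of_nonneg_left (abs_phid_le_inv_five (hl j) hr) (abs_nonneg _)
  calc _ ≤ r ^ 5 * ((∑ j, |a j| * (9216 * lam j ^ 2)) * (r ^ 5)⁻¹) ^ 2 := by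
        rw [← sq_abs]; gcongr
    _ = (∑ j, |a j| * (9216 * lam j ^ 2)) ^ 2 * (r ^ 5)⁻¹ := by
        generalize ∑ j, |a j| * (9216 * lam j ^ 2) = X
        field_simp

theorem integrableOn_resd : IntegrableOn (fun r => r ^ 5 * resd lam a r ^ 2) (Ioi 0) := by
  obtain ⟨C, hC, h⟩ := exists_resd_bound hl a
  have hc : Continuous fun r => r ^ 5 * resd lam a r ^ 2 :=
    (continuous_id.pow 5).mul ((continuous_resd hl a).pow 2)
  rw [← Ioc_union_Ioi_eq_Ioi zero_le_one]
  refine IntegrableOn.union (hc.integrableOn_Ioc) ?_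
  refine ((integrableOn_Ioi_rpow_of_lt (a := -5) (by norm_num) one_pos).const_mul C).mono'
    hc.aestronglyMeasurable ?_
  refine ae_Ioi fun r hr => ?_
  have hr0 : (0:ℝ) < r := one_pos.trans hr
  rw [norm_of_nonneg (by positivity)]
  refine (h r hr0).trans_eq ?_
  rw [Real.rpow_neg hr0.le]
  norm_cast

theorem tendsto_resd : Tendsto (fun T : ℝ => ∫ r in Ioi |T|, r ^ 5 * resd lam a r ^ 2) atTop (𝓝 0) := by
  obtain ⟨C, hC, h⟩ := exists_resd_bound hl a
  refine squeeze_zero_norm' (a := fun T : ℝ => C * (T ^ ((-5:ℝ) + 1) / (-((-5:ℝ) + 1)))) ?_ ?_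
  · filter_upwards [eventually_gt_atTop 0] with T hT
    rw [abs_of_pos hT]
    refine abs_tail_integral_le hT (by norm_num) fun ρ hρ => ?_
    have hr0 : (0:ℝ) < ρ := hT.trans hρ
    rw [abs_of_nonneg (by positivity), Real.rpow_neg hr0.le]
    refine (h ρ hr0).trans_eq ?_
    norm_cast
  · have := ((tendsto_rpow_neg_atTop (y := 4) (by norm_num)).div_const 4).const_mul C
    norm_num at this ⊢
    exact this

variable {U : ℝ → ℝ → ℝ} (h : ContDiff ℝ 2 (unc U)) (c : ℝ)
include h

theorem eden_rmd_le {t r : ℝ} (hr : 0 ≤ r) : eden (rmd U lam a c) t r ≤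
    eden U t r + eden U (-t) r + 2 * (r ^ 5 * resd lam a r ^ 2) := by
  unfold eden
  rw [dT_rmd hl a h, dR_rmd hl a h, ← mul_add, mul_left_comm, ← mul_add]
  refine mul_le_mul_of_nonneg_left ?_ (by positivity)
  nlinarith [sq_nonneg (dT U t r + dT U (-t) r), sq_nonneg (dR U t r - dR U (-t) r),
    sq_nonneg ((dR U t r + dR U (-t) r) / 2 + resd lam a r), sq_nonneg (dT U t r), sq_nonneg (dT U (-t) r)]

variable (hi : ∀ t, IntegrableOn (eden U t) (Ioi |t|))
include hi

theorem integrableOn_bound (t : ℝ) : IntegrableOn (fun r =>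
    eden U t r + eden U (-t) r + 2 * (r ^ 5 * resd lam a r ^ 2)) (Ioi |t|) :=
  ((hi t).add (by have := hi (-t); rwa [abs_neg] at this)).add
    (((integrableOn_resd hl a).mono_set (Ioi_subset_Ioi (abs_nonneg t))).const_mul 2)

theorem integrableOn_eden_rmd (hs : ContDiff ℝ 2 (fun p : ℝ × ℝ => rmd U lam a c p.1 p.2)) (t : ℝ) :
    IntegrableOn (eden (rmd U lam a c) t) (Ioi |t|) := by
  refine (integrableOn_bound hl a h hi t).mono' (eden_continuous hs t).aestronglyMeasurable ?_
  refine ae_Ioi fun r hr => ?_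
  have hr0 : 0 ≤ r := (abs_nonneg t).trans (le_of_lt hr)
  rw [norm_eq_abs, abs_of_nonneg (eden_nonneg hr0)]
  exact eden_rmd_le hl a h c hr0

theorem eventually_eden_rmd_le (hs : ContDiff ℝ 2 (fun p : ℝ × ℝ => rmd U lam a c p.1 p.2)) {Ep Em : ℝ}
    (hp : Tendsto (fun t : ℝ => ∫ r in Ioi |t|, eden U t r) atTop (𝓝 Ep))
    (hm : Tendsto (fun t : ℝ => ∫ r in Ioi |t|, eden U t r) atBot (𝓝 Em)) :
    ∀ δ > 0, ∀ᶠ T : ℝ in atTop, ∫ r in Ioi |T|, eden (rmd U lam a c) T r ≤ (Ep + Em) + δ := by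
  intro δ hδ
  have h1 := (hp.add (hm.comp tendsto_neg_atTop_atBot)).add ((tendsto_resd hl a).const_mul 2)
  rw [mul_zero, add_zero] at h1
  filter_upwards [h1.eventually (gt_mem_nhds (lt_add_of_pos_right (Ep + Em) hδ))] with T hT
  refine le_trans ?_ hT.le
  have e1 := hi (-T)
  rw [abs_neg] at e1
  have e2 := ((integrableOn_resd hl a).mono_set (Ioi_subset_Ioi (abs_nonneg T))).const_mul 2
  simp only [Function.comp_apply, abs_neg]
  have e3 : IntegrableOn (fun r => eden U T r + eden U (-T) r) (Ioi |T|) := (hi T).add e1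
  rw [← integral_add (hi T) e1, ← integral_const_mul, ← integral_add e3 e2]
  refine setIntegral_mono_on (integrableOn_eden_rmd hl a h c hi hs T)
    (integrableOn_bound hl a h hi T) measurableSet_Ioi fun r hr => ?_
  exact eden_rmd_le hl a h c ((abs_nonneg T).trans (le_of_lt hr))

end

/-! ### The orthogonality conditions in polar coordinates -/

section
variable {J : ℕ} {lam : Fin J → ℝ} (hl : ∀ j, 0 < lam j)
include hl

theorem resd_single (i : Fin J) : resd lam (Pi.single i 1) = phid (lam i) := by
  ext r; simp [resd, Pi.single_apply]

theorem integral_mul_vphi_eq_zero {H : ℝ → ℝ → ℝ} {M : ℝ} (h : ContDiff ℝ 2 (unc H))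
    (hM0 : 0 ≤ M) (hM : ∀ t r, |t| ≤ r → 0 < r → |H t r| ≤ M * (r ^ 2)⁻¹)
    (hi : IntegrableOn (eden H 0) (Ioi 0)) (i : Fin J)
    (ho : ∫ r in Ioi (0:ℝ), r ^ 5 * (dR H 0 r * phid (lam i) r) = 0) :
    ∫ r in Ioi (0:ℝ), Fn H r r * vphi (lam i) r = 0 := by
  set l := lam i
  have hl0 : 0 < l := hl i
  have hcd : Continuous (phid l) := by
    have := continuous_resd hl (Pi.single i 1); rwa [resd_single hl] at this
  have hcH : Continuous (H 0) := continuous_slice h.continuous 0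
  have hcR : Continuous (dR H 0) := continuous_slice (C2_partials h).2.1.continuous 0
  have hg : ∀ r ∈ Ioi (0:ℝ), HasDerivAt (fun r => r ^ 5 * phid l r) (r ^ 5 * (Vr l r * phi l r)) r := by
    intro r hr
    have hr0 : r ≠ 0 := ne_of_gt hr
    refine ((hasDerivAt_pow 5 r).mul (phid_der hl0 hr)).congr_deriv ?_
    field_simp
    ring
  have hH : ∀ r ∈ Ioi (0:ℝ), HasDerivAt (H 0) (dR H 0 r) r := fun r _ =>
    hasDerivAt_dR (h.of_le one_le_two) 0 r
  have hM' : ∀ r, 0 < r → |H 0 r| ≤ M * (r ^ 2)⁻¹ := fun r hr => hM 0 r (by simpa using hr.le) hr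
  have i1 : IntegrableOn (H 0 * fun r => r ^ 5 * (Vr l r * phi l r)) (Ioi 0) := by
    have hc : Continuous (H 0 * fun r => r ^ 5 * (Vr l r * phi l r)) :=
      hcH.mul ((continuous_id.pow 5).mul ((Vr_cont hl0).mul (phi_cont hl0)))
    rw [← Ioc_union_Ioi_eq_Ioi zero_le_one]
    refine IntegrableOn.union hc.integrableOn_Ioc ?_
    refine ((integrableOn_Ioi_rpow_of_lt (a := -5) (by norm_num) one_pos).const_mul
      (M * (1152 * l ^ 2) ^ 2)).mono' hc.aestronglyMeasurable ?_
    refine ae_Ioi fun r hr => ?_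
    have hr0 : (0:ℝ) < r := one_pos.trans hr
    have e1 : |Vr l r| ≤ 1152 * l ^ 2 / r ^ 4 := by
      rw [le_div_iff₀ (by positivity), mul_comm]; exact four_mul_Vr_le hl0
    have e2 := abs_phi_le_inv_four hl0 hr0
    rw [Pi.mul_apply, norm_eq_abs, abs_mul, abs_mul, abs_mul, abs_of_pos (pow_pos hr0 5)]
    calc _ ≤ M * (r ^ 2)⁻¹ * (r ^ 5 * (1152 * l ^ 2 / r ^ 4 * (1152 * l ^ 2 / r ^ 4))) := by
          gcongr; exact hM' r hr0
      _ = M * (1152 * l ^ 2) ^ 2 * (r ^ 5)⁻¹ := by field_simp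
      _ = _ := by
          rw [Real.rpow_neg hr0.le]; norm_cast
  have i2 : IntegrableOn (dR H 0 * fun r => r ^ 5 * phid l r) (Ioi 0) := by
    have hr := integrableOn_resd hl (Pi.single i 1)
    rw [resd_single hl] at hr
    refine (hi.add hr).mono' (hcR.mul ((continuous_id.pow 5).mul hcd)).aestronglyMeasurable ?_
    refine ae_Ioi fun r hr => ?_
    have hr0 : (0:ℝ) < r := hr
    rw [Pi.mul_apply, norm_eq_abs, mul_left_comm, abs_mul, abs_of_pos (pow_pos hr0 5)]
    simp only [Pi.add_apply, eden]
    rw [← mul_add]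
    refine mul_le_mul_of_nonneg_left ?_ (by positivity)
    rw [abs_le]
    change _ ≤ _ ∧ _ ≤ dT H 0 r ^ 2 + dR H 0 r ^ 2 + phid l r ^ 2
    constructor <;> nlinarith [sq_nonneg (dT H 0 r), sq_nonneg (dR H 0 r + phid l r),
      sq_nonneg (dR H 0 r - phid l r), sq_nonneg (dR H 0 r), sq_nonneg (phid l r)]
  have l0 : Tendsto (H 0 * fun r => r ^ 5 * phid l r) (𝓝[>] 0) (𝓝 0) := by
    have hc : Continuous (H 0 * fun r => r ^ 5 * phid l r) :=
      hcH.mul ((continuous_id.pow 5).mul hcd)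
    have := hc.tendsto 0
    simp only [Pi.mul_apply, zero_pow (by norm_num : 5 ≠ 0), zero_mul, mul_zero] at this
    exact this.mono_left nhdsWithin_le_nhds
  have l1 : Tendsto (H 0 * fun r => r ^ 5 * phid l r) atTop (𝓝 0) := by
    refine squeeze_zero_norm' ?_
      (by simpa using (tendsto_inv_pow_zero two_ne_zero).const_mul (M * (9216 * l ^ 2)))
    filter_upwards [eventually_gt_atTop 0] with r hr
    rw [Pi.mul_apply, norm_eq_abs, abs_mul, abs_mul, abs_of_pos (pow_pos hr 5)]
    calc _ ≤ M * (r ^ 2)⁻¹ * (r ^ 5 * (9216 * l ^ 2 / r ^ 5)) := by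
          gcongr
          · exact hM' r hr
          · exact abs_phid_le_inv_five hl0 hr
      _ = _ := by field_simp
  have key := integral_Ioi_mul_deriv_eq_deriv_mul hH hg i1 i2 l0 l1
  have e : ∫ r in Ioi (0:ℝ), dR H 0 r * (r ^ 5 * phid l r) = 0 := by
    refine Eq.trans ?_ ho
    congr 1; ext r; ring
  rw [e] at key
  refine Eq.trans ?_ (key.trans (by ring))
  refine Ioi_congr fun r hr => ?_
  have := Fn_eq (U := H) 0 r
  simp only [sub_zero, add_zero] at this
  simp only [this, vphi]
  rw [← rpow_five_half_sq hr]
  ring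

theorem gradient_rescH_LW6 (i : Fin J) {x : E6} (hx : x ≠ 0) :
    gradient (rescH (lam i) LW6) x = (phid (lam i) ‖x‖ / ‖x‖) • x :=
  (hasGradientAt_radial hx (Eventually.of_forall (rescH_LW6 (hl i))) (phi_der (hl i) _)).gradient

variable {u : ℝ → E6 → ℝ} {P : E6 → ℝ} (hu : IsRadSolOf P u) {p : ℝ → ℝ} (hP : ∀ x, P x = p ‖x‖)
  (a : Fin J → ℝ) (c : ℝ)
include hu hP

theorem gradient_sub_res {x : E6} (hx : x ≠ 0) :
    gradient (fun y => u 0 y - ∑ j, a j * rescH (lam j) LW6 y) x =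
      (dR (rmd (fun t => prof (u t)) lam a c) 0 ‖x‖ / ‖x‖) • x := by
  have hs := (hu.radWave hP).smooth
  refine (hasGradientAt_radial (g := fun r => prof (u 0) r - res lam a r) hx
    (.of_forall fun y => ?_) ?_).gradient
  · simp only [res, rescH_LW6 (hl _)]
    rw [eq_prof (hu.2.1 0) y]
  · rw [dR_rmd hl a hs, neg_zero, add_self_div_two]
    exact (hasDerivAt_dR (U := fun t => prof (u t)) (hs.of_le one_le_two) 0 _).sub (hasDerivAt_res hl a _)

theorem orth_radial (i : Fin J) (ho : ∫ x, ⟪gradient (fun y => u 0 y - ∑ j, a j * rescH (lam j) LW6 y) x,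
      gradient (rescH (lam i) LW6) x⟫ = 0) : ∫ r in Ioi (0:ℝ), r ^ 5 *
      (dR (rmd (fun t => prof (u t)) lam a c) 0 r * phid (lam i) r) = 0 := by
  have h1 := integral_radial (fun r => dR (rmd (fun t => prof (u t)) lam a c) 0 r * phid (lam i) r)
  have hae : ∀ᵐ x : E6, x ≠ 0 := by simp [ae_iff]
  rw [integral_congr_ae (g := fun x : E6 =>
    dR (rmd (fun t => prof (u t)) lam a c) 0 ‖x‖ * phid (lam i) ‖x‖)] at ho
  · rw [ho] at h1
    exact (mul_eq_zero.1 h1.symm).resolve_left c6_pos.ne'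
  · filter_upwards [hae] with x hx
    have hn : ‖x‖ ≠ 0 := norm_ne_zero_iff.2 hx
    rw [gradient_sub_res hl hu hP a c hx, gradient_rescH_LW6 hl i hx, real_inner_smul_left,
      real_inner_smul_right, real_inner_self_eq_norm_sq]
    field_simp

end

/-! ### The gradient of the remainder on dyadic shells -/

theorem dT_eq_zero_of_even {H : ℝ → ℝ → ℝ} (h : ContDiff ℝ 1 (unc H))
    (heven : ∀ t r, H (-t) r = H t r) (r : ℝ) : dT H 0 r = 0 := by
  have h1 := hasDerivAt_dT h 0 r
  have h2 := (hasDerivAt_dT h (-0) r).comp (h₂ := fun t' => H t' r) 0 (hasDerivAt_neg 0)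
  rw [show ((fun t' => H t' r) ∘ Neg.neg) = fun t' => H t' r from funext fun t => heven t r,
    neg_zero] at h2
  linarith [h1.unique h2]

section
variable {J : ℕ} (hJ : 0 < J) {lam : Fin J → ℝ} (hl : ∀ j, 0 < lam j)
include hJ hl

theorem om_le_quarter {r ρ : ℝ} (hr : 0 < r) (hρ : r < ρ) :
    om lam ρ ≤ 8 * om lam r * (r ^ (-(1/4) : ℝ) * ρ ^ (1/4 : ℝ)) := by
  have h1 := om_mul_le hJ hl hr (r := ρ / r) (div_pos (hr.trans hρ) hr)
  rw [mul_div_cancel₀ _ hr.ne'] at h1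
  have h2 := one_add_abs_log_le (div_pos (hr.trans hρ) hr)
  have h3 := one_le_om hJ lam r
  have h4 : 1 ≤ (ρ / r) ^ (1/4 : ℝ) :=
    Real.one_le_rpow ((one_le_div hr).2 hρ.le) (by norm_num)
  have h5 : ((ρ / r) ^ (1/4 : ℝ))⁻¹ ≤ 1 := inv_le_one_of_one_le₀ h4
  have e : (ρ / r) ^ (1/4 : ℝ) = r ^ (-(1/4) : ℝ) * ρ ^ (1/4 : ℝ) := by
    rw [Real.div_rpow (hr.trans hρ).le hr.le, Real.rpow_neg hr.le, div_eq_mul_inv, mul_comm]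
  rw [← e]
  nlinarith [abs_nonneg (Real.log (ρ / r))]

theorem om_le_two_mul {r R : ℝ} (hR : 0 < R) (h1 : R ≤ r) (h2 : r ≤ 2 * R) :
    om lam r ≤ 2 * om lam R := by
  have hr : 0 < r := hR.trans_le h1
  have h3 := om_mul_le hJ hl hR (r := r / R) (div_pos hr hR)
  rw [mul_div_cancel₀ _ hR.ne'] at h3
  have h4 : |Real.log (r / R)| ≤ 1 := by
    rw [abs_of_nonneg (Real.log_nonneg ((one_le_div hR).2 h1))]
    refine (Real.log_le_log (div_pos hr hR) ((div_le_iff₀ hR).2 h2)).trans ?_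
    linarith [Real.log_two_lt_d9]
  linarith [one_le_om hJ lam R]

variable {κ s : ℝ → ℝ} {F : ℝ → ℝ → ℝ} {K B s0 N : ℝ} (hs : PreSys κ s F K B s0) (hN : 0 ≤ N)
  (hF : ∀ ξ η, 0 < ξ → 0 < η → |F ξ η| ≤ N * (√(nr ξ η) * om lam (nr ξ η)))
include hs hN hF

theorem abs_tailI_le {r : ℝ} (hr : 0 < r) :
    |tailI κ s F r r| ≤ 4 * (8 * K * N * om lam r + s0) * r ^ (-(1/2) : ℝ) := by
  have hK := hs.K0
  have hρ0 := hs.ρ0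
  have h1 : ∀ ρ, r < ρ → |κ ρ * F r (2 * ρ - r) + s ρ| ≤
      (8 * K * N * om lam r + s0) * r ^ (-(1/4) : ℝ) * ρ ^ (-(5/4) : ℝ) := by
    intro ρ hρ
    have h0 : 0 < ρ := hr.trans hρ
    have e1 : nr r (2 * ρ - r) = ρ := by unfold nr; ring
    have e2 := hF r (2 * ρ - r) hr (by linarith)
    rw [e1] at e2
    have e3 := om_le_quarter hJ hl hr hρ
    have hq : r ^ (1/4 : ℝ) ≤ ρ ^ (1/4 : ℝ) := by gcongr
    have hq0 : 0 < r ^ (1/4 : ℝ) := by positivity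
    have e4 : ρ ^ (-(3/2) : ℝ) ≤ r ^ (-(1/4) : ℝ) * ρ ^ (-(5/4) : ℝ) := by
      rw [show (-(3/2) : ℝ) = -(1/4) + -(5/4) by norm_num, Real.rpow_add h0]
      gcongr ?_ * _
      exact Real.rpow_le_rpow_of_nonpos hr hρ.le (by norm_num)
    calc _ ≤ |κ ρ| * |F r (2 * ρ - r)| + |s ρ| := by rw [← abs_mul]; exact abs_add_le _ _
      _ ≤ K * ρ ^ (-2 : ℝ) * (N * (ρ ^ (1/2 : ℝ) * (8 * om lam r * (r ^ (-(1/4) : ℝ) * ρ ^ (1/4 : ℝ))))) +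
          s0 * (r ^ (-(1/4) : ℝ) * ρ ^ (-(5/4) : ℝ)) := by
          gcongr
          · exact hs.κb ρ h0
          · refine e2.trans ?_
            rw [sqrt_eq_rpow]
            gcongr
          · exact (hs.sb ρ h0).trans (by gcongr)
      _ = _ := by
          rw [show (-(5/4) : ℝ) = -2 + 1 / 2 + 1 / 4 by norm_num, Real.rpow_add h0, Real.rpow_add h0]
          ring
  have h2 := abs_tail_integral_le hr (by norm_num) h1
  rw [tailI, add_self_div_two]
  refine h2.trans_eq ?_
  have e : r ^ (-(1/4) : ℝ) * r ^ (-(5/4) + 1 : ℝ) = r ^ (-(1/2) : ℝ) := by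
    rw [← Real.rpow_add hr]; norm_num
  linear_combination 4 * (8 * K * N * om lam r + s0) * e

theorem shell_le {H : ℝ → ℝ → ℝ} {G : ℝ → ℝ} {E R : ℝ} (hFH : F = Fn H)
    (h : ContDiff ℝ 2 (unc H)) (heven : ∀ t r, H (-t) r = H t r)
    (hGc : ContinuousOn G (Ioi 0)) (hAG : ∀ r, 0 < r → An H r r = G r - 1 / 2 * tailI κ s F r r)
    (hGE : ∀ x y, 0 < x → x < y → ∫ z in x..y, G z ^ 2 ≤ E) (hR : 0 < R) :
    ∫ r in R..(2 * R), r ^ 5 * dR H 0 r ^ 2 ≤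
      8 * E + 2 * ((64 * K + 5) * (N + s0) * om lam R) ^ 2 := by
  have hK := hs.K0
  have hρ0 := hs.ρ0
  have hom := one_le_om hJ lam R
  set D := (64 * K + 5) * (N + s0) * om lam R
  have hD : 0 ≤ D := by positivity
  have hcR : Continuous (dR H 0) := continuous_slice (C2_partials h).2.1.continuous 0
  have hpt : ∀ r ∈ Icc R (2 * R), r ^ 5 * dR H 0 r ^ 2 ≤ 8 * G r ^ 2 + 2 * D ^ 2 / R := by
    intro r hr
    have hr0 : 0 < r := hR.trans_le hr.1
    have e1 := An_eq (U := H) 0 r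
    have e2 := Fn_eq (U := H) 0 r
    rw [sub_zero, add_zero] at e1 e2
    rw [hAG r hr0, dT_eq_zero_of_even (h.of_le one_le_two) heven] at e1
    rw [← hFH] at e2
    have e3 : r ^ (5/2 : ℝ) * dR H 0 r = 2 * G r + (-tailI κ s F r r - 5 / 2 * (F r r / r)) := by
      rw [e2]; linear_combination -2 * e1
    have e4 := abs_tailI_le hJ hl hs hN hF hr0
    have e5 := hF r r hr0 hr0
    rw [show nr r r = r by unfold nr; ring] at e5
    have hom2 := om_le_two_mul hJ hl hR hr.1 hr.2
    have hsq : r ^ (-(1/2) : ℝ) = (√r)⁻¹ := by rw [Real.rpow_neg hr0.le, sqrt_eq_rpow]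
    have hs0 : 0 < √r := sqrt_pos.2 hr0
    have e6 : |F r r / r| ≤ N * om lam r * (√r)⁻¹ := by
      rw [abs_div, abs_of_pos hr0, div_le_iff₀ hr0]
      have e : (√r)⁻¹ * r = √r := by
        rw [inv_mul_eq_iff_eq_mul₀ hs0.ne', Real.mul_self_sqrt hr0.le]
      exact e5.trans_eq (by linear_combination -N * om lam r * e)
    have e7 : |(-tailI κ s F r r - 5 / 2 * (F r r / r))| ≤ D * (√r)⁻¹ := by
      calc _ ≤ |tailI κ s F r r| + 5 / 2 * |F r r / r| := by
            refine (abs_sub _ _).trans ?_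
            rw [abs_neg, abs_mul, abs_of_pos (by norm_num : (0:ℝ) < 5 / 2)]
        _ ≤ 4 * (8 * K * N * (2 * om lam R) + s0) * (√r)⁻¹ + 5 / 2 * (N * (2 * om lam R) * (√r)⁻¹) := by
            rw [hsq] at e4
            refine add_le_add (e4.trans (by gcongr)) ?_
            gcongr
            exact e6.trans (by gcongr)
        _ = (64 * K * N * om lam R + 4 * s0 + 5 * N * om lam R) * (√r)⁻¹ := by ring
        _ ≤ D * (√r)⁻¹ := by
            gcongr
            have : 0 ≤ s0 * (om lam R - 1) := mul_nonneg hρ0 (by linarith)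
            have : 0 ≤ K * s0 * om lam R := by positivity
            have : 0 ≤ s0 * om lam R := by positivity
            simp only [D]
            nlinarith
    have e8 : (-tailI κ s F r r - 5 / 2 * (F r r / r)) ^ 2 ≤ D ^ 2 / R := by
      rw [← sq_abs]
      calc _ ≤ (D * (√r)⁻¹) ^ 2 := by gcongr
        _ = D ^ 2 / r := by rw [mul_pow, inv_pow, sq_sqrt hr0.le, div_eq_mul_inv]
        _ ≤ D ^ 2 / R := by gcongr; exact hr.1
    rw [← rpow_five_half_sq hr0, ← mul_pow, e3, mul_div_assoc]
    nlinarith [sq_nonneg (2 * G r - (-tailI κ s F r r - 5 / 2 * (F r r / r)))]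
  have hRR : R ≤ 2 * R := by linarith
  have hGi : IntervalIntegrable (fun r => G r ^ 2) volume R (2 * R) := by
    refine ContinuousOn.intervalIntegrable ((hGc.pow 2).mono fun x hx => ?_)
    rw [uIcc_of_le hRR] at hx
    exact hR.trans_le hx.1
  have hi1 : IntervalIntegrable (fun r => r ^ 5 * dR H 0 r ^ 2) volume R (2 * R) :=
    Continuous.intervalIntegrable (by fun_prop) _ _
  refine (intervalIntegral.integral_mono_on hRR hi1
    ((hGi.const_mul 8).add intervalIntegrable_const) hpt).trans ?_
  rw [intervalIntegral.integral_add (hGi.const_mul 8) intervalIntegrable_const,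
    intervalIntegral.integral_const_mul, intervalIntegral.integral_const, smul_eq_mul]
  have := hGE R (2 * R) hR (by linarith)
  rw [show (2 * R - R) * (2 * D ^ 2 / R) = 2 * D ^ 2 by field_simp; ring]
  linarith

end

/-! ### The size of the resonant coefficients -/

theorem phid_lower {l r : ℝ} (hl : 0 < l) (h1 : l ≤ r) (h2 : r ≤ 2 * l) :
    3 / 10 * (l ^ 3)⁻¹ ≤ |phid l r| := by
  have hr : 0 < r := hl.trans_le h1
  have hs : r ^ 2 ≤ 4 * l ^ 2 := by nlinarith
  have e : |phid l r| = 4608 * l ^ 2 * r * (48 * l ^ 2 - r ^ 2) / (r ^ 2 + 24 * l ^ 2) ^ 4 := by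
    have : r ^ 2 - 48 * l ^ 2 ≤ 0 := by nlinarith
    rw [phid, abs_div, abs_of_pos (by positivity : 0 < (r ^ 2 + 24 * l ^ 2) ^ 4), abs_mul,
      abs_of_pos (by positivity : 0 < 4608 * l ^ 2 * r), abs_of_nonpos this, neg_sub]
  rw [e, ← div_eq_mul_inv, div_le_div_iff₀ (by positivity) (by positivity)]
  calc 3 / 10 * (r ^ 2 + 24 * l ^ 2) ^ 4 ≤ 3 / 10 * (4 * l ^ 2 + 24 * l ^ 2) ^ 4 := by gcongr
    _ ≤ 4608 * l ^ 2 * l * (44 * l ^ 2) * l ^ 3 := by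
        have : 0 < l ^ 8 := by positivity
        nlinarith
    _ ≤ _ := by gcongr; nlinarith

theorem abs_phid_other {J : ℕ} {lam : Fin J → ℝ} (hl : ∀ j, 0 < lam j) (ha : StrictAnti lam)
    (hg : gam lam ≤ 1) {i j : Fin J} (hij : j ≠ i) {r : ℝ} (h1 : lam i ≤ r) (h2 : r ≤ 2 * lam i) :
    |phid (lam j) r| ≤ 9216 * gam lam ^ 2 * (lam i ^ 3)⁻¹ := by
  have hi := hl i
  have hj := hl j
  have hr : 0 < r := hi.trans_le h1
  have hg0 := gam_nonneg lam hl
  rcases lt_or_gt_of_ne hij with h | h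
  · have h3 := gam_bound lam hl ha h
    refine (abs_phid_le_lin hj hr).trans ?_
    rw [← div_eq_mul_inv, div_le_div_iff₀ (by positivity) (by positivity)]
    calc r * lam i ^ 3 ≤ 2 * lam i * lam i ^ 3 := by gcongr
      _ = 2 * lam i ^ 4 := by ring
      _ ≤ 2 * (gam lam * lam j) ^ 4 := by gcongr
      _ = 2 * gam lam ^ 2 * gam lam ^ 2 * lam j ^ 4 := by ring
      _ ≤ 9216 * gam lam ^ 2 * 1 * lam j ^ 4 := by
          gcongr
          · norm_num
          · exact pow_le_one₀ hg0 hg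
      _ = _ := by ring
  · have h3 := gam_bound lam hl ha h
    refine (abs_phid_le_inv_five hj hr).trans ?_
    rw [← div_eq_mul_inv, div_le_div_iff₀ (by positivity) (by positivity)]
    calc 9216 * lam j ^ 2 * lam i ^ 3 ≤ 9216 * (gam lam * lam i) ^ 2 * lam i ^ 3 := by gcongr
      _ = 9216 * gam lam ^ 2 * lam i ^ 5 := by ring
      _ ≤ _ := by gcongr

section
variable {J : ℕ} {lam : Fin J → ℝ} (hl : ∀ j, 0 < lam j) (a : Fin J → ℝ)
include hl

theorem sq_le_shell_resd (ha : StrictAnti lam) (hg : gam lam ≤ 1) (hgJ : 92160 * J * gam lam ^ 2 ≤ 1)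
    {i : Fin J} (hi : ∀ j, |a j| ≤ |a i|) :
    |a i| ^ 2 ≤ 25 * ∫ r in lam i..2 * lam i, r ^ 5 * resd lam a r ^ 2 := by
  have hl0 := hl i
  set l := lam i
  set A := |a i|
  have hA : 0 ≤ A := abs_nonneg _
  have hll : l ≤ 2 * l := by linarith
  have hpt : ∀ r ∈ Icc l (2 * l), A ^ 2 / 25 / l ≤ r ^ 5 * resd lam a r ^ 2 := by
    intro r hr
    have hr0 : 0 < r := hl0.trans_le hr.1
    have e1 : resd lam a r = a i * phid l r + ∑ j ∈ Finset.univ.erase i, a j * phid (lam j) r := by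
      rw [resd, ← Finset.add_sum_erase _ _ (Finset.mem_univ i)]
    have e2 : |∑ j ∈ Finset.univ.erase i, a j * phid (lam j) r| ≤ 1 / 10 * A * (l ^ 3)⁻¹ := by
      refine (Finset.abs_sum_le_sum_abs _ _).trans ((Finset.sum_le_sum fun j hj => ?_ :
        _ ≤ ∑ j ∈ Finset.univ.erase i, A * (9216 * gam lam ^ 2 * (l ^ 3)⁻¹)).trans ?_)
      · rw [abs_mul]
        exact mul_le_mul (hi j) (abs_phid_other hl ha hg (Finset.ne_of_mem_erase hj) hr.1 hr.2)
          (abs_nonneg _) hA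
      · rw [Finset.sum_const, nsmul_eq_mul]
        have : ((Finset.univ.erase i).card : ℝ) ≤ J := by
          exact_mod_cast (Finset.card_erase_le).trans (by simp)
        calc _ ≤ (J : ℝ) * (A * (9216 * gam lam ^ 2 * (l ^ 3)⁻¹)) := by gcongr
          _ = (92160 * J * gam lam ^ 2) * (1 / 10 * A * (l ^ 3)⁻¹) := by ring
          _ ≤ _ := mul_le_of_le_one_left (by positivity) hgJ
    have e3 : 1 / 5 * A * (l ^ 3)⁻¹ ≤ |resd lam a r| := by
      rw [e1]
      have h3 := abs_sub_abs_le_abs_sub (a i * phid l r)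
        (-∑ j ∈ Finset.univ.erase i, a j * phid (lam j) r)
      rw [sub_neg_eq_add, abs_neg, abs_mul] at h3
      have h4 := mul_le_mul_of_nonneg_left (phid_lower hl0 hr.1 hr.2) hA
      linarith
    calc A ^ 2 / 25 / l = l ^ 5 * (1 / 5 * A * (l ^ 3)⁻¹) ^ 2 := by field_simp; ring
      _ ≤ r ^ 5 * |resd lam a r| ^ 2 := by gcongr; exact hr.1
      _ = _ := by rw [sq_abs]
  have hc : Continuous fun r => r ^ 5 * resd lam a r ^ 2 :=
    (continuous_id.pow 5).mul ((continuous_resd hl a).pow 2)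
  have := intervalIntegral.integral_mono_on hll (intervalIntegrable_const (μ := volume)) (hc.intervalIntegrable _ _) hpt
  rw [intervalIntegral.integral_const, smul_eq_mul,
    show (2 * l - l) * (A ^ 2 / 25 / l) = A ^ 2 / 25 by field_simp; ring] at this
  linarith

theorem shell_triangle {f : ℝ → ℝ} (hf : Continuous f) {R : ℝ} (hR : 0 < R) :
    ∫ r in R..2 * R, r ^ 5 * resd lam a r ^ 2 ≤ 2 * ((∫ r in R..2 * R, r ^ 5 * f r ^ 2) +
      ∫ r in R..2 * R, r ^ 5 * (f r - resd lam a r) ^ 2) := by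
  have hc := continuous_resd hl a
  have i1 : IntervalIntegrable (fun r => r ^ 5 * f r ^ 2) volume R (2 * R) :=
    Continuous.intervalIntegrable (by fun_prop) _ _
  have i2 : IntervalIntegrable (fun r => r ^ 5 * (f r - resd lam a r) ^ 2) volume R (2 * R) :=
    Continuous.intervalIntegrable (by fun_prop) _ _
  rw [← intervalIntegral.integral_add i1 i2, ← intervalIntegral.integral_const_mul]
  refine intervalIntegral.integral_mono_on (by linarith)
    (Continuous.intervalIntegrable (by fun_prop) _ _) ((i1.add i2).const_mul 2) fun r hr => ?_
  have hr0 : 0 < r := hR.trans_le hr.1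
  rw [← mul_add, mul_left_comm]
  refine mul_le_mul_of_nonneg_left ?_ (by positivity)
  nlinarith [sq_nonneg (2 * f r - resd lam a r)]

end

/-! ### The estimate in polar coordinates -/

theorem shell_arith {K C E q ρ om g A n L Q : ℝ} (hK : 0 ≤ K) (hC : 0 ≤ C) (hq : 0 ≤ q) (hqE : q ^ 2 = E)
    (hρ0 : 0 ≤ ρ) (hn : 0 ≤ n) (hA : 0 ≤ A) (hρ : ρ ≤ 40 * q + n * g ^ 2 * A) (hom : 1 ≤ om)
    (hL : L = (64 * K + 5) * (C + 1))
    (h : Q ≤ 8 * E + 2 * ((64 * K + 5) * (C * (q + ρ) + ρ) * om) ^ 2) :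
    Q ≤ (8 + 2 * (L ^ 2 * (2 * 41 ^ 2 + 2 * n ^ 2))) * (E + g ^ 4 * A ^ 2) * om ^ 2 := by
  subst hL
  set X := 41 * q + n * g ^ 2 * A
  have hX : 0 ≤ X := by positivity
  have e1 : (64 * K + 5) * (C * (q + ρ) + ρ) ≤ (64 * K + 5) * (C + 1) * X := by
    rw [mul_assoc]
    refine mul_le_mul_of_nonneg_left ?_ (by positivity)
    refine le_trans (b := (C + 1) * (q + ρ)) (by linarith)
      (mul_le_mul_of_nonneg_left (by simp only [X]; linarith) (by positivity))
  have h3 : 0 ≤ g ^ 4 * A ^ 2 := by positivity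
  have hE : 0 ≤ E := hqE ▸ sq_nonneg q
  have e2 : X ^ 2 ≤ (2 * 41 ^ 2 + 2 * n ^ 2) * (E + g ^ 4 * A ^ 2) := by
    have h1 := sq_nonneg (41 * q - n * g ^ 2 * A)
    have h2 : 0 ≤ n ^ 2 * E := by positivity
    have : X ^ 2 = 2 * 41 ^ 2 * q ^ 2 + 2 * n ^ 2 * (g ^ 4 * A ^ 2) - (41 * q - n * g ^ 2 * A) ^ 2 := by
      simp only [X]; ring
    rw [this, hqE]
    linarith
  have h4 : 1 ≤ om ^ 2 := one_le_pow₀ hom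
  have e3 : ((64 * K + 5) * (C * (q + ρ) + ρ) * om) ^ 2 ≤
      ((64 * K + 5) * (C + 1)) ^ 2 * ((2 * 41 ^ 2 + 2 * n ^ 2) * (E + g ^ 4 * A ^ 2)) * om ^ 2 := by
    rw [mul_pow]
    refine mul_le_mul_of_nonneg_right ?_ (by positivity)
    refine (pow_le_pow_left₀ (by positivity) e1 2).trans ?_
    rw [mul_pow _ X]
    exact mul_le_mul_of_nonneg_left e2 (by positivity)
  have e4 : 8 * E ≤ 8 * (E + g ^ 4 * A ^ 2) * om ^ 2 := by
    refine le_trans ?_ (le_mul_of_one_le_right (by positivity) h4)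
    linarith
  linarith

theorem absorb_arith {C E g S A Q : ℝ} (hC : 0 < C) (hE : 0 ≤ E) (hS : 0 ≤ S) (hg0 : 0 ≤ g) (hg1 : g ≤ 1)
    (hg : 100 * C * g ^ 4 ≤ 1) (hA : A ^ 2 ≤ 25 * (2 * (S + Q))) (hQ : Q ≤ C * (E + g ^ 4 * A ^ 2)) :
    C * (E + g ^ 4 * A ^ 2) ≤ C * (1 + 100 * C + 100) * (E + g ^ 4 * S) := by
  have h1 := mul_le_mul_of_nonneg_right hg (sq_nonneg A)
  have h2 : A ^ 2 ≤ 100 * S + 100 * C * E := by linarith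
  have h3 : 0 ≤ g ^ 4 := by positivity
  have h4 : g ^ 4 ≤ 1 := pow_le_one₀ hg0 hg1
  have h5 := mul_le_mul_of_nonneg_left h2 h3
  have h6 := mul_le_mul_of_nonneg_right h4 (by positivity : 0 ≤ 100 * C * E)
  have h7 : 0 ≤ g ^ 4 * S := by positivity
  have h8 : 0 ≤ C * (g ^ 4 * S) := by positivity
  rw [mul_assoc C]
  refine mul_le_mul_of_nonneg_left ?_ hC.le
  linarith

/-- The shell integrals of the gradient of the remainder, in terms of the exterior energy and of one
shell integral of the gradient of the initial data. -/
theorem exists_shell_bound (J : ℕ) (hJ : 0 < J) : ∃ δ C : ℝ, 0 < δ ∧ δ ≤ 1 / 3 ∧ 0 < C ∧ ∀ lam : Fin J → ℝ,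
    (∀ j, 0 < lam j) → StrictAnti lam → gam lam ≤ δ → ∀ (U : ℝ → ℝ → ℝ) (Ep Em : ℝ) (a : Fin J → ℝ),
    RadWave (pot lam) (fun _ => 0) U → IntegrableOn (eden U 0) (Ioi 0) →
    Tendsto (fun t : ℝ => ∫ r in Ioi |t|, eden U t r) atTop (𝓝 Ep) →
    Tendsto (fun t : ℝ => ∫ r in Ioi |t|, eden U t r) atBot (𝓝 Em) →
    (∀ i, ∫ r in Ioi (0:ℝ), r ^ 5 * ((dR U 0 r - resd lam a r) * phid (lam i) r) = 0) →
    ∃ i, ∀ R, 0 < R → ∫ r in R..(2 * R), r ^ 5 * (dR U 0 r - resd lam a r) ^ 2 ≤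
      C * (Ep + Em + gam lam ^ 4 * ∫ r in lam i..(2 * lam i), r ^ 5 * dR U 0 r ^ 2) * om lam R ^ 2 := by
  obtain ⟨δ, D, hδ, hD, hext⟩ := ext_estimate hJ
  set K : ℝ := 15 / 4 + 12 * J with hKdef
  set L : ℝ := (64 * K + 5) * (D + 1)
  have hK : 0 ≤ K := by positivity
  obtain ⟨C, hCdef⟩ : ∃ C : ℝ, 8 + 2 * (L ^ 2 * (2 * 41 ^ 2 + 2 * (2304 * J ^ 2) ^ 2)) = C := ⟨_, rfl⟩
  have hC : 0 < C := hCdef ▸ by positivity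
  have hN : 0 < 92160 * (J:ℝ) + 100 * C + 3 := by positivity
  have hJ0 : (0:ℝ) ≤ J := J.cast_nonneg
  refine ⟨min δ (1 / (92160 * J + 100 * C + 3)), C * (1 + 100 * C + 100), by positivity, ?_, by positivity, ?_⟩
  · exact (min_le_right _ _).trans (one_div_le_one_div_of_le (by norm_num) (by linarith))
  intro lam hl ha hg U Ep Em a hU hE0 hp hm ho
  have hg0 := gam_nonneg lam hl
  have hgN : gam lam * (92160 * J + 100 * C + 3) ≤ 1 := by
    rw [← le_div_iff₀ hN]; exact hg.trans (min_le_right _ _)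
  have hx1 : 0 ≤ gam lam * J := by positivity
  have hx2 : 0 ≤ gam lam * C := by positivity
  have hg1 : gam lam ≤ 1 := by linarith
  have hg2 : gam lam ^ 2 ≤ gam lam := pow_le_of_le_one hg0 hg1 (by norm_num)
  have hg4 : gam lam ^ 4 ≤ gam lam := pow_le_of_le_one hg0 hg1 (by norm_num)
  have hne : Nonempty (Fin J) := ⟨⟨0, hJ⟩⟩
  obtain ⟨i, hi⟩ := Finite.exists_max fun j => |a j|
  have hint : ∀ t : ℝ, 0 ≤ ∫ r in Ioi |t|, eden U t r := fun t =>
    setIntegral_nonneg measurableSet_Ioi fun r hr => eden_nonneg ((abs_nonneg t).trans (le_of_lt hr))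
  have hEp : 0 ≤ Ep := ge_of_tendsto' hp hint
  have hEm : 0 ≤ Em := ge_of_tendsto' hm hint
  set E := Ep + Em with hEdef
  have hE : 0 ≤ E := add_nonneg hEp hEm
  have hb : ∀ R, 0 < R → ∫ r in R..(2 * R), r ^ 5 * (dR U 0 r - resd lam a r) ^ 2 ≤
      C * (E + gam lam ^ 4 * |a i| ^ 2) * om lam R ^ 2 := by
    intro R hR
    have hκ : ∀ r, 0 < r → |15 / (4 * r ^ 2) + pot lam r| ≤ K * r ^ (-2 : ℝ) := fun r hr => abs_kap_le hl hr
    have hpc := (continuous_pot hl).continuousOn (s := Ioi 0)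
    set Λ := ∑ j, lam j ^ 2
    have hΛ : 0 ≤ Λ := Finset.sum_nonneg fun j _ => sq_nonneg _
    obtain ⟨c, M, hM0, hM, hI⟩ : ∃ c M : ℝ, 0 ≤ M ∧
        (∀ t r, |t| ≤ r → 0 < r → |U t r - c| ≤ M * (r ^ 2)⁻¹) ∧
        ∀ t, IntegrableOn (eden U t) (Ioi |t|) := by
      obtain ⟨T1, h1⟩ := eventually_atTop.1 (hp.eventually (gt_mem_nhds (lt_add_one Ep)))
      obtain ⟨T2, h2⟩ := eventually_atBot.1 (hm.eventually (gt_mem_nhds (lt_add_one Em)))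
      refine hU.exists_limit (T₀ := |T1| + |T2| + 1) (E₀ := E + 1) (s0 := 1152 * Λ) hpc hK (by positivity)
        (by positivity) hκ (fun r hr => rpow_source hr (abs_pot_le hl hr)) hE0 fun t ht => ?_
      rcases le_total 0 t with h0 | h0
      · rw [abs_of_nonneg h0] at ht
        linarith [h1 t (by linarith [le_abs_self T1, abs_nonneg T2])]
      · rw [abs_of_nonpos h0] at ht
        linarith [h2 t (by linarith [neg_abs_le T2, abs_nonneg T1])]
    set H := rmd U lam a c
    set S := src lam a c
    set s0 := 1152 * |c| * Λ + 2304 * J ^ 2 * gam lam ^ 2 * |a i| with hρdef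
    have hρ : 0 ≤ s0 := by positivity
    have hMH := abs_rmd_le hl (a := a) hM
    have hM1 : 0 ≤ M + ∑ j, |a j| * 12 := by positivity
    have hH : RadBound (pot lam) S H K (M + ∑ j, |a j| * 12) s0 := ⟨hU.rmd hl a c, rmd_neg U lam a c, hpc,
      (continuous_src hl a c).continuousOn, hK, hρ, hM1, hκ, fun r hr =>
      rpow_source hr (abs_src_le hl ha hi c hr), hMH⟩
    have hiH := integrableOn_eden_rmd hl a hU.smooth c hI hH.smooth
    have hEH := eventually_eden_rmd_le hl a hU.smooth c hI hH.smooth hp hm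
    obtain ⟨hsys, hAn⟩ := hH.sys
    have hG := fun x y hx hxy => hH.rad_le hiH hEH (x := x) (y := y) hx hxy
    have hc := hH.source_limit_le hiH hEH (tendsto_pot hl)
      (tendsto_src hl c)
    have hE2 : √E ^ 2 = E := sq_sqrt hE
    have hcE : 1152 * |c| * Λ ≤ 40 * √E := by
      refine abs_le_of_sq_le_sq' (?_ : (1152 * |c| * Λ) ^ 2 ≤ (40 * √E) ^ 2) (by positivity) |>.2
      rw [mul_pow 40, hE2, mul_pow, mul_pow, sq_abs]
      linarith
    have hdR : ∀ r, dR H 0 r = dR U 0 r - resd lam a r := fun r => by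
      rw [dR_rmd hl a hU.smooth, neg_zero, add_self_div_two]
    have hF := hext lam hl ha (hg.trans (min_le_left _ _)) _ _ _ K _ s0 (√E) _ hsys (sqrt_nonneg _)
      (by rw [hE2]; exact hG) (fun ξ η hξ hη => abs_Fn_le hMH hξ hη) (fun i => by
        refine integral_mul_vphi_eq_zero hl hH.smooth hM1 hMH (by simpa using hiH 0) i ?_
        simp only [hdR]
        exact ho i)
    have hq := shell_le hJ hl hsys.toPreSys (by positivity) hF rfl hH.smooth hH.even hsys.Gc
      (fun r hr => hAn r r hr hr) hG hR
    simp only [hdR] at hq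
    rw [← hCdef]
    exact shell_arith hK hD.le (sqrt_nonneg E) hE2 hρ (by positivity) (abs_nonneg _)
      (add_le_add_left hcE _) (one_le_om hJ lam R) rfl hq
  have hli := hl i
  have hom : om lam (lam i) = 1 := by
    refine le_antisymm ?_ (one_le_om hJ lam _)
    simpa [div_self hli.ne'] using om_le lam (lam i) i
  have hbi := hb (lam i) hli
  rw [hom, one_pow, mul_one] at hbi
  have hc : Continuous (dR U 0) := continuous_slice (C2_partials hU.smooth).2.1.continuous 0
  have hA : |a i| ^ 2 ≤ 25 * _ := (sq_le_shell_resd hl a ha hg1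
    ((mul_le_mul_of_nonneg_left hg2 (by positivity)).trans (by linarith)) hi)
  have hS : 0 ≤ ∫ r in lam i..(2 * lam i), r ^ 5 * dR U 0 r ^ 2 :=
    intervalIntegral.integral_nonneg (by linarith) fun r hr => by
      have : 0 ≤ r := hli.le.trans hr.1
      positivity
  refine ⟨i, fun R hR => (hb R hR).trans ?_⟩
  refine mul_le_mul_of_nonneg_right ?_ (sq_nonneg _)
  refine absorb_arith hC hE hS hg0 hg1 ?_ (hA.trans (mul_le_mul_of_nonneg_left
    (shell_triangle hl a hc hli) (by norm_num))) hbi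
  have := mul_le_mul_of_nonneg_left hg4 (by positivity : 0 ≤ 100 * C)
  linarith

/-! ### The weighted norm in polar coordinates -/

theorem shell_integral_radial {F : E6 → ℝ} {g : ℝ → ℝ} (h : ∀ x, x ≠ 0 → F x ^ 2 = g ‖x‖) {R : ℝ} (hR : 0 < R) :
    ∫ x in {x : E6 | R < ‖x‖ ∧ ‖x‖ < 2 * R}, F x ^ 2 = c6 * ∫ r in R..(2 * R), r ^ 5 * g r := by
  have hm : MeasurableSet {x : E6 | R < ‖x‖ ∧ ‖x‖ < 2 * R} :=
    measurable_norm (measurableSet_Ioo (a := R) (b := 2 * R))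
  have hae : ∀ᵐ x : E6, x ≠ 0 := by simp [ae_iff]
  have h1 : ∫ x in {x : E6 | R < ‖x‖ ∧ ‖x‖ < 2 * R}, F x ^ 2 = ∫ x : E6, (Ioo R (2 * R)).indicator g ‖x‖ := by
    rw [← integral_indicator hm]
    refine integral_congr_ae ?_
    filter_upwards [hae] with x hx
    by_cases hxt : R < ‖x‖ ∧ ‖x‖ < 2 * R
    · rw [indicator_of_mem (by exact hxt), indicator_of_mem (by exact hxt), h x hx]
    · rw [indicator_of_notMem (by exact hxt), indicator_of_notMem (by exact hxt)]
  have h2 : ∀ r, r ^ 5 * (Ioo R (2 * R)).indicator g r = (Ioo R (2 * R)).indicator (fun r => r ^ 5 * g r) r := by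
    intro r
    by_cases hr : r ∈ Ioo R (2 * R)
    · rw [indicator_of_mem hr, indicator_of_mem hr]
    · rw [indicator_of_notMem hr, indicator_of_notMem hr, mul_zero]
  rw [h1, integral_radial]
  simp only [h2]
  rw [setIntegral_indicator measurableSet_Ioo, intervalIntegral.integral_of_le (by linarith),
    integral_Ioc_eq_integral_Ioo,
    inter_eq_right.2 (Ioo_subset_Ioi_self.trans (Ioi_subset_Ioi hR.le))]

theorem ZlamE_sq_le {J : ℕ} (hJ : 0 < J) {lam : Fin J → ℝ} {F : E6 → ℝ} {Y : ℝ} (hY : 0 ≤ Y)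
    (h : ∀ R, 0 < R → ∫ x in {x : E6 | R < ‖x‖ ∧ ‖x‖ < 2 * R}, F x ^ 2 ≤ Y * om lam R ^ 2) :
    ZlamE lam F ^ 2 ≤ ENNReal.ofReal Y := by
  have : ZlamE lam F ≤ ENNReal.ofReal √Y := by
    refine iSup_le fun R => ENNReal.ofReal_le_ofReal ?_
    have ho : 0 < om lam R.1 := one_pos.trans_le (one_le_om hJ lam _)
    change (om lam R.1)⁻¹ * _ ≤ _
    rw [inv_mul_le_iff₀ ho]
    refine sqrt_le_iff.2 ⟨by positivity, (h R.1 R.2).trans ?_⟩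
    rw [mul_pow, sq_sqrt hY, mul_comm]
  calc _ ≤ ENNReal.ofReal √Y ^ 2 := pow_le_pow_left₀ zero_le this 2
    _ = _ := by rw [← ENNReal.ofReal_pow (sqrt_nonneg _), sq_sqrt hY]

theorem le_ZlamE_sq {J : ℕ} (hJ : 0 < J) {lam : Fin J → ℝ} (hl : ∀ j, 0 < lam j) (F : E6 → ℝ) (i : Fin J) :
    ENNReal.ofReal (∫ x in {x : E6 | lam i < ‖x‖ ∧ ‖x‖ < 2 * lam i}, F x ^ 2) ≤ ZlamE lam F ^ 2 := by
  have h0 : 0 ≤ ∫ x in {x : E6 | lam i < ‖x‖ ∧ ‖x‖ < 2 * lam i}, F x ^ 2 :=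
    integral_nonneg fun x => sq_nonneg _
  have hom : om lam (lam i) = 1 := by
    refine le_antisymm ?_ (one_le_om hJ lam _)
    simpa [div_self (hl i).ne'] using om_le lam (lam i) i
  have := le_iSup (fun R : {R : ℝ // 0 < R} => ENNReal.ofReal ((om lam R.1)⁻¹ *
    √(∫ x in {x : E6 | R.1 < ‖x‖ ∧ ‖x‖ < 2 * R.1}, F x ^ 2))) ⟨lam i, hl i⟩
  simp only [hom, inv_one, one_mul] at this
  calc _ = ENNReal.ofReal (√(∫ x in {x : E6 | lam i < ‖x‖ ∧ ‖x‖ < 2 * lam i}, F x ^ 2)) ^ 2 := by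
        rw [← ENNReal.ofReal_pow (sqrt_nonneg _), sq_sqrt h0]
    _ ≤ _ := pow_le_pow_left₀ zero_le this 2

theorem pow_four_le_mul_log_sq {g : ℝ} (h0 : 0 ≤ g) (h1 : g ≤ 1 / 3) : g ^ 4 ≤ g ^ 4 * Real.log g ^ 2 := by
  rcases h0.eq_or_lt with rfl | h0
  · simp
  refine le_mul_of_one_le_right (by positivity) ?_
  have : Real.log g ≤ -1 := by
    rw [Real.log_le_iff_le_exp h0]
    refine h1.trans ?_
    rw [Real.exp_neg, one_div]
    exact inv_anti₀ (exp_pos _) (Real.exp_one_lt_three.le)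
  nlinarith

theorem norm_gradient_sq {u : ℝ → E6 → ℝ} {P : E6 → ℝ} (hu : IsRadSolOf P u) {p : ℝ → ℝ}
    (hP : ∀ x, P x = p ‖x‖) {x : E6} (hx : x ≠ 0) :
    ‖gradient (u 0) x‖ ^ 2 = dR (fun t => prof (u t)) 0 ‖x‖ ^ 2 := by
  rw [(hasGradientAt_radial hx (Eventually.of_forall (eq_prof (hu.2.1 0)))
    (hasDerivAt_dR (U := fun t => prof (u t)) ((hu.radWave hP).smooth.of_le one_le_two) 0 _)).gradient,
    norm_smul, norm_div, norm_norm, div_mul_cancel₀ _ (norm_ne_zero_iff.2 hx), norm_eq_abs, sq_abs]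

/-- Channels for even-in-time solutions around a multisoliton: here the orthogonal projection
`Π⊥_{Ḣ¹,λ} u₀ = u₀ - w` is characterized by `w` being the element of `span((ΛW)_{(λ_j)})`
with `u₀ - w` orthogonal in `Ḣ¹` to each `(ΛW)_{(λ_i)}`. -/
theorem stmt17 (J : ℕ) (hJ : 0 < J) :
    ∃ γs C : ℝ, 0 < γs ∧ 0 < C ∧
      ∀ lam : Fin J → ℝ, (∀ j, 0 < lam j) → StrictAnti lam → gam lam ≤ γs →
        ∀ (u : ℝ → E6 → ℝ) (Ep Em : ℝ), IsRadSolOf (Vmulti lam) u →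
          Tendsto (fun t => ∫ x in {x : E6 | |t| ≤ ‖x‖}, eDensity u t x) atTop (𝓝 Ep) →
          Tendsto (fun t => ∫ x in {x : E6 | |t| ≤ ‖x‖}, eDensity u t x) atBot (𝓝 Em) →
          ∀ w : E6 → ℝ, InSpanH lam w →
            (∀ i, ∫ x, ⟪gradient (fun y => u 0 y - w y) x,
                gradient (rescH (lam i) LW6) x⟫ = 0) →
            ZlamE lam (fun x => ‖gradient (fun y => u 0 y - w y) x‖) ^ 2 ≤
              ENNReal.ofReal C * (ENNReal.ofReal (Ep + Em) +
                ENNReal.ofReal (gam lam ^ 4 * Real.log (gam lam) ^ 2) *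
                  ZlamE lam (fun x => ‖gradient (u 0) x‖) ^ 2) := by
  obtain ⟨δ, C, hδ, hδ3, hC, h⟩ := exists_shell_bound J hJ
  refine ⟨δ, C, hδ, hC, ?_⟩
  intro lam hl ha hg u Ep Em hu hp hm w ⟨a, hw⟩ ho
  subst hw
  have hP := Vmulti_eq hl
  set U := fun t => prof (u t) with hU
  have hc := c6_pos
  have hp' : Tendsto (fun t : ℝ => ∫ r in Ioi |t|, eden U t r) atTop (𝓝 (Ep / c6)) := by
    refine (hp.div_const c6).congr fun t => ?_
    rw [hu.exterior, mul_div_cancel_left₀ _ hc.ne']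
    rfl
  have hm' : Tendsto (fun t : ℝ => ∫ r in Ioi |t|, eden U t r) atBot (𝓝 (Em / c6)) := by
    refine (hm.div_const c6).congr fun t => ?_
    rw [hu.exterior, mul_div_cancel_left₀ _ hc.ne']
    rfl
  have hs := (hu.radWave hP).smooth
  have hd : ∀ r, dR (rmd U lam a 0) 0 r = dR U 0 r - resd lam a r := fun r => by
    rw [dR_rmd hl a hs, neg_zero, add_self_div_two]
  obtain ⟨i, hi⟩ := h lam hl ha hg U (Ep / c6) (Em / c6) a (hu.radWave hP) hu.energy_zero hp' hm'
    fun i => by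
      have := orth_radial hl hu hP a 0 i (ho i)
      change ∫ r in Ioi (0:ℝ), r ^ 5 * (dR (rmd U lam a 0) 0 r * phid (lam i) r) = 0 at this
      simpa only [hd] using this
  have hint : ∀ t : ℝ, 0 ≤ ∫ x in {x : E6 | |t| ≤ ‖x‖}, eDensity u t x := fun t =>
    integral_nonneg fun x => by unfold eDensity; positivity
  have hE : 0 ≤ Ep + Em := add_nonneg (ge_of_tendsto' hp hint) (ge_of_tendsto' hm hint)
  have hQ := shell_integral_radial (F := fun x => ‖gradient (u 0) x‖)
    (g := fun r => dR U 0 r ^ 2) (fun x hx => norm_gradient_sq hu hP hx) (hl i)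
  have hQ0 : 0 ≤ ∫ x in {x : E6 | lam i < ‖x‖ ∧ ‖x‖ < 2 * lam i}, ‖gradient (u 0) x‖ ^ 2 :=
    integral_nonneg fun x => sq_nonneg _
  have hle := le_ZlamE_sq hJ hl (fun x => ‖gradient (u 0) x‖) i
  set Q := ∫ x in {x : E6 | lam i < ‖x‖ ∧ ‖x‖ < 2 * lam i}, ‖gradient (u 0) x‖ ^ 2
  have hg0 := gam_nonneg lam hl
  have hY : 0 ≤ Ep + Em + gam lam ^ 4 * Q := by positivity
  refine (ZlamE_sq_le hJ (mul_nonneg hC.le hY) fun R hR => ?_).trans ?_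
  · rw [shell_integral_radial (g := fun r => (dR U 0 r - resd lam a r) ^ 2) (fun x hx => ?_) hR]
    · refine (mul_le_mul_of_nonneg_left (hi R hR) hc.le).trans_eq ?_
      rw [hQ]
      field_simp
    · rw [gradient_sub_res hl hu hP a 0 hx, hd, norm_smul, norm_div, norm_norm,
        div_mul_cancel₀ _ (norm_ne_zero_iff.2 hx), norm_eq_abs, sq_abs]
  · rw [ENNReal.ofReal_mul hC.le]
    gcongr
    refine ENNReal.ofReal_add_le.trans ?_
    gcongr
    rw [ENNReal.ofReal_mul (by positivity)]
    gcongr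
    exact pow_four_le_mul_log_sq hg0 (hg.trans hδ3)

end
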